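/- For every integer n ≥ 0, writing N_i = N(i,11,11n+10) and M_i = M(i,11,11n+10), the following hold: 3N_1 + 2N_5 + 2M_3 ≥ 2N_2 + 2N_3 + N_4 + 2M_0; 3N_0 + N_2 + N_3 + M_0 ≥ 3N_1 + 2N_4 + M_3; 2N_1 + 4N_4 + M_3 ≥ N_0 + N_2 + N_3 + 3N_5 + M_0; and 6N_2 + 6N_3 + 6M_0 + 5M_3 ≥ 6N_0 + 6N_1 + 3N_4 + 8N_5. -/

import Mathlib

/-- `p n`: the number of partitions of `n`. -/
def partitionCount (n : ℕ) : ℕ := Fintype.card (Nat.Partition n)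

/-- The rank of a partition: its largest part minus its number of parts
(the empty partition has rank 0). -/
def partitionRank {n : ℕ} (π : Nat.Partition n) : ℤ :=
  (π.parts.sup : ℤ) - (Multiset.card π.parts : ℤ)

/-- The crank of a partition `π`: if `π` has no parts equal to 1, it is the largest part;
otherwise it is (number of parts larger than the number of ones) − (number of ones). -/
def partitionCrank {n : ℕ} (π : Nat.Partition n) : ℤ :=
  if π.parts.count 1 = 0 then (π.parts.sup : ℤ)
  else ((π.parts.filter fun x => π.parts.count 1 < x).card : ℤ) - (π.parts.count 1 : ℤ)

/-- `rankCount a r n` = `N(a,r,n)`: the number of partitions of `n` whose rank is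
congruent to `a` modulo `r`. -/
def rankCount (a r : ℤ) (n : ℕ) : ℕ :=
  (Finset.univ.filter fun π : Nat.Partition n => partitionRank π % r = a % r).card

/-- `crankCount a n` = `M(a,11,n)`: for `n ≠ 1`, the number of partitions of `n` whose crank
is congruent to `a` modulo 11; at `n = 1` the standard convention `M(0,11,1) = −1`,
`M(1,11,1) = M(10,11,1) = 1`, and `M(a,11,1) = 0` otherwise. -/
def crankCount (a : ℤ) (n : ℕ) : ℤ :=
  if n = 1 then
    if a % 11 = 0 then -1
    else if a % 11 = 1 ∨ a % 11 = 10 then 1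
    else 0
  else ((Finset.univ.filter fun π : Nat.Partition n => partitionCrank π % 11 = a % 11).card : ℤ)

open Filter Topology

/-- The shifted triangular number `n(n-1)/2`, for integer `n`. -/
def tri (n : ℤ) : ℤ := n * (n - 1) / 2

lemma two_mul_tri (n : ℤ) : 2 * tri n = n * (n - 1) :=
  Int.two_mul_ediv_two_of_even (Int.even_mul_pred_self n)

lemma tri_eq_of_two_mul {n m : ℤ} (h : n * (n - 1) = 2 * m) : tri n = m := by
  have := two_mul_tri n
  omega

lemma tri_add (n m : ℤ) : tri (n + m) = tri n + tri m + n * m :=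
  tri_eq_of_two_mul (by linear_combination -two_mul_tri n - two_mul_tri m)

@[simp] lemma tri_zero : tri 0 = 0 := rfl

@[simp] lemma tri_one : tri 1 = 0 := rfl

lemma tri_add_one (n : ℤ) : tri (n + 1) = tri n + n := by
  rw [tri_add]; simp

lemma tri_one_sub (n : ℤ) : tri (1 - n) = tri n :=
  tri_eq_of_two_mul (by linear_combination -two_mul_tri n)

lemma tri_neg (n : ℤ) : tri (-n) = tri n + n :=
  tri_eq_of_two_mul (by linear_combination -two_mul_tri n)

lemma neg_one_zpow_add (m n : ℤ) : (-1 : ℝ) ^ (m + n) = (-1) ^ m * (-1) ^ n :=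
  zpow_add₀ (by norm_num) m n

lemma neg_one_zpow_neg (m : ℤ) : (-1 : ℝ) ^ (-m) = (-1) ^ m := by
  rw [zpow_neg, ← inv_zpow]; norm_num

lemma neg_one_zpow_mul_self (m : ℤ) : (-1 : ℝ) ^ m * (-1) ^ m = 1 := by
  rw [← mul_zpow]; simp

section Summability

variable {Q : ℝ}

lemma summable_nat_gauss (h0 : 0 < Q) (h1 : Q < 1) {c : ℝ} (hc : 0 < c) {g : ℕ → ℤ}
    (hg : ∀ n, g (n + 1) = g n + n) :
    Summable fun n : ℕ => Q ^ g n * c ^ n := by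
  refine summable_of_ratio_test_tendsto_lt_one (l := 0) one_pos ?_ ?_
  · exact Eventually.of_forall fun n => by positivity
  · have : (fun n : ℕ => ‖Q ^ g (n + 1) * c ^ (n + 1)‖ / ‖Q ^ g n * c ^ n‖)
        = fun n : ℕ => Q ^ n * c := by
      funext n
      rw [Real.norm_of_nonneg (by positivity), Real.norm_of_nonneg (by positivity), hg,
        zpow_add₀ h0.ne', zpow_natCast, pow_succ]
      field_simp
    rw [this]
    simpa using (tendsto_pow_atTop_nhds_zero_of_lt_one h0.le h1).mul_const c

/-- Gaussian sums over the integers converge. -/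
lemma summable_gauss (h0 : 0 < Q) (h1 : Q < 1) {c : ℝ} (hc : 0 < c) :
    Summable fun n : ℤ => Q ^ tri n * c ^ n := by
  rw [summable_int_iff_summable_nat_and_neg]
  constructor
  · simpa using summable_nat_gauss h0 h1 hc (g := fun n => tri n)
      (fun n => by push_cast; exact tri_add_one n)
  · have := summable_nat_gauss h0 h1 (mul_pos h0 (inv_pos.2 hc)) (g := fun n => tri n)
      (fun n => by push_cast; exact tri_add_one n)
    refine this.congr fun n => ?_
    rw [tri_neg, zpow_add₀ h0.ne', zpow_neg, mul_pow, zpow_natCast, zpow_natCast, inv_pow]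
    ring

lemma abs_natCast_le_two_zpow (n : ℤ) : |(n : ℝ)| ≤ 2 ^ n + 2⁻¹ ^ n := by
  have key : ∀ m : ℕ, (m : ℝ) ≤ 2 ^ m := fun m => by exact_mod_cast (Nat.lt_two_pow_self (n := m)).le
  rcases Int.eq_nat_or_neg n with ⟨m, rfl | rfl⟩
  · have : (0 : ℝ) ≤ 2⁻¹ ^ (m : ℤ) := by positivity
    have := key m
    simp only [Int.cast_natCast, Nat.abs_cast, zpow_natCast] at *
    linarith
  · have : (0 : ℝ) ≤ 2 ^ (-(m : ℤ)) := by positivity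
    have := key m
    simp only [Int.cast_neg, Int.cast_natCast, abs_neg, Nat.abs_cast, inv_zpow', neg_neg,
      zpow_natCast] at *
    linarith

lemma summable_abs_mul_gauss (h0 : 0 < Q) (h1 : Q < 1) {c : ℝ} (hc : 0 < c) :
    Summable fun n : ℤ => |(n : ℝ)| * (Q ^ tri n * c ^ n) := by
  have h := (summable_gauss h0 h1 (mul_pos two_pos hc)).add
    (summable_gauss h0 h1 (mul_pos (inv_pos.2 two_pos) hc))
  refine Summable.of_nonneg_of_le (fun n => by positivity) (fun n => ?_) h
  have : 0 ≤ Q ^ tri n * c ^ n := by positivity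
  calc _ ≤ (2 ^ n + 2⁻¹ ^ n) * (Q ^ tri n * c ^ n) :=
        mul_le_mul_of_nonneg_right (abs_natCast_le_two_zpow n) this
    _ = _ := by rw [mul_zpow, mul_zpow]; ring

lemma tendsto_zpow_int_atTop (h0 : 0 < Q) (h1 : Q < 1) :
    Tendsto (fun k : ℤ => Q ^ k) atTop (𝓝 0) := by
  rw [← Nat.map_cast_int_atTop, tendsto_map'_iff]
  simpa [Function.comp_def] using tendsto_pow_atTop_nhds_zero_of_lt_one h0.le h1

lemma tendsto_zpow_int_atBot (h0 : 0 < Q) (h1 : Q < 1) :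
    Tendsto (fun k : ℤ => Q ^ k) atBot atTop := by
  have h2 : Tendsto (fun k : ℤ => Q⁻¹ ^ k) atTop atTop := by
    rw [← Nat.map_cast_int_atTop, tendsto_map'_iff]
    simpa [Function.comp_def, inv_pow] using
      tendsto_pow_atTop_atTop_of_one_lt ((one_lt_inv₀ h0).2 h1)
  refine (h2.comp tendsto_neg_atBot_atTop).congr fun k => ?_
  simp [inv_zpow']

/-- Away from its poles, `k ↦ 1/(1 - u Q^k)` is bounded. -/
lemma exists_bound_inv_one_sub (h0 : 0 < Q) (h1 : Q < 1) {u : ℝ} (hu : u ≠ 0) :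
    ∃ C, 0 < C ∧ ∀ k : ℤ, |(1 - u * Q ^ k)⁻¹| ≤ C := by
  have htop : Tendsto (fun k : ℤ => |(1 - u * Q ^ k)⁻¹|) atTop (𝓝 1) := by
    have : Tendsto (fun k : ℤ => Q ^ k) atTop (𝓝 0) := tendsto_zpow_int_atTop h0 h1
    have := ((this.const_mul u).const_sub 1).inv₀ (by simp)
    simpa using this.abs
  have hbot : Tendsto (fun k : ℤ => |(1 - u * Q ^ k)⁻¹|) atBot (𝓝 0) := by
    have h2 : Tendsto (fun k : ℤ => |1 - u * Q ^ k|) atBot atTop := by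
      have h3 : Tendsto (fun k : ℤ => |u| * Q ^ k - 1) atBot atTop := by
        refine tendsto_atTop_add_const_right _ (-1) (Tendsto.const_mul_atTop (abs_pos.2 hu) ?_)
        exact tendsto_zpow_int_atBot h0 h1
      refine tendsto_atTop_mono (fun k => ?_) h3
      have := abs_sub_abs_le_abs_sub (u * Q ^ k) 1
      rw [abs_mul, abs_of_pos (zpow_pos h0 k), abs_one, abs_sub_comm] at this
      exact this
    refine h2.inv_tendsto_atTop.congr fun k => ?_
    simp [abs_inv]
  have hb : IsBoundedUnder (· ≤ ·) cofinite (fun k : ℤ => |(1 - u * Q ^ k)⁻¹|) := by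
    obtain ⟨A, hA⟩ := hbot.isBoundedUnder_le
    obtain ⟨B, hB⟩ := htop.isBoundedUnder_le
    refine ⟨max A B, ?_⟩
    rw [Int.cofinite_eq, map_sup, eventually_sup]
    exact ⟨hA.mono fun x hx => hx.trans (le_max_left _ _),
      hB.mono fun x hx => hx.trans (le_max_right _ _)⟩
  obtain ⟨C, hC⟩ := hb.bddAbove_range_of_cofinite
  exact ⟨max C 1, by positivity, fun k => (hC ⟨k, rfl⟩).trans (le_max_left _ _)⟩

end Summability

/-- The theta series `∑ (-1)^n Q^(n(n-1)/2) x^n`. -/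
noncomputable def theta (Q x : ℝ) : ℝ := ∑' n : ℤ, (-1) ^ n * Q ^ tri n * x ^ n

/-- The coefficients `(-1)^k Q^(k(k+1)/2)`. -/
noncomputable def eps (Q : ℝ) (k : ℤ) : ℝ := (-1) ^ k * Q ^ tri (k + 1)

/-- The level one Appell sum `∑ (-1)^k Q^(k(k+1)/2) / (1 - u Q^k)`. -/
noncomputable def appell (Q u : ℝ) : ℝ := ∑' k : ℤ, eps Q k * (1 - u * Q ^ k)⁻¹

/-- `u` is nonzero and not an integral power of `Q`. -/
def OffLattice (Q u : ℝ) : Prop := u ≠ 0 ∧ ∀ k : ℤ, u * Q ^ k ≠ 1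

section Theta

variable {Q : ℝ}

lemma OffLattice.one_sub_ne {u : ℝ} (h : OffLattice Q u) (k : ℤ) : 1 - u * Q ^ k ≠ 0 :=
  sub_ne_zero.2 (h.2 k).symm

lemma OffLattice.mul_zpow (h0 : 0 < Q) {u : ℝ} (h : OffLattice Q u) (i : ℤ) :
    OffLattice Q (u * Q ^ i) := by
  refine ⟨mul_ne_zero h.1 (zpow_pos h0 i).ne', fun k => ?_⟩
  rw [mul_assoc, ← zpow_add₀ h0.ne']
  exact h.2 _

lemma OffLattice.inv {u : ℝ} (h : OffLattice Q u) : OffLattice Q u⁻¹ := by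
  refine ⟨inv_ne_zero h.1, fun k hk => h.2 (-k) ?_⟩
  rw [zpow_neg, ← inv_inv u, ← mul_inv, hk, inv_one]

lemma summable_abs_theta (h0 : 0 < Q) (h1 : Q < 1) {x : ℝ} (hx : x ≠ 0) :
    Summable fun n : ℤ => ‖(-1) ^ n * Q ^ tri n * x ^ n‖ := by
  refine (summable_gauss h0 h1 (abs_pos.2 hx)).congr fun n => ?_
  rw [norm_mul, norm_mul, Real.norm_eq_abs, Real.norm_eq_abs, Real.norm_eq_abs, abs_neg_one_zpow,
    abs_of_pos (zpow_pos h0 _), abs_zpow, one_mul]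

lemma summable_theta (h0 : 0 < Q) (h1 : Q < 1) {x : ℝ} (hx : x ≠ 0) :
    Summable fun n : ℤ => (-1) ^ n * Q ^ tri n * x ^ n := (summable_abs_theta h0 h1 hx).of_norm

lemma norm_eps (h0 : 0 < Q) (k : ℤ) : ‖eps Q k‖ = Q ^ tri (k + 1) := by
  rw [eps, norm_mul, Real.norm_eq_abs, Real.norm_eq_abs, abs_neg_one_zpow,
    abs_of_pos (zpow_pos h0 _), one_mul]

lemma norm_eps_mul_zpow (h0 : 0 < Q) (c : ℝ) (k : ℤ) :
    ‖eps Q k * c ^ k‖ = Q ^ tri k * (Q * |c|) ^ k := by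
  rw [norm_mul, norm_eps h0, tri_add_one, zpow_add₀ h0.ne', Real.norm_eq_abs, abs_zpow,
    _root_.mul_zpow]
  ring

lemma summable_norm_eps_mul_zpow (h0 : 0 < Q) (h1 : Q < 1) {c : ℝ} (hc : c ≠ 0) :
    Summable fun k : ℤ => ‖eps Q k * c ^ k‖ := by
  simp_rw [norm_eps_mul_zpow h0]
  exact summable_gauss h0 h1 (mul_pos h0 (abs_pos.2 hc))

lemma summable_norm_eps (h0 : 0 < Q) (h1 : Q < 1) : Summable fun k : ℤ => ‖eps Q k‖ := by
  simpa using summable_norm_eps_mul_zpow h0 h1 one_ne_zero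

/-- Multiplying an absolutely summable family by the bounded factor `1/(1 - u Q^k)`. -/
lemma Summable.mul_inv_one_sub (h0 : 0 < Q) (h1 : Q < 1) {u : ℝ} (hu : u ≠ 0) {a : ℤ → ℝ}
    (ha : Summable fun k => ‖a k‖) : Summable fun k : ℤ => ‖a k * (1 - u * Q ^ k)⁻¹‖ := by
  obtain ⟨C, -, hC⟩ := exists_bound_inv_one_sub h0 h1 hu
  refine Summable.of_nonneg_of_le (fun k => norm_nonneg _) (fun k => ?_) (ha.mul_right C)
  rw [norm_mul]
  exact mul_le_mul_of_nonneg_left (hC k) (norm_nonneg _)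

lemma summable_norm_appell (h0 : 0 < Q) (h1 : Q < 1) {u : ℝ} (hu : u ≠ 0) :
    Summable fun k : ℤ => ‖eps Q k * (1 - u * Q ^ k)⁻¹‖ :=
  (summable_norm_eps h0 h1).mul_inv_one_sub h0 h1 hu

lemma theta_mul_zpow (h0 : 0 < Q) {x : ℝ} (hx : x ≠ 0) (i : ℤ) :
    theta Q (x * Q ^ i) = (-1) ^ i * x ^ (-i) * Q ^ (-tri i) * theta Q x := by
  have : ∀ n : ℤ, (-1 : ℝ) ^ (n + (-i)) * Q ^ tri (n + (-i)) * (x * Q ^ i) ^ (n + (-i))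
      = (-1) ^ i * x ^ (-i) * Q ^ (-tri i) * ((-1) ^ n * Q ^ tri n * x ^ n) := fun n => by
    rw [neg_one_zpow_add, neg_one_zpow_neg, _root_.mul_zpow, ← zpow_mul,
      show tri (n + -i) = tri n + -tri i + -(i * (n + -i)) by
        rw [tri_add, tri_neg]; linear_combination two_mul_tri i,
      zpow_add₀ h0.ne' (tri n + -tri i), zpow_add₀ h0.ne' (tri n), zpow_neg Q (i * (n + -i)),
      zpow_add₀ hx]
    have := zpow_pos h0 (i * (n + -i))
    field_simp
  unfold theta
  rw [← Equiv.tsum_eq (Equiv.addRight (-i)), ← tsum_mul_left]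
  exact tsum_congr this

lemma theta_inv {x : ℝ} (hx : x ≠ 0) : theta Q x⁻¹ = -x⁻¹ * theta Q x := by
  unfold theta
  rw [← Equiv.tsum_eq (Equiv.subLeft (1 : ℤ)), ← tsum_mul_left]
  refine tsum_congr fun n => ?_
  simp only [Equiv.subLeft_apply]
  rw [tri_one_sub, inv_zpow', neg_sub, zpow_sub_one₀ hx, sub_eq_add_neg, neg_one_zpow_add,
    neg_one_zpow_neg]
  ring

lemma theta_one : theta Q 1 = 0 := by
  have := theta_inv (Q := Q) one_ne_zero
  simp only [inv_one] at this
  linarith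

lemma appell_mul_zpow_nat (h0 : 0 < Q) (h1 : Q < 1) {u : ℝ} (hu : OffLattice Q u) :
    appell Q (u * Q) = -u * appell Q u := by
  have hs := (summable_norm_appell h0 h1 hu.1).of_norm
  have ht := summable_theta h0 h1 (one_ne_zero)
  have : ∀ k : ℤ, eps Q (k + (-1)) * (1 - u * Q * Q ^ (k + (-1)))⁻¹
      = -u * (eps Q k * (1 - u * Q ^ k)⁻¹) - (-1) ^ k * Q ^ tri k * 1 ^ k := fun k => by
    have h2 := hu.one_sub_ne k
    have h3 := zpow_pos h0 k
    have h4 : Q * Q ^ (k + -1) = Q ^ k := by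
      rw [← zpow_one_add₀ h0.ne']; ring_nf
    rw [mul_assoc, h4, eps, eps, neg_add_cancel_right, neg_one_zpow_add, tri_add_one,
      zpow_add₀ h0.ne']
    field_simp
    norm_num
    ring
  calc appell Q (u * Q) = ∑' k : ℤ, eps Q (k + (-1)) * (1 - u * Q * Q ^ (k + (-1)))⁻¹ := by
        rw [appell, ← Equiv.tsum_eq (Equiv.addRight (-1 : ℤ))]; rfl
    _ = -u * appell Q u - theta Q 1 := by
        rw [tsum_congr this, (hs.mul_left _).tsum_sub ht, tsum_mul_left]; rfl
    _ = _ := by rw [theta_one, sub_zero]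

lemma appell_mul_zpow (h0 : 0 < Q) (h1 : Q < 1) {u : ℝ} (hu : OffLattice Q u) (i : ℤ) :
    appell Q (u * Q ^ i) = (-1) ^ i * u ^ i * Q ^ tri i * appell Q u := by
  have step : ∀ i : ℤ, appell Q (u * Q ^ (i + 1)) = -(u * Q ^ i) * appell Q (u * Q ^ i) :=
    fun i => by
      rw [zpow_add_one₀ h0.ne', ← mul_assoc]
      exact appell_mul_zpow_nat h0 h1 (hu.mul_zpow h0 i)
  induction i using Int.induction_on with
  | zero => simp
  | succ i ih =>
    rw [step, ih, tri_add_one, zpow_add₀ h0.ne', zpow_add_one₀ hu.1, zpow_add_one₀ (by norm_num)]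
    ring
  | pred i ih =>
    have := step (-i - 1)
    rw [sub_add_cancel, ih] at this
    have h2 : tri (-i : ℤ) = tri (-i - 1) + (-i - 1) := by
      rw [← tri_add_one, sub_add_cancel]
    have h3 := zpow_pos h0 (-i - 1 : ℤ)
    rw [← sub_add_cancel (-i : ℤ) 1, zpow_add_one₀ hu.1, zpow_add_one₀ (by norm_num),
      sub_add_cancel, h2, zpow_add₀ h0.ne'] at this
    have h4 : u * Q ^ (-i - 1 : ℤ) ≠ 0 := mul_ne_zero hu.1 h3.ne'
    apply mul_left_cancel₀ (neg_ne_zero.2 h4)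
    rw [← this]
    ring

/-- The sum of a row in the double series below. -/
lemma tsum_eps_row (h0 : 0 < Q) (h1 : Q < 1) {u : ℝ} (hu : OffLattice Q u) (i : ℤ) :
    ∑' j : ℤ, eps Q j * (1 - u * Q ^ (j - i))⁻¹ = eps Q i * u ^ (-i) * appell Q u := by
  have := appell_mul_zpow h0 h1 hu (-i)
  rw [tri_neg, ← tri_add_one, neg_one_zpow_neg] at this
  rw [eps, mul_right_comm _ (Q ^ _), ← this, appell]
  refine tsum_congr fun j => ?_
  rw [mul_assoc u, ← zpow_add₀ h0.ne', neg_add_eq_sub]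

lemma tsum_eps_mul_zpow_div (h0 : 0 < Q) (h1 : Q < 1) {u : ℝ} (hu : OffLattice Q u) (i : ℤ) :
    ∑' j : ℤ, eps Q j * Q ^ (-(i * j)) * (1 - u * Q ^ j)⁻¹ = u ^ i * appell Q u := by
  have h := appell_mul_zpow h0 h1 hu i
  rw [appell, ← Equiv.tsum_eq (Equiv.addRight (-i))] at h
  have h2 : ∀ j : ℤ, eps Q (j + -i) * (1 - u * Q ^ i * Q ^ (j + -i))⁻¹
      = ((-1) ^ i * Q ^ tri i) * (eps Q j * Q ^ (-(i * j)) * (1 - u * Q ^ j)⁻¹) := fun j => by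
    rw [mul_assoc u, ← zpow_add₀ h0.ne', add_comm j, add_neg_cancel_left, eps, eps,
      show tri (-i + j + 1) = tri i + tri (j + 1) + -(i * j) by
        rw [add_assoc, tri_add, tri_neg]; ring,
      zpow_add₀ h0.ne', zpow_add₀ h0.ne', neg_one_zpow_add, neg_one_zpow_neg]
    ring
  simp only [Equiv.coe_addRight] at h
  rw [tsum_congr h2, tsum_mul_left] at h
  have h3 : (-1 : ℝ) ^ i * Q ^ tri i ≠ 0 :=
    mul_ne_zero (zpow_ne_zero _ (by norm_num)) (zpow_pos h0 _).ne'
  apply mul_left_cancel₀ h3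
  rw [h]
  ring

end Theta

/-- The Kronecker series `∑ x^k / (1 - z Q^k)`. -/
noncomputable def kron (Q x z : ℝ) : ℝ := ∑' k : ℤ, x ^ k * (1 - z * Q ^ k)⁻¹

section Kronecker

variable {Q : ℝ}

lemma inv_one_sub_zpow_neg (h0 : 0 < Q) {z : ℝ} (hz : OffLattice Q z) (k : ℤ) :
    (1 - z * Q ^ (-k))⁻¹ = -(z⁻¹ * Q ^ k * (1 - z⁻¹ * Q ^ k)⁻¹) := by
  have h := hz.one_sub_ne (-k)
  have h2 := hz.inv.one_sub_ne k
  have h3 := hz.1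
  have h4 := (zpow_pos h0 k).ne'
  rw [zpow_neg] at *
  have h5 : (1 - z * (Q ^ k)⁻¹) * (z⁻¹ * Q ^ k) = -(1 - z⁻¹ * Q ^ k) := by
    field_simp
    ring
  refine inv_eq_of_mul_eq_one_right ?_
  rw [mul_neg, ← mul_assoc, h5, neg_mul, neg_neg, mul_inv_cancel₀ h2]

lemma offLattice_of_mem_Ioo (h0 : 0 < Q) (h1 : Q < 1) {z : ℝ} (hz : Q < z) (hz1 : z < 1) :
    OffLattice Q z := by
  have z0 : 0 < z := h0.trans hz
  refine ⟨z0.ne', fun k hk => ?_⟩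
  rcases le_or_gt 0 k with h | h
  · have : Q ^ k ≤ 1 := by
      lift k to ℕ using h
      simpa using pow_le_one₀ h0.le h1.le
    nlinarith [zpow_pos h0 k]
  · have : Q ^ (k + 1) ≥ 1 := one_le_zpow_of_nonpos₀ h0 h1.le (by omega)
    rw [zpow_add_one₀ h0.ne'] at this
    nlinarith [zpow_pos h0 k]

lemma summable_norm_kron (h0 : 0 < Q) (h1 : Q < 1) {x z : ℝ} (hx : Q < x) (hx1 : x < 1)
    (hz : OffLattice Q z) : Summable fun k : ℤ => ‖x ^ k * (1 - z * Q ^ k)⁻¹‖ := by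
  have x0 : 0 < x := h0.trans hx
  obtain ⟨C, -, hC⟩ := exists_bound_inv_one_sub h0 h1 hz.1
  obtain ⟨D, -, hD⟩ := exists_bound_inv_one_sub h0 h1 hz.inv.1
  rw [summable_int_iff_summable_nat_and_neg]
  constructor
  · refine Summable.of_nonneg_of_le (fun k => norm_nonneg _) (fun k => ?_)
      ((summable_geometric_of_lt_one x0.le hx1).mul_right C)
    rw [norm_mul, zpow_natCast, Real.norm_of_nonneg (by positivity)]
    exact mul_le_mul_of_nonneg_left (hC k) (by positivity)
  · refine Summable.of_nonneg_of_le (fun k => norm_nonneg _) (fun k => ?_)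
      ((summable_geometric_of_lt_one (r := Q / x) (by positivity)
        ((div_lt_one x0).2 hx)).mul_right (|z⁻¹| * D))
    rw [inv_one_sub_zpow_neg h0 hz, norm_mul, norm_neg, norm_mul, norm_mul, Real.norm_eq_abs,
      Real.norm_eq_abs, Real.norm_eq_abs, Real.norm_eq_abs, abs_of_pos (zpow_pos x0 _),
      abs_of_pos (zpow_pos h0 _), zpow_neg, zpow_natCast, zpow_natCast, div_pow]
    have := hD k
    rw [zpow_natCast] at this
    calc (x ^ k)⁻¹ * (|z⁻¹| * Q ^ k * |(1 - z⁻¹ * Q ^ k)⁻¹|)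
        ≤ (x ^ k)⁻¹ * (|z⁻¹| * Q ^ k * D) := by gcongr
      _ = _ := by ring

lemma kron_mul_zpow {x z : ℝ} (hx : x ≠ 0) (i : ℤ) :
    ∑' k : ℤ, x ^ k * (1 - z * Q ^ (k - i))⁻¹ = x ^ i * kron Q x z := by
  rw [kron, ← Equiv.tsum_eq (Equiv.addRight i), ← tsum_mul_left]
  refine tsum_congr fun k => ?_
  simp only [Equiv.coe_addRight, add_sub_cancel_right]
  rw [zpow_add₀ hx]
  ring

/-- The shear `(n, k) ↦ (n - k, k)`. -/
def shear : ℤ × ℤ ≃ ℤ × ℤ where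
  toFun p := (p.1 - p.2, p.2)
  invFun p := (p.1 + p.2, p.2)
  left_inv p := by simp
  right_inv p := by simp

lemma theta_mul_kron (h0 : 0 < Q) (h1 : Q < 1) {x z : ℝ} (hx : Q < x) (hx1 : x < 1)
    (hz : OffLattice Q z) : theta Q x * kron Q x z = appell Q z * theta Q (x * z) := by
  have x0 : 0 < x := h0.trans hx
  have s1 := summable_abs_theta h0 h1 x0.ne'
  have s2 := summable_norm_kron h0 h1 hx hx1 hz
  have s3 := summable_mul_of_summable_norm s1 s2
  have s4 := (Equiv.summable_iff shear).2 s3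
  rw [theta, kron, tsum_mul_tsum_of_summable_norm s1 s2, ← Equiv.tsum_eq shear]
  refine (Summable.tsum_prod s4).trans ?_
  rw [theta, ← tsum_mul_left]
  refine tsum_congr fun n => ?_
  have : ∀ k : ℤ, (-1 : ℝ) ^ (n - k) * Q ^ tri (n - k) * x ^ (n - k) *
      (x ^ k * (1 - z * Q ^ k)⁻¹) = ((-1) ^ n * Q ^ tri n * x ^ n) *
      (eps Q k * Q ^ (-(n * k)) * (1 - z * Q ^ k)⁻¹) := fun k => by
    rw [eps, sub_eq_add_neg, neg_one_zpow_add, neg_one_zpow_neg, zpow_add₀ x0.ne', zpow_neg x k,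
      show tri (n + -k) = tri n + tri (k + 1) + -(n * k) by
        rw [tri_add, tri_neg, ← tri_add_one]; ring,
      zpow_add₀ h0.ne', zpow_add₀ h0.ne']
    have := zpow_pos x0 k
    field_simp
  simp only [shear, Equiv.coe_fn_mk, Function.comp_apply]
  rw [tsum_congr this, tsum_mul_left, tsum_eps_mul_zpow_div h0 h1 hz, _root_.mul_zpow]
  ring

set_option maxHeartbeats 1000000 in
lemma kron_eq_double (h0 : 0 < Q) (h1 : Q < 1) {x z : ℝ} (hx : Q < x) (hx1 : x < 1)
    (hz : Q < z) (hz1 : z < 1) : kron Q x z = ∑' k : ℕ, ∑' l : ℕ, x ^ k * z ^ l * Q ^ (k * l)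
      - ∑' k : ℕ, ∑' l : ℕ, x⁻¹ ^ (k + 1) * z⁻¹ ^ (l + 1) * Q ^ ((k + 1) * (l + 1)) := by
  have x0 : 0 < x := h0.trans hx
  have z0 : 0 < z := h0.trans hz
  have hzo := offLattice_of_mem_Ioo h0 h1 hz hz1
  have hs := (summable_norm_kron h0 h1 hx hx1 hzo).of_norm
  have i1 : Function.Injective fun k : ℕ => (k : ℤ) := Nat.cast_injective
  have i2 : Function.Injective fun k : ℕ => (-((k : ℤ) + 1)) := fun a b h => by simpa using h
  have e := tsum_of_nat_of_neg_add_one (f := fun k : ℤ => x ^ k * (1 - z * Q ^ k)⁻¹)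
    (hs.comp_injective i1) (hs.comp_injective i2)
  rw [kron, e, sub_eq_add_neg, ← tsum_neg]
  refine congrArg₂ (· + ·) ?_ ?_
  · refine tsum_congr fun k => ?_
    have hk : Q ^ k ≤ 1 := pow_le_one₀ h0.le h1.le
    have : z * Q ^ k < 1 := (mul_le_of_le_one_right z0.le hk).trans_lt hz1
    rw [zpow_natCast, zpow_natCast, ← tsum_geometric_of_lt_one (by positivity) this,
      ← tsum_mul_left]
    refine tsum_congr fun l => ?_
    rw [mul_pow, pow_mul]
    ring
  · refine tsum_congr fun k => ?_
    have hk : Q ^ k ≤ 1 := pow_le_one₀ h0.le h1.le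
    have hz2 : z⁻¹ * Q < 1 := by rw [inv_mul_lt_one₀ z0]; exact hz
    have : z⁻¹ * Q ^ (k + 1) < 1 := by
      rw [pow_succ']
      calc z⁻¹ * (Q * Q ^ k) = z⁻¹ * Q * Q ^ k := by ring
        _ ≤ z⁻¹ * Q := mul_le_of_le_one_right (by positivity) hk
        _ < 1 := hz2
    rw [inv_one_sub_zpow_neg h0 hzo]
    rw [show (Q ^ ((k : ℤ) + 1)) = Q ^ (k + 1) by norm_cast,
      ← tsum_geometric_of_lt_one (by positivity) this, ← tsum_mul_left, ← tsum_neg,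
      ← tsum_mul_left, ← tsum_neg]
    refine tsum_congr fun l => ?_
    rw [mul_pow, ← pow_mul, inv_pow x, zpow_neg, mul_add_one (k + 1), pow_add Q,
      show (x ^ ((k : ℤ) + 1)) = x ^ (k + 1) by norm_cast, pow_succ z⁻¹ l]
    ring

lemma kron_comm (h0 : 0 < Q) (h1 : Q < 1) {x z : ℝ} (hx : Q < x) (hx1 : x < 1)
    (hz : Q < z) (hz1 : z < 1) : kron Q x z = kron Q z x := by
  have x0 : 0 < x := h0.trans hx
  have z0 : 0 < z := h0.trans hz
  rw [kron_eq_double h0 h1 hx hx1 hz hz1, kron_eq_double h0 h1 hz hz1 hx hx1]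
  congr 1
  · have : Summable (Function.uncurry fun k l : ℕ => x ^ k * z ^ l * Q ^ (k * l)) := by
      refine Summable.of_nonneg_of_le (fun p => by simp only [Function.uncurry]; positivity)
        (fun p => ?_) (Summable.mul_of_nonneg (summable_geometric_of_lt_one x0.le hx1)
        (summable_geometric_of_lt_one z0.le hz1) (fun _ => by positivity) fun _ => by positivity)
      exact mul_le_of_le_one_right (by positivity) (pow_le_one₀ h0.le h1.le)
    rw [← this.tsum_comm]
    exact tsum_congr fun k => tsum_congr fun l => by rw [mul_comm l k]; ring
  · have : Summable (Function.uncurry fun k l : ℕ =>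
        x⁻¹ ^ (k + 1) * z⁻¹ ^ (l + 1) * Q ^ ((k + 1) * (l + 1))) := by
      have hx2 : x⁻¹ * Q < 1 := by rw [inv_mul_lt_one₀ x0]; exact hx
      have hz2 : z⁻¹ * Q < 1 := by rw [inv_mul_lt_one₀ z0]; exact hz
      have := ((Summable.mul_of_nonneg
        (summable_geometric_of_lt_one (by positivity) hx2)
        (summable_geometric_of_lt_one (by positivity) hz2) (fun _ => by positivity)
        fun _ => by positivity).mul_left (x⁻¹ * z⁻¹ * Q))
      refine Summable.of_nonneg_of_le (fun p => by simp only [Function.uncurry]; positivity)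
        (fun p => ?_) this
      obtain ⟨k, l⟩ := p
      have e : x⁻¹ ^ (k + 1) * z⁻¹ ^ (l + 1) * Q ^ ((k + 1) * (l + 1))
        = x⁻¹ * z⁻¹ * Q * ((x⁻¹ * Q) ^ k * (z⁻¹ * Q) ^ l) * Q ^ (k * l) := by
          rw [mul_pow, mul_pow]; ring
      simp only [Function.uncurry, e]
      exact mul_le_of_le_one_right (by positivity) (pow_le_one₀ h0.le h1.le)
    rw [← this.tsum_comm]
    exact tsum_congr fun k => tsum_congr fun l => by rw [mul_comm (l + 1)]; ring

end Kronecker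

section Durfee

variable {𝕜 : Type*} [NormedField 𝕜] {q : 𝕜}

/-- The reciprocal `1/((1-q)⋯(1-q^n))`, extended by zero to negative `n`. -/
noncomputable def qinv (q : 𝕜) (n : ℤ) : 𝕜 :=
  if n < 0 then 0 else (∏ i ∈ Finset.range n.toNat, (1 - q ^ (i + 1)))⁻¹

/-- The Euler product `∏ (1 - q^(n+1))`. -/
noncomputable def eulerProd (q : 𝕜) : 𝕜 := ∏' n : ℕ, (1 - q ^ (n + 1))

/-- The Durfee rectangle series. -/
noncomputable def durfee (q : 𝕜) (N : ℤ) : 𝕜 :=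
  ∑' m : ℤ, q ^ (m * m + N * m) * qinv q m * qinv q (m + N)

lemma qinv_of_neg {n : ℤ} (hn : n < 0) : qinv q n = 0 := if_pos hn

lemma qinv_natCast (n : ℕ) : qinv q n = (∏ i ∈ Finset.range n, (1 - q ^ (i + 1)))⁻¹ := by
  simp [qinv]

@[simp] lemma qinv_zero : qinv q 0 = 1 := by simp [qinv]

lemma one_sub_pow_ne_zero (hq : ‖q‖ < 1) (n : ℕ) : 1 - q ^ (n + 1) ≠ 0 := by
  intro h
  have : ‖q ^ (n + 1)‖ < 1 := by
    rw [norm_pow]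
    exact pow_lt_one₀ (norm_nonneg _) hq (by omega)
  rw [← sub_eq_zero.1 h, norm_one] at this
  exact lt_irrefl _ this

lemma qinv_sub_one (hq : ‖q‖ < 1) (n : ℤ) : qinv q (n - 1) = (1 - q ^ n) * qinv q n := by
  rcases lt_trichotomy n 0 with h | rfl | h
  · rw [qinv_of_neg h, qinv_of_neg (by omega), mul_zero]
  · rw [qinv_of_neg (by omega)]; simp
  · obtain ⟨m, rfl⟩ : ∃ m : ℕ, n = m + 1 := ⟨(n - 1).toNat, by omega⟩
    rw [add_sub_cancel_right, show (m : ℤ) + 1 = ((m + 1 : ℕ) : ℤ) by push_cast; rfl,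
      qinv_natCast, qinv_natCast, Finset.prod_range_succ, zpow_natCast, mul_inv]
    have := one_sub_pow_ne_zero hq m
    field_simp

lemma summable_norm_neg_pow (hq : ‖q‖ < 1) : Summable fun n : ℕ => ‖-q ^ (n + 1)‖ := by
  simp_rw [norm_neg, norm_pow, pow_succ]
  exact (summable_geometric_of_lt_one (norm_nonneg _) hq).mul_right _

variable [CompleteSpace 𝕜]

lemma eulerProd_ne_zero (hq : ‖q‖ < 1) : eulerProd q ≠ 0 := by
  have := tprod_one_add_ne_zero_of_summable (f := fun n : ℕ => -q ^ (n + 1))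
    (fun n => by rw [← sub_eq_add_neg]; exact one_sub_pow_ne_zero hq n) (summable_norm_neg_pow hq)
  simpa [eulerProd, sub_eq_add_neg] using this

lemma multipliable_euler (hq : ‖q‖ < 1) : Multipliable fun n : ℕ => 1 - q ^ (n + 1) := by
  have := multipliable_one_add_of_summable (f := fun n : ℕ => -q ^ (n + 1))
    (summable_norm_neg_pow hq)
  simpa [sub_eq_add_neg] using this

lemma tendsto_qinv (hq : ‖q‖ < 1) :
    Tendsto (fun n : ℕ => qinv q n) atTop (𝓝 (eulerProd q)⁻¹) := by
  simp_rw [qinv_natCast]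
  exact ((multipliable_euler hq).hasProd.tendsto_prod_nat).inv₀ (eulerProd_ne_zero hq)

lemma exists_bound_qinv (hq : ‖q‖ < 1) : ∃ B, 0 ≤ B ∧ ∀ n : ℤ, ‖qinv q n‖ ≤ B := by
  obtain ⟨B, hB⟩ := (tendsto_qinv hq).norm.bddAbove_range
  have h0 : 0 ≤ B := (norm_nonneg _).trans (hB ⟨0, rfl⟩)
  refine ⟨B, h0, fun n => ?_⟩
  rcases lt_or_ge n 0 with h | h
  · simpa [qinv_of_neg h] using h0
  · lift n to ℕ using h
    exact hB ⟨n, rfl⟩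

omit [CompleteSpace 𝕜] in
lemma norm_durfee_pow (h0 : q ≠ 0) (N m : ℤ) :
    ‖q ^ (m * m + N * m)‖ = (‖q‖ ^ 2) ^ tri m * (‖q‖ ^ (N + 1)) ^ m := by
  have : ‖q‖ ≠ 0 := norm_ne_zero_iff.2 h0
  rw [norm_zpow, ← zpow_natCast, ← zpow_mul, ← zpow_mul, ← zpow_add₀ this]
  congr 1
  push_cast
  linear_combination -two_mul_tri m

omit [CompleteSpace 𝕜] in
lemma summable_durfee_pow (h0 : q ≠ 0) (hq : ‖q‖ < 1) (N : ℤ) :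
    Summable fun m : ℤ => ‖q ^ (m * m + N * m)‖ := by
  simp_rw [norm_durfee_pow h0]
  have : 0 < ‖q‖ := norm_pos_iff.2 h0
  exact summable_gauss (by positivity) (pow_lt_one₀ this.le hq two_ne_zero) (by positivity)

lemma summable_durfee (h0 : q ≠ 0) (hq : ‖q‖ < 1) (N M : ℤ) :
    Summable fun m : ℤ => q ^ (m * m + N * m) * qinv q m * qinv q (m + M) := by
  obtain ⟨B, hB0, hB⟩ := exists_bound_qinv hq
  refine .of_norm (Summable.of_nonneg_of_le (fun _ => norm_nonneg _) (fun m => ?_)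
    ((summable_durfee_pow h0 hq N).mul_right (B * B)))
  rw [norm_mul, norm_mul, mul_assoc]
  gcongr <;> apply hB

lemma durfee_step (h0 : q ≠ 0) (hq : ‖q‖ < 1) (N : ℤ) :
    durfee q N - durfee q (N + 1) = -q ^ (N + 1) * (durfee q (N + 1) - durfee q (N + 2)) := by
  have e1 : durfee q (N + 2) * q ^ (N + 1)
      = ∑' m : ℤ, q ^ (m * m + N * m) * (1 - q ^ m) * qinv q m * qinv q (m + (N + 1)) := by
    rw [durfee, ← Equiv.tsum_eq (Equiv.addRight (-1 : ℤ)), ← tsum_mul_right]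
    refine tsum_congr fun m => ?_
    simp only [Equiv.coe_addRight]
    rw [← sub_eq_add_neg, qinv_sub_one hq, show m - 1 + (N + 2) = m + (N + 1) by ring,
      show (m - 1) * (m - 1) + (N + 2) * (m - 1) = (m * m + N * m) + -(N + 1) by ring,
      zpow_add₀ h0, zpow_neg]
    have := zpow_ne_zero (N + 1) h0
    field_simp
  have hp : ∀ m : ℤ, q ^ (m * m + (N + 1) * m) = q ^ (m * m + N * m) * q ^ m := fun m => by
    rw [← zpow_add₀ h0]
    congr 1
    ring
  have hr : ∀ m : ℤ, q ^ (m + N + 1) = q ^ m * q ^ (N + 1) := fun m => by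
    rw [← zpow_add₀ h0, add_assoc]
  have e2 : durfee q (N + 1) * q ^ (N + 1)
      = ∑' m : ℤ, q ^ (m * m + N * m) * q ^ (m + N + 1) * qinv q m * qinv q (m + (N + 1)) := by
    rw [durfee, ← tsum_mul_right]
    refine tsum_congr fun m => ?_
    rw [hp, hr]
    ring
  have s := summable_durfee h0 hq
  have s1 : Summable fun m : ℤ =>
      q ^ (m * m + N * m) * (1 - q ^ m) * qinv q m * qinv q (m + (N + 1)) := by
    refine ((s N (N + 1)).sub (s (N + 1) (N + 1))).congr fun m => ?_
    rw [hp]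
    ring
  have s2 : Summable fun m : ℤ =>
      q ^ (m * m + N * m) * q ^ (m + N + 1) * qinv q m * qinv q (m + (N + 1)) := by
    refine ((s (N + 1) (N + 1)).mul_left (q ^ (N + 1))).congr fun m => ?_
    rw [hp, hr]
    ring
  have e3 : durfee q N - durfee q (N + 1)
      = durfee q (N + 2) * q ^ (N + 1) - durfee q (N + 1) * q ^ (N + 1) := by
    rw [e1, e2, durfee, durfee, ← (s N N).tsum_sub (s (N + 1) (N + 1)), ← s1.tsum_sub s2]
    refine tsum_congr fun m => ?_
    have h := qinv_sub_one hq (m + (N + 1))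
    rw [show m + (N + 1) - 1 = m + N by ring] at h
    rw [h, hp, ← add_assoc m]
    ring
  rw [e3]
  ring

lemma tendsto_durfee (h0 : q ≠ 0) (hq : ‖q‖ < 1) :
    Tendsto (fun N : ℕ => durfee q N) atTop (𝓝 (eulerProd q)⁻¹) := by
  obtain ⟨B, hB0, hB⟩ := exists_bound_qinv hq
  have key := tendsto_tsum_of_dominated_convergence (𝓕 := atTop)
    (f := fun (N : ℕ) (m : ℤ) => q ^ (m * m + N * m) * qinv q m * qinv q (m + N))
    (g := fun m : ℤ => if m = 0 then (eulerProd q)⁻¹ else 0)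
    ((summable_durfee_pow h0 hq 0).mul_right (B * B)) (fun m => ?_)
    (Eventually.of_forall fun N m => ?_)
  · simpa [durfee] using key
  · rcases lt_trichotomy m 0 with h | rfl | h
    · simp [qinv_of_neg h, h.ne]
    · simpa using tendsto_qinv hq
    · rw [if_neg h.ne']
      lift m to ℕ using h.le
      have h1 : Tendsto (fun N : ℕ => (q ^ m) ^ N) atTop (𝓝 0) := by
        refine tendsto_pow_atTop_nhds_zero_of_norm_lt_one ?_
        rw [norm_pow]
        exact pow_lt_one₀ (norm_nonneg _) hq (by omega)
      refine squeeze_zero_norm (a := fun N : ℕ => ‖(q ^ m) ^ N‖ * (‖q ^ (m * m)‖ * (B * B)))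
        (fun N => ?_) (by simpa using h1.norm.mul_const (‖q ^ (m * m)‖ * (B * B)))
      have : q ^ ((m : ℤ) * m + N * m) = (q ^ m) ^ N * q ^ (m * m) := by
        rw [← pow_mul, ← pow_add, ← zpow_natCast]
        congr 1
        push_cast
        ring
      rw [this, norm_mul, norm_mul, norm_mul, mul_assoc, mul_assoc]
      gcongr <;> apply hB
  · rcases lt_or_ge m 0 with h | h
    · simp only [qinv_of_neg h, mul_zero, zero_mul, norm_zero]
      positivity
    · rw [norm_mul, norm_mul, mul_assoc]
      gcongr ?_ * (?_ * ?_)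
      · rw [norm_zpow, norm_zpow]
        exact zpow_le_zpow_right_of_le_one₀ (norm_pos_iff.2 h0) hq.le (by
          have : 0 ≤ (N : ℤ) * m := by positivity
          omega)
      · apply hB
      · apply hB

/-- Durfee rectangles: the series does not depend on the shape. -/
theorem durfee_eq (h0 : q ≠ 0) (hq : ‖q‖ < 1) (N : ℤ) : durfee q N = (eulerProd q)⁻¹ := by
  set d : ℤ → 𝕜 := fun N => durfee q N - durfee q (N + 1) with hd
  have step : ∀ N, d N = -q ^ (N + 1) * d (N + 1) := fun N => by
    simp only [hd, durfee_step h0 hq N]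
    ring_nf
  have lim : Tendsto (fun N : ℕ => d N) atTop (𝓝 0) := by
    have := (tendsto_durfee h0 hq).sub ((tendsto_add_atTop_iff_nat 1).2 (tendsto_durfee h0 hq))
    rw [sub_self] at this
    refine this.congr fun N => ?_
    simp [hd]
  have pos : ∀ N : ℕ, d N = 0 := fun N => by
    have le : ∀ k : ℕ, ‖d N‖ ≤ ‖d ((N + k : ℕ))‖ := fun k => by
      induction k with
      | zero => simp
      | succ k ih =>
        refine ih.trans ?_
        rw [step]
        have : ‖-q ^ (((N + k : ℕ) : ℤ) + 1)‖ ≤ 1 := by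
          rw [norm_neg, norm_zpow]
          exact_mod_cast pow_le_one₀ (n := N + k + 1) (norm_nonneg _) hq.le
        rw [norm_mul]
        simpa [add_assoc] using mul_le_mul_of_nonneg_right this (norm_nonneg (d (((N + k : ℕ) : ℤ) + 1)))
    have : Tendsto (fun k : ℕ => ‖d ((N + k : ℕ))‖) atTop (𝓝 0) := by
      have := lim.norm.comp (tendsto_add_atTop_nat N)
      simpa [Function.comp_def, add_comm] using this
    exact norm_le_zero_iff.1 (ge_of_tendsto' this le)
  have all : ∀ N : ℤ, d N = 0 := fun N => by
    have : ∀ k : ℕ, d (-(k : ℤ)) = 0 := fun k => by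
      induction k with
      | zero => exact_mod_cast pos 0
      | succ k ih =>
        rw [step, show -((k + 1 : ℕ) : ℤ) + 1 = -(k : ℤ) by push_cast; ring, ih, mul_zero]
    rcases Int.eq_nat_or_neg N with ⟨k, rfl | rfl⟩
    exacts [pos k, this k]
  have const : ∀ k : ℕ, durfee q N = durfee q (N + k) := fun k => by
    induction k with
    | zero => simp
    | succ k ih =>
      rw [ih, sub_eq_zero.1 (all (N + k))]
      push_cast
      ring_nf
  have h2 : Tendsto (fun k : ℕ => durfee q ((N.natAbs + k : ℕ) : ℤ)) atTop (𝓝 (eulerProd q)⁻¹) := by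
    have := (tendsto_durfee h0 hq).comp (tendsto_add_atTop_nat N.natAbs)
    simpa [Function.comp_def, add_comm] using this
  have h3 : ∀ k : ℕ, durfee q ((N.natAbs + k : ℕ) : ℤ) = durfee q N := fun k => by
    have e : ((N.natAbs + k : ℕ) : ℤ) = N + ((N.natAbs - N).toNat + k : ℕ) := by omega
    rw [const ((N.natAbs - N).toNat + k), e]
  simp_rw [h3] at h2
  exact tendsto_nhds_unique tendsto_const_nhds h2

end Durfee

section PentagonalNumberTheorem

variable {𝕜 : Type*} [NormedField 𝕜] {q : 𝕜}

lemma natCast_pentagonal_eq (k : ℤ) : (pentagonal k : ℤ) = 3 * tri k + k := by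
  have h1 := two_mul_natCast_pentagonal k
  have h2 := two_mul_tri k
  linarith

lemma summable_norm_pentagonal (hq : ‖q‖ < 1) :
    Summable fun k : ℤ => ‖(-1) ^ k * q ^ (3 * tri k + k)‖ := by
  have := (summable_geometric_of_lt_one (norm_nonneg q) hq).comp_injective pentagonal_injective
  refine this.congr fun k => ?_
  rw [← natCast_pentagonal_eq, zpow_natCast]
  simp

variable [CompleteSpace 𝕜]

lemma exists_bound_prod_one_sub (hq : ‖q‖ < 1) :
    ∃ B, 0 ≤ B ∧ ∀ k n : ℕ, ‖∏ i ∈ Finset.range n, (1 - q ^ (k + i + 1))‖ ≤ B := by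
  obtain ⟨B, hB⟩ := (multipliable_euler hq).hasProd.tendsto_prod_nat.norm.bddAbove_range
  obtain ⟨C, hC0, hC⟩ := exists_bound_qinv hq
  have hB0 : 0 ≤ B := (norm_nonneg _).trans (hB ⟨0, rfl⟩)
  refine ⟨C * B, by positivity, fun k n => ?_⟩
  have hp : ∏ i ∈ Finset.range k, (1 - q ^ (i + 1)) ≠ 0 :=
    Finset.prod_ne_zero_iff.2 fun i _ => one_sub_pow_ne_zero hq i
  have key : ∏ i ∈ Finset.range n, (1 - q ^ (k + i + 1))
      = qinv q k * ∏ i ∈ Finset.range (k + n), (1 - q ^ (i + 1)) := by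
    rw [Finset.prod_range_add, qinv_natCast, inv_mul_cancel_left₀ hp]
  rw [key, norm_mul]
  exact mul_le_mul (hC k) (hB ⟨_, rfl⟩) (norm_nonneg _) hC0

/-- Euler's pentagonal number theorem. -/
theorem eulerProd_eq_tsum (hq : ‖q‖ < 1) :
    eulerProd q = ∑' k : ℤ, (-1) ^ k * q ^ (3 * tri k + k) := by
  obtain ⟨B, hB0, hB⟩ := exists_bound_prod_one_sub hq
  have hs := (summable_norm_pentagonal hq).of_norm
  have hbound : ∀ k n : ℕ, ‖q ^ ((k + 1) * n) * ∏ i ∈ Finset.range (n + 1), (1 - q ^ (k + i + 1))‖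
      ≤ ‖q‖ ^ n * B := fun k n => by
    rw [norm_mul, norm_pow]
    refine mul_le_mul (pow_le_pow_of_le_one (norm_nonneg _) hq.le ?_) (hB _ _) (norm_nonneg _)
      (by positivity)
    nlinarith
  have hgeo : Summable fun n : ℕ => ‖q‖ ^ n * B :=
    (summable_geometric_of_lt_one (norm_nonneg q) hq).mul_right B
  obtain ⟨f, hf⟩ : ∃ f : ℤ → 𝕜, ∀ k, f k = (-1) ^ (-k) * q ^ (3 * tri (-k) + -k) :=
    ⟨_, fun _ => rfl⟩
  have hs' : Summable f := ((Equiv.neg ℤ).summable_iff.2 hs).congr fun k => (hf k).symm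
  have hnat : Summable fun k : ℕ => f k := hs'.comp_injective Nat.cast_injective
  have hneg : Summable fun k : ℕ => f (-((k : ℤ) + 1)) :=
    hs'.comp_injective (i := fun k : ℕ => -((k : ℤ) + 1)) fun a b h => by simpa using h
  have hterm : ∀ k : ℕ, f k + f (-((k : ℤ) + 1))
      = (-1) ^ k * (q ^ pentagonal (-k) - q ^ pentagonal (k + 1)) := fun k => by
    rw [hf, hf, ← natCast_pentagonal_eq, ← natCast_pentagonal_eq, zpow_natCast, zpow_natCast,
      neg_neg, zpow_neg, zpow_natCast, ← Nat.cast_succ, zpow_natCast, pow_succ, ← inv_pow,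
      inv_neg_one]
    push_cast
    ring
  rw [eulerProd, Pentagonal.tprod_one_sub_pow]
  · calc _ = ∑' k : ℕ, (f k + f (-((k : ℤ) + 1))) := tsum_congr fun k => by rw [hterm]
      _ = ∑' k : ℤ, f k := by
        rw [(hnat.hasSum.of_nat_of_neg_add_one hneg.hasSum).tsum_eq, hnat.tsum_add hneg]
      _ = _ := by
        rw [← (Equiv.neg ℤ).tsum_eq fun k : ℤ => (-1) ^ k * q ^ (3 * tri k + k)]
        exact tsum_congr hf
  · exact tendsto_pow_atTop_nhds_zero_of_norm_lt_one hq
  · exact fun k => .of_norm_bounded hgeo (hbound k)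
  · intro k
    have := multipliable_one_add_of_summable (f := fun n : ℕ => -q ^ (n + k + 1))
      (by simpa [add_right_comm] using
        (summable_nat_add_iff (f := fun n : ℕ => ‖-q ^ (n + 1)‖) k).2 (summable_norm_neg_pow hq))
    simpa [sub_eq_add_neg] using this
  · refine (hnat.add hneg).congr fun k => ?_
    rw [hterm]
  · have h1 : Tendsto (fun k : ℕ => ‖q‖ ^ k * ∑' n : ℕ, ‖q‖ ^ n * B) atTop (𝓝 0) := by
      simpa using (tendsto_pow_atTop_nhds_zero_of_lt_one (norm_nonneg q) hq).mul_const _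
    refine squeeze_zero_norm (fun k => ?_) h1
    rw [norm_mul, norm_mul, norm_pow, norm_neg, norm_one, one_pow, one_mul, norm_pow]
    refine mul_le_mul (pow_le_pow_of_le_one (norm_nonneg _) hq.le ?_)
      (tsum_of_norm_bounded hgeo.hasSum (hbound k)) (norm_nonneg _) (by positivity)
    rw [Nat.le_div_iff_mul_le two_pos]
    nlinarith

end PentagonalNumberTheorem

/-- The product `∏ (1 - x Q^i)` over `i ≥ 0`. -/
noncomputable def poch (Q x : ℝ) : ℝ := ∏' i : ℕ, (1 - x * Q ^ i)

/-- Euler's expansion of `poch`. -/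
noncomputable def eulerSeries (Q x : ℝ) : ℝ := ∑' n : ℤ, (-1) ^ n * Q ^ tri n * qinv Q n * x ^ n

section TripleProduct

variable {Q : ℝ}

lemma norm_lt_one_of_pos (h0 : 0 < Q) (h1 : Q < 1) : ‖Q‖ < 1 := by
  rwa [Real.norm_of_nonneg h0.le]

lemma norm_euler_term_le (h0 : 0 < Q) {B c : ℝ} (hB : ∀ n : ℤ, ‖qinv Q n‖ ≤ B) {x : ℝ}
    (hx : |x| ≤ c) (hc : 0 < c) (n : ℤ) :
    ‖(-1) ^ n * Q ^ tri n * qinv Q n * x ^ n‖ ≤ Q ^ tri n * c ^ n * B := by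
  have hB0 : 0 ≤ B := (norm_nonneg _).trans (hB 0)
  rcases lt_or_ge n 0 with h | h
  · rw [qinv_of_neg h]
    simp only [mul_zero, zero_mul, norm_zero]
    positivity
  · lift n to ℕ using h
    rw [norm_mul, norm_mul, norm_mul, Real.norm_eq_abs, abs_neg_one_zpow, one_mul,
      Real.norm_of_nonneg (zpow_pos h0 _).le, zpow_natCast, zpow_natCast, norm_pow, Real.norm_eq_abs,
      mul_right_comm]
    gcongr
    exacts [hx, hB n]

lemma summable_norm_euler (h0 : 0 < Q) (h1 : Q < 1) (x : ℝ) :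
    Summable fun n : ℤ => ‖(-1) ^ n * Q ^ tri n * qinv Q n * x ^ n‖ := by
  obtain ⟨B, -, hB⟩ := exists_bound_qinv (norm_lt_one_of_pos h0 h1)
  have hc : 0 < |x| + 1 := by positivity
  exact Summable.of_nonneg_of_le (fun _ => norm_nonneg _)
    (norm_euler_term_le h0 hB (le_add_of_nonneg_right zero_le_one) hc)
    ((summable_gauss h0 h1 hc).mul_right B)

lemma continuousAt_eulerSeries (h0 : 0 < Q) (h1 : Q < 1) (a : ℝ) :
    ContinuousAt (eulerSeries Q) a := by
  obtain ⟨B, -, hB⟩ := exists_bound_qinv (norm_lt_one_of_pos h0 h1)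
  have hc : 0 < |a| + 1 := by positivity
  refine tendsto_tsum_of_dominated_convergence ((summable_gauss h0 h1 hc).mul_right B)
    (fun n => ?_) ?_
  · rcases lt_or_ge n 0 with h | h
    · simp [qinv_of_neg h]
    · lift n to ℕ using h
      simp only [zpow_natCast]
      exact ((continuous_pow n).tendsto a).const_mul _
  · have : ∀ᶠ x in 𝓝 a, |x| < |a| + 1 :=
      (continuous_abs.tendsto a).eventually_lt_const (lt_add_one _)
    filter_upwards [this] with x hx n
    exact norm_euler_term_le h0 hB hx.le hc n

lemma eulerSeries_zero : eulerSeries Q 0 = 1 := by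
  rw [eulerSeries, tsum_eq_single 0]
  · simp
  · intro n hn
    simp [zero_zpow n hn]

lemma eulerSeries_step (h0 : 0 < Q) (h1 : Q < 1) {x : ℝ} (hx : x ≠ 0) :
    eulerSeries Q x = (1 - x) * eulerSeries Q (x * Q) := by
  have s := fun x => (summable_norm_euler h0 h1 x).of_norm
  have e : eulerSeries Q x - eulerSeries Q (x * Q) = -x * eulerSeries Q (x * Q) := by
    rw [eulerSeries, eulerSeries, ← (s _).tsum_sub (s _), ← tsum_mul_left,
      ← Equiv.tsum_eq (Equiv.addRight (1 : ℤ))]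
    refine tsum_congr fun n => ?_
    have h := qinv_sub_one (norm_lt_one_of_pos h0 h1) (n + 1)
    rw [add_sub_cancel_right] at h
    simp only [Equiv.coe_addRight]
    rw [h, neg_one_zpow_add, tri_add_one, zpow_add₀ h0.ne', _root_.mul_zpow, _root_.mul_zpow,
      zpow_add_one₀ hx, zpow_add_one₀ h0.ne']
    ring
  linear_combination e

lemma eulerSeries_eq_poch (h0 : 0 < Q) (h1 : Q < 1) {x : ℝ} (hx : x ≠ 0) :
    eulerSeries Q x = poch Q x := by
  have it : ∀ N : ℕ, eulerSeries Q x
      = (∏ i ∈ Finset.range N, (1 - x * Q ^ i)) * eulerSeries Q (x * Q ^ N) := fun N => by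
    induction N with
    | zero => simp
    | succ N ih =>
      rw [ih, eulerSeries_step h0 h1 (mul_ne_zero hx (pow_pos h0 N).ne'), Finset.prod_range_succ,
        pow_succ]
      ring_nf
  have m : Multipliable fun i : ℕ => 1 - x * Q ^ i := by
    have := multipliable_one_add_of_summable (f := fun i : ℕ => -(x * Q ^ i)) (by
      simp_rw [norm_neg, norm_mul, norm_pow]
      exact (summable_geometric_of_lt_one (norm_nonneg _) (norm_lt_one_of_pos h0 h1)).mul_left _)
    simpa [sub_eq_add_neg] using this
  have t0 : Tendsto (fun N : ℕ => x * Q ^ N) atTop (𝓝 0) := by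
    simpa using (tendsto_pow_atTop_nhds_zero_of_lt_one h0.le h1).const_mul x
  have t := m.hasProd.tendsto_prod_nat.mul ((continuousAt_eulerSeries h0 h1 0).tendsto.comp t0)
  rw [eulerSeries_zero, mul_one] at t
  exact tendsto_nhds_unique (tendsto_const_nhds.congr it) t

lemma poch_step (h0 : 0 < Q) (h1 : Q < 1) {x : ℝ} (hx : x ≠ 0) :
    poch Q x = (1 - x) * poch Q (x * Q) := by
  rw [← eulerSeries_eq_poch h0 h1 hx, eulerSeries_step h0 h1 hx,
    eulerSeries_eq_poch h0 h1 (mul_ne_zero hx h0.ne')]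

lemma poch_self : poch Q Q = eulerProd Q := by
  simp_rw [poch, eulerProd, pow_succ']

lemma poch_ne_zero (h0 : 0 < Q) (h1 : Q < 1) {x : ℝ} (hx : OffLattice Q x) : poch Q x ≠ 0 := by
  have := tprod_one_add_ne_zero_of_summable (f := fun i : ℕ => -(x * Q ^ i))
    (fun i => by
      rw [← sub_eq_add_neg]
      exact_mod_cast hx.one_sub_ne i) (by
      simp_rw [norm_neg, norm_mul, norm_pow]
      exact (summable_geometric_of_lt_one (norm_nonneg _) (norm_lt_one_of_pos h0 h1)).mul_left _)
  simpa [poch, sub_eq_add_neg] using this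

/-- Jacobi's triple product. -/
theorem theta_eq_poch (h0 : 0 < Q) (h1 : Q < 1) {x : ℝ} (hx : x ≠ 0) :
    theta Q x = eulerProd Q * (poch Q x * poch Q (Q * x⁻¹)) := by
  have hQ := norm_lt_one_of_pos h0 h1
  have hx' : Q * x⁻¹ ≠ 0 := mul_ne_zero h0.ne' (inv_ne_zero hx)
  have n1 := summable_norm_euler h0 h1 x
  have n2 := summable_norm_euler h0 h1 (Q * x⁻¹)
  have s := summable_mul_of_summable_norm n1 n2
  rw [← eulerSeries_eq_poch h0 h1 hx, ← eulerSeries_eq_poch h0 h1 hx', eulerSeries, eulerSeries,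
    tsum_mul_tsum_of_summable_norm n1 n2]
  let σ : ℤ × ℤ ≃ ℤ × ℤ :=
    { toFun := fun p => (p.2 + p.1, p.2)
      invFun := fun p => (p.1 - p.2, p.2)
      left_inv := fun p => by simp
      right_inv := fun p => by simp }
  have e : ∀ p : ℤ × ℤ, (-1) ^ (σ p).1 * Q ^ tri (σ p).1 * qinv Q (σ p).1 * x ^ (σ p).1
      * ((-1) ^ (σ p).2 * Q ^ tri (σ p).2 * qinv Q (σ p).2 * (Q * x⁻¹) ^ (σ p).2)
      = (-1) ^ p.1 * Q ^ tri p.1 * x ^ p.1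
        * (Q ^ (p.2 * p.2 + p.1 * p.2) * qinv Q p.2 * qinv Q (p.2 + p.1)) := by
    rintro ⟨N, n⟩
    simp only [σ, Equiv.coe_fn_mk]
    have a1 : Q ^ tri (n + N) * Q ^ tri n * Q ^ n = Q ^ tri N * Q ^ (n * n + N * n) := by
      rw [← zpow_add₀ h0.ne', ← zpow_add₀ h0.ne', ← zpow_add₀ h0.ne', tri_add]
      congr 1
      linear_combination two_mul_tri n
    have a2 : x ^ (n + N) * x⁻¹ ^ n = x ^ N := by
      rw [zpow_add₀ hx, inv_zpow]
      have := zpow_ne_zero n hx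
      field_simp
    have a3 : (-1 : ℝ) ^ (n + N) * (-1) ^ n = (-1) ^ N := by
      rw [neg_one_zpow_add]
      linear_combination (-1 : ℝ) ^ N * neg_one_zpow_mul_self n
    rw [_root_.mul_zpow]
    calc _ = ((-1 : ℝ) ^ (n + N) * (-1) ^ n) * (Q ^ tri (n + N) * Q ^ tri n * Q ^ n)
          * (x ^ (n + N) * x⁻¹ ^ n) * (qinv Q n * qinv Q (n + N)) := by ring
      _ = _ := by rw [a1, a2, a3]; ring
  have s' := σ.summable_iff.2 s
  rw [← σ.tsum_eq]
  simp only [Function.comp_def] at s'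
  simp_rw [e] at s' ⊢
  rw [s'.tsum_prod, theta, ← tsum_mul_left]
  refine tsum_congr fun N => ?_
  have := durfee_eq h0.ne' hQ N
  rw [durfee] at this
  simp only [tsum_mul_left]
  rw [this]
  have := eulerProd_ne_zero hQ
  field_simp

lemma OffLattice.mul_inv_self (h0 : 0 < Q) {x : ℝ} (hx : OffLattice Q x) :
    OffLattice Q (Q * x⁻¹) := by
  simpa [mul_comm] using hx.inv.mul_zpow h0 1

lemma theta_ne_zero (h0 : 0 < Q) (h1 : Q < 1) {x : ℝ} (hx : OffLattice Q x) : theta Q x ≠ 0 := by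
  rw [theta_eq_poch h0 h1 hx.1]
  exact mul_ne_zero (eulerProd_ne_zero (norm_lt_one_of_pos h0 h1))
    (mul_ne_zero (poch_ne_zero h0 h1 hx) (poch_ne_zero h0 h1 (hx.mul_inv_self h0)))

lemma theta_eq_one_sub_mul (h0 : 0 < Q) (h1 : Q < 1) {x : ℝ} (hx : x ≠ 0) :
    theta Q x = (1 - x) * (eulerProd Q * (poch Q (x * Q) * poch Q (Q * x⁻¹))) := by
  rw [theta_eq_poch h0 h1 hx, poch_step h0 h1 hx]
  ring

lemma tendsto_theta_div (h0 : 0 < Q) (h1 : Q < 1) :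
    Tendsto (fun x => eulerProd Q * (poch Q (x * Q) * poch Q (Q * x⁻¹))) (𝓝 1)
      (𝓝 (eulerProd Q ^ 3)) := by
  have c := (continuousAt_eulerSeries h0 h1 Q).tendsto
  have a : Tendsto (fun x : ℝ => x * Q) (𝓝 1) (𝓝 Q) := by
    simpa using (continuous_mul_const Q).tendsto 1
  have b : Tendsto (fun x : ℝ => Q * x⁻¹) (𝓝 1) (𝓝 Q) := by
    simpa using (tendsto_inv₀ (one_ne_zero (α := ℝ))).const_mul Q
  have := ((c.comp a).mul (c.comp b)).const_mul (eulerProd Q)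
  rw [eulerSeries_eq_poch h0 h1 h0.ne', poch_self] at this
  rw [show eulerProd Q ^ 3 = eulerProd Q * (eulerProd Q * eulerProd Q) by ring]
  refine this.congr' ?_
  filter_upwards [isOpen_ne.mem_nhds (one_ne_zero (α := ℝ))] with x hx
  rw [Function.comp_apply, Function.comp_apply,
    eulerSeries_eq_poch h0 h1 (mul_ne_zero hx h0.ne'),
    eulerSeries_eq_poch h0 h1 (mul_ne_zero h0.ne' (inv_ne_zero hx))]

/-- The part of `appell` that is regular at `1`. -/
noncomputable def appellReg (Q u : ℝ) : ℝ :=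
  ∑' k : ℤ, if k = 0 then 0 else eps Q k * (1 - u * Q ^ k)⁻¹

lemma appell_eq_add_reg (h0 : 0 < Q) (h1 : Q < 1) {u : ℝ} (hu : u ≠ 0) :
    appell Q u = (1 - u)⁻¹ + appellReg Q u := by
  rw [appell, (summable_norm_appell h0 h1 hu).of_norm.tsum_eq_add_tsum_ite 0, appellReg]
  simp [eps]

lemma exists_bound_inv_near_one (h0 : 0 < Q) (h1 : Q < 1) :
    ∃ C, 0 < C ∧ ∀ᶠ u in 𝓝 (1 : ℝ), ∀ k : ℤ, k ≠ 0 → |(1 - u * Q ^ k)⁻¹| ≤ C := by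
  have hm : 0 < (1 - Q) / 4 := by linarith
  refine ⟨((1 - Q) / 4)⁻¹, by positivity, ?_⟩
  have r1 : ∀ᶠ u in 𝓝 (1 : ℝ), u * Q < (1 + Q) / 2 := by
    have : Tendsto (fun u : ℝ => u * Q) (𝓝 1) (𝓝 Q) := by
      simpa using (continuous_mul_const Q).tendsto 1
    exact this.eventually_lt_const (by linarith)
  have r2 : ∀ᶠ u in 𝓝 (1 : ℝ), 1 + (1 - Q) / 2 < u * Q⁻¹ := by
    have : Tendsto (fun u : ℝ => u * Q⁻¹) (𝓝 1) (𝓝 Q⁻¹) := by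
      simpa using (continuous_mul_const Q⁻¹).tendsto 1
    refine this.eventually_const_lt ?_
    rw [← one_div, lt_div_iff₀ h0]
    nlinarith
  filter_upwards [r1, r2, lt_mem_nhds (show (0 : ℝ) < 1 by norm_num)] with u hu1 hu2 hu0 k hk
  rw [abs_inv]
  refine inv_anti₀ hm ?_
  rcases lt_or_gt_of_ne hk with h | h
  · have : u * Q⁻¹ ≤ u * Q ^ k := by
      gcongr
      rw [← zpow_neg_one]
      exact zpow_le_zpow_right_of_le_one₀ h0 h1.le (by omega)
    rw [abs_sub_comm]
    exact le_trans (by linarith) (le_abs_self _)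
  · have : u * Q ^ k ≤ u * Q := by
      gcongr
      nth_rw 2 [← zpow_one Q]
      exact zpow_le_zpow_right_of_le_one₀ h0 h1.le (by omega)
    exact le_trans (by linarith) (le_abs_self _)

lemma appellReg_one (h0 : 0 < Q) : appellReg Q 1 = 0 := by
  have : appellReg Q 1 = -appellReg Q 1 := by
    conv_lhs => rw [appellReg, ← Equiv.tsum_eq (Equiv.neg ℤ)]
    rw [appellReg, ← tsum_neg]
    refine tsum_congr fun k => ?_
    simp only [Equiv.neg_apply, neg_eq_zero]
    split_ifs with hk
    · simp
    have hk' : (1 : ℝ) - 1 * Q ^ k = 1 - Q ^ k := by rw [one_mul]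
    have e : eps Q (-k) * Q ^ k = eps Q k := by
      rw [eps, eps, neg_one_zpow_neg, mul_assoc, ← zpow_add₀ h0.ne', show -k + 1 = 1 - k by ring,
        tri_one_sub, tri_add_one]
    rw [hk', one_mul, ← e, zpow_neg]
    have h := (zpow_pos h0 k).ne'
    have : 1 - (Q ^ k)⁻¹ = -(1 - Q ^ k) * (Q ^ k)⁻¹ := by field_simp; ring
    rw [this, mul_inv, inv_inv, inv_neg]
    ring
  linarith

lemma tendsto_appellReg (h0 : 0 < Q) (h1 : Q < 1) :
    Tendsto (appellReg Q) (𝓝 1) (𝓝 0) := by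
  obtain ⟨C, hC, h⟩ := exists_bound_inv_near_one h0 h1
  rw [← appellReg_one h0]
  refine tendsto_tsum_of_dominated_convergence ((summable_norm_eps h0 h1).mul_right C)
    (fun k => ?_) ?_
  · split_ifs with hk
    · exact tendsto_const_nhds
    · refine Tendsto.const_mul _ (Tendsto.inv₀ ?_ ?_)
      · exact (Continuous.tendsto (by fun_prop) _)
      · rw [one_mul, sub_ne_zero]
        exact fun h => hk ((zpow_eq_one_iff_right₀ h0.le h1.ne).1 h.symm)
  · filter_upwards [h] with u hu k
    split_ifs with hk
    · rw [norm_zero]; positivity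
    · rw [norm_mul]
      gcongr
      exact hu k hk

lemma tendsto_appell_mul_theta (h0 : 0 < Q) (h1 : Q < 1) :
    Tendsto (fun x => appell Q x * theta Q x) (𝓝[≠] 1) (𝓝 (eulerProd Q ^ 3)) := by
  have a : Tendsto (fun x : ℝ => 1 + (1 - x) * appellReg Q x) (𝓝 1) (𝓝 1) := by
    have : Tendsto (fun x : ℝ => 1 - x) (𝓝 1) (𝓝 0) := by
      simpa using (continuous_sub_left (1 : ℝ)).tendsto 1
    simpa using (this.mul (tendsto_appellReg h0 h1)).const_add 1
  have := (a.mul (tendsto_theta_div h0 h1)).mono_left (nhdsWithin_le_nhds (s := {1}ᶜ))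
  rw [one_mul] at this
  refine this.congr' ?_
  filter_upwards [nhdsWithin_le_nhds (isOpen_ne.mem_nhds (one_ne_zero (α := ℝ))),
    self_mem_nhdsWithin] with x hx hx1
  rw [appell_eq_add_reg h0 h1 hx, theta_eq_one_sub_mul h0 h1 hx]
  have : 1 - x ≠ 0 := sub_ne_zero.2 (Ne.symm hx1)
  field_simp

lemma appell_mul_theta_of_mem (h0 : 0 < Q) (h1 : Q < 1) {z : ℝ} (hz : Q < z) (hz1 : z < 1) :
    appell Q z * theta Q z = eulerProd Q ^ 3 := by
  have h : ∀ᶠ x in 𝓝[<] (1 : ℝ), appell Q x * theta Q x = appell Q z * theta Q z := by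
    have r1 : ∀ᶠ x in 𝓝[<] (1 : ℝ), Q < x * z := by
      have : Tendsto (fun x : ℝ => x * z) (𝓝[<] 1) (𝓝 z) := by
        simpa using ((continuous_mul_const z).tendsto 1).mono_left nhdsWithin_le_nhds
      exact this.eventually_const_lt hz
    filter_upwards [r1, Ioo_mem_nhdsLT h1] with x hx1 ⟨hx, hx'⟩
    have hz0 : 0 < z := h0.trans hz
    have o : OffLattice Q (x * z) := offLattice_of_mem_Ioo h0 h1 hx1 (by nlinarith)
    have a := theta_mul_kron h0 h1 hx hx' (offLattice_of_mem_Ioo h0 h1 hz hz1)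
    have b := theta_mul_kron h0 h1 hz hz1 (offLattice_of_mem_Ioo h0 h1 hx hx')
    rw [← kron_comm h0 h1 hx hx' hz hz1, mul_comm z x] at b
    refine mul_right_cancel₀ (theta_ne_zero h0 h1 o) ?_
    linear_combination theta Q z * a - theta Q x * b
  have t : Tendsto (fun x => appell Q x * theta Q x) (𝓝[<] 1) (𝓝 (eulerProd Q ^ 3)) :=
    (tendsto_appell_mul_theta h0 h1).mono_left (nhdsWithin_mono _ (fun x (hx : x < 1) => hx.ne))
  exact tendsto_nhds_unique tendsto_const_nhds ((tendsto_congr' h).1 t)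

lemma exists_zpow_mul_mem (h0 : 0 < Q) (h1 : Q < 1) {z : ℝ} (hz : 0 < z) :
    ∃ n : ℤ, Q < z * Q ^ n ∧ z * Q ^ n ≤ 1 := by
  obtain ⟨n, h, h'⟩ := exists_mem_Ioc_zpow hz ((one_lt_inv₀ h0).2 h1)
  have hq : 0 < Q ^ (n + 1) := zpow_pos h0 _
  refine ⟨n + 1, ?_, ?_⟩
  · rw [inv_zpow, ← zpow_neg] at h
    have := mul_lt_mul_of_pos_right h hq
    rwa [← zpow_add₀ h0.ne', neg_add_cancel_left, zpow_one] at this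
  · have := mul_le_mul_of_nonneg_right h' hq.le
    rwa [inv_zpow, inv_mul_cancel₀ hq.ne'] at this

theorem appell_mul_theta (h0 : 0 < Q) (h1 : Q < 1) {z : ℝ} (hz : 0 < z) (ho : OffLattice Q z) :
    appell Q z * theta Q z = eulerProd Q ^ 3 := by
  obtain ⟨n, hn, hn'⟩ := exists_zpow_mul_mem h0 h1 hz
  have := appell_mul_theta_of_mem h0 h1 hn (lt_of_le_of_ne hn' (ho.2 n))
  rw [appell_mul_zpow h0 h1 ho, theta_mul_zpow h0 hz.ne'] at this
  rw [← this]
  have a : z ^ n * z ^ (-n) = 1 := by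
    rw [← zpow_add₀ hz.ne', add_neg_cancel, zpow_zero]
  have b : Q ^ tri n * Q ^ (-tri n) = 1 := by
    rw [← zpow_add₀ h0.ne', add_neg_cancel, zpow_zero]
  calc _ = 1 * 1 * 1 * (appell Q z * theta Q z) := by ring
    _ = ((-1 : ℝ) ^ n * (-1) ^ n) * (z ^ n * z ^ (-n)) * (Q ^ tri n * Q ^ (-tri n))
      * (appell Q z * theta Q z) := by rw [a, b, neg_one_zpow_mul_self]
    _ = _ := by ring

end TripleProduct

/-- The Lambert type series `∑ a k / (1 - u Q^k)`; a term with vanishing denominator is dropped. -/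
noncomputable def lambert (Q : ℝ) (a : ℤ → ℝ) (u : ℝ) : ℝ := ∑' k : ℤ, a k * (1 - u * Q ^ k)⁻¹

section Lambert

variable {Q : ℝ}

lemma exists_bound_inv_near (h0 : 0 < Q) (h1 : Q < 1) {u₀ : ℝ} (hu : u₀ ≠ 0) :
    ∃ C, 0 < C ∧ ∀ᶠ u in 𝓝 u₀, ∀ k : ℤ, u₀ * Q ^ k ≠ 1 → |(1 - u * Q ^ k)⁻¹| ≤ C := by
  obtain ⟨C, hC, hk⟩ := exists_bound_inv_one_sub h0 h1 hu
  refine ⟨2 * C, by positivity, ?_⟩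
  have hb : 0 < |u₀| := abs_pos.2 hu
  have hd : 0 < |u₀| / (2 * (C + 1)) := by positivity
  filter_upwards [Metric.ball_mem_nhds u₀ hd] with u hu' k hne
  have hz : 1 - u₀ * Q ^ k ≠ 0 := sub_ne_zero.2 hne.symm
  have hQ : 0 < Q ^ k := zpow_pos h0 k
  have hp : 0 < |1 - u₀ * Q ^ k| := abs_pos.2 hz
  have hm : 1 ≤ C * |1 - u₀ * Q ^ k| := by
    have := hk k
    rw [abs_inv] at this
    calc 1 = |1 - u₀ * Q ^ k|⁻¹ * |1 - u₀ * Q ^ k| := (inv_mul_cancel₀ hp.ne').symm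
      _ ≤ _ := by gcongr
  have h2 : |u₀| * Q ^ k ≤ (C + 1) * |1 - u₀ * Q ^ k| := by
    have : |u₀| * Q ^ k = |u₀ * Q ^ k| := by rw [abs_mul, abs_of_pos hQ]
    rw [this]
    calc |u₀ * Q ^ k| = |1 - (1 - u₀ * Q ^ k)| := by ring_nf
      _ ≤ |1| + |1 - u₀ * Q ^ k| := abs_sub _ _
      _ ≤ _ := by rw [abs_one]; linarith
  have h3 : |u - u₀| * Q ^ k ≤ |1 - u₀ * Q ^ k| / 2 := by
    rw [Metric.mem_ball, Real.dist_eq] at hu'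
    have : |u - u₀| * (2 * (C + 1)) ≤ |u₀| := by
      rw [lt_div_iff₀ (by positivity)] at hu'
      exact hu'.le
    have h4 := mul_le_mul_of_nonneg_right this hQ.le
    have h5 : 0 < C + 1 := by linarith
    have : (C + 1) * (2 * (|u - u₀| * Q ^ k)) ≤ (C + 1) * |1 - u₀ * Q ^ k| := by linarith
    linarith [le_of_mul_le_mul_left this h5]
  have h6 : |1 - u₀ * Q ^ k| / 2 ≤ |1 - u * Q ^ k| := by
    have := abs_sub_abs_le_abs_sub (1 - u₀ * Q ^ k) (1 - u * Q ^ k)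
    rw [show 1 - u₀ * Q ^ k - (1 - u * Q ^ k) = (u - u₀) * Q ^ k by ring, abs_mul,
      abs_of_pos hQ] at this
    linarith
  rw [abs_inv]
  have h7 : 0 < |1 - u * Q ^ k| := lt_of_lt_of_le (by positivity) h6
  rw [inv_le_iff_one_le_mul₀ h7]
  nlinarith

lemma tendsto_lambert_regular (h0 : 0 < Q) (h1 : Q < 1) {a : ℤ → ℝ} (ha : Summable fun k => ‖a k‖)
    {u₀ : ℝ} (hu : u₀ ≠ 0) :
    Tendsto (fun u => ∑' k : ℤ, if u₀ * Q ^ k = 1 then 0 else a k * (1 - u * Q ^ k)⁻¹) (𝓝 u₀)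
      (𝓝 (lambert Q a u₀)) := by
  obtain ⟨C, hC, h⟩ := exists_bound_inv_near h0 h1 hu
  refine tendsto_tsum_of_dominated_convergence (ha.mul_right C) (fun k => ?_) ?_
  · split_ifs with hk
    · simp [hk]
    · refine Tendsto.const_mul _ (Tendsto.inv₀ (Continuous.tendsto (by fun_prop) _) ?_)
      exact sub_ne_zero.2 (Ne.symm hk)
  · filter_upwards [h] with u hu k
    split_ifs with hk
    · rw [norm_zero]; positivity
    · rw [norm_mul]
      gcongr
      exact hu k hk

lemma continuousAt_lambert (h0 : 0 < Q) (h1 : Q < 1) {a : ℤ → ℝ} (ha : Summable fun k => ‖a k‖)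
    {u₀ : ℝ} (hu : OffLattice Q u₀) : Tendsto (lambert Q a) (𝓝 u₀) (𝓝 (lambert Q a u₀)) := by
  refine (tendsto_lambert_regular h0 h1 ha hu.1).congr fun u => ?_
  exact tsum_congr fun k => if_neg (hu.2 k)

lemma tendsto_lambert_one (h0 : 0 < Q) (h1 : Q < 1) {a : ℤ → ℝ} (ha : Summable fun k => ‖a k‖) :
    Tendsto (fun u => lambert Q a u - a 0 * (1 - u)⁻¹) (𝓝 1) (𝓝 (lambert Q a 1)) := by
  refine (tendsto_lambert_regular h0 h1 ha one_ne_zero).congr' ?_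
  filter_upwards [isOpen_ne.mem_nhds (one_ne_zero (α := ℝ))] with u hu
  rw [lambert, (ha.mul_inv_one_sub h0 h1 hu).of_norm.tsum_eq_add_tsum_ite 0, zpow_zero, mul_one,
    add_sub_cancel_left]
  refine tsum_congr fun k => ?_
  have : 1 * Q ^ k = 1 ↔ k = 0 := by
    rw [one_mul, zpow_eq_one_iff_right₀ h0.le h1.ne]
  simp only [this]

/-- The level three Appell sum. -/
noncomputable def appellThree (Q u c : ℝ) : ℝ := lambert Q (fun k => eps Q k ^ 3 * c ^ k) u

/-- The level one Appell sum with an additional parameter. -/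
noncomputable def appellOne (Q u c : ℝ) : ℝ := lambert Q (fun k => eps Q k * c ^ k) u

lemma appellOne_one (u : ℝ) : appellOne Q u 1 = appell Q u := by
  simp [appellOne, lambert, appell]

lemma eps_zero : eps Q 0 = 1 := by simp [eps]

lemma norm_eps_le_one_mul (h0 : 0 < Q) (h1 : Q < 1) (k : ℤ) : ‖eps Q k‖ ≤ 1 := by
  rw [norm_eps h0]
  have : 0 ≤ tri (k + 1) := by
    have := two_mul_tri (k + 1)
    have : 0 ≤ (k + 1) * k := by
      rcases le_or_gt 0 k with h | h
      · positivity
      · exact mul_nonneg_of_nonpos_of_nonpos (by omega) h.le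
    nlinarith
  exact (zpow_le_zpow_right_of_le_one₀ h0 h1.le this).trans (zpow_zero Q).le

lemma summable_norm_eps_cube (h0 : 0 < Q) (h1 : Q < 1) {c : ℝ} (hc : c ≠ 0) :
    Summable fun k : ℤ => ‖eps Q k ^ 3 * c ^ k‖ := by
  refine Summable.of_nonneg_of_le (fun _ => norm_nonneg _) (fun k => ?_)
    (summable_norm_eps_mul_zpow h0 h1 hc)
  rw [norm_mul, norm_mul, norm_pow]
  gcongr
  exact pow_le_of_le_one (norm_nonneg _) (norm_eps_le_one_mul h0 h1 k) three_ne_zero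

/-- The theta series of level three. -/
noncomputable def thetaThree (Q c : ℝ) : ℝ := ∑' k : ℤ, eps Q k ^ 3 * Q ^ (-k) * c ^ k

lemma hasSum_prod_three {a b c : ℤ → ℝ} (ha : Summable fun k => ‖a k‖)
    (hb : Summable fun k => ‖b k‖) (hc : Summable fun k => ‖c k‖) :
    HasSum (fun p : ℤ × ℤ × ℤ => a p.1 * (b p.2.1 * c p.2.2))
      ((∑' k, a k) * ((∑' k, b k) * ∑' k, c k)) := by
  rw [tsum_mul_tsum_of_summable_norm hb hc, tsum_mul_tsum_of_summable_norm ha (hb.mul_norm hc)]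
  exact (summable_mul_of_summable_norm ha (hb.mul_norm hc)).hasSum

lemma hasSum_pole (h0 : 0 < Q) (h1 : Q < 1) {h : ℤ → ℝ} (hh : Summable fun i => ‖eps Q i * h i‖)
    {a b : ℝ} (ha : OffLattice Q a) (hb : OffLattice Q b) :
    HasSum (fun p : ℤ × ℤ × ℤ => eps Q p.1 * h p.1 * ((eps Q p.2.1 * (1 - a * Q ^ (p.2.1 - p.1))⁻¹)
        * (eps Q p.2.2 * (1 - b * Q ^ (p.2.2 - p.1))⁻¹)))
      (appell Q a * appell Q b * ∑' i, eps Q i ^ 3 * (a * b) ^ (-i) * h i) := by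
  obtain ⟨A, -, hA⟩ := exists_bound_inv_one_sub h0 h1 ha.1
  obtain ⟨B, -, hB⟩ := exists_bound_inv_one_sub h0 h1 hb.1
  have he := summable_norm_eps h0 h1
  have row : ∀ {c : ℝ}, OffLattice Q c → ∀ i, Summable fun j : ℤ =>
      ‖eps Q j * (1 - c * Q ^ (j - i))⁻¹‖ := fun {c} hc i => by
    have := he.mul_inv_one_sub h0 h1 (hc.mul_zpow h0 (-i)).1
    refine this.congr fun j => ?_
    rw [mul_assoc, ← zpow_add₀ h0.ne', neg_add_eq_sub]
  have s : Summable fun p : ℤ × ℤ × ℤ => eps Q p.1 * h p.1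
      * ((eps Q p.2.1 * (1 - a * Q ^ (p.2.1 - p.1))⁻¹)
        * (eps Q p.2.2 * (1 - b * Q ^ (p.2.2 - p.1))⁻¹)) := by
    have m := (hasSum_prod_three (hh.norm.congr fun _ => rfl) (he.norm.congr fun _ => rfl)
      (he.norm.congr fun _ => rfl)).summable
    refine .of_norm (Summable.of_nonneg_of_le (fun _ => norm_nonneg _) (fun p => ?_)
      (m.mul_right (A * B)))
    calc _ = ‖eps Q p.1 * h p.1‖ * ((‖eps Q p.2.1‖ * ‖(1 - a * Q ^ (p.2.1 - p.1))⁻¹‖)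
            * (‖eps Q p.2.2‖ * ‖(1 - b * Q ^ (p.2.2 - p.1))⁻¹‖)) := by
          simp only [norm_mul]
      _ ≤ ‖eps Q p.1 * h p.1‖ * ((‖eps Q p.2.1‖ * A) * (‖eps Q p.2.2‖ * B)) := by
          have := (abs_nonneg _).trans (hA 0)
          have := (abs_nonneg _).trans (hB 0)
          gcongr
          exacts [hA _, hB _]
      _ = _ := by ring
  refine s.hasSum_iff.2 ?_
  rw [s.tsum_prod, ← tsum_mul_left]
  refine tsum_congr fun i => ?_
  dsimp only
  rw [tsum_mul_left, ← tsum_mul_tsum_of_summable_norm (row ha i) (row hb i), tsum_eps_row h0 h1 ha,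
    tsum_eps_row h0 h1 hb, _root_.mul_zpow]
  ring

/-- Cyclic rotation of triples. -/
def rotate : ℤ × ℤ × ℤ ≃ ℤ × ℤ × ℤ where
  toFun p := (p.2.1, p.2.2, p.1)
  invFun p := (p.2.2, p.1, p.2.1)
  left_inv _ := rfl
  right_inv _ := rfl

/-- Three terms summing the partial fractions attached to `u`, `v`, `w`. -/
lemma tsum_cyclic (h0 : 0 < Q) (h1 : Q < 1) {g : ℝ → ℝ} {u v w S : ℝ} (hu : u ≠ 0) (hv : v ≠ 0)
    (hw : w ≠ 0) (huv : OffLattice Q (v / u)) (hvw : OffLattice Q (w / v))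
    (hwu : OffLattice Q (u / w))
    (gu : Summable fun i => ‖eps Q i * g (u * Q ^ i)‖)
    (gv : Summable fun i => ‖eps Q i * g (v * Q ^ i)‖)
    (gw : Summable fun i => ‖eps Q i * g (w * Q ^ i)‖)
    {f : ℤ × ℤ × ℤ → ℝ} (hS : HasSum f S)
    (hf : ∀ i j k : ℤ, ∀ A B C : ℝ, A = u * Q ^ i → B = v * Q ^ j → C = w * Q ^ k →
      A ≠ B → B ≠ C → C ≠ A → A ≠ 0 → B ≠ 0 → C ≠ 0 →
      f (i, j, k) = eps Q i * eps Q j * eps Q k * (g A * (1 - B / A)⁻¹ * (1 - C / A)⁻¹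
        + g B * (1 - C / B)⁻¹ * (1 - A / B)⁻¹ + g C * (1 - A / C)⁻¹ * (1 - B / C)⁻¹)) :
    appell Q (v / u) * appell Q (w / u) * (∑' i, eps Q i ^ 3 * (v / u * (w / u)) ^ (-i) * g (u * Q ^ i))
    + appell Q (w / v) * appell Q (u / v) * (∑' i, eps Q i ^ 3 * (w / v * (u / v)) ^ (-i) * g (v * Q ^ i))
    + appell Q (u / w) * appell Q (v / w) * (∑' i, eps Q i ^ 3 * (u / w * (v / w)) ^ (-i) * g (w * Q ^ i))
      = S := by
  have inv : ∀ {a b : ℝ}, OffLattice Q (a / b) → OffLattice Q (b / a) := fun h => by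
    simpa using h.inv
  have hu3 := hasSum_pole h0 h1 gu huv (inv hwu)
  have hv3 := rotate.hasSum_iff.2 (hasSum_pole h0 h1 gv hvw (inv huv))
  have hw3 := rotate.symm.hasSum_iff.2 (hasSum_pole h0 h1 gw hwu (inv hvw))
  refine ((hu3.add hv3).add hw3).unique ?_
  convert hS using 1
  funext ⟨i, j, k⟩
  have hQ : ∀ i : ℤ, Q ^ i ≠ 0 := fun i => (zpow_pos h0 i).ne'
  have ne : ∀ {a b : ℝ}, a ≠ 0 → OffLattice Q (b / a) → ∀ i j : ℤ, a * Q ^ i ≠ b * Q ^ j :=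
    fun {a b} ha h i j e => h.2 (j - i) (by
      rw [zpow_sub₀ h0.ne', div_mul_div_comm, ← e, div_self (mul_ne_zero ha (hQ i))])
  have dv : ∀ (a b : ℝ) (i j : ℤ), b / a * Q ^ (j - i) = b * Q ^ j / (a * Q ^ i) :=
    fun a b i j => by rw [zpow_sub₀ h0.ne', div_mul_div_comm]
  simp only [Function.comp_apply, rotate, Equiv.coe_fn_mk, Equiv.coe_fn_symm_mk, dv]
  rw [hf i j k _ _ _ rfl rfl rfl (ne hu huv i j) (ne hv hvw j k) (ne hw hwu k i)
    (mul_ne_zero hu (hQ i)) (mul_ne_zero hv (hQ j)) (mul_ne_zero hw (hQ k))]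
  ring

lemma OffLattice.div_swap {a b : ℝ} (h : OffLattice Q (a / b)) : OffLattice Q (b / a) := by
  simpa using h.inv

lemma summable_norm_eps_mul_zpow_div (h0 : 0 < Q) (h1 : Q < 1) (u : ℝ) :
    Summable fun i : ℤ => ‖eps Q i * (u * Q ^ i)⁻¹‖ := by
  have := (summable_norm_eps_mul_zpow h0 h1 (inv_ne_zero h0.ne')).mul_right ‖u⁻¹‖
  refine this.congr fun i => ?_
  rw [← norm_mul, mul_inv, inv_zpow]
  ring_nf

/-- Product of three level one Appell sums as a sum of level three ones. -/
theorem appell_mul_appell_mul_appell (h0 : 0 < Q) (h1 : Q < 1) {u v w : ℝ} (hu : OffLattice Q u)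
    (hv : OffLattice Q v) (hw : OffLattice Q w) (huv : OffLattice Q (v / u))
    (hvw : OffLattice Q (w / v)) (hwu : OffLattice Q (u / w)) :
    appell Q (v / u) * appell Q (w / u) * appellThree Q u (u ^ 2 / (v * w))
    + appell Q (w / v) * appell Q (u / v) * appellThree Q v (v ^ 2 / (w * u))
    + appell Q (u / w) * appell Q (v / w) * appellThree Q w (w ^ 2 / (u * v))
      = appell Q u * (appell Q v * appell Q w) := by
  have key := tsum_cyclic h0 h1 (g := fun A => (1 - A)⁻¹) hu.1 hv.1 hw.1 huv hvw hwu
    (summable_norm_appell h0 h1 hu.1) (summable_norm_appell h0 h1 hv.1)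
    (summable_norm_appell h0 h1 hw.1) (hasSum_prod_three (summable_norm_appell h0 h1 hu.1)
      (summable_norm_appell h0 h1 hv.1) (summable_norm_appell h0 h1 hw.1)) (by
    intro i j k A B C hA hB hC hAB hBC hCA hA0 hB0 hC0
    have a1 : 1 - A ≠ 0 := hA ▸ hu.one_sub_ne i
    have b1 : 1 - B ≠ 0 := hB ▸ hv.one_sub_ne j
    have c1 : 1 - C ≠ 0 := hC ▸ hw.one_sub_ne k
    simp only [← hA, ← hB, ← hC]
    have h1 : A - B ≠ 0 := sub_ne_zero.2 hAB
    have h2 : B - C ≠ 0 := sub_ne_zero.2 hBC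
    have h3 : C - A ≠ 0 := sub_ne_zero.2 hCA
    have e1 : (1 - B / A)⁻¹ = A / (A - B) := by rw [one_sub_div hA0, inv_div]
    have e2 : (1 - C / A)⁻¹ = -A / (C - A) := by
      rw [one_sub_div hA0, inv_div, ← neg_sub C A, div_neg, neg_div]
    have e3 : (1 - C / B)⁻¹ = B / (B - C) := by rw [one_sub_div hB0, inv_div]
    have e4 : (1 - A / B)⁻¹ = -B / (A - B) := by
      rw [one_sub_div hB0, inv_div, ← neg_sub A B, div_neg, neg_div]
    have e5 : (1 - A / C)⁻¹ = C / (C - A) := by rw [one_sub_div hC0, inv_div]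
    have e6 : (1 - B / C)⁻¹ = -C / (B - C) := by
      rw [one_sub_div hC0, inv_div, ← neg_sub B C, div_neg, neg_div]
    rw [e1, e2, e3, e4, e5, e6]
    field_simp
    ring)
  have e : ∀ a b c : ℝ, (∑' i : ℤ, eps Q i ^ 3 * (b / a * (c / a)) ^ (-i) * (1 - a * Q ^ i)⁻¹)
      = appellThree Q a (a ^ 2 / (b * c)) := fun a b c => by
    refine tsum_congr fun i => ?_
    rw [zpow_neg, ← inv_zpow, div_mul_div_comm, inv_div, sq]
  simp only [e] at key
  exact key

/-- The quintuple product relation in terms of Appell sums. -/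
theorem appell_thetaThree (h0 : 0 < Q) (h1 : Q < 1) {u v w : ℝ} (hu : u ≠ 0) (hv : v ≠ 0)
    (hw : w ≠ 0) (huv : OffLattice Q (v / u)) (hvw : OffLattice Q (w / v))
    (hwu : OffLattice Q (u / w)) :
    appell Q (v / u) * appell Q (w / u) * (u⁻¹ * thetaThree Q (u ^ 2 / (v * w)))
    + appell Q (w / v) * appell Q (u / v) * (v⁻¹ * thetaThree Q (v ^ 2 / (w * u)))
    + appell Q (u / w) * appell Q (v / w) * (w⁻¹ * thetaThree Q (w ^ 2 / (u * v))) = 0 := by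
  have key := tsum_cyclic h0 h1 (g := fun A => A⁻¹) hu hv hw huv hvw hwu
    (summable_norm_eps_mul_zpow_div h0 h1 u) (summable_norm_eps_mul_zpow_div h0 h1 v)
    (summable_norm_eps_mul_zpow_div h0 h1 w) (hasSum_zero) (by
    intro i j k A B C hA hB hC hAB hBC hCA hA0 hB0 hC0
    have h1 : A - B ≠ 0 := sub_ne_zero.2 hAB
    have h2 : B - C ≠ 0 := sub_ne_zero.2 hBC
    have h3 : C - A ≠ 0 := sub_ne_zero.2 hCA
    have e1 : (1 - B / A)⁻¹ = A / (A - B) := by rw [one_sub_div hA0, inv_div]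
    have e2 : (1 - C / A)⁻¹ = -A / (C - A) := by
      rw [one_sub_div hA0, inv_div, ← neg_sub C A, div_neg, neg_div]
    have e3 : (1 - C / B)⁻¹ = B / (B - C) := by rw [one_sub_div hB0, inv_div]
    have e4 : (1 - A / B)⁻¹ = -B / (A - B) := by
      rw [one_sub_div hB0, inv_div, ← neg_sub A B, div_neg, neg_div]
    have e5 : (1 - A / C)⁻¹ = C / (C - A) := by rw [one_sub_div hC0, inv_div]
    have e6 : (1 - B / C)⁻¹ = -C / (B - C) := by
      rw [one_sub_div hC0, inv_div, ← neg_sub B C, div_neg, neg_div]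
    rw [e1, e2, e3, e4, e5, e6]
    field_simp
    ring)
  have e : ∀ a b c : ℝ, (∑' i : ℤ, eps Q i ^ 3 * (b / a * (c / a)) ^ (-i) * (a * Q ^ i)⁻¹)
      = a⁻¹ * thetaThree Q (a ^ 2 / (b * c)) := fun a b c => by
    rw [thetaThree, ← tsum_mul_left]
    refine tsum_congr fun i => ?_
    rw [zpow_neg, ← inv_zpow, div_mul_div_comm, inv_div, sq, mul_inv, zpow_neg]
    ring
  simp only [e] at key
  exact key

/-- The level one analogue, with a Kronecker series. -/
theorem appell_mul_kron (h0 : 0 < Q) (h1 : Q < 1) {a u w : ℝ} (ha : Q < a) (ha1 : a < 1)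
    (hu : OffLattice Q u) (hw : OffLattice Q w) (hwu : OffLattice Q (w / u)) :
    appell Q u * kron Q a w = kron Q a (w / u) * appellOne Q u a
      + appell Q (u / w) * appellOne Q w (a * w / u) := by
  have a0 : 0 < a := h0.trans ha
  have hQ : ∀ i : ℤ, Q ^ i ≠ 0 := fun i => (zpow_pos h0 i).ne'
  have sk := summable_norm_kron h0 h1 ha ha1 hw
  have sk' := summable_norm_kron h0 h1 ha ha1 hwu
  have se := summable_norm_appell h0 h1 hu.1
  have sl := summable_mul_of_summable_norm se sk
  set T₁ : ℤ × ℤ → ℝ := fun p => eps Q p.1 * (1 - u * Q ^ p.1)⁻¹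
    * (a ^ p.2 * (1 - w / u * Q ^ (p.2 - p.1))⁻¹) with hT₁
  set T₂ : ℤ × ℤ → ℝ := fun p => eps Q p.1 * (1 - u / w * Q ^ (p.1 - p.2))⁻¹
    * (a ^ p.2 * (1 - w * Q ^ p.2)⁻¹) with hT₂
  have split : ∀ p : ℤ × ℤ, eps Q p.1 * (1 - u * Q ^ p.1)⁻¹ * (a ^ p.2 * (1 - w * Q ^ p.2)⁻¹)
      = T₁ p + T₂ p := by
    rintro ⟨i, k⟩
    have A0 := mul_ne_zero hu.1 (hQ i)
    have W0 := mul_ne_zero hw.1 (hQ k)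
    have hA := hu.one_sub_ne i
    have hW := hw.one_sub_ne k
    have hD : u * Q ^ i - w * Q ^ k ≠ 0 := fun h => hwu.2 (k - i) (by
      rw [zpow_sub₀ h0.ne', div_mul_div_comm, ← sub_eq_zero.1 h, div_self A0])
    simp only [hT₁, hT₂, zpow_sub₀ h0.ne', div_mul_div_comm]
    generalize u * Q ^ i = A at *
    generalize w * Q ^ k = W at *
    have e1 : (1 - W / A)⁻¹ = A / (A - W) := by rw [one_sub_div A0, inv_div]
    have e2 : (1 - A / W)⁻¹ = -W / (A - W) := by
      rw [one_sub_div W0, inv_div, ← neg_sub A W, div_neg, neg_div]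
    rw [e1, e2]
    field_simp
    ring
  have row : ∀ i : ℤ, ∀ k : ℤ, a ^ k * (1 - w / u * Q ^ (k - i))⁻¹
      = a ^ i * (a ^ (k - i) * (1 - w / u * Q ^ (k - i))⁻¹) := fun i k => by
    rw [← mul_assoc, ← zpow_add₀ a0.ne', add_sub_cancel]
  have s₁ : Summable T₁ := by
    refine .of_norm ((summable_prod_of_nonneg fun _ => norm_nonneg _).2 ⟨fun i => ?_, ?_⟩)
    · have := ((Equiv.subRight i).summable_iff.2 sk').mul_left
        ‖eps Q i * (1 - u * Q ^ i)⁻¹ * a ^ i‖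
      refine this.congr fun k => ?_
      rw [Function.comp_apply, Equiv.subRight_apply, ← norm_mul, hT₁]
      dsimp only
      rw [row, mul_assoc (_ * _) (a ^ i)]
    · have := ((summable_norm_eps_mul_zpow h0 h1 a0.ne').mul_inv_one_sub h0 h1 hu.1).mul_right
        (∑' k : ℤ, ‖a ^ k * (1 - w / u * Q ^ k)⁻¹‖)
      refine this.congr fun i => ?_
      rw [← (Equiv.subRight i).tsum_eq, ← tsum_mul_left]
      refine tsum_congr fun k => ?_
      rw [Equiv.subRight_apply, ← norm_mul, hT₁]
      dsimp only
      rw [row]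
      congr 1
      ring
  have s₂ : Summable T₂ := by
    refine (sl.sub s₁).congr fun p => ?_
    rw [split, add_sub_cancel_left]
  rw [appell, kron, tsum_mul_tsum_of_summable_norm se sk, tsum_congr split, s₁.tsum_add s₂,
    s₁.tsum_prod, s₂.tsum_prod, ← (show Summable (Function.uncurry fun i k => T₂ (i, k)) from s₂).tsum_comm,
    appellOne, appellOne, lambert, lambert, ← tsum_mul_left, ← tsum_mul_left]
  congr 1
  · refine tsum_congr fun i => ?_
    simp only [hT₁]
    rw [tsum_mul_left, kron_mul_zpow a0.ne']
    ring
  · refine tsum_congr fun k => ?_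
    simp only [hT₂]
    rw [tsum_mul_right, tsum_eps_row h0 h1 hwu.div_swap, div_eq_mul_inv (a * w), mul_assoc a,
      _root_.mul_zpow, zpow_neg, ← inv_zpow, inv_div, div_eq_mul_inv w]
    ring

end Lambert

/-- Logarithmic derivative of `theta`. -/
noncomputable def logTheta (Q x : ℝ) : ℝ := x * deriv (theta Q) x / theta Q x

section Weierstrass

variable {Q : ℝ}

/-- Even half of the theta series. -/
noncomputable def thetaEven (Q z : ℝ) : ℝ := ∑' k : ℤ, Q ^ (k * k) * z ^ (2 * k)

/-- Odd half of the theta series. -/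
noncomputable def thetaOdd (Q z : ℝ) : ℝ := ∑' k : ℤ, Q ^ (k * (k + 1)) * z ^ (2 * k + 1)

/-- The antisymmetric form behind Weierstrass' three term relation. -/
noncomputable def bracket (Q a b : ℝ) : ℝ :=
  thetaOdd Q a * thetaEven Q b - thetaEven Q a * thetaOdd Q b

lemma summable_norm_thetaEven (h0 : 0 < Q) (h1 : Q < 1) {z : ℝ} (hz : z ≠ 0) :
    Summable fun k : ℤ => ‖Q ^ (k * k) * z ^ (2 * k)‖ := by
  refine (summable_gauss (Q := Q ^ 2) (c := Q * |z| ^ 2) (by positivity)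
    (pow_lt_one₀ h0.le h1 two_ne_zero) (by positivity)).congr fun k => ?_
  rw [norm_mul, norm_zpow, norm_zpow, Real.norm_of_nonneg h0.le, Real.norm_eq_abs, _root_.mul_zpow, ← mul_assoc, ← zpow_natCast Q 2,
    ← zpow_natCast |z| 2, ← zpow_mul, ← zpow_mul, ← zpow_add₀ h0.ne']
  congr 2
  push_cast
  linear_combination two_mul_tri k

lemma summable_norm_thetaOdd (h0 : 0 < Q) (h1 : Q < 1) {z : ℝ} (hz : z ≠ 0) :
    Summable fun k : ℤ => ‖Q ^ (k * (k + 1)) * z ^ (2 * k + 1)‖ := by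
  refine ((summable_gauss (Q := Q ^ 2) (c := Q ^ 2 * |z| ^ 2) (by positivity)
    (pow_lt_one₀ h0.le h1 two_ne_zero) (by positivity)).mul_right |z|).congr fun k => ?_
  rw [norm_mul, norm_zpow, norm_zpow, Real.norm_of_nonneg h0.le, Real.norm_eq_abs, _root_.mul_zpow, ← mul_assoc, ← zpow_natCast Q 2,
    ← zpow_natCast |z| 2, ← zpow_mul, ← zpow_mul, ← zpow_mul, ← zpow_add₀ h0.ne', mul_assoc,
    ← zpow_add_one₀ (abs_pos.2 hz).ne']
  congr 2
  push_cast
  linear_combination two_mul_tri k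

theorem theta_mul_theta (h0 : 0 < Q) (h1 : Q < 1) {a z : ℝ} (ha : a ≠ 0) (hz : z ≠ 0) :
    theta Q (a * z) * theta Q (a / z) = a * bracket Q a z := by
  have n1 := summable_abs_theta h0 h1 (mul_ne_zero ha hz)
  have n2 := summable_abs_theta h0 h1 (div_ne_zero ha hz)
  have hs := (summable_mul_of_summable_norm n1 n2).hasSum
  rw [← tsum_mul_tsum_of_summable_norm n1 n2] at hs
  set F : ℤ × ℤ → ℝ := fun p => (-1) ^ p.1 * Q ^ tri p.1 * (a * z) ^ p.1
    * ((-1) ^ p.2 * Q ^ tri p.2 * (a / z) ^ p.2) with hF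
  let g₀ : ℤ × ℤ → ℤ × ℤ := fun p => (p.1 + 1 + p.2, p.1 + 1 - p.2)
  let g₁ : ℤ × ℤ → ℤ × ℤ := fun p => (p.1 + p.2 + 1, p.1 - p.2)
  have i₀ : Function.Injective g₀ := by
    rintro ⟨m, n⟩ ⟨m', n'⟩ h
    simp only [g₀, Prod.mk.injEq] at h ⊢
    omega
  have i₁ : Function.Injective g₁ := by
    rintro ⟨m, n⟩ ⟨m', n'⟩ h
    simp only [g₁, Prod.mk.injEq] at h ⊢
    omega
  have sgn : ∀ m n k : ℤ, m + n = 2 * k → (-1 : ℝ) ^ m * (-1) ^ n = 1 := fun m n k h => by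
    rw [← neg_one_zpow_add, h, two_mul, neg_one_zpow_add, neg_one_zpow_mul_self]
  have mono : ∀ m n : ℤ, F (m, n) = ((-1) ^ m * (-1) ^ n) * Q ^ (tri m + tri n) * a ^ (m + n)
      * z ^ (m - n) := fun m n => by
    simp only [hF]
    rw [_root_.mul_zpow, div_zpow, zpow_add₀ h0.ne', zpow_add₀ ha, zpow_sub₀ hz]
    ring
  have e₀ : ∀ p, F (g₀ p) = a * ((Q ^ (p.1 * (p.1 + 1)) * a ^ (2 * p.1 + 1))
      * (Q ^ (p.2 * p.2) * z ^ (2 * p.2))) := by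
    rintro ⟨l, k⟩
    simp only [g₀]
    rw [mono, sgn _ _ (l + 1) (by ring),
      show tri (l + 1 + k) + tri (l + 1 - k) = l * (l + 1) + k * k by
        have := two_mul_tri (l + 1 + k)
        have := two_mul_tri (l + 1 - k)
        nlinarith,
      show l + 1 + k + (l + 1 - k) = 2 * l + 1 + 1 by ring,
      show l + 1 + k - (l + 1 - k) = 2 * k by ring, zpow_add₀ h0.ne', zpow_add_one₀ ha (2 * l + 1)]
    ring
  have e₁ : ∀ p, F (g₁ p) = -a * ((Q ^ (p.1 * p.1) * a ^ (2 * p.1))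
      * (Q ^ (p.2 * (p.2 + 1)) * z ^ (2 * p.2 + 1))) := by
    rintro ⟨l, k⟩
    simp only [g₁]
    have sg : (-1 : ℝ) ^ (l + k + 1) * (-1) ^ (l - k) = -1 := by
      rw [neg_one_zpow_add, zpow_one, mul_right_comm, sgn _ _ l (by ring), one_mul]
    rw [mono, sg,
      show tri (l + k + 1) + tri (l - k) = l * l + k * (k + 1) by
        have := two_mul_tri (l + k + 1)
        have := two_mul_tri (l - k)
        nlinarith,
      show l + k + 1 + (l - k) = 2 * l + 1 by ring,
      show l + k + 1 - (l - k) = 2 * k + 1 by ring, zpow_add₀ h0.ne', zpow_add_one₀ ha (2 * l)]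
    ring
  have pr : ∀ {f g : ℤ → ℝ}, Summable (fun k => ‖f k‖) → Summable (fun k => ‖g k‖) →
      HasSum (fun p : ℤ × ℤ => f p.1 * g p.2) ((∑' k, f k) * ∑' k, g k) := fun hf hg => by
    rw [tsum_mul_tsum_of_summable_norm hf hg]
    exact (summable_mul_of_summable_norm hf hg).hasSum
  have s₀ : HasSum (F ∘ g₀) (a * (thetaOdd Q a * thetaEven Q z)) :=
    ((pr (summable_norm_thetaOdd h0 h1 ha) (summable_norm_thetaEven h0 h1 hz)).mul_left a).congr_fun
      e₀
  have s₁ : HasSum (F ∘ g₁) (-a * (thetaEven Q a * thetaOdd Q z)) :=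
    ((pr (summable_norm_thetaEven h0 h1 ha) (summable_norm_thetaOdd h0 h1 hz)).mul_left
      (-a)).congr_fun e₁
  have hc : IsCompl (Set.range g₀) (Set.range g₁) := by
    constructor
    · rw [Set.disjoint_left]
      rintro _ ⟨⟨l, k⟩, rfl⟩ ⟨⟨l', k'⟩, h⟩
      simp only [g₀, g₁, Prod.mk.injEq] at h
      omega
    · rw [codisjoint_iff_le_sup]
      rintro ⟨m, n⟩ -
      rcases Int.even_or_odd' (m - n) with ⟨k, h | h⟩
      · left
        refine ⟨(n + k - 1, k), ?_⟩
        simp only [g₀, Prod.mk.injEq]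
        omega
      · right
        refine ⟨(n + k, k), ?_⟩
        simp only [g₁, Prod.mk.injEq]
        omega
  have r₀ : HasSum (F ∘ ((↑) : Set.range g₀ → ℤ × ℤ)) _ := i₀.hasSum_range_iff.2 s₀
  have r₁ : HasSum (F ∘ ((↑) : Set.range g₁ → ℤ × ℤ)) _ := i₁.hasSum_range_iff.2 s₁
  have := HasSum.add_isCompl (f := F) hc r₀ r₁
  rw [theta, theta, hs.unique this, bracket]
  ring

lemma bracket_plucker (a b c d : ℝ) : bracket Q a b * bracket Q c d - bracket Q a c * bracket Q b d
    + bracket Q a d * bracket Q b c = 0 := by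
  unfold bracket
  ring

lemma differentiableAt_theta (h0 : 0 < Q) (h1 : Q < 1) {x : ℝ} (hx : 0 < x) :
    DifferentiableAt ℝ (theta Q) x := by
  have hs : Summable fun n : ℤ => |(n : ℝ)| * (Q ^ tri n * (2 * x) ^ n) * (2 * x)⁻¹
      + |(n : ℝ)| * (Q ^ tri n * (x / 2) ^ n) * (x / 2)⁻¹ :=
    ((summable_abs_mul_gauss h0 h1 (by positivity)).mul_right _).add
      ((summable_abs_mul_gauss h0 h1 (by positivity)).mul_right _)
  have hm : x ∈ Set.Ioo (x / 2) (2 * x) := ⟨by linarith, by linarith⟩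
  refine (hasDerivAt_tsum_of_isPreconnected (t := Set.Ioo (x / 2) (2 * x))
    (g := fun (n : ℤ) (x : ℝ) => (-1) ^ n * Q ^ tri n * x ^ n)
    (g' := fun (n : ℤ) (x : ℝ) => (-1) ^ n * Q ^ tri n * (n * x ^ (n - 1)))
    hs isOpen_Ioo isPreconnected_Ioo (fun n t ht => ?_) (fun n t ht => ?_) hm
    (summable_theta h0 h1 hx.ne') hm).differentiableAt
  · have ht0 : t ≠ 0 := by linarith [ht.1]
    exact (hasDerivAt_zpow n t (Or.inl ht0)).const_mul _
  · have ht0 : 0 < t := by linarith [ht.1]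
    rw [norm_mul, norm_mul, norm_mul, Real.norm_eq_abs, abs_neg_one_zpow, one_mul,
      Real.norm_of_nonneg (zpow_pos h0 _).le, Real.norm_eq_abs,
      Real.norm_of_nonneg (zpow_pos ht0 _).le]
    have : t ^ (n - 1) ≤ (2 * x) ^ (n - 1) + (x / 2) ^ (n - 1) := by
      have p1 : 0 < (2 * x) ^ (n - 1) := by positivity
      have p2 : 0 < (x / 2) ^ (n - 1) := by positivity
      rcases le_or_gt 0 (n - 1) with h | h
      · have := zpow_le_zpow_left₀ h ht0.le ht.2.le
        linarith
      · have := zpow_le_zpow_left₀ (n := -(n - 1)) (by omega) (by positivity) ht.1.le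
        rw [zpow_neg, zpow_neg, inv_le_inv₀ p2 (by positivity)] at this
        linarith
    calc _ ≤ Q ^ tri n * (|(n : ℝ)| * ((2 * x) ^ (n - 1) + (x / 2) ^ (n - 1))) := by gcongr
      _ = _ := by
        rw [zpow_sub_one₀ (by positivity), zpow_sub_one₀ (by positivity)]
        ring

lemma hasDerivAt_theta_one (h0 : 0 < Q) (h1 : Q < 1) :
    HasDerivAt (theta Q) (-eulerProd Q ^ 3) 1 := by
  rw [hasDerivAt_iff_tendsto_slope]
  refine ((tendsto_theta_div h0 h1).neg.mono_left nhdsWithin_le_nhds).congr' ?_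
  filter_upwards [nhdsWithin_le_nhds (isOpen_ne.mem_nhds (one_ne_zero (α := ℝ))),
    self_mem_nhdsWithin] with x hx hx1
  rw [slope_def_field, theta_one, theta_eq_one_sub_mul h0 h1 hx, sub_zero]
  have : x - 1 ≠ 0 := sub_ne_zero.2 hx1
  field_simp
  ring

lemma hasDerivAt_theta_mul (h0 : 0 < Q) (h1 : Q < 1) {x : ℝ} (hx : 0 < x) :
    HasDerivAt (fun w => theta Q (x * w)) (x * deriv (theta Q) x) 1 := by
  have h := (differentiableAt_theta h0 h1 (x := x * 1) (by simpa)).hasDerivAt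
  have := h.comp (1 : ℝ) ((hasDerivAt_id (1 : ℝ)).const_mul x)
  simpa [Function.comp_def, mul_comm] using this

theorem logTheta_add (h0 : 0 < Q) (h1 : Q < 1) {u v : ℝ} (hu : 0 < u) (hv : 0 < v)
    (ov : OffLattice Q v) (op : OffLattice Q (u * v)) (om : OffLattice Q (u / v)) :
    logTheta Q (u * v) + logTheta Q (v / u) - 2 * logTheta Q v
      = eulerProd Q ^ 3 * theta Q (v ^ 2) * theta Q u ^ 2
        / (theta Q v ^ 2 * theta Q (u * v) * theta Q (u / v)) := by
  have key : ∀ w : ℝ, 0 < w → theta Q (v * w) ^ 2 * (theta Q (u * v) * theta Q (u / v))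
      + u / v * (theta Q (u * v * w) * theta Q (v / u * w)) * theta Q v ^ 2
      - theta Q (v ^ 2 * w) * theta Q w * theta Q u ^ 2 = 0 := fun w hw => by
    have b1 := theta_mul_theta h0 h1 (mul_pos hv hw).ne' one_ne_zero
    have b2 := theta_mul_theta h0 h1 hu.ne' hv.ne'
    have b3 := theta_mul_theta h0 h1 (mul_pos hv hw).ne' hu.ne'
    have b4 := theta_mul_theta h0 h1 one_ne_zero hv.ne'
    have b5 := theta_mul_theta h0 h1 (mul_pos hv hw).ne' hv.ne'
    have b6 := theta_mul_theta h0 h1 one_ne_zero hu.ne'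
    have t1 := theta_inv (Q := Q) hv.ne'
    have t2 := theta_inv (Q := Q) hu.ne'
    simp only [mul_one, div_one, one_mul, one_div] at b1 b4 b6
    rw [t1] at b4
    rw [t2] at b6
    rw [show v * w * u = u * v * w by ring, show v * w / u = v / u * w by ring] at b3
    rw [show v * w * v = v ^ 2 * w by ring, show v * w / v = w by field_simp] at b5
    have c4 : theta Q v ^ 2 = -v * bracket Q 1 v := by
      rw [← b4]
      field_simp
    have c6 : theta Q u ^ 2 = -u * bracket Q 1 u := by
      rw [← b6]
      field_simp
    rw [sq, b1, b2, b3, b5, c4, c6]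
    have p := bracket_plucker (Q := Q) (v * w) 1 u v
    field_simp
    linear_combination (v * w * u) * p
  have d1 := hasDerivAt_theta_mul h0 h1 hv
  have d2 := hasDerivAt_theta_mul h0 h1 (mul_pos hu hv)
  have d3 := hasDerivAt_theta_mul h0 h1 (div_pos hv hu)
  have d4 := hasDerivAt_theta_mul h0 h1 (pow_pos hv 2)
  have d5 := hasDerivAt_theta_one h0 h1
  have D := (((d1.fun_pow 2).mul_const (theta Q (u * v) * theta Q (u / v))).add
    (((d2.fun_mul d3).const_mul (u / v)).mul_const (theta Q v ^ 2))).sub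
    ((d4.fun_mul d5).mul_const (theta Q u ^ 2))
  have z := D.unique ((hasDerivAt_const (1 : ℝ) (0 : ℝ)).congr_of_eventuallyEq (by
    filter_upwards [lt_mem_nhds (show (0 : ℝ) < 1 by norm_num)] with w hw
    exact key w hw))
  have n1 := theta_ne_zero h0 h1 ov
  have n2 := theta_ne_zero h0 h1 op
  have n3 := theta_ne_zero h0 h1 om
  have t : theta Q (v / u) = -(v / u) * theta Q (u / v) := by
    have := theta_inv (Q := Q) om.1
    rwa [inv_div] at this
  have n4 : theta Q (v / u) ≠ 0 := by
    rw [t]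
    exact mul_ne_zero (neg_ne_zero.2 (div_pos hv hu).ne') n3
  simp only [mul_one, theta_one, mul_zero, zero_add] at z
  have e : logTheta Q (v / u) * theta Q (v / u) = v / u * deriv (theta Q) (v / u) := by
    rw [logTheta]
    field_simp
  have e1 : logTheta Q v * theta Q v = v * deriv (theta Q) v := by
    rw [logTheta]
    field_simp
  have e2 : logTheta Q (u * v) * theta Q (u * v) = u * v * deriv (theta Q) (u * v) := by
    rw [logTheta]
    field_simp
  rw [← e, ← e1, ← e2, t] at z
  rw [eq_div_iff (by positivity)]
  push_cast at z
  field_simp at z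
  linear_combination -z

end Weierstrass

section Specialization

variable {Q : ℝ}

lemma appell_eq_div (h0 : 0 < Q) (h1 : Q < 1) {z : ℝ} (hz : 0 < z) (ho : OffLattice Q z) :
    appell Q z = eulerProd Q ^ 3 / theta Q z := by
  rw [eq_div_iff (theta_ne_zero h0 h1 ho), appell_mul_theta h0 h1 hz ho]

lemma OffLattice.eventually (h0 : 0 < Q) (h1 : Q < 1) {x : ℝ} (hx : 0 < x) (ho : OffLattice Q x) :
    ∀ᶠ ζ in 𝓝 (1 : ℝ), OffLattice Q (ζ * x) := by
  obtain ⟨n, hn, hn'⟩ := exists_zpow_mul_mem h0 h1 hx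
  have hc : Tendsto (fun ζ : ℝ => ζ * x * Q ^ n) (𝓝 1) (𝓝 (x * Q ^ n)) := by
    have : Continuous fun ζ : ℝ => ζ * x * Q ^ n := by fun_prop
    simpa using this.tendsto 1
  filter_upwards [hc.eventually (lt_mem_nhds hn),
    hc.eventually (gt_mem_nhds (lt_of_le_of_ne hn' (ho.2 n)))] with ζ h h'
  have := (offLattice_of_mem_Ioo h0 h1 h h').mul_zpow h0 (-n)
  rwa [mul_assoc (ζ * x), ← zpow_add₀ h0.ne', add_neg_cancel, zpow_zero, mul_one] at this

lemma eventually_offLattice_one (h0 : 0 < Q) (h1 : Q < 1) :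
    ∀ᶠ ζ in 𝓝[≠] (1 : ℝ), OffLattice Q ζ := by
  filter_upwards [nhdsWithin_le_nhds (lt_mem_nhds h1),
    nhdsWithin_le_nhds (gt_mem_nhds ((one_lt_inv₀ h0).2 h1)), self_mem_nhdsWithin] with ζ ha hb hc
  rcases lt_or_gt_of_ne hc with h | h
  · exact offLattice_of_mem_Ioo h0 h1 ha h
  · have h2 : Q < ζ⁻¹ := (lt_inv_comm₀ (by linarith) h0).1 hb
    simpa using (offLattice_of_mem_Ioo h0 h1 h2 (inv_lt_one_of_one_lt₀ h)).inv

lemma tendsto_mul_appell_sub (h0 : 0 < Q) (h1 : Q < 1) {φ : ℝ → ℝ} {φ' : ℝ}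
    (h : HasDerivAt φ φ' 1) (hφ : φ 1 = 1) :
    Tendsto (fun ζ => φ ζ * appell Q ζ - (1 - ζ)⁻¹) (𝓝[≠] 1) (𝓝 (-φ')) := by
  have t := (hasDerivAt_iff_tendsto_slope.1 h).neg.add
    ((h.continuousAt.tendsto.mul (tendsto_appellReg h0 h1)).mono_left nhdsWithin_le_nhds)
  rw [mul_zero, add_zero] at t
  refine t.congr' ?_
  filter_upwards [nhdsWithin_le_nhds (isOpen_ne.mem_nhds (one_ne_zero (α := ℝ))),
    self_mem_nhdsWithin] with ζ hζ hζ1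
  rw [appell_eq_add_reg h0 h1 hζ, slope_def_field, hφ]
  have a : ζ - 1 ≠ 0 := sub_ne_zero.2 hζ1
  have b : 1 - ζ ≠ 0 := sub_ne_zero.2 (Ne.symm hζ1)
  have c : (1 - ζ)⁻¹ = -(ζ - 1)⁻¹ := by rw [← inv_neg, neg_sub]
  rw [c, div_eq_mul_inv]
  ring

lemma tendsto_one_mul (x : ℝ) : Tendsto (fun ζ : ℝ => ζ * x) (𝓝[≠] 1) (𝓝 x) := by
  have : Continuous fun ζ : ℝ => ζ * x := by fun_prop
  simpa using (this.tendsto 1).mono_left nhdsWithin_le_nhds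

lemma hasDerivAt_theta_left (h0 : 0 < Q) (h1 : Q < 1) {x : ℝ} (hx : 0 < x) (ho : OffLattice Q x) :
    HasDerivAt (fun w => theta Q (w * x)) (logTheta Q x * theta Q x) 1 := by
  have := hasDerivAt_theta_mul h0 h1 hx
  rw [logTheta, div_mul_cancel₀ _ (theta_ne_zero h0 h1 ho)]
  simpa only [mul_comm] using this

theorem appellThree_pair (h0 : 0 < Q) (h1 : Q < 1) {x z : ℝ} (hx : 0 < x) (hz : 0 < z)
    (ox : OffLattice Q x) (ox2 : OffLattice Q (x ^ 2)) (oz : OffLattice Q z)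
    (om : OffLattice Q (z / x)) (op : OffLattice Q (z * x)) :
    appellThree Q (z / x) (x⁻¹ ^ 3) + x ^ 3 * appellThree Q (z * x) (x ^ 3)
      = x * appellThree Q z 1 * (theta Q (x ^ 2) / theta Q x)
        + eulerProd Q ^ 3 * theta Q x * theta Q (x ^ 2)
          / (theta Q z * theta Q (z / x) * theta Q (z * x)) := by
  have e1 : z / x / z = x⁻¹ := by field_simp
  have e2 : z * x / (z / x) = x ^ 2 := by field_simp
  have e3 : z / (z * x) = x⁻¹ := by field_simp
  have e4 : z * x / z = x := by field_simp
  have e5 : z / (z / x) = x := by field_simp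
  have e6 : z / x / (z * x) = (x ^ 2)⁻¹ := by field_simp
  have e7 : z ^ 2 / (z / x * (z * x)) = 1 := by field_simp
  have e8 : (z / x) ^ 2 / (z * x * z) = x⁻¹ ^ 3 := by field_simp
  have e9 : (z * x) ^ 2 / (z * (z / x)) = x ^ 3 := by field_simp
  have key := appell_mul_appell_mul_appell h0 h1 oz om op (by rw [e1]; exact ox.inv)
    (by rwa [e2]) (by rw [e3]; exact ox.inv)
  rw [e1, e2, e3, e4, e5, e6, e7, e8, e9] at key
  have n1 := theta_ne_zero h0 h1 ox
  have n2 := theta_ne_zero h0 h1 ox2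
  have n3 := theta_ne_zero h0 h1 oz
  have n4 := theta_ne_zero h0 h1 om
  have n5 := theta_ne_zero h0 h1 op
  have nJ : eulerProd Q ≠ 0 := eulerProd_ne_zero (norm_lt_one_of_pos h0 h1)
  rw [appell_eq_div h0 h1 (inv_pos.2 hx) ox.inv,
    appell_eq_div h0 h1 (inv_pos.2 (pow_pos hx 2)) ox2.inv, appell_eq_div h0 h1 hx ox,
    appell_eq_div h0 h1 (pow_pos hx 2) ox2, appell_eq_div h0 h1 hz oz,
    appell_eq_div h0 h1 (div_pos hz hx) om, appell_eq_div h0 h1 (mul_pos hz hx) op,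
    theta_inv ox.1, theta_inv ox2.1] at key
  field_simp at key ⊢
  linear_combination key

theorem appellThree_pair_self (h0 : 0 < Q) (h1 : Q < 1) {x : ℝ} (hx : 0 < x)
    (ox : OffLattice Q x) (ox2 : OffLattice Q (x ^ 2)) :
    appellThree Q 1 (x⁻¹ ^ 3) + x ^ 3 * appellThree Q (x ^ 2) (x ^ 3)
      = x * appellThree Q x 1 * (theta Q (x ^ 2) / theta Q x)
        + (logTheta Q x + logTheta Q (x ^ 2)) := by
  have n1 := theta_ne_zero h0 h1 ox
  have n2 := theta_ne_zero h0 h1 ox2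
  have hφ := ((hasDerivAt_const (1 : ℝ) (theta Q x * theta Q (x ^ 2))).fun_div
    ((hasDerivAt_theta_left h0 h1 hx ox).fun_mul (hasDerivAt_theta_left h0 h1 (pow_pos hx 2) ox2))
    (by simpa using mul_ne_zero n1 n2))
  have T := tendsto_mul_appell_sub h0 h1 hφ (by simp [n1, n2])
  have A := (tendsto_lambert_one h0 h1
    (summable_norm_eps_cube h0 h1 (pow_ne_zero 3 (inv_ne_zero ox.1)))).mono_left
      (nhdsWithin_le_nhds (s := {1}ᶜ))
  have B := (continuousAt_lambert h0 h1 (summable_norm_eps_cube h0 h1 (pow_ne_zero 3 ox.1))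
    ox2).comp (tendsto_one_mul (x ^ 2))
  have C := (continuousAt_lambert h0 h1 (summable_norm_eps_cube h0 h1 (one_ne_zero (α := ℝ)))
    ox).comp (tendsto_one_mul x)
  have L := (A.add (B.const_mul (x ^ 3))).sub
    ((C.const_mul x).mul_const (theta Q (x ^ 2) / theta Q x))
  have : ∀ᶠ ζ in 𝓝[≠] (1 : ℝ), OffLattice Q ζ ∧ 0 < ζ ∧ OffLattice Q (ζ * x)
      ∧ OffLattice Q (ζ * x ^ 2) :=
    (eventually_offLattice_one h0 h1).and (((eventually_gt_nhds one_pos).filter_mono nhdsWithin_le_nhds).and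
      (((ox.eventually h0 h1 hx).filter_mono nhdsWithin_le_nhds).and
        ((ox2.eventually h0 h1 (pow_pos hx 2)).filter_mono nhdsWithin_le_nhds)))
  have u := tendsto_nhds_unique (L.congr' (by
    filter_upwards [this] with ζ ⟨o, hζ, oz, op⟩
    have e1 : ζ * x / x = ζ := by field_simp
    have e2 : ζ * x * x = ζ * x ^ 2 := by ring
    have key := appellThree_pair h0 h1 hx (mul_pos hζ hx) ox ox2 oz (by rwa [e1]) (by rwa [e2])
    rw [e1, e2] at key
    have n4 := theta_ne_zero h0 h1 o
    have n5 := theta_ne_zero h0 h1 oz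
    have n6 := theta_ne_zero h0 h1 op
    have : theta Q x * theta Q (x ^ 2) / (theta Q (ζ * x) * theta Q (ζ * x ^ 2)) * appell Q ζ
        = eulerProd Q ^ 3 * theta Q x * theta Q (x ^ 2)
          / (theta Q (ζ * x) * theta Q ζ * theta Q (ζ * x ^ 2)) := by
      rw [appell_eq_div h0 h1 hζ o]
      field_simp
    rw [this, eq_comm, sub_eq_iff_eq_add]
    simp only [Function.comp_def, appellThree] at key ⊢
    rw [eps_zero, zpow_zero, one_pow, one_mul, one_mul]
    linear_combination -key)) T
  change appellThree Q 1 (x⁻¹ ^ 3) + x ^ 3 * appellThree Q (x ^ 2) (x ^ 3)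
    - x * appellThree Q x 1 * (theta Q (x ^ 2) / theta Q x) = _ at u
  rw [← sub_eq_iff_eq_add', u]
  simp only [one_mul, zero_mul, zero_sub]
  field_simp

theorem appellOne_pair (h0 : 0 < Q) (h1 : Q < 1) {x z : ℝ} (hx : Q < x) (hx1 : x < 1) (hz : 0 < z)
    (ox2 : OffLattice Q (x ^ 2)) (om : OffLattice Q (z / x)) (op : OffLattice Q (z * x)) :
    x * appellOne Q (z * x) x + appellOne Q (z / x) x⁻¹
      = eulerProd Q ^ 3 * theta Q z * theta Q (x ^ 2)
          / (theta Q x * theta Q (z * x) * theta Q (z / x)) := by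
  have x0 := h0.trans hx
  have ox := offLattice_of_mem_Ioo h0 h1 hx hx1
  have e1 : z / x / (z * x) = (x ^ 2)⁻¹ := by field_simp
  have e2 : z * x / (z / x) = x ^ 2 := by field_simp
  have e3 : x * (z / x) / (z * x) = x⁻¹ := by field_simp
  have key := appell_mul_kron h0 h1 hx hx1 op om (by rw [e1]; exact ox2.inv)
  rw [e1, e2, e3] at key
  have k1 := theta_mul_kron h0 h1 hx hx1 om
  have k2 := theta_mul_kron h0 h1 hx hx1 ox2.inv
  rw [show x * (z / x) = z by field_simp] at k1
  rw [show x * (x ^ 2)⁻¹ = x⁻¹ by field_simp, theta_inv ox.1] at k2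
  have n1 := theta_ne_zero h0 h1 ox
  have n2 := theta_ne_zero h0 h1 ox2
  have n4 := theta_ne_zero h0 h1 om
  have n5 := theta_ne_zero h0 h1 op
  have nJ : eulerProd Q ≠ 0 := eulerProd_ne_zero (norm_lt_one_of_pos h0 h1)
  rw [mul_comm, ← eq_div_iff n1] at k1 k2
  rw [k1, k2, appell_eq_div h0 h1 (inv_pos.2 (pow_pos x0 2)) ox2.inv,
    appell_eq_div h0 h1 (pow_pos x0 2) ox2,
    appell_eq_div h0 h1 (div_pos hz x0) om, appell_eq_div h0 h1 (mul_pos hz x0) op,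
    theta_inv ox2.1] at key
  field_simp at key ⊢
  linear_combination -key

theorem appellOne_pair_self (h0 : 0 < Q) (h1 : Q < 1) {x : ℝ} (hx : Q < x) (hx1 : x < 1)
    (ox2 : OffLattice Q (x ^ 2)) :
    x * appellOne Q (x ^ 2) x + appellOne Q 1 x⁻¹ = logTheta Q (x ^ 2) - logTheta Q x := by
  have x0 := h0.trans hx
  have ox := offLattice_of_mem_Ioo h0 h1 hx hx1
  have n1 := theta_ne_zero h0 h1 ox
  have n2 := theta_ne_zero h0 h1 ox2
  have hφ := ((hasDerivAt_theta_left h0 h1 x0 ox).mul_const (theta Q (x ^ 2))).fun_div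
    ((hasDerivAt_theta_left h0 h1 (pow_pos x0 2) ox2).const_mul (theta Q x))
    (by simpa using mul_ne_zero n1 n2)
  have T := tendsto_mul_appell_sub h0 h1 hφ (by simp [n1, n2])
  have A := (tendsto_lambert_one h0 h1
    (summable_norm_eps_mul_zpow h0 h1 (inv_ne_zero ox.1))).mono_left
      (nhdsWithin_le_nhds (s := {1}ᶜ))
  have B := (continuousAt_lambert h0 h1 (summable_norm_eps_mul_zpow h0 h1 ox.1)
    ox2).comp (tendsto_one_mul (x ^ 2))
  have L := (B.const_mul x).add A
  have : ∀ᶠ ζ in 𝓝[≠] (1 : ℝ), OffLattice Q ζ ∧ 0 < ζ ∧ OffLattice Q (ζ * x ^ 2) :=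
    (eventually_offLattice_one h0 h1).and (((eventually_gt_nhds one_pos).filter_mono nhdsWithin_le_nhds).and
        ((ox2.eventually h0 h1 (pow_pos x0 2)).filter_mono nhdsWithin_le_nhds))
  have u := tendsto_nhds_unique (L.congr' (by
    filter_upwards [this] with ζ ⟨o, hζ, op⟩
    have e1 : ζ * x / x = ζ := by field_simp
    have e2 : ζ * x * x = ζ * x ^ 2 := by ring
    have key := appellOne_pair h0 h1 hx hx1 (mul_pos hζ x0) ox2 (by rwa [e1]) (by rwa [e2])
    rw [e1, e2] at key
    have n4 := theta_ne_zero h0 h1 o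
    have n6 := theta_ne_zero h0 h1 op
    have : theta Q (ζ * x) * theta Q (x ^ 2) / (theta Q x * theta Q (ζ * x ^ 2)) * appell Q ζ
        = eulerProd Q ^ 3 * theta Q (ζ * x) * theta Q (x ^ 2)
          / (theta Q x * theta Q (ζ * x ^ 2) * theta Q ζ) := by
      rw [appell_eq_div h0 h1 hζ o]
      field_simp
    rw [this, eq_comm, sub_eq_iff_eq_add]
    simp only [Function.comp_def, appellOne] at key ⊢
    rw [eps_zero, zpow_zero, one_mul, one_mul]
    linear_combination -key)) T
  change x * appellOne Q (x ^ 2) x + appellOne Q 1 x⁻¹ = _ at u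
  rw [u]
  simp only [one_mul]
  field_simp
  ring

theorem thetaThree_pair (h0 : 0 < Q) (h1 : Q < 1) {x : ℝ} (hx : 0 < x)
    (ox : OffLattice Q x) (ox2 : OffLattice Q (x ^ 2)) :
    thetaThree Q (x⁻¹ ^ 3) + x * thetaThree Q (x ^ 3)
      = thetaThree Q 1 * (theta Q (x ^ 2) / theta Q x) := by
  have e2 : x / x⁻¹ = x ^ 2 := by field_simp
  have e3 : x⁻¹ / x = (x ^ 2)⁻¹ := by field_simp
  have e4 : (1 : ℝ) ^ 2 / (x⁻¹ * x) = 1 := by field_simp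
  have e5 : x⁻¹ ^ 2 / (x * 1) = x⁻¹ ^ 3 := by field_simp
  have e6 : x ^ 2 / (1 * x⁻¹) = x ^ 3 := by field_simp
  have key := appell_thetaThree h0 h1 one_ne_zero (inv_ne_zero ox.1) ox.1
    (by rw [div_one]; exact ox.inv) (by rwa [e2]) (by rw [one_div]; exact ox.inv)
  rw [e2, e3, e4, e5, e6, div_one, div_one, one_div, one_div, inv_inv] at key
  have n1 := theta_ne_zero h0 h1 ox
  have n2 := theta_ne_zero h0 h1 ox2
  have nJ : eulerProd Q ≠ 0 := eulerProd_ne_zero (norm_lt_one_of_pos h0 h1)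
  rw [appell_eq_div h0 h1 (inv_pos.2 hx) ox.inv,
    appell_eq_div h0 h1 (inv_pos.2 (pow_pos hx 2)) ox2.inv, appell_eq_div h0 h1 hx ox,
    appell_eq_div h0 h1 (pow_pos hx 2) ox2, theta_inv ox.1, theta_inv ox2.1] at key
  have hc : eulerProd Q ^ 6 * x ≠ 0 := mul_ne_zero (pow_ne_zero 6 nJ) hx.ne'
  field_simp at key ⊢
  apply mul_left_cancel₀ hc
  linear_combination key

lemma logTheta_inv (h0 : 0 < Q) (h1 : Q < 1) {x : ℝ} (hx : 0 < x) (ho : OffLattice Q x) :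
    logTheta Q x⁻¹ = 1 - logTheta Q x := by
  have n1 := theta_ne_zero h0 h1 ho
  have i1 := hasDerivAt_inv (one_ne_zero (α := ℝ))
  have a := (hasDerivAt_theta_left h0 h1 (inv_pos.2 hx) ho.inv).comp_of_eq (1 : ℝ) i1 inv_one.symm
  have b := ((i1.mul_const x⁻¹).fun_neg).fun_mul (hasDerivAt_theta_left h0 h1 hx ho)
  have := a.unique (b.congr_of_eventuallyEq (by
    filter_upwards [lt_mem_nhds (one_pos (α := ℝ))] with w hw
    rw [Function.comp_apply, ← mul_inv, theta_inv (mul_pos hw hx).ne']))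
  rw [theta_inv ho.1] at this
  simp only [inv_one, one_mul, one_pow] at this
  have hc : x⁻¹ * theta Q x ≠ 0 := mul_ne_zero (inv_ne_zero ho.1) n1
  apply mul_right_cancel₀ hc
  linear_combination this

lemma logTheta_mul_self (h0 : 0 < Q) (h1 : Q < 1) {x : ℝ} (hx : 0 < x) (ho : OffLattice Q x) :
    logTheta Q (x * Q) = logTheta Q x - 1 := by
  have n1 := theta_ne_zero h0 h1 ho
  have i1 := hasDerivAt_inv (one_ne_zero (α := ℝ))
  have shift : ∀ {y : ℝ}, 0 < y → theta Q (y * Q) = -y⁻¹ * theta Q y := fun hy => by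
    have := theta_mul_zpow h0 hy.ne' 1
    simpa using this
  have oQ : OffLattice Q (x * Q) := by simpa using ho.mul_zpow h0 1
  have a := hasDerivAt_theta_left h0 h1 (mul_pos hx h0) oQ
  have b := ((i1.mul_const x⁻¹).fun_neg).fun_mul (hasDerivAt_theta_left h0 h1 hx ho)
  have := a.unique (b.congr_of_eventuallyEq (by
    filter_upwards [lt_mem_nhds (one_pos (α := ℝ))] with w hw
    rw [← mul_inv, ← mul_assoc, shift (mul_pos hw hx)]))
  rw [shift hx] at this
  simp only [inv_one, one_mul, one_pow] at this
  have hc : x⁻¹ * theta Q x ≠ 0 := mul_ne_zero (inv_ne_zero ho.1) n1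
  apply mul_right_cancel₀ hc
  linear_combination -this

end Specialization

/-- The normalized theta values, generators of the ring of modular units. -/
noncomputable def unitP (q : ℝ) (n : ℤ) : ℝ :=
  q ^ (tri n - 5 * n) * theta (q ^ 121) (q ^ (11 * n)) / eulerProd (q ^ 121)

/-- Normalized logarithmic derivative of theta. -/
noncomputable def unitD (q : ℝ) (n : ℤ) : ℝ := logTheta (q ^ 121) (q ^ (11 * n)) + n / 11 - 1 / 2

/-- The part of the rank Lambert series with index congruent to `r` modulo `11`. -/
noncomputable def rankClass (q : ℝ) (b r : ℤ) : ℝ :=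
  ∑' m : ℤ, (-1) ^ (11 * m + r) * q ^ (3 * tri (11 * m + r) + (11 * m + r) + b * (11 * m + r))
    * (1 - q ^ (11 * (11 * m + r)))⁻¹

/-- The part of the crank Lambert series with index congruent to `r` modulo `11`. -/
noncomputable def crankClass (q : ℝ) (b r : ℤ) : ℝ :=
  ∑' m : ℤ, (-1) ^ (11 * m + r) * q ^ (tri (11 * m + r) + b * (11 * m + r))
    * (1 - q ^ (11 * (11 * m + r)))⁻¹

/-- The part of the pentagonal series with index congruent to `r` modulo `11`. -/
noncomputable def pentClass (q : ℝ) (r : ℤ) : ℝ :=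
  ∑' m : ℤ, (-1) ^ (11 * m + r) * q ^ (3 * tri (11 * m + r) + (11 * m + r))

section Dissection

variable {q : ℝ}

lemma offLattice_zpow (h0 : 0 < q) (h1 : q < 1) {n : ℤ} (hn : ¬ 11 ∣ n) :
    OffLattice (q ^ 121) (q ^ (11 * n)) := by
  refine ⟨(zpow_pos h0 _).ne', fun k hk => hn ?_⟩
  rw [← zpow_natCast, ← zpow_mul, ← zpow_add₀ h0.ne', zpow_eq_one_iff_right₀ h0.le h1.ne] at hk
  push_cast at hk
  omega

lemma base_pos (h0 : 0 < q) : 0 < q ^ 121 := pow_pos h0 _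

lemma base_lt_one (h0 : 0 < q) (h1 : q < 1) : q ^ 121 < 1 := pow_lt_one₀ h0.le h1 (by norm_num)

lemma base_euler_ne (h0 : 0 < q) (h1 : q < 1) : eulerProd (q ^ 121) ≠ 0 :=
  eulerProd_ne_zero (norm_lt_one_of_pos (base_pos h0) (base_lt_one h0 h1))

lemma theta_eq_unitP (h0 : 0 < q) (h1 : q < 1) (n : ℤ) :
    theta (q ^ 121) (q ^ (11 * n))
      = q ^ (-(tri n - 5 * n)) * (unitP q n * eulerProd (q ^ 121)) := by
  have := base_euler_ne h0 h1
  rw [unitP, div_mul_cancel₀ _ this, ← mul_assoc, ← zpow_add₀ h0.ne', neg_add_cancel, zpow_zero,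
    one_mul]

lemma unitP_ne_zero (h0 : 0 < q) (h1 : q < 1) {n : ℤ} (hn : ¬ 11 ∣ n) : unitP q n ≠ 0 :=
  div_ne_zero (mul_ne_zero (zpow_pos h0 _).ne'
    (theta_ne_zero (base_pos h0) (base_lt_one h0 h1) (offLattice_zpow h0 h1 hn)))
    (base_euler_ne h0 h1)

lemma unitP_neg (h0 : 0 < q) (n : ℤ) : unitP q (-n) = -unitP q n := by
  have e : tri (-n) - 5 * -n = (tri n - 5 * n) + 11 * n := by
    rw [tri_neg]
    ring
  have e' : q ^ (11 * -n) = (q ^ (11 * n))⁻¹ := by rw [mul_neg, zpow_neg]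
  rw [unitP, unitP, e, e', theta_inv (zpow_pos h0 _).ne', zpow_add₀ h0.ne']
  have := (zpow_pos h0 (11 * n)).ne'
  field_simp

lemma unitP_add_eleven (h0 : 0 < q) (n : ℤ) : unitP q (n + 11) = -unitP q n := by
  have e : tri (n + 11) - 5 * (n + 11) = (tri n - 5 * n) + 11 * n := by
    rw [tri_add]
    norm_num [tri]
    ring
  have e' : q ^ (11 * (n + 11)) = q ^ (11 * n) * (q ^ 121) ^ (1 : ℤ) := by
    rw [zpow_one, ← zpow_natCast, ← zpow_add₀ h0.ne']
    congr 1
    push_cast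
    ring
  rw [unitP, unitP, e, e', theta_mul_zpow (base_pos h0) (zpow_pos h0 _).ne', zpow_add₀ h0.ne',
    zpow_neg _ (1 : ℤ)]
  have := (zpow_pos h0 (11 * n)).ne'
  simp only [zpow_one, tri_one, neg_zero, zpow_zero]
  field_simp

lemma unitD_neg (h0 : 0 < q) (h1 : q < 1) {n : ℤ} (hn : ¬ 11 ∣ n) : unitD q (-n) = -unitD q n := by
  rw [unitD, unitD, mul_neg, zpow_neg, logTheta_inv (base_pos h0) (base_lt_one h0 h1)
    (zpow_pos h0 _) (offLattice_zpow h0 h1 hn)]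
  push_cast
  ring

lemma unitD_add_eleven (h0 : 0 < q) (h1 : q < 1) {n : ℤ} (hn : ¬ 11 ∣ n) :
    unitD q (n + 11) = unitD q n := by
  have e' : q ^ (11 * (n + 11)) = q ^ (11 * n) * q ^ 121 := by
    rw [← zpow_natCast q 121, ← zpow_add₀ h0.ne']
    congr 1
    push_cast
    ring
  rw [unitD, unitD, e', logTheta_mul_self (base_pos h0) (base_lt_one h0 h1)
    (zpow_pos h0 _) (offLattice_zpow h0 h1 hn)]
  push_cast
  ring

lemma rankClass_eq (h0 : 0 < q) (s t : ℤ) : rankClass q (17 - 3 * s) (s + t)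
    = (-1) ^ (s + t) * q ^ (3 * tri (s + t) + (s + t) + (17 - 3 * s) * (s + t))
      * appellThree (q ^ 121) (q ^ (11 * (s + t))) (q ^ (33 * t)) := by
  rw [rankClass, appellThree, lambert, ← tsum_mul_left]
  refine tsum_congr fun m => ?_
  have a : (-1 : ℝ) ^ (11 * m + (s + t)) = (-1) ^ (s + t) * ((-1) ^ m) ^ 3 := by
    rw [← zpow_natCast, ← zpow_mul, ← neg_one_zpow_add,
      show 11 * m + (s + t) = s + t + m * 3 + (4 * m + 4 * m) by ring, neg_one_zpow_add,
      neg_one_zpow_add (4 * m), neg_one_zpow_mul_self, mul_one]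
    push_cast
    rfl
  have b : q ^ (3 * tri (11 * m + (s + t)) + (11 * m + (s + t)) + (17 - 3 * s) * (11 * m + (s + t)))
      = q ^ (3 * tri (s + t) + (s + t) + (17 - 3 * s) * (s + t))
        * (((q ^ 121) ^ tri (m + 1)) ^ 3 * (q ^ (33 * t)) ^ m) := by
    rw [← zpow_natCast q 121, ← zpow_natCast _ 3, ← zpow_mul, ← zpow_mul, ← zpow_mul,
      ← zpow_add₀ h0.ne', ← zpow_add₀ h0.ne']
    congr 1
    push_cast
    have := two_mul_tri (11 * m + (s + t))
    have := two_mul_tri (s + t)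
    have := two_mul_tri (m + 1)
    linarith
  have c : q ^ (11 * (11 * m + (s + t))) = q ^ (11 * (s + t)) * (q ^ 121) ^ m := by
    rw [← zpow_natCast q 121, ← zpow_mul, ← zpow_add₀ h0.ne']
    congr 1
    push_cast
    ring
  rw [a, b, c, eps]
  ring

lemma crankClass_eq (h0 : 0 < q) (s t : ℤ) : crankClass q (6 - s) (s + t)
    = (-1) ^ (s + t) * q ^ (tri (s + t) + (6 - s) * (s + t))
      * appellOne (q ^ 121) (q ^ (11 * (s + t))) (q ^ (11 * t)) := by
  rw [crankClass, appellOne, lambert, ← tsum_mul_left]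
  refine tsum_congr fun m => ?_
  have a : (-1 : ℝ) ^ (11 * m + (s + t)) = (-1) ^ (s + t) * (-1) ^ m := by
    rw [← neg_one_zpow_add,
      show 11 * m + (s + t) = s + t + m + (5 * m + 5 * m) by ring, neg_one_zpow_add,
      neg_one_zpow_add (5 * m), neg_one_zpow_mul_self, mul_one]
  have b : q ^ (tri (11 * m + (s + t)) + (6 - s) * (11 * m + (s + t)))
      = q ^ (tri (s + t) + (6 - s) * (s + t))
        * ((q ^ 121) ^ tri (m + 1) * (q ^ (11 * t)) ^ m) := by
    rw [← zpow_natCast q 121, ← zpow_mul, ← zpow_mul,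
      ← zpow_add₀ h0.ne', ← zpow_add₀ h0.ne']
    congr 1
    push_cast
    have := two_mul_tri (11 * m + (s + t))
    have := two_mul_tri (s + t)
    have := two_mul_tri (m + 1)
    linarith
  have c : q ^ (11 * (11 * m + (s + t))) = q ^ (11 * (s + t)) * (q ^ 121) ^ m := by
    rw [← zpow_natCast q 121, ← zpow_mul, ← zpow_add₀ h0.ne']
    congr 1
    push_cast
    ring
  rw [a, b, c, eps]
  ring

lemma pentClass_eq (h0 : 0 < q) (t : ℤ) : pentClass q (2 + t)
    = (-1) ^ t * q ^ (3 * tri (2 + t) + (2 + t)) * thetaThree (q ^ 121) (q ^ (33 * t)) := by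
  rw [pentClass, thetaThree, ← tsum_mul_left]
  refine tsum_congr fun m => ?_
  have a : (-1 : ℝ) ^ (11 * m + (2 + t)) = (-1) ^ t * ((-1) ^ m) ^ 3 := by
    rw [← zpow_natCast, ← zpow_mul, ← neg_one_zpow_add,
      show 11 * m + (2 + t) = t + m * 3 + ((4 * m + 1) + (4 * m + 1)) by ring, neg_one_zpow_add,
      neg_one_zpow_add (4 * m + 1), neg_one_zpow_mul_self, mul_one]
    push_cast
    rfl
  have b : q ^ (3 * tri (11 * m + (2 + t)) + (11 * m + (2 + t)))
      = q ^ (3 * tri (2 + t) + (2 + t))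
        * (((q ^ 121) ^ tri (m + 1)) ^ 3 * (q ^ 121) ^ (-m) * (q ^ (33 * t)) ^ m) := by
    rw [← zpow_natCast q 121, ← zpow_natCast _ 3, ← zpow_mul, ← zpow_mul, ← zpow_mul, ← zpow_mul,
      ← zpow_add₀ h0.ne', ← zpow_add₀ h0.ne', ← zpow_add₀ h0.ne']
    congr 1
    push_cast
    have := two_mul_tri (11 * m + (2 + t))
    have := two_mul_tri (2 + t)
    have := two_mul_tri (m + 1)
    linarith
  rw [a, b, eps]
  ring

lemma pentClass_two (h0 : 0 < q) : pentClass q 2 = q ^ 5 * thetaThree (q ^ 121) 1 := by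
  have := pentClass_eq h0 0
  have e : 3 * tri 2 + 2 = (5 : ℕ) := by norm_num [tri]
  simpa only [add_zero, mul_zero, zpow_zero, one_mul, e, zpow_natCast] using this

theorem pentClass_pair (h0 : 0 < q) (h1 : q < 1) {t : ℤ} (ht : ¬ 11 ∣ t) :
    pentClass q (2 + t) + pentClass q (2 - t)
      = (-1) ^ t * q ^ 5 * thetaThree (q ^ 121) 1 * (unitP q (2 * t) / unitP q t) := by
  have ot := offLattice_zpow h0 h1 ht
  have ot2 := offLattice_zpow h0 h1 (n := 2 * t) (by omega)
  have e : q ^ (11 * (2 * t)) = (q ^ (11 * t)) ^ 2 := by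
    rw [← zpow_natCast, ← zpow_mul]
    congr 1
    push_cast
    ring
  rw [e] at ot2
  have key := thetaThree_pair (base_pos h0) (base_lt_one h0 h1) (zpow_pos h0 _) ot ot2
  have e3 : (q ^ (11 * t)) ^ 3 = q ^ (33 * t) := by
    rw [← zpow_natCast, ← zpow_mul]
    congr 1
    push_cast
    ring
  rw [inv_pow, e3, ← zpow_neg, ← mul_neg 33, ← e, theta_eq_unitP h0 h1, theta_eq_unitP h0 h1] at key
  have nJ := base_euler_ne h0 h1
  have np := unitP_ne_zero h0 h1 ht
  have nq := fun n : ℤ => (zpow_pos h0 n).ne'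
  rw [show (q ^ (-(tri (2 * t) - 5 * (2 * t))) * (unitP q (2 * t) * eulerProd (q ^ 121)))
      / (q ^ (-(tri t - 5 * t)) * (unitP q t * eulerProd (q ^ 121)))
      = q ^ (-(tri (2 * t) - 5 * (2 * t)) - (-(tri t - 5 * t))) * (unitP q (2 * t) / unitP q t) by
    rw [zpow_sub₀ h0.ne']
    have := nq (-(tri t - 5 * t))
    field_simp] at key
  rw [sub_eq_add_neg, pentClass_eq h0, pentClass_eq h0, neg_one_zpow_neg]
  have a : q ^ (3 * tri (2 + t) + (2 + t)) = q ^ (3 * tri (2 + -t) + (2 + -t)) * q ^ (11 * t) := by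
    rw [← zpow_add₀ h0.ne']
    congr 1
    have := two_mul_tri (2 + t)
    have := two_mul_tri (2 + -t)
    linarith
  have b : q ^ 5 = q ^ (3 * tri (2 + -t) + (2 + -t))
      * q ^ (-(tri (2 * t) - 5 * (2 * t)) - (-(tri t - 5 * t))) := by
    rw [← zpow_add₀ h0.ne', ← zpow_natCast]
    congr 1
    have := two_mul_tri (2 * t)
    have := two_mul_tri t
    have := two_mul_tri (2 + -t)
    push_cast
    linarith
  rw [a, b]
  linear_combination ((-1) ^ t * q ^ (3 * tri (2 + -t) + (2 + -t))) * key

end Dissection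

lemma thetaThree_one {Q : ℝ} (h0 : 0 < Q) (h1 : Q < 1) : thetaThree Q 1 = eulerProd Q := by
  rw [eulerProd_eq_tsum (norm_lt_one_of_pos h0 h1), thetaThree, ← (Equiv.neg ℤ).tsum_eq]
  refine tsum_congr fun k => ?_
  have a : Q ^ (3 * tri k + k) = (Q ^ tri (-k + 1)) ^ 3 * Q ^ k := by
    rw [← zpow_natCast _ 3, ← zpow_mul, ← zpow_add₀ h0.ne']
    congr 1
    push_cast
    rw [show -k + 1 = 1 - k by ring, tri_one_sub]
    ring
  have b : ((-1 : ℝ) ^ k) ^ 3 = (-1) ^ k := by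
    rw [pow_succ, pow_two, neg_one_zpow_mul_self, one_mul]
  rw [a, Equiv.neg_apply, eps, one_zpow, mul_one, neg_one_zpow_neg, neg_neg, mul_pow, b, mul_assoc]

/-- The nonmodular factor of the rank Lambert series. -/
noncomputable def mockFactor (q : ℝ) (s : ℤ) : ℝ :=
  (-1) ^ s * q ^ (15 * s - 3 * tri s - 5) * appellThree (q ^ 121) (q ^ (11 * s)) 1
    / eulerProd (q ^ 121)

section Dissection

variable {q : ℝ}

lemma theta_div_theta (h0 : 0 < q) (h1 : q < 1) (m : ℤ) {n : ℤ} (hn : ¬ 11 ∣ n) :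
    theta (q ^ 121) (q ^ (11 * m)) / theta (q ^ 121) (q ^ (11 * n))
      = q ^ (-(tri m - 5 * m) + (tri n - 5 * n)) * (unitP q m / unitP q n) := by
  have nJ := base_euler_ne h0 h1
  have np := unitP_ne_zero h0 h1 hn
  have nq := (zpow_pos h0 (tri n - 5 * n)).ne'
  rw [theta_eq_unitP h0 h1, theta_eq_unitP h0 h1, zpow_add₀ h0.ne', zpow_neg _ (tri n - 5 * n)]
  field_simp

lemma theta_mul_div_theta (h0 : 0 < q) (h1 : q < 1) (a b : ℤ) {c d e : ℤ} (hc : ¬ 11 ∣ c)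
    (hd : ¬ 11 ∣ d) (he : ¬ 11 ∣ e) :
    eulerProd (q ^ 121) ^ 3 * theta (q ^ 121) (q ^ (11 * a)) * theta (q ^ 121) (q ^ (11 * b))
      / (theta (q ^ 121) (q ^ (11 * c)) * theta (q ^ 121) (q ^ (11 * d))
        * theta (q ^ 121) (q ^ (11 * e)))
      = q ^ (-(tri a - 5 * a) + -(tri b - 5 * b) + (tri c - 5 * c) + (tri d - 5 * d)
          + (tri e - 5 * e))
        * (eulerProd (q ^ 121) ^ 2 * unitP q a * unitP q b
          / (unitP q c * unitP q d * unitP q e)) := by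
  have nJ := base_euler_ne h0 h1
  have nc := unitP_ne_zero h0 h1 hc
  have nd := unitP_ne_zero h0 h1 hd
  have ne := unitP_ne_zero h0 h1 he
  have nq := fun n => (zpow_pos h0 n).ne'
  have := nq (tri c - 5 * c)
  have := nq (tri d - 5 * d)
  have := nq (tri e - 5 * e)
  simp only [theta_eq_unitP h0 h1]
  rw [zpow_add₀ h0.ne', zpow_add₀ h0.ne', zpow_add₀ h0.ne', zpow_add₀ h0.ne',
    zpow_neg _ (tri c - 5 * c), zpow_neg _ (tri d - 5 * d), zpow_neg _ (tri e - 5 * e)]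
  field_simp

lemma div_mul_mul_cancel_mid (a b c d e f : ℝ) {J : ℝ} (hJ : J ≠ 0) :
    a * b * c / J * (d * e * J * f) = a * d * (b * e) * c * f := by
  field_simp

lemma zpow_pow_eq (a : ℤ) (n : ℕ) (b : ℤ) (h : a * n = b) :
    (q ^ a) ^ n = q ^ b := by
  rw [← zpow_natCast, ← zpow_mul, h]

theorem rankClass_pair (h0 : 0 < q) (h1 : q < 1) {s t : ℤ} (hs : ¬ 11 ∣ s) (ht : ¬ 11 ∣ t)
    (hm : ¬ 11 ∣ s - t) (hp : ¬ 11 ∣ s + t) :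
    rankClass q (17 - 3 * s) (s + t) + rankClass q (17 - 3 * s) (s - t)
      = mockFactor q s * (pentClass q (2 + t) + pentClass q (2 - t))
        + (-1) ^ (s + t) * (eulerProd (q ^ 121) ^ 2 * unitP q t * unitP q (2 * t)
          / (unitP q s * unitP q (s - t) * unitP q (s + t))) := by
  have e : (q ^ (11 * t)) ^ 2 = q ^ (11 * (2 * t)) := zpow_pow_eq _ _ _ (by push_cast; ring)
  have e3 : (q ^ (11 * t)) ^ 3 = q ^ (33 * t) := zpow_pow_eq _ _ _ (by push_cast; ring)
  have em : q ^ (11 * s) / q ^ (11 * t) = q ^ (11 * (s - t)) := by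
    rw [← zpow_sub₀ h0.ne', mul_sub]
  have ep : q ^ (11 * s) * q ^ (11 * t) = q ^ (11 * (s + t)) := by
    rw [← zpow_add₀ h0.ne', mul_add]
  have ot2 := offLattice_zpow h0 h1 (n := 2 * t) (by omega)
  have key := appellThree_pair (base_pos h0) (base_lt_one h0 h1) (zpow_pos h0 (11 * t))
    (zpow_pos h0 (11 * s)) (offLattice_zpow h0 h1 ht) (by rwa [e]) (offLattice_zpow h0 h1 hs)
    (by rw [em]; exact offLattice_zpow h0 h1 hm) (by rw [ep]; exact offLattice_zpow h0 h1 hp)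
  rw [em, ep, e, theta_div_theta h0 h1 _ ht, theta_mul_div_theta h0 h1 _ _ hs hm hp, inv_pow, e3,
    ← zpow_neg, ← mul_neg 33] at key
  have a : q ^ (3 * tri (s + t) + (s + t) + (17 - 3 * s) * (s + t))
      = q ^ (3 * tri (s + -t) + (s + -t) + (17 - 3 * s) * (s + -t)) * q ^ (33 * t) := by
    rw [← zpow_add₀ h0.ne']
    congr 1
    have := two_mul_tri (s + t)
    have := two_mul_tri (s + -t)
    linarith
  have b : q ^ (15 * s - 3 * tri s - 5) * q ^ 5
      = q ^ (3 * tri (s + -t) + (s + -t) + (17 - 3 * s) * (s + -t)) * q ^ (11 * t)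
        * q ^ (-(tri (2 * t) - 5 * (2 * t)) + (tri t - 5 * t)) := by
    rw [← zpow_add₀ h0.ne', ← zpow_add₀ h0.ne', ← zpow_natCast, ← zpow_add₀ h0.ne']
    congr 1
    have := two_mul_tri (2 * t)
    have := two_mul_tri t
    have := two_mul_tri s
    have := two_mul_tri (s + -t)
    push_cast
    linarith
  have c : 1 = q ^ (3 * tri (s + -t) + (s + -t) + (17 - 3 * s) * (s + -t))
        * q ^ (-(tri t - 5 * t) + -(tri (2 * t) - 5 * (2 * t)) + (tri s - 5 * s)
          + (tri (s - t) - 5 * (s - t)) + (tri (s + t) - 5 * (s + t))) := by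
    rw [← zpow_add₀ h0.ne', eq_comm]
    refine (zpow_eq_one_iff_right₀ h0.le h1.ne).2 ?_
    have := two_mul_tri (2 * t)
    have := two_mul_tri t
    have := two_mul_tri s
    have := two_mul_tri (s + -t)
    have := two_mul_tri (s - t)
    have := two_mul_tri (s + t)
    linarith
  have nJ := base_euler_ne h0 h1
  rw [pentClass_pair h0 h1 ht, thetaThree_one (base_pos h0) (base_lt_one h0 h1), sub_eq_add_neg s t,
    rankClass_eq h0, rankClass_eq h0, neg_one_zpow_add s (-t), neg_one_zpow_neg,
    ← neg_one_zpow_add, a, mockFactor, ← sub_eq_add_neg s t]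
  rw [← sub_eq_add_neg s t] at b c
  rw [div_mul_mul_cancel_mid _ _ _ _ _ _ nJ, ← neg_one_zpow_add, b]
  linear_combination ((-1) ^ (s + t) * q ^ (3 * tri (s - t) + (s - t) + (17 - 3 * s) * (s - t)))
    * key - (-1) ^ (s + t) * (eulerProd (q ^ 121) ^ 2 * unitP q t * unitP q (2 * t)
          / (unitP q s * unitP q (s - t) * unitP q (s + t))) * c

theorem rankClass_self (h0 : 0 < q) (h1 : q < 1) (s : ℤ) :
    rankClass q (17 - 3 * s) s = mockFactor q s * pentClass q 2 := by
  have nJ := base_euler_ne h0 h1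
  have := rankClass_eq h0 s 0
  rw [add_zero, mul_zero, zpow_zero] at this
  have b : q ^ (3 * tri s + s + (17 - 3 * s) * s) = q ^ (15 * s - 3 * tri s - 5) * q ^ 5 := by
    rw [← zpow_natCast, ← zpow_add₀ h0.ne']
    congr 1
    have := two_mul_tri s
    push_cast
    linarith
  rw [this, pentClass_two h0, thetaThree_one (base_pos h0) (base_lt_one h0 h1), mockFactor, b]
  field_simp

theorem rankClass_pair_self (h0 : 0 < q) (h1 : q < 1) {s : ℤ} (hs : ¬ 11 ∣ s) :
    rankClass q (17 - 3 * s) (2 * s) + rankClass q (17 - 3 * s) 0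
      = mockFactor q s * (pentClass q (2 + s) + pentClass q (2 - s))
        + (unitD q s + unitD q (2 * s) + 1 - 3 * s / 11) := by
  have e : (q ^ (11 * s)) ^ 2 = q ^ (11 * (2 * s)) := zpow_pow_eq _ _ _ (by push_cast; ring)
  have e3 : (q ^ (11 * s)) ^ 3 = q ^ (33 * s) := zpow_pow_eq _ _ _ (by push_cast; ring)
  have ot2 := offLattice_zpow h0 h1 (n := 2 * s) (by omega)
  have key := appellThree_pair_self (base_pos h0) (base_lt_one h0 h1) (zpow_pos h0 (11 * s))
    (offLattice_zpow h0 h1 hs) (by rwa [e])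
  rw [e, theta_div_theta h0 h1 _ hs, inv_pow, e3, ← zpow_neg, ← mul_neg 33] at key
  have a : q ^ (3 * tri (s + s) + (s + s) + (17 - 3 * s) * (s + s)) = q ^ (33 * s) := by
    congr 1
    have := two_mul_tri (s + s)
    linarith
  have b : q ^ (15 * s - 3 * tri s - 5) * q ^ 5
      = q ^ (11 * s) * q ^ (-(tri (2 * s) - 5 * (2 * s)) + (tri s - 5 * s)) := by
    rw [← zpow_add₀ h0.ne', ← zpow_natCast, ← zpow_add₀ h0.ne']
    congr 1
    have := two_mul_tri (2 * s)
    have := two_mul_tri s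
    push_cast
    linarith
  have nJ := base_euler_ne h0 h1
  have r1 := rankClass_eq h0 s s
  have r2 := rankClass_eq h0 s (-s)
  rw [neg_one_zpow_add, neg_one_zpow_mul_self, a, ← two_mul] at r1
  rw [add_neg_cancel, zpow_zero] at r2
  rw [pentClass_pair h0 h1 hs, thetaThree_one (base_pos h0) (base_lt_one h0 h1), r1, r2, mockFactor,
    unitD, unitD]
  rw [div_mul_mul_cancel_mid _ _ _ _ _ _ nJ, b, neg_one_zpow_mul_self]
  simp only [mul_zero, zpow_zero, tri_zero, add_zero, one_mul, mul_one] at key ⊢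
  push_cast
  linear_combination key

theorem crankClass_pair (h0 : 0 < q) (h1 : q < 1) {s t : ℤ} (ht : 0 < t) (ht' : t < 11)
    (hm : ¬ 11 ∣ s - t) (hp : ¬ 11 ∣ s + t) :
    crankClass q (6 - s) (s + t) + crankClass q (6 - s) (s - t)
      = (-1) ^ (s + t) * (eulerProd (q ^ 121) ^ 2 * unitP q s * unitP q (2 * t)
          / (unitP q t * unitP q (s + t) * unitP q (s - t))) := by
  have e : (q ^ (11 * t)) ^ 2 = q ^ (11 * (2 * t)) := zpow_pow_eq _ _ _ (by push_cast; ring)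
  have em : q ^ (11 * s) / q ^ (11 * t) = q ^ (11 * (s - t)) := by
    rw [← zpow_sub₀ h0.ne', mul_sub]
  have ep : q ^ (11 * s) * q ^ (11 * t) = q ^ (11 * (s + t)) := by
    rw [← zpow_add₀ h0.ne', mul_add]
  have hx : q ^ 121 < q ^ (11 * t) := by
    rw [← zpow_natCast]
    exact zpow_lt_zpow_right_of_lt_one₀ h0 h1 (by push_cast; omega)
  have hx1 : q ^ (11 * t) < 1 := zpow_lt_one₀ h0 h1 (by omega)
  have key := appellOne_pair (base_pos h0) (base_lt_one h0 h1) hx hx1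
    (zpow_pos h0 (11 * s)) (by rw [e]; exact offLattice_zpow h0 h1 (by omega))
    (by rw [em]; exact offLattice_zpow h0 h1 hm) (by rw [ep]; exact offLattice_zpow h0 h1 hp)
  rw [em, ep, e, theta_mul_div_theta h0 h1 _ _ (by omega) hp hm, ← zpow_neg, ← mul_neg 11] at key
  have a : q ^ (tri (s + t) + (6 - s) * (s + t))
      = q ^ (tri (s + -t) + (6 - s) * (s + -t)) * q ^ (11 * t) := by
    rw [← zpow_add₀ h0.ne']
    congr 1
    have := two_mul_tri (s + t)
    have := two_mul_tri (s + -t)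
    linarith
  have c : 1 = q ^ (tri (s + -t) + (6 - s) * (s + -t))
        * q ^ (-(tri s - 5 * s) + -(tri (2 * t) - 5 * (2 * t)) + (tri t - 5 * t)
          + (tri (s + t) - 5 * (s + t)) + (tri (s - t) - 5 * (s - t))) := by
    rw [← zpow_add₀ h0.ne', eq_comm]
    refine (zpow_eq_one_iff_right₀ h0.le h1.ne).2 ?_
    have := two_mul_tri (2 * t)
    have := two_mul_tri t
    have := two_mul_tri s
    have := two_mul_tri (s + -t)
    have := two_mul_tri (s - t)
    have := two_mul_tri (s + t)
    linarith
  rw [sub_eq_add_neg s t, crankClass_eq h0, crankClass_eq h0, neg_one_zpow_add s (-t),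
    neg_one_zpow_neg, ← neg_one_zpow_add, a, ← sub_eq_add_neg s t]
  rw [← sub_eq_add_neg s t] at c
  linear_combination ((-1) ^ (s + t) * q ^ (tri (s - t) + (6 - s) * (s - t)))
    * key - (-1) ^ (s + t) * (eulerProd (q ^ 121) ^ 2 * unitP q s * unitP q (2 * t)
          / (unitP q t * unitP q (s + t) * unitP q (s - t))) * c

theorem crankClass_self (h0 : 0 < q) (h1 : q < 1) {s : ℤ} (hs : ¬ 11 ∣ s) :
    crankClass q (6 - s) s = (-1) ^ s * (eulerProd (q ^ 121) ^ 2 / unitP q s) := by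
  have nJ := base_euler_ne h0 h1
  have nP := unitP_ne_zero h0 h1 hs
  have := crankClass_eq h0 s 0
  have ne := theta_ne_zero (base_pos h0) (base_lt_one h0 h1) (offLattice_zpow h0 h1 hs)
  have key := appell_mul_theta (base_pos h0) (base_lt_one h0 h1) (zpow_pos h0 _) (offLattice_zpow h0 h1 hs)
  rw [theta_eq_unitP h0 h1, ← eq_div_iff (by rw [← theta_eq_unitP h0 h1]; exact ne)] at key
  rw [add_zero, mul_zero, zpow_zero, appellOne_one, key] at this
  rw [this, show tri s + (6 - s) * s = -(tri s - 5 * s) by linarith [two_mul_tri s]]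
  have := (zpow_pos h0 (-(tri s - 5 * s))).ne'
  field_simp

theorem crankClass_pair_self (h0 : 0 < q) (h1 : q < 1) {s : ℤ} (hs : 0 < s) (hs' : s < 11) :
    crankClass q (6 - s) (2 * s) + crankClass q (6 - s) 0 = unitD q (2 * s) - unitD q s - s / 11 := by
  have e : (q ^ (11 * s)) ^ 2 = q ^ (11 * (2 * s)) := zpow_pow_eq _ _ _ (by push_cast; ring)
  have hx : q ^ 121 < q ^ (11 * s) := by
    rw [← zpow_natCast]
    exact zpow_lt_zpow_right_of_lt_one₀ h0 h1 (by push_cast; omega)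
  have hx1 : q ^ (11 * s) < 1 := zpow_lt_one₀ h0 h1 (by omega)
  have key := appellOne_pair_self (base_pos h0) (base_lt_one h0 h1) hx hx1
    (by rw [e]; exact offLattice_zpow h0 h1 (by omega))
  rw [e, ← zpow_neg, ← mul_neg 11] at key
  have a : q ^ (tri (s + s) + (6 - s) * (s + s)) = q ^ (11 * s) := by
    congr 1
    have := two_mul_tri (s + s)
    linarith
  have r1 := crankClass_eq h0 s s
  have r2 := crankClass_eq h0 s (-s)
  rw [neg_one_zpow_add, neg_one_zpow_mul_self, a, ← two_mul] at r1
  rw [add_neg_cancel, zpow_zero] at r2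
  rw [r1, r2, unitD, unitD]
  simp only [mul_zero, zpow_zero, tri_zero, add_zero, one_mul, mul_one] at key ⊢
  push_cast
  linear_combination key

end Dissection

section GeneratingFunctions

variable {𝕜 : Type*} [NormedField 𝕜]

open scoped Classical in
/-- The generating function of the partitions satisfying `P`. -/
noncomputable def genFn (q : 𝕜) (P : Multiset ℕ → Prop) : 𝕜 :=
  ∑' s : Multiset ℕ, if 0 ∉ s ∧ P s then q ^ s.sum else 0

lemma card_partition_le (n : ℕ) : Fintype.card (Nat.Partition n) ≤ 2 ^ n :=
  (Fintype.card_le_of_surjective _ Nat.Partition.ofComposition_surj).trans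
    ((composition_card n).trans_le (Nat.pow_le_pow_right two_pos (Nat.sub_le n 1)))

lemma injective_parts :
    Function.Injective fun x : Σ n : ℕ, Nat.Partition n => x.2.parts := by
  rintro ⟨n, x⟩ ⟨m, y⟩ (h : x.parts = y.parts)
  obtain rfl : n = m := by rw [← x.parts_sum, ← y.parts_sum, h]
  rw [Nat.Partition.ext h]

lemma notMem_range_parts {s : Multiset ℕ}
    (hs : s ∉ Set.range fun x : Σ n : ℕ, Nat.Partition n => x.2.parts) : 0 ∈ s := by
  by_contra h
  exact hs ⟨⟨s.sum, ⟨s, fun {i} hi => Nat.pos_of_ne_zero fun h' => h (h' ▸ hi), rfl⟩⟩, rfl⟩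

lemma zero_notMem_parts {n : ℕ} (x : Nat.Partition n) : 0 ∉ x.parts :=
  fun h => (x.parts_pos h).ne' rfl

lemma summable_pow_sum {r : ℝ} (h0 : 0 ≤ r) (h1 : r < 1 / 2) :
    Summable fun s : Multiset ℕ => if 0 ∉ s then r ^ s.sum else 0 := by
  refine (injective_parts.summable_iff fun s hs => if_neg ?_).1 ?_
  · exact not_not.2 (notMem_range_parts hs)
  refine (summable_sigma_of_nonneg fun x => ?_).2 ⟨fun n => Summable.of_finite, ?_⟩
  · dsimp only [Function.comp]
    split_ifs <;> positivity
  refine .of_nonneg_of_le (fun n => tsum_nonneg fun x => ?_) (fun n => ?_)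
    (summable_geometric_of_lt_one (r := 2 * r) (by positivity) (by linarith))
  · dsimp only [Function.comp]
    split_ifs <;> positivity
  · simp only [Function.comp, zero_notMem_parts, not_false_eq_true, if_true, Nat.Partition.parts_sum,
      tsum_fintype, Finset.sum_const, Finset.card_univ, nsmul_eq_mul, mul_pow]
    gcongr
    exact_mod_cast card_partition_le n

variable {q : 𝕜}

open scoped Classical in
lemma summable_norm_genFn (hq : ‖q‖ < 1 / 2) (P : Multiset ℕ → Prop) :
    Summable fun s : Multiset ℕ => ‖if 0 ∉ s ∧ P s then q ^ s.sum else 0‖ := by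
  refine .of_nonneg_of_le (fun _ => norm_nonneg _) (fun s => ?_)
    (summable_pow_sum (norm_nonneg q) hq)
  by_cases h : 0 ∈ s
  · simp [h]
  · by_cases hP : P s <;> simp [h, hP]

open scoped Classical in
lemma hasSum_genFn [CompleteSpace 𝕜] (hq : ‖q‖ < 1 / 2) (P : Multiset ℕ → Prop) :
    HasSum (fun s : Multiset ℕ => if 0 ∉ s ∧ P s then q ^ s.sum else 0) (genFn q P) :=
  (summable_norm_genFn hq P).of_norm.hasSum

lemma norm_genFn_le (hq : ‖q‖ < 1 / 2) (P : Multiset ℕ → Prop) :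
    ‖genFn q P‖ ≤ ∑' s : Multiset ℕ, if 0 ∉ s then ‖q‖ ^ s.sum else 0 := by
  classical
  refine tsum_of_norm_bounded (summable_pow_sum (norm_nonneg q) hq).hasSum fun s => ?_
  by_cases h : 0 ∈ s
  · simp [h]
  · by_cases hP : P s <;> simp [h, hP]

lemma genFn_congr {P Q : Multiset ℕ → Prop} (h : ∀ s, 0 ∉ s → (P s ↔ Q s)) :
    genFn q P = genFn q Q := by
  classical
  refine tsum_congr fun s => ?_
  by_cases hs : 0 ∈ s
  · simp [hs]
  · simp [hs, h s hs]

lemma genFn_or [CompleteSpace 𝕜] (hq : ‖q‖ < 1 / 2) {P Q R : Multiset ℕ → Prop}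
    (h : ∀ s, 0 ∉ s → (P s ↔ Q s ∨ R s)) (hd : ∀ s, 0 ∉ s → Q s → ¬ R s) :
    genFn q P = genFn q Q + genFn q R := by
  classical
  rw [((hasSum_genFn hq Q).add (hasSum_genFn hq R)).tsum_eq.symm, genFn]
  refine tsum_congr fun s => ?_
  by_cases hs : 0 ∈ s
  · simp [hs]
  · by_cases hQ : Q s
    · simp [hs, h s hs, hQ, hd s hs hQ]
    · simp [hs, h s hs, hQ]

lemma hasSum_genFn_fiber [CompleteSpace 𝕜] (hq : ‖q‖ < 1 / 2) {β : Type*} (f : Multiset ℕ → β) (P : β → Prop)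
    [DecidablePred P] :
    HasSum (fun c => if P c then genFn q (f · = c) else 0) (genFn q fun s => P (f s)) := by
  classical
  obtain ⟨F, hF⟩ : ∃ F : Multiset ℕ → 𝕜, ∀ s, F s = if 0 ∉ s ∧ P (f s) then q ^ s.sum else 0 :=
    ⟨_, fun _ => rfl⟩
  have h1 : HasSum F (genFn q fun s => P (f s)) :=
    (hasSum_genFn hq fun s => P (f s)).congr_fun fun s => by rw [hF]; congr
  refine (h1.tsum_fiberwise f).congr_fun fun c => ?_
  rw [tsum_subtype, genFn]
  simp only [Set.indicator_apply, hF]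
  split_ifs with hc
  · refine tsum_congr fun s => ?_
    by_cases h : f s = c
    · simp [h, hc]
    · simp [h]
  · rw [eq_comm]
    refine (tsum_congr fun s => ?_).trans tsum_zero
    by_cases h : f s = c
    · simp [h, hc]
    · simp [h]

lemma genFn_bij {P Q : Multiset ℕ → Prop} (a b : ℕ) (f g : Multiset ℕ → Multiset ℕ)
    (hf : ∀ s, 0 ∉ s → P s → 0 ∉ f s ∧ Q (f s) ∧ g (f s) = s ∧ s.sum + a = (f s).sum + b)
    (hg : ∀ s, 0 ∉ s → Q s → 0 ∉ g s ∧ P (g s) ∧ f (g s) = s) :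
    q ^ a * genFn q P = q ^ b * genFn q Q := by
  classical
  have key : ∀ R : Multiset ℕ → Prop, genFn q R = ∑' s : {s // 0 ∉ s ∧ R s}, q ^ (s : Multiset ℕ).sum :=
    fun R => by
      rw [genFn]
      refine Eq.trans (tsum_congr fun s => ?_)
        (tsum_subtype {s : Multiset ℕ | 0 ∉ s ∧ R s} fun s => q ^ s.sum).symm
      rw [Set.indicator_apply]
      rfl
  let e : {s // 0 ∉ s ∧ P s} ≃ {s // 0 ∉ s ∧ Q s} :=
    { toFun := fun s => ⟨f s, (hf s s.2.1 s.2.2).1, (hf s s.2.1 s.2.2).2.1⟩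
      invFun := fun s => ⟨g s, (hg s s.2.1 s.2.2).1, (hg s s.2.1 s.2.2).2.1⟩
      left_inv := fun s => Subtype.ext (hf s s.2.1 s.2.2).2.2.1
      right_inv := fun s => Subtype.ext (hg s s.2.1 s.2.2).2.2 }
  rw [key P, key Q, ← e.tsum_eq, ← tsum_mul_left, ← tsum_mul_left]
  refine tsum_congr fun s => ?_
  rw [← pow_add, ← pow_add, add_comm a, (hf s s.2.1 s.2.2).2.2.2, add_comm b]
  rfl

lemma hasSum_card_mul_pow [CompleteSpace 𝕜] (hq : ‖q‖ < 1 / 2) (P : Multiset ℕ → Prop) [DecidablePred P] :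
    HasSum (fun n : ℕ => (((Finset.univ.filter fun π : Nat.Partition n => P π.parts).card : ℕ) : 𝕜)
      * q ^ n) (genFn q P) := by
  classical
  have h1 := hasSum_genFn hq P
  replace h1 := (injective_parts.hasSum_iff fun s hs =>
    if_neg fun h => h.1 (notMem_range_parts hs)).2 h1
  refine (h1.sigma fun n => hasSum_fintype _).congr_fun fun n => ?_
  simp only [Function.comp, zero_notMem_parts, not_false_eq_true, true_and, Nat.Partition.parts_sum]
  rw [Finset.sum_ite, Finset.sum_const_zero, add_zero, Finset.sum_const, nsmul_eq_mul]

end GeneratingFunctions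

section Rank

/-- The rank of a multiset of parts. -/
def msRank (s : Multiset ℕ) : ℤ := (s.sup : ℤ) - (Multiset.card s : ℤ)

/-- Remove the largest part, add one to every other part, and fill up with ones. -/
def dysonMap (m : ℤ) (s : Multiset ℕ) : Multiset ℕ :=
  (s.erase s.sup).map (· + 1) +
    Multiset.replicate ((s.sup : ℤ) - m - 1 - (Multiset.card (s.erase s.sup) : ℤ)).toNat 1

/-- The inverse of `dysonMap`. -/
def dysonInv (m : ℤ) (s : Multiset ℕ) : Multiset ℕ :=
  (((Multiset.card s : ℤ) + m + 1).toNat ::ₘ (s.filter (1 < ·)).map (· - 1)).filter (0 < ·)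

lemma sup_cons_of_le {a : ℕ} {t : Multiset ℕ} (h : ∀ b ∈ t, b ≤ a) : (a ::ₘ t).sup = a := by
  rw [Multiset.sup_cons]
  exact sup_eq_left.2 (Multiset.sup_le.2 h)

lemma exists_cons_of_ne_zero {s : Multiset ℕ} (hs : s ≠ 0) :
    ∃ a t, s = a ::ₘ t ∧ ∀ b ∈ t, b ≤ a := by
  have hmem : s.sup ∈ s := by
    induction s using Multiset.induction_on with
    | empty => exact absurd rfl hs
    | cons a t ih =>
      rw [Multiset.sup_cons]
      by_cases ht : t = 0
      · simp [ht]
      · rcases le_total a t.sup with h | h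
        · rw [sup_eq_right.2 h]
          exact Multiset.mem_cons_of_mem (ih ht)
        · rw [sup_eq_left.2 h]
          exact Multiset.mem_cons_self a t
  exact ⟨_, _, (Multiset.cons_erase hmem).symm,
    fun b hb => Multiset.le_sup (Multiset.mem_of_mem_erase hb)⟩

lemma filter_map_succ_add_replicate (t : Multiset ℕ) (n : ℕ) (h0 : 0 ∉ t) :
    (((t.map (· + 1) + Multiset.replicate n 1).filter (1 < ·)).map (· - 1)) = t := by
  rw [Multiset.filter_add, Multiset.filter_eq_self.2, Multiset.filter_eq_nil.2, add_zero,
    Multiset.map_map]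
  · simp
  · intro a ha
    simp [Multiset.eq_of_mem_replicate ha]
  · intro a ha
    obtain ⟨b, hb, rfl⟩ := Multiset.mem_map.1 ha
    have : b ≠ 0 := fun h => h0 (h ▸ hb)
    omega

lemma filter_add_replicate_eq (s : Multiset ℕ) (h0 : 0 ∉ s) :
    s.filter (1 < ·) + Multiset.replicate (Multiset.card s - Multiset.card (s.filter (1 < ·))) 1
      = s := by
  have h1 : s.filter (fun x => ¬ 1 < x)
      = Multiset.replicate (Multiset.card (s.filter fun x => ¬ 1 < x)) 1 := by
    refine Multiset.eq_replicate.2 ⟨rfl, fun b hb => ?_⟩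
    obtain ⟨hb1, hb2⟩ := Multiset.mem_filter.1 hb
    have : b ≠ 0 := fun h => h0 (h ▸ hb1)
    omega
  have h2 := Multiset.filter_add_not (1 < ·) s
  have h3 := congrArg Multiset.card h2
  rw [Multiset.card_add] at h3
  rw [show Multiset.card s - Multiset.card (s.filter (1 < ·))
    = Multiset.card (s.filter fun x => ¬ 1 < x) by omega, ← h1, h2]

lemma dysonMap_cons {m : ℤ} {a : ℕ} {t : Multiset ℕ} (h : ∀ b ∈ t, b ≤ a) :
    dysonMap m (a ::ₘ t) = t.map (· + 1) +
      Multiset.replicate ((a : ℤ) - m - 1 - (Multiset.card t : ℤ)).toNat 1 := by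
  rw [dysonMap, sup_cons_of_le h, Multiset.erase_cons_head]

lemma sum_map_succ (t : Multiset ℕ) : (t.map (· + 1)).sum = t.sum + Multiset.card t := by
  simp [Multiset.sum_map_add]

lemma sum_map_pred {t : Multiset ℕ} (h : ∀ b ∈ t, 1 < b) :
    (t.map (· - 1)).sum + Multiset.card t = t.sum := by
  rw [← Multiset.card_map (· - 1) t, ← sum_map_succ, Multiset.map_map]
  rw [Multiset.map_congr (g := id) rfl, Multiset.map_id]
  intro b hb
  have := h b hb
  simp only [Function.comp, id]
  omega

lemma dysonMap_spec {m : ℤ} (hm : 1 ≤ m ∨ m ≤ -3) {s : Multiset ℕ} (h0 : 0 ∉ s)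
    (hs : m ≤ msRank s) :
    0 ∉ dysonMap m s ∧ msRank (dysonMap m s) ≤ m + 2 ∧ dysonInv m (dysonMap m s) = s ∧
      (s.sum : ℤ) = (dysonMap m s).sum + (m + 1) := by
  by_cases hz : s = 0
  · subst hz
    have hm' : m ≤ -3 := by
      rcases hm with h | h
      · simp [msRank] at hs
        omega
      · exact h
    obtain ⟨k, rfl⟩ : ∃ k : ℕ, m = -(k : ℤ) - 3 := ⟨(-m - 3).toNat, by omega⟩
    have hd : dysonMap (-(k : ℤ) - 3) 0 = Multiset.replicate (k + 2) 1 := by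
      have : ((((0 : Multiset ℕ).sup : ℕ) : ℤ) - (-(k : ℤ) - 3) - 1
          - (Multiset.card ((0 : Multiset ℕ).erase (0 : Multiset ℕ).sup) : ℤ)).toNat = k + 2 := by
        simp
        omega
      rw [dysonMap, this]
      simp
    rw [hd]
    refine ⟨?_, ?_, ?_, ?_⟩
    · exact fun h => zero_ne_one (Multiset.eq_of_mem_replicate h)
    · have : (Multiset.replicate (k + 2) 1).sup ≤ 1 :=
        Multiset.sup_le.2 fun b hb => (Multiset.eq_of_mem_replicate hb).le
      rw [msRank, Multiset.card_replicate]
      push_cast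
      omega
    · have := filter_map_succ_add_replicate 0 (k + 2) (by simp)
      simp only [Multiset.map_zero, zero_add] at this
      rw [dysonInv, this, Multiset.card_replicate]
      rw [show ((k + 2 : ℕ) + (-(k : ℤ) - 3) + 1).toNat = 0 by omega]
      simp
    · simp
      ring
  · obtain ⟨a, t, rfl, h⟩ := exists_cons_of_ne_zero hz
    rw [dysonMap_cons h]
    rw [msRank, sup_cons_of_le h, Multiset.card_cons] at hs
    push_cast at hs
    obtain ⟨c, hc⟩ : ∃ c : ℕ, (a : ℤ) - m - 1 - Multiset.card t = c :=
      ⟨((a : ℤ) - m - 1 - Multiset.card t).toNat, by omega⟩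
    have h0t : 0 ∉ t := fun h => h0 (Multiset.mem_cons_of_mem h)
    have ha : 0 < a := Nat.pos_of_ne_zero fun h => h0 (h ▸ Multiset.mem_cons_self a t)
    rw [hc, Int.toNat_natCast]
    refine ⟨?_, ?_, ?_, ?_⟩
    · simp [Multiset.mem_replicate]
    · have : (t.map (· + 1) + Multiset.replicate c 1).sup ≤ a + 1 := by
        refine Multiset.sup_le.2 fun b hb => ?_
        rcases Multiset.mem_add.1 hb with hb | hb
        · obtain ⟨b, hb', rfl⟩ := Multiset.mem_map.1 hb
          exact Nat.succ_le_succ (h b hb')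
        · rw [Multiset.eq_of_mem_replicate hb]
          omega
      rw [msRank, Multiset.card_add, Multiset.card_map, Multiset.card_replicate]
      push_cast
      omega
    · rw [dysonInv, filter_map_succ_add_replicate t c h0t, Multiset.card_add, Multiset.card_map,
        Multiset.card_replicate]
      rw [show (((Multiset.card t + c : ℕ) : ℤ) + m + 1).toNat = a by push_cast; omega]
      exact Multiset.filter_eq_self.2 fun b hb => Nat.pos_of_ne_zero fun hb' => h0 (hb' ▸ hb)
    · rw [Multiset.sum_add, sum_map_succ, Multiset.sum_replicate, Multiset.sum_cons]
      push_cast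
      rw [smul_eq_mul]
      push_cast
      linarith

lemma dysonInv_spec {m : ℤ} (hm : 1 ≤ m ∨ m ≤ -3) {s : Multiset ℕ} (h0 : 0 ∉ s)
    (hs : msRank s ≤ m + 2) :
    0 ∉ dysonInv m s ∧ m ≤ msRank (dysonInv m s) ∧ dysonMap m (dysonInv m s) = s := by
  have hle : ∀ b ∈ s, (b : ℤ) ≤ Multiset.card s + m + 2 := fun b hb => by
    have : b ≤ s.sup := Multiset.le_sup hb
    rw [msRank] at hs
    omega
  have hc0 : 0 ≤ (Multiset.card s : ℤ) + m + 1 := by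
    by_cases hz : s = 0
    · subst hz
      simp [msRank] at hs
      simp
      omega
    · obtain ⟨b, hb⟩ := Multiset.exists_mem_of_ne_zero hz
      have : b ≠ 0 := fun h => h0 (h ▸ hb)
      have := hle b hb
      omega
  obtain ⟨c, hc⟩ : ∃ c : ℕ, (Multiset.card s : ℤ) + m + 1 = c :=
    ⟨((Multiset.card s : ℤ) + m + 1).toNat, by omega⟩
  set t := (s.filter (1 < ·)).map (· - 1) with ht
  have h0t : ∀ b ∈ t, 0 < b := fun b hb => by
    obtain ⟨b, hb', rfl⟩ := Multiset.mem_map.1 hb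
    have := (Multiset.mem_filter.1 hb').2
    omega
  have htc : ∀ b ∈ t, b ≤ c := fun b hb => by
    obtain ⟨b, hb', rfl⟩ := Multiset.mem_map.1 hb
    have := hle b (Multiset.mem_filter.1 hb').1
    omega
  have hcard : Multiset.card t ≤ Multiset.card s := by
    rw [ht, Multiset.card_map]
    exact Multiset.card_le_card (Multiset.filter_le _ _)
  have hts : t.map (· + 1) = s.filter (1 < ·) := by
    rw [ht, Multiset.map_map]
    refine (Multiset.map_congr rfl fun b hb => ?_).trans (Multiset.map_id _)
    have := (Multiset.mem_filter.1 hb).2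
    simp only [Function.comp, id]
    omega
  have hs' : t.map (· + 1) + Multiset.replicate (Multiset.card s - Multiset.card t) 1 = s := by
    have := filter_add_replicate_eq s h0
    rwa [← hts, Multiset.card_map] at this
  have hinv : dysonInv m s = (c ::ₘ t).filter (0 < ·) := by
    rw [dysonInv, hc, Int.toNat_natCast]
  refine ⟨fun h => ?_, ?_⟩
  · rw [hinv] at h
    exact lt_irrefl 0 (Multiset.mem_filter.1 h).2
  rcases Nat.eq_zero_or_pos c with hcz | hcp
  · have htz : t = 0 := Multiset.eq_zero_of_forall_notMem fun b hb => by
      have := h0t b hb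
      have := htc b hb
      omega
    have hi0 : dysonInv m s = 0 := by rw [hinv, htz, hcz]; rfl
    have hm3 : m ≤ -1 := by omega
    rw [hi0]
    refine ⟨by simp [msRank]; omega, ?_⟩
    rw [htz] at hs'
    simp only [Multiset.map_zero, zero_add, Multiset.card_zero, Nat.sub_zero] at hs'
    have : ((((0 : Multiset ℕ).sup : ℕ) : ℤ) - m - 1
        - (Multiset.card ((0 : Multiset ℕ).erase (0 : Multiset ℕ).sup) : ℤ)).toNat
        = Multiset.card s := by
      simp
      omega
    rw [dysonMap, this]
    simpa using hs'
  · have hi : dysonInv m s = c ::ₘ t := by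
      rw [hinv]
      refine Multiset.filter_eq_self.2 fun b hb => ?_
      rcases Multiset.mem_cons.1 hb with rfl | hb
      · exact hcp
      · exact h0t b hb
    rw [hi, msRank, sup_cons_of_le htc, dysonMap_cons htc, Multiset.card_cons]
    refine ⟨by push_cast; omega, ?_⟩
    rw [show ((c : ℤ) - m - 1 - (Multiset.card t : ℤ)).toNat = Multiset.card s - Multiset.card t by
      omega]
    exact hs'

variable {𝕜 : Type*} [NormedField 𝕜] [CompleteSpace 𝕜] {q : 𝕜}

lemma genFn_msRank_ge (hq : ‖q‖ < 1 / 2) {m : ℕ} (hm : 1 ≤ m) :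
    genFn q (fun s => (m : ℤ) ≤ msRank s)
      = q ^ (m + 1) * (genFn q (fun _ => True) - genFn q fun s => ((m + 3 : ℕ) : ℤ) ≤ msRank s) := by
  have h1 := genFn_bij (q := q) (P := fun s => (m : ℤ) ≤ msRank s)
    (Q := fun s => msRank s ≤ m + 2) 0 (m + 1) (dysonMap m) (dysonInv m)
    (fun s h0 hs => by
      obtain ⟨h1, h2, h3, h4⟩ := dysonMap_spec (Or.inl (by exact_mod_cast hm)) h0 hs
      exact ⟨h1, h2, h3, by exact_mod_cast h4⟩)
    (fun s h0 hs => dysonInv_spec (Or.inl (by exact_mod_cast hm)) h0 hs)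
  rw [pow_zero, one_mul] at h1
  rw [h1, genFn_or hq (P := fun _ => True) (Q := fun s => msRank s ≤ m + 2)
    (R := fun s => ((m + 3 : ℕ) : ℤ) ≤ msRank s), add_sub_cancel_right]
  · intro s _
    push_cast
    simp only [true_iff]
    omega
  · intro s _ h
    push_cast
    omega

lemma genFn_msRank_le (hq : ‖q‖ < 1 / 2) {m : ℕ} (hm : 1 ≤ m) :
    genFn q (fun s => (m : ℤ) ≤ -msRank s)
      = q ^ (m + 1) * (genFn q (fun _ => True) - genFn q fun s => ((m + 3 : ℕ) : ℤ) ≤ -msRank s) := by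
  have hm' : 1 ≤ -(m : ℤ) - 2 ∨ -(m : ℤ) - 2 ≤ -3 := Or.inr (by omega)
  have h1 := genFn_bij (q := q) (P := fun s => -(m : ℤ) - 2 ≤ msRank s)
    (Q := fun s => (m : ℤ) ≤ -msRank s) (m + 1) 0 (dysonMap (-(m : ℤ) - 2))
    (dysonInv (-(m : ℤ) - 2))
    (fun s h0 hs => by
      obtain ⟨h1, h2, h3, h4⟩ := dysonMap_spec hm' h0 hs
      exact ⟨h1, by omega, h3, by omega⟩)
    (fun s h0 hs => dysonInv_spec hm' h0 (by omega))
  rw [pow_zero, one_mul] at h1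
  rw [← h1, genFn_or hq (P := fun _ => True) (Q := fun s => -(m : ℤ) - 2 ≤ msRank s)
    (R := fun s => ((m + 3 : ℕ) : ℤ) ≤ -msRank s), add_sub_cancel_right]
  · intro s _
    push_cast
    simp only [true_iff]
    omega
  · intro s _ h
    push_cast
    omega

end Rank

section Crank

/-- The number of ones and the number of parts exceeding it; if there are no ones, zero and the
largest part. -/
def crankPair (s : Multiset ℕ) : ℕ × ℕ :=
  if s.count 1 = 0 then (0, s.sup)
  else (s.count 1, Multiset.card (s.filter (s.count 1 < ·)))

/-- The crank of a multiset of parts. -/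
def msCrank (s : Multiset ℕ) : ℤ := ((crankPair s).2 : ℤ) - ((crankPair s).1 : ℤ)

lemma crankPair_eq_zero_iff (s : Multiset ℕ) (l : ℕ) :
    crankPair s = (0, l) ↔ s.count 1 = 0 ∧ s.sup = l := by
  rw [crankPair]
  split_ifs with h <;> simp [h]

lemma crankPair_eq_iff (s : Multiset ℕ) {i : ℕ} (hi : 1 ≤ i) (l : ℕ) :
    crankPair s = (i, l) ↔ s.count 1 = i ∧ Multiset.card (s.filter (i < ·)) = l := by
  rw [crankPair]
  split_ifs with h
  · simp only [Prod.mk.injEq, h]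
    omega
  · constructor
    · rintro h'
      obtain ⟨rfl, h2⟩ := Prod.mk.inj h'
      exact ⟨rfl, h2⟩
    · rintro ⟨rfl, rfl⟩
      rfl

variable {𝕜 : Type*} [NormedField 𝕜] {q : 𝕜}

lemma genFn_mem_and {a : ℕ} (ha : 0 < a) (P : Multiset ℕ → Prop) :
    genFn q (fun s => a ∈ s ∧ P s) = q ^ a * genFn q fun s => P (a ::ₘ s) := by
  have h := genFn_bij (q := q) (P := fun s => a ∈ s ∧ P s) (Q := fun s => P (a ::ₘ s)) 0 a
    (fun s => s.erase a) (fun s => a ::ₘ s)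
    (fun s h0 ⟨h1, h2⟩ => ⟨fun h => h0 (Multiset.mem_of_mem_erase h), by
      rwa [Multiset.cons_erase h1], Multiset.cons_erase h1, by
      conv_lhs => rw [← Multiset.cons_erase h1]
      rw [Multiset.sum_cons]
      ring⟩)
    (fun s h0 hs => ⟨by simp [h0, ha.ne], ⟨Multiset.mem_cons_self a s, hs⟩,
      Multiset.erase_cons_head a s⟩)
  rwa [pow_zero, one_mul] at h

lemma genFn_eq_zero_multiset : genFn q (fun s => s = 0) = 1 := by
  classical
  rw [genFn, tsum_eq_single 0]
  · simp
  · intro s hs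
    simp [hs]

/-- Partitions without ones and with parts at most `l`. -/
lemma genFn_noOnes_le [CompleteSpace 𝕜] (hq : ‖q‖ < 1 / 2) (l : ℕ) (hl : 1 ≤ l) :
    genFn q (fun s => s.count 1 = 0 ∧ s.sup ≤ l) = (1 - q) * qinv q l := by
  have hq1 : ‖q‖ < 1 := by linarith
  induction l, hl using Nat.le_induction with
  | base =>
    rw [genFn_congr (Q := fun s => s = 0), genFn_eq_zero_multiset]
    · have h := qinv_sub_one hq1 1
      rw [sub_self, qinv_zero, zpow_one] at h
      exact h
    · intro s h0
      constructor
      · rintro ⟨h1, h2⟩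
        refine Multiset.eq_zero_of_forall_notMem fun b hb => ?_
        have hb1 : b ≤ 1 := (Multiset.le_sup hb).trans h2
        rw [Multiset.count_eq_zero] at h1
        interval_cases b
        · exact h0 hb
        · exact h1 hb
      · rintro rfl
        simp
  | succ l hl ih =>
    have h1 : genFn q (fun s => s.count 1 = 0 ∧ s.sup ≤ l + 1)
        = genFn q (fun s => s.count 1 = 0 ∧ s.sup ≤ l)
          + q ^ (l + 1) * genFn q (fun s => s.count 1 = 0 ∧ s.sup ≤ l + 1) := by
      refine (genFn_or hq (Q := fun s => s.count 1 = 0 ∧ s.sup ≤ l)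
        (R := fun s => l + 1 ∈ s ∧ (s.count 1 = 0 ∧ s.sup ≤ l + 1)) ?_ ?_).trans
        (congrArg₂ _ rfl ((genFn_mem_and l.succ_pos _).trans
          (congrArg₂ _ rfl (genFn_congr fun s _ => ?_))))
      · intro s h0
        constructor
        · rintro ⟨h1, h2⟩
          by_cases hm : l + 1 ∈ s
          · exact Or.inr ⟨hm, h1, h2⟩
          · refine Or.inl ⟨h1, Multiset.sup_le.2 fun b hb => ?_⟩
            have := (Multiset.le_sup hb).trans h2
            have : b ≠ l + 1 := fun h => hm (h ▸ hb)
            omega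
        · rintro (⟨h1, h2⟩ | ⟨_, h⟩)
          · exact ⟨h1, h2.trans l.le_succ⟩
          · exact h
      · rintro s h0 ⟨_, h2⟩ ⟨h3, _⟩
        have := (Multiset.le_sup h3).trans h2
        omega
      · rw [Multiset.count_cons_of_ne (by omega), Multiset.sup_cons, sup_le_iff]
        simp
    have h2 := qinv_sub_one hq1 ((l : ℤ) + 1)
    rw [add_sub_cancel_right] at h2
    have h3 : (1 - q ^ (l + 1)) ≠ 0 := one_sub_pow_ne_zero hq1 l
    refine mul_left_cancel₀ h3 ?_
    rw [ih] at h1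
    push_cast
    rw [h2] at h1
    rw [show ((l : ℤ) + 1) = ((l + 1 : ℕ) : ℤ) by push_cast; rfl, zpow_natCast] at h1
    push_cast at h1 ⊢
    linear_combination h1

/-- Removing all ones. -/
lemma genFn_count_one (P : Multiset ℕ → Prop) (hP : ∀ s, P (1 ::ₘ s) ↔ P s) (i : ℕ) :
    genFn q (fun s => s.count 1 = i ∧ P s) = q ^ i * genFn q fun s => s.count 1 = 0 ∧ P s := by
  induction i with
  | zero => simp
  | succ i ih =>
    rw [genFn_congr (Q := fun s => 1 ∈ s ∧ (s.count 1 = i + 1 ∧ P s)), genFn_mem_and one_pos,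
      pow_succ', mul_assoc, ← ih, pow_one]
    · congr 1
      refine genFn_congr fun s _ => ?_
      rw [Multiset.count_cons_self, hP]
      simp
    · intro s _
      constructor
      · rintro ⟨h1, h2⟩
        exact ⟨Multiset.count_pos.1 (by omega), h1, h2⟩
      · exact fun h => h.2

lemma genFn_crankPair_base [CompleteSpace 𝕜] (hq : ‖q‖ < 1 / 2) {i : ℕ} (hi : 1 ≤ i) :
    genFn q (crankPair · = (i, 0)) = q ^ i * ((1 - q) * qinv q i) := by
  rw [genFn_congr (Q := fun s => s.count 1 = i ∧ s.sup ≤ i), genFn_count_one (q := q)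
    (fun s => s.sup ≤ i), genFn_noOnes_le hq i hi]
  · intro s
    rw [Multiset.sup_cons, sup_le_iff]
    simp [hi]
  · intro s _
    rw [crankPair_eq_iff s hi, Multiset.card_eq_zero, Multiset.filter_eq_nil, Multiset.sup_le]
    simp

lemma genFn_crankPair_zero [CompleteSpace 𝕜] (hq : ‖q‖ < 1 / 2) {l : ℕ} (hl : 2 ≤ l) :
    genFn q (crankPair · = (0, l)) = q ^ l * ((1 - q) * qinv q l) := by
  rw [genFn_congr (Q := fun s => l ∈ s ∧ (s.count 1 = 0 ∧ s.sup ≤ l)), genFn_mem_and (by omega),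
    ← genFn_noOnes_le hq l (by omega)]
  · congr 1
    refine genFn_congr fun s _ => ?_
    rw [Multiset.count_cons_of_ne (by omega), Multiset.sup_cons, sup_le_iff]
    simp
  · intro s _
    rw [crankPair_eq_zero_iff]
    constructor
    · rintro ⟨h1, h2⟩
      have hs : s ≠ 0 := by
        rintro rfl
        simp at h2
        omega
      obtain ⟨a, t, rfl, ht⟩ := exists_cons_of_ne_zero hs
      rw [sup_cons_of_le ht] at h2
      subst h2
      exact ⟨Multiset.mem_cons_self a t, h1, (sup_cons_of_le ht).le⟩
    · rintro ⟨h1, h2, h3⟩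
      exact ⟨h2, le_antisymm h3 (Multiset.le_sup h1)⟩

lemma genFn_crankPair_zero_zero : genFn q (crankPair · = (0, 0)) = 1 := by
  rw [genFn_congr (Q := fun s => s = 0), genFn_eq_zero_multiset]
  intro s h0
  rw [crankPair_eq_zero_iff]
  constructor
  · rintro ⟨_, h2⟩
    refine Multiset.eq_zero_of_forall_notMem fun b hb => ?_
    have := Multiset.le_sup hb
    rw [h2, Nat.le_zero] at this
    exact h0 (this ▸ hb)
  · rintro rfl
    simp

lemma genFn_crankPair_zero_one : genFn q (crankPair · = (0, 1)) = 0 := by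
  classical
  rw [genFn]
  refine (tsum_congr fun s => if_neg ?_).trans tsum_zero
  rintro ⟨h0, h⟩
  rw [crankPair_eq_zero_iff] at h
  obtain ⟨h1, h2⟩ := h
  have hs : s ≠ 0 := by
    rintro rfl
    simp at h2
  obtain ⟨a, t, rfl, ht⟩ := exists_cons_of_ne_zero hs
  rw [sup_cons_of_le ht] at h2
  rw [Multiset.count_eq_zero] at h1
  exact h1 (h2 ▸ Multiset.mem_cons_self a t)

lemma card_filter_map_shift {i : ℕ} (s : Multiset ℕ) (h : i + 1 ∉ s) :
    Multiset.card ((s.map fun x => if i < x then x - 1 else x).filter (i < ·))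
      = Multiset.card (s.filter (i < ·)) := by
  rw [Multiset.filter_map, Multiset.card_map]
  congr 1
  refine Multiset.filter_congr fun x hx => ?_
  have : x ≠ i + 1 := fun h' => h (h' ▸ hx)
  dsimp only [Function.comp]
  split_ifs <;> omega

lemma genFn_crankPair_succ [CompleteSpace 𝕜] (hq : ‖q‖ < 1 / 2) {i : ℕ} (hi : 1 ≤ i) (l : ℕ) :
    genFn q (crankPair · = (i, l + 1))
      = q ^ (l + 1) * genFn q (crankPair · = (i, l + 1))
        + q ^ (i + 1) * genFn q (crankPair · = (i, l)) := by
  have h1 : genFn q (fun s => i + 1 ∉ s ∧ crankPair s = (i, l + 1))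
      = q ^ (l + 1) * genFn q (crankPair · = (i, l + 1)) := by
    have h := genFn_bij (q := q) (P := fun s => i + 1 ∉ s ∧ crankPair s = (i, l + 1))
      (Q := fun s => crankPair s = (i, l + 1)) 0 (l + 1)
      (fun s => s.map fun x => if i < x then x - 1 else x)
      (fun s => s.map fun x => if i < x then x + 1 else x) ?_ ?_
    · rwa [pow_zero, one_mul] at h
    · rintro s h0 ⟨hs, hc⟩
      rw [crankPair_eq_iff s hi] at hc
      have hne : ∀ x ∈ s, x ≠ i + 1 := fun x hx h' => hs (h' ▸ hx)
      refine ⟨?_, ?_, ?_, ?_⟩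
      · intro h
        obtain ⟨x, hx, h⟩ := Multiset.mem_map.1 h
        have : x ≠ 0 := fun h' => h0 (h' ▸ hx)
        split_ifs at h <;> omega
      · rw [crankPair_eq_iff _ hi, card_filter_map_shift s hs]
        refine ⟨Eq.trans ?_ hc.1, hc.2⟩
        rw [Multiset.count_map, Multiset.count_eq_card_filter_eq]
        congr 1
        refine Multiset.filter_congr fun x hx => ?_
        have := hne x hx
        split_ifs <;> omega
      · rw [Multiset.map_map]
        refine (Multiset.map_congr rfl fun x hx => ?_).trans (Multiset.map_id _)
        have := hne x hx
        simp only [Function.comp, id]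
        split_ifs <;> omega
      · rw [← hc.2, add_zero, ← Multiset.filter_add_not (i < ·) s]
        rw [Multiset.map_add, Multiset.sum_add, Multiset.sum_add, Multiset.filter_add,
          Multiset.card_add, Multiset.filter_filter, Multiset.filter_filter]
        simp only [and_self, and_not_self, Multiset.filter_false, Multiset.card_zero, add_zero]
        rw [Multiset.map_congr (g := fun x => x - 1) rfl fun x hx =>
          if_pos (Multiset.mem_filter.1 hx).2, Multiset.map_congr (g := id)
          (f := fun x => if i < x then x - 1 else x) (s := s.filter fun x => ¬ i < x) rfl
          fun x hx => if_neg (Multiset.mem_filter.1 hx).2, Multiset.map_id, add_right_comm, sum_map_pred]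
        intro b hb
        have := (Multiset.mem_filter.1 hb).2
        omega
    · intro s h0 hc
      rw [crankPair_eq_iff s hi] at hc
      have hback : (s.map fun x => if i < x then x + 1 else x).map
          (fun x => if i < x then x - 1 else x) = s := by
        rw [Multiset.map_map]
        refine (Multiset.map_congr rfl fun x hx => ?_).trans (Multiset.map_id _)
        simp only [Function.comp, id]
        split_ifs
        all_goals omega
      have hni : i + 1 ∉ s.map fun x => if i < x then x + 1 else x := by
        intro h
        obtain ⟨x, hx, h⟩ := Multiset.mem_map.1 h
        split_ifs at h <;> omega
      refine ⟨?_, ⟨hni, ?_⟩, hback⟩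
      · intro h
        obtain ⟨x, hx, h⟩ := Multiset.mem_map.1 h
        have : x ≠ 0 := fun h' => h0 (h' ▸ hx)
        split_ifs at h
        all_goals omega
      · rw [crankPair_eq_iff _ hi, ← card_filter_map_shift _ hni, hback]
        refine ⟨Eq.trans ?_ hc.1, hc.2⟩
        rw [Multiset.count_map, Multiset.count_eq_card_filter_eq]
        congr 1
        refine Multiset.filter_congr fun x hx => ?_
        split_ifs <;> omega
  have h2 : genFn q (fun s => i + 1 ∈ s ∧ crankPair s = (i, l + 1))
      = q ^ (i + 1) * genFn q (crankPair · = (i, l)) := by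
    rw [genFn_mem_and i.succ_pos]
    congr 1
    refine genFn_congr fun s _ => ?_
    rw [crankPair_eq_iff _ hi, crankPair_eq_iff _ hi, Multiset.count_cons_of_ne (by omega),
      Multiset.filter_cons_of_pos _ (Nat.lt_succ_self i), Multiset.card_cons, add_left_inj]
  rw [← h1, ← h2]
  refine genFn_or hq (fun s _ => ?_) fun s _ h h' => h.1 h'.1
  tauto

/-- The generating function of `crankPair`, up to the exceptional values. -/
lemma genFn_crankPair [CompleteSpace 𝕜] (hq : ‖q‖ < 1 / 2) (i l : ℕ) :
    genFn q (crankPair · = (i, l)) + (if (i, l) = (0, 0) then -q else 0)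
        + (if (i, l) = (0, 1) then q else 0)
      = q ^ (i + l + i * l) * ((1 - q) * (qinv q i * qinv q l)) := by
  have hq1 : ‖q‖ < 1 := by linarith
  have hone : (1 - q) * qinv q 1 = 1 := by
    have h := qinv_sub_one hq1 1
    rw [sub_self, qinv_zero, zpow_one] at h
    exact h.symm
  rcases Nat.eq_zero_or_pos i with rfl | hi
  · rcases l with _ | _ | l
    · simp only [if_true, Prod.mk.injEq, zero_ne_one, and_false, if_false]
      rw [genFn_crankPair_zero_zero, Nat.cast_zero, qinv_zero]
      ring
    · simp only [zero_add, if_true, Prod.mk.injEq, one_ne_zero, and_false, if_false]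
      rw [genFn_crankPair_zero_one, Nat.cast_zero, qinv_zero, Nat.cast_one]
      linear_combination -q * hone
    · rw [genFn_crankPair_zero hq (by omega), if_neg (by simp), if_neg (by simp), Nat.cast_zero,
        qinv_zero]
      ring
  · rw [if_neg (by simp; omega), if_neg (by simp; omega), add_zero, add_zero]
    induction l with
    | zero =>
      rw [genFn_crankPair_base hq hi, Nat.cast_zero, qinv_zero]
      ring
    | succ l ih =>
      have h2 := qinv_sub_one hq1 ((l : ℤ) + 1)
      rw [add_sub_cancel_right] at h2
      have h3 : (1 - q ^ (l + 1)) ≠ 0 := one_sub_pow_ne_zero hq1 l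
      have h1 := genFn_crankPair_succ hq hi l
      rw [ih, h2] at h1
      rw [show ((l : ℤ) + 1) = ((l + 1 : ℕ) : ℤ) by push_cast; rfl, zpow_natCast] at h1
      refine mul_left_cancel₀ h3 ?_
      linear_combination h1
end Crank

section CrankSeries

variable {𝕜 : Type*} [NormedField 𝕜] [CompleteSpace 𝕜] {q : 𝕜}

/-- A two parameter version of `durfee`. -/
noncomputable def durfeeTwo (q : 𝕜) (N M : ℤ) : 𝕜 :=
  ∑' m : ℤ, q ^ (m * m + N * m) * qinv q m * qinv q (m + M)

lemma hasSum_durfeeTwo (h0 : q ≠ 0) (hq : ‖q‖ < 1) (N M : ℤ) :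
    HasSum (fun m : ℤ => q ^ (m * m + N * m) * qinv q m * qinv q (m + M)) (durfeeTwo q N M) :=
  (summable_durfee h0 hq N M).hasSum

lemma durfeeTwo_self (h0 : q ≠ 0) (hq : ‖q‖ < 1) (M : ℤ) :
    durfeeTwo q M M = (eulerProd q)⁻¹ :=
  durfee_eq h0 hq M

lemma durfeeTwo_rec (h0 : q ≠ 0) (hq : ‖q‖ < 1) (M : ℤ) :
    durfeeTwo q M M
      = durfeeTwo q (M + 1) M + q ^ (M + 1) * durfeeTwo q (M + 2) (M + 1) := by
  have h1 := (hasSum_durfeeTwo h0 hq M M).sub (hasSum_durfeeTwo h0 hq (M + 1) M)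
  have h2 := (hasSum_durfeeTwo h0 hq (M + 2) (M + 1)).mul_left (q ^ (M + 1))
  rw [← (Equiv.subRight (1 : ℤ)).hasSum_iff] at h2
  have h3 := h1.unique (h2.congr_fun fun m => ?_)
  · rw [← h3]; ring
  have e : Equiv.subRight (1 : ℤ) m = m - 1 := rfl
  simp only [Function.comp, e]
  rw [qinv_sub_one hq, show m - 1 + (M + 1) = m + M by ring,
    show q ^ (m * m + (M + 1) * m) = q ^ (m * m + M * m) * q ^ m by
      rw [← zpow_add₀ h0]; congr 1; ring,
    show q ^ (m * m + M * m) = q ^ (M + 1) * q ^ ((m - 1) * (m - 1) + (M + 2) * (m - 1)) by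
      rw [← zpow_add₀ h0]; congr 1; ring]
  ring

lemma durfeeTwo_crank (h0 : q ≠ 0) (hq : ‖q‖ < 1) (M : ℤ) :
    q ^ M * (1 - q) * durfeeTwo q (M + 2) M
      = q ^ M * durfeeTwo q (M + 1) M
        - q ^ (M + 1) * durfeeTwo q (M + 2) (M + 1) := by
  have h1 := (((hasSum_durfeeTwo h0 hq (M + 1) M).mul_left (1 + q ^ M)).sub
    (hasSum_durfeeTwo h0 hq M M)).add ((hasSum_durfeeTwo h0 hq (M + 2) M).mul_left (-q ^ M))
  have h2 := (hasSum_durfeeTwo h0 hq (M + 2) M).mul_left (-q ^ (M + 1))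
  rw [← (Equiv.subRight (1 : ℤ)).hasSum_iff] at h2
  have h3 := h1.unique (h2.congr_fun fun m => ?_)
  · rw [durfeeTwo_rec h0 hq M] at h3
    rw [zpow_add_one₀ h0] at h3 ⊢
    linear_combination -h3
  have e : Equiv.subRight (1 : ℤ) m = m - 1 := rfl
  simp only [Function.comp, e]
  rw [qinv_sub_one hq, show m - 1 + M = m + M - 1 by ring, qinv_sub_one hq,
    show q ^ (m * m + (M + 1) * m) = q ^ (m * m + M * m) * q ^ m by
      rw [← zpow_add₀ h0]; congr 1; ring,
    show q ^ (m * m + (M + 2) * m) = q ^ (m * m + M * m) * q ^ m * q ^ m by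
      rw [← zpow_add₀ h0, ← zpow_add₀ h0]; congr 1; ring,
    show q ^ (m * m + M * m) = q ^ (M + 1) * q ^ ((m - 1) * (m - 1) + (M + 2) * (m - 1)) by
      rw [← zpow_add₀ h0]; congr 1; ring, zpow_add₀ h0 m M]
  ring

/-- The tail sums whose differences count partitions by crank. -/
noncomputable def crankTail (q : 𝕜) (m : ℕ) : 𝕜 := q ^ m * durfeeTwo q (m + 1) m

lemma crankTail_rec (h0 : q ≠ 0) (hq : ‖q‖ < 1) (m : ℕ) :
    crankTail q m = q ^ m * ((eulerProd q)⁻¹ - crankTail q (m + 1)) := by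
  rw [← durfeeTwo_self h0 hq m, durfeeTwo_rec h0 hq m, crankTail, crankTail]
  push_cast
  rw [← zpow_natCast q (m + 1)]
  push_cast
  rw [show ((m : ℤ) + 1 + 1) = m + 2 by ring]
  ring

lemma norm_crankTail_le (h0 : q ≠ 0) (hq : ‖q‖ < 1) : ∃ B, ∀ m, ‖crankTail q m‖ ≤ B := by
  obtain ⟨B, hB0, hB⟩ := exists_bound_qinv hq
  have hn : 0 < ‖q‖ := norm_pos_iff.2 h0
  refine ⟨∑' d : ℤ, ‖q ^ (d * d + 0 * d)‖ * (B * B), fun m => ?_⟩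
  rw [crankTail, durfeeTwo, ← tsum_mul_left]
  refine tsum_of_norm_bounded ((summable_durfee_pow h0 hq 0).mul_right (B * B)).hasSum fun d => ?_
  rcases lt_or_ge d 0 with hd | hd
  · rw [qinv_of_neg hd]
    simp only [mul_zero, zero_mul, norm_zero]
    positivity
  · rw [norm_mul, norm_mul, norm_mul, mul_assoc, ← mul_assoc, ← norm_mul]
    have : ‖q ^ m * q ^ (d * d + ((m : ℤ) + 1) * d)‖ ≤ ‖q ^ (d * d + 0 * d)‖ := by
      rw [← zpow_natCast q m, ← zpow_add₀ h0, norm_zpow, norm_zpow]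
      refine zpow_le_zpow_right_of_le_one₀ hn hq.le ?_
      nlinarith [Int.natCast_nonneg m, mul_nonneg (Int.natCast_nonneg m) hd]
    gcongr <;> apply hB

/-- The weight of the crank `c`, with the conventional correction at `n = 1`. -/
noncomputable def crankWeight (q : 𝕜) (c : ℤ) : 𝕜 :=
  genFn q (msCrank · = c) + (if c = 0 then -q else 0) + (if c = 1 then q else 0)

lemma hasSum_crankWeight (hq : ‖q‖ < 1 / 2) (c : ℤ) :
    HasSum (fun x : ℕ × ℕ => if (x.2 : ℤ) - x.1 = c then
      q ^ (x.1 + x.2 + x.1 * x.2) * ((1 - q) * (qinv q x.1 * qinv q x.2)) else 0)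
      (crankWeight q c) := by
  have h1 := hasSum_genFn_fiber (q := q) hq crankPair fun x => (x.2 : ℤ) - x.1 = c
  have h2 := hasSum_ite_eq ((0, 0) : ℕ × ℕ) (if (0 : ℤ) = c then -q else 0)
  have h3 := hasSum_ite_eq ((0, 1) : ℕ × ℕ) (if (1 : ℤ) = c then q else 0)
  have h4 := (h1.add h2).add h3
  rw [crankWeight, show (if c = 0 then -q else 0) = if 0 = c then -q else 0 by simp only [eq_comm],
    show (if c = 1 then q else 0) = if 1 = c then q else 0 by simp only [eq_comm]]
  refine h4.congr_fun fun x => ?_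
  obtain ⟨i, l⟩ := x
  rw [← genFn_crankPair hq i l]
  by_cases hx : (i, l) = (0, 0)
  · obtain ⟨rfl, rfl⟩ := Prod.mk.inj hx
    by_cases hc : (0 : ℤ) = c <;> simp [hc]
  by_cases hy : (i, l) = (0, 1)
  · obtain ⟨rfl, rfl⟩ := Prod.mk.inj hy
    by_cases hc : (1 : ℤ) = c <;> simp [hc]
  simp only [hx, hy, if_false, add_zero]

lemma crankWeight_of_injective (h0 : q ≠ 0) (hq : ‖q‖ < 1 / 2) (m : ℕ) {c : ℤ}
    (f : ℕ → ℕ × ℕ) (hf : Function.Injective f)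
    (hr : ∀ x : ℕ × ℕ, (x.2 : ℤ) - x.1 = c ↔ x ∈ Set.range f)
    (hv : ∀ d, f d = (d, d + m) ∨ f d = (d + m, d)) :
    crankWeight q c = crankTail q m - crankTail q (m + 1) := by
  have hq1 : ‖q‖ < 1 := by linarith
  have h1 := hasSum_crankWeight hq c
  rw [← hf.hasSum_iff fun x hx => if_neg fun h => hx ((hr x).1 h)] at h1
  have h2 := hasSum_durfeeTwo h0 hq1 (m + 2) m
  rw [← Nat.cast_injective.hasSum_iff (f := fun d : ℤ =>
    q ^ (d * d + ((m : ℤ) + 2) * d) * qinv q d * qinv q (d + m))] at h2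
  · have h3 := h1.unique ((h2.mul_left (q ^ m * (1 - q))).congr_fun fun d => ?_)
    · rw [h3, crankTail, crankTail]
      have := durfeeTwo_crank h0 hq1 m
      rw [zpow_natCast] at this
      rw [this, ← zpow_natCast q (m + 1)]
      push_cast
      rw [show ((m : ℤ) + 1 + 1) = m + 2 by ring]
    · dsimp only [Function.comp]
      rw [if_pos ((hr _).2 ⟨d, rfl⟩)]
      have e : q ^ ((d : ℤ) * d + ((m : ℤ) + 2) * d) = q ^ (d * d + (m + 2) * d) := by
        rw [← zpow_natCast]; push_cast; rfl
      rw [e]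
      rcases hv d with h | h <;> rw [h] <;> push_cast <;> ring
  · intro d hd
    rw [qinv_of_neg, mul_zero, zero_mul]
    by_contra h
    exact hd ⟨d.toNat, Int.toNat_of_nonneg (by omega)⟩

lemma crankWeight_natCast (h0 : q ≠ 0) (hq : ‖q‖ < 1 / 2) (m : ℕ) :
    crankWeight q m = crankTail q m - crankTail q (m + 1) := by
  refine crankWeight_of_injective h0 hq m (fun d => (d, d + m)) (fun a b h => (Prod.mk.inj h).1)
    (fun x => ⟨fun h => ⟨x.1, Prod.ext rfl (by dsimp only; omega)⟩, ?_⟩) fun d => Or.inl rfl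
  rintro ⟨d, rfl⟩
  push_cast
  ring

lemma crankWeight_neg_natCast (h0 : q ≠ 0) (hq : ‖q‖ < 1 / 2) (m : ℕ) :
    crankWeight q (-m) = crankTail q m - crankTail q (m + 1) := by
  refine crankWeight_of_injective h0 hq m (fun d => (d + m, d)) (fun a b h => (Prod.mk.inj h).2)
    (fun x => ⟨fun h => ⟨x.2, Prod.ext (by dsimp only; omega) rfl⟩, ?_⟩) fun d => Or.inr rfl
  rintro ⟨d, rfl⟩
  push_cast
  ring
end CrankSeries

section ClassSums

variable {𝕜 : Type*} [NormedField 𝕜] [CompleteSpace 𝕜] {q : 𝕜}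

/-- Coefficients of the tail series. -/
def tailCoeff (q : 𝕜) (γ k : ℕ) : 𝕜 :=
  (-1) ^ k * q ^ ((2 * γ + 1) * (k + 1).choose 2 + γ * (k + 1))

/-- The tail series, solving `S m = q ^ (m + γ) * (1 - S (m + 2 * γ + 1))`. -/
noncomputable def tail (q : 𝕜) (γ m : ℕ) : 𝕜 := ∑' k : ℕ, tailCoeff q γ k * q ^ ((k + 1) * m)

/-- The sum of `tail` over the arithmetic progression `b + 11 ℕ`. -/
noncomputable def tailClass (q : 𝕜) (γ b : ℕ) : 𝕜 :=
  ∑' k : ℕ, tailCoeff q γ k * q ^ ((k + 1) * b) * (1 - q ^ (11 * (k + 1)))⁻¹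

/-- The bilateral series for the rank (`γ = 1`) and the crank (`γ = 0`). -/
noncomputable def bilat (q : 𝕜) (γ : ℕ) (b : ℤ) : 𝕜 :=
  ∑' n : ℤ, (-1) ^ n * q ^ ((2 * γ + 1) * tri n + γ * n + b * n) * (1 - q ^ (11 * n))⁻¹

omit [CompleteSpace 𝕜] in
lemma norm_tailCoeff_le (hq : ‖q‖ < 1) (γ k : ℕ) : ‖tailCoeff q γ k‖ ≤ 1 := by
  rw [tailCoeff, norm_mul, norm_pow, norm_neg, norm_one, one_pow, one_mul, norm_pow]
  exact pow_le_one₀ (norm_nonneg q) hq.le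

omit [CompleteSpace 𝕜] in
lemma norm_tail_term_le (hq : ‖q‖ < 1) (γ : ℕ) {m : ℕ} (hm : 1 ≤ m) (k : ℕ) :
    ‖tailCoeff q γ k * q ^ ((k + 1) * m)‖ ≤ ‖q‖ ^ k := by
  rw [norm_mul, norm_pow]
  refine (mul_le_of_le_one_left (by positivity) (norm_tailCoeff_le hq γ k)).trans ?_
  exact pow_le_pow_of_le_one (norm_nonneg q) hq.le (by nlinarith)

lemma hasSum_tail (hq : ‖q‖ < 1) (γ : ℕ) {m : ℕ} (hm : 1 ≤ m) :
    HasSum (fun k : ℕ => tailCoeff q γ k * q ^ ((k + 1) * m)) (tail q γ m) :=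
  (Summable.of_norm_bounded (summable_geometric_of_lt_one (norm_nonneg q) hq)
    (norm_tail_term_le hq γ hm)).hasSum

omit [CompleteSpace 𝕜] in
lemma norm_tail_le (hq : ‖q‖ < 1) (γ : ℕ) {m : ℕ} (hm : 1 ≤ m) :
    ‖tail q γ m‖ ≤ (1 - ‖q‖)⁻¹ :=
  tsum_of_norm_bounded (hasSum_geometric_of_lt_one (norm_nonneg q) hq)
    (norm_tail_term_le hq γ hm)

lemma tail_rec (hq : ‖q‖ < 1) (γ : ℕ) {m : ℕ} (hm : 1 ≤ m) :
    tail q γ m = q ^ (m + γ) * (1 - tail q γ (m + (2 * γ + 1))) := by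
  have h := (hasSum_tail hq γ hm)
  rw [← hasSum_nat_add_iff' 1] at h
  have h2 := (hasSum_tail hq γ (show 1 ≤ m + (2 * γ + 1) by omega)).mul_left (-q ^ (m + γ))
  have h3 := h.unique (h2.congr_fun fun k => ?_)
  · simp only [Finset.sum_range_one, tailCoeff, pow_zero, one_mul, zero_add] at h3
    rw [show Nat.choose 1 2 = 0 from rfl] at h3
    simp only [mul_zero, mul_one, zero_add] at h3
    rw [pow_add] at h3 ⊢
    linear_combination h3
  · rw [tailCoeff, tailCoeff, Nat.choose_succ_succ' (k + 1) 1, Nat.choose_one_right]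
    ring

lemma eq_mul_tail (hq : ‖q‖ < 1) (γ : ℕ) (P : 𝕜) (x : ℕ → 𝕜) {B : ℝ} (hB : ∀ m, ‖x m‖ ≤ B)
    (hx : ∀ m, 1 ≤ m → x m = q ^ (m + γ) * (P - x (m + (2 * γ + 1)))) {m : ℕ} (hm : 1 ≤ m) :
    x m = P * tail q γ m := by
  have key : ∀ j m : ℕ, 1 ≤ m →
      ‖x m - P * tail q γ m‖ ≤ ‖q‖ ^ j * (B + ‖P‖ * (1 - ‖q‖)⁻¹) := by
    intro j
    induction j with
    | zero =>
      intro m hm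
      rw [pow_zero, one_mul]
      refine (norm_sub_le _ _).trans ?_
      rw [norm_mul]
      gcongr
      · exact hB m
      · exact norm_tail_le hq γ hm
    | succ j ih =>
      intro m hm
      rw [hx m hm, tail_rec hq γ hm, show q ^ (m + γ) * (P - x (m + (2 * γ + 1)))
        - P * (q ^ (m + γ) * (1 - tail q γ (m + (2 * γ + 1))))
        = -(q ^ (m + γ) * (x (m + (2 * γ + 1)) - P * tail q γ (m + (2 * γ + 1)))) by ring,
        norm_neg, norm_mul, pow_succ', mul_assoc, norm_pow]
      have h1 : ‖q‖ ^ (m + γ) ≤ ‖q‖ := pow_le_of_le_one (norm_nonneg q) hq.le (by omega)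
      gcongr
      exact ih _ (by omega)
  have h1 : Tendsto (fun j : ℕ => ‖q‖ ^ j * (B + ‖P‖ * (1 - ‖q‖)⁻¹)) atTop (𝓝 0) := by
    simpa using (tendsto_pow_atTop_nhds_zero_of_lt_one (norm_nonneg q) hq).mul_const
      (B + ‖P‖ * (1 - ‖q‖)⁻¹)
  have h2 := ge_of_tendsto' h1 fun j => key j m hm
  exact sub_eq_zero.1 (norm_le_zero_iff.1 h2)

lemma hasSum_tail_class (hq : ‖q‖ < 1) (γ : ℕ) {b : ℕ} (hb : 1 ≤ b) :
    HasSum (fun j : ℕ => tail q γ (b + 11 * j)) (tailClass q γ b) := by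
  have hs : Summable fun x : ℕ × ℕ => tailCoeff q γ x.1 * q ^ ((x.1 + 1) * (b + 11 * x.2)) := by
    have hg := summable_geometric_of_lt_one (norm_nonneg q) hq
    refine Summable.of_norm_bounded (hg.mul_of_nonneg hg (fun _ => by positivity)
      fun _ => by positivity) fun x => ?_
    rw [norm_mul, norm_pow, ← pow_add]
    refine (mul_le_of_le_one_left (by positivity) (norm_tailCoeff_le hq γ _)).trans ?_
    refine pow_le_pow_of_le_one (norm_nonneg q) hq.le ?_
    nlinarith [Nat.zero_le x.1, Nat.zero_le x.2, mul_le_mul' (le_refl (x.1 + 1)) hb]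
  have hfib : ∀ k : ℕ, HasSum (fun j : ℕ => tailCoeff q γ k * q ^ ((k + 1) * (b + 11 * j)))
      (tailCoeff q γ k * q ^ ((k + 1) * b) * (1 - q ^ (11 * (k + 1)))⁻¹) := by
    intro k
    have h5 : ‖q ^ (11 * (k + 1))‖ < 1 := by
      rw [norm_pow]
      exact pow_lt_one₀ (norm_nonneg q) hq (by omega)
    refine ((hasSum_geometric_of_norm_lt_one h5).mul_left
      (tailCoeff q γ k * q ^ ((k + 1) * b))).congr_fun fun j => ?_
    rw [← pow_mul, mul_assoc, ← pow_add]
    congr 2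
    ring
  have h2 : HasSum (fun x : ℕ × ℕ => tailCoeff q γ x.1 * q ^ ((x.1 + 1) * (b + 11 * x.2)))
      (tailClass q γ b) := by
    rw [tailClass, (hs.hasSum.prod_fiberwise hfib).tsum_eq]
    exact hs.hasSum
  have hrow : ∀ j : ℕ, HasSum (fun k : ℕ => tailCoeff q γ k * q ^ ((k + 1) * (b + 11 * j)))
      (tail q γ (b + 11 * j)) := fun j => hasSum_tail hq γ (by omega)
  obtain ⟨F, hF⟩ : ∃ F : ℕ → ℕ → 𝕜, ∀ k j,
      F k j = tailCoeff q γ k * q ^ ((k + 1) * (b + 11 * j)) := ⟨_, fun _ _ => rfl⟩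
  simp_rw [← hF] at h2 hrow
  exact HasSum.prod_fiberwise (f := fun x : ℕ × ℕ => F x.2 x.1)
    ((Equiv.prodComm ℕ ℕ).hasSum_iff.2 h2) hrow

lemma tri_natCast_add_one (k : ℕ) : tri ((k : ℤ) + 1) = ((k + 1).choose 2 : ℕ) := by
  induction k with
  | zero => simp
  | succ k ih =>
    rw [tri_add_one, Nat.choose_succ_succ' (k + 1) 1, Nat.choose_one_right]
    push_cast at ih ⊢
    rw [ih]
    ring

lemma hasSum_bilat (h0 : q ≠ 0) (hq : ‖q‖ < 1) (γ : ℕ) {b : ℕ} (h1 : 1 ≤ b) (h2 : b ≤ 11) :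
    HasSum (fun n : ℤ => (-1 : 𝕜) ^ n * q ^ ((2 * γ + 1) * tri n + γ * n + b * n)
      * (1 - q ^ (11 * n))⁻¹) (tailClass q γ (12 - b) - tailClass q γ b) := by
  have hsT : ∀ b : ℕ, 1 ≤ b → HasSum (fun k : ℕ =>
      tailCoeff q γ k * q ^ ((k + 1) * b) * (1 - q ^ (11 * (k + 1)))⁻¹) (tailClass q γ b) := by
    intro b hb
    refine Summable.hasSum ?_
    refine Summable.of_norm_bounded ((summable_geometric_of_lt_one (norm_nonneg q) hq).mul_right
      (1 - ‖q‖)⁻¹) fun k => ?_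
    rw [norm_mul, norm_inv]
    have h3 : 1 - ‖q‖ ≤ ‖1 - q ^ (11 * (k + 1))‖ := by
      have h4 : ‖q ^ (11 * (k + 1))‖ ≤ ‖q‖ := by
        rw [norm_pow]
        exact pow_le_of_le_one (norm_nonneg q) hq.le (by omega)
      have h5 := norm_sub_norm_le 1 (q ^ (11 * (k + 1)))
      rw [norm_one] at h5
      linarith
    have h4 : 0 < 1 - ‖q‖ := by linarith
    have := norm_tail_term_le hq γ hb k
    gcongr
  obtain ⟨f, hf⟩ : ∃ f : ℤ → 𝕜, ∀ n, f n = (-1 : 𝕜) ^ n * q ^ ((2 * γ + 1) * tri n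
    + γ * n + b * n) * (1 - q ^ (11 * n))⁻¹ := ⟨_, fun _ => rfl⟩
  simp_rw [← hf]
  have hpos : HasSum (fun n : ℕ => f n) (-tailClass q γ b) := by
    rw [← hasSum_nat_add_iff' 1]
    have hz : ∑ i ∈ Finset.range 1, f (i : ℕ) = 0 := by
      rw [Finset.sum_range_one, hf]
      simp
    rw [hz, sub_zero]
    refine (hsT b h1).neg.congr_fun fun k => ?_
    have hsign : (-1 : 𝕜) ^ ((k : ℤ) + 1) = -(-1) ^ k := by
      rw [zpow_add_one₀ (by norm_num), zpow_natCast]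
      ring
    have hpow : q ^ ((2 * (γ : ℤ) + 1) * tri ((k : ℤ) + 1) + γ * ((k : ℤ) + 1)
        + b * ((k : ℤ) + 1))
        = q ^ ((2 * γ + 1) * (k + 1).choose 2 + γ * (k + 1)) * q ^ ((k + 1) * b) := by
      rw [← zpow_natCast q (_ + _), ← zpow_natCast q ((k + 1) * b), ← zpow_add₀ h0,
        tri_natCast_add_one]
      congr 1
      push_cast
      ring
    have hden : q ^ (11 * ((k : ℤ) + 1)) = q ^ (11 * (k + 1)) := by
      rw [← zpow_natCast q (11 * (k + 1))]
      push_cast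
      rfl
    rw [hf, Nat.cast_add, Nat.cast_one, hsign, hpow, hden, tailCoeff]
    ring
  have hneg : HasSum (fun n : ℕ => f (-(n + 1))) (tailClass q γ (12 - b)) := by
    refine (hsT (12 - b) (by omega)).congr_fun fun k => ?_
    have hne : 1 - q ^ (11 * (k + 1)) ≠ 0 := one_sub_pow_ne_zero hq (11 * k + 10)
    have hnp : q ^ (11 * (k + 1)) ≠ 0 := pow_ne_zero _ h0
    have hinv : (1 - q ^ (11 * (-((k : ℤ) + 1))))⁻¹
        = -(q ^ (11 * (k + 1)) * (1 - q ^ (11 * (k + 1)))⁻¹) := by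
      rw [show 11 * (-((k : ℤ) + 1)) = -((11 * (k + 1) : ℕ) : ℤ) by push_cast; ring, zpow_neg,
        zpow_natCast]
      have : q ^ (11 * (k + 1)) - 1 ≠ 0 := fun h => hne (by linear_combination -h)
      have h' : 1 - (q ^ (11 * (k + 1)))⁻¹ = -(1 - q ^ (11 * (k + 1))) * (q ^ (11 * (k + 1)))⁻¹ := by
        rw [neg_mul, sub_mul, mul_inv_cancel₀ hnp]
        ring
      rw [h', mul_inv, inv_inv, inv_neg]
      ring
    have hsign : (-1 : 𝕜) ^ (-((k : ℤ) + 1)) = -(-1) ^ k := by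
      rw [zpow_neg, ← inv_zpow, inv_neg, inv_one, zpow_add_one₀ (by norm_num), zpow_natCast]
      ring
    have hpow : q ^ ((2 * (γ : ℤ) + 1) * tri (-((k : ℤ) + 1)) + γ * (-((k : ℤ) + 1))
        + b * (-((k : ℤ) + 1))) * q ^ (11 * (k + 1))
        = q ^ ((2 * γ + 1) * (k + 1).choose 2 + γ * (k + 1)) * q ^ ((k + 1) * (12 - b)) := by
      rw [← zpow_natCast q (_ + _), ← zpow_natCast q ((k + 1) * (12 - b)),
        ← zpow_natCast q (11 * (k + 1)), ← zpow_add₀ h0, ← zpow_add₀ h0, tri_neg,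
        tri_natCast_add_one]
      congr 1
      push_cast [show b ≤ 12 by omega]
      ring
    rw [hf, hinv, hsign, tailCoeff, mul_assoc ((-1) ^ k) (q ^ _) (q ^ _), ← hpow]
    ring
  have := hpos.of_nat_of_neg_add_one hneg
  rwa [neg_add_eq_sub] at this

lemma bilat_eq (h0 : q ≠ 0) (hq : ‖q‖ < 1) (γ : ℕ) {b : ℕ} (h1 : 1 ≤ b) (h2 : b ≤ 11) :
    bilat q γ b = tailClass q γ (12 - b) - tailClass q γ b :=
  (hasSum_bilat h0 hq γ h1 h2).tsum_eq

/-- Class sums of a symmetric weight whose values are differences of tails. -/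
lemma hasSum_class (h0 : q ≠ 0) (hq : ‖q‖ < 1) (γ : ℕ) (P : 𝕜) (Φ : ℤ → 𝕜)
    (hp : ∀ c : ℕ, 1 ≤ c → Φ c = P * (tail q γ c - tail q γ (c + 1)))
    (hn : ∀ c : ℕ, 1 ≤ c → Φ (-c) = P * (tail q γ c - tail q γ (c + 1)))
    {a : ℕ} (h1 : 1 ≤ a) (h2 : a ≤ 10) :
    HasSum (fun c : ℤ => if c % 11 = a % 11 then Φ c else 0)
      (P * (bilat q γ (a + 1 : ℕ) - bilat q γ a)) := by
  have hinj : Function.Injective fun j : ℤ => (a : ℤ) + 11 * j := fun x y h => by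
    dsimp only at h
    omega
  rw [← hinj.hasSum_iff]
  swap
  · intro c hc
    refine if_neg fun h => hc ⟨c / 11, ?_⟩
    dsimp only
    omega
  obtain ⟨f, hf⟩ : ∃ f : ℤ → 𝕜, ∀ j, f j = Φ ((a : ℤ) + 11 * j) := ⟨_, fun _ => rfl⟩
  have hA : HasSum (fun n : ℕ => f n) (P * (tailClass q γ a - tailClass q γ (a + 1))) := by
    refine (((hasSum_tail_class hq γ h1).sub (hasSum_tail_class hq γ (show 1 ≤ a + 1 by omega))).mul_left
      P).congr_fun fun j => ?_
    rw [hf, show (a : ℤ) + 11 * (j : ℕ) = ((a + 11 * j : ℕ) : ℤ) by push_cast; rfl,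
      hp _ (by omega), show a + 11 * j + 1 = a + 1 + 11 * j by ring]
  have hB : HasSum (fun n : ℕ => f (-(n + 1)))
      (P * (tailClass q γ (11 - a) - tailClass q γ (12 - a))) := by
    refine (((hasSum_tail_class hq γ (show 1 ≤ 11 - a by omega)).sub
      (hasSum_tail_class hq γ (show 1 ≤ 12 - a by omega))).mul_left P).congr_fun fun j => ?_
    rw [hf, show (a : ℤ) + 11 * (-((j : ℕ) + 1)) = -((11 - a + 11 * j : ℕ) : ℤ) by
      push_cast [show a ≤ 11 by omega]; ring, hn _ (by omega),
      show 11 - a + 11 * j + 1 = 12 - a + 11 * j by omega]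
  have h := hA.of_nat_of_neg_add_one hB
  rw [bilat_eq h0 hq γ (by omega) (by omega), bilat_eq h0 hq γ h1 (by omega),
    show 12 - (a + 1) = 11 - a by omega]
  rw [← mul_add] at h
  convert h using 1
  · funext j
    rw [hf, Function.comp, if_pos (by omega)]
  · ring

/-- The class of zero. -/
lemma hasSum_class_zero (h0 : q ≠ 0) (hq : ‖q‖ < 1) (γ : ℕ) (P : 𝕜) (Φ : ℤ → 𝕜)
    (hp : ∀ c : ℕ, 1 ≤ c → Φ c = P * (tail q γ c - tail q γ (c + 1)))
    (hn : ∀ c : ℕ, 1 ≤ c → Φ (-c) = P * (tail q γ c - tail q γ (c + 1)))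
    (htot : HasSum Φ P) :
    HasSum (fun c : ℤ => if c % 11 = 0 then Φ c else 0) (P * (1 + 2 * bilat q γ 1)) := by
  have h1 := hasSum_sum fun a (ha : a ∈ Finset.Icc 1 10) => hasSum_class h0 hq γ P Φ hp hn
    (Finset.mem_Icc.1 ha).1 (Finset.mem_Icc.1 ha).2
  have h2 : ∑ a ∈ Finset.Icc 1 10, P * (bilat q γ (a + 1 : ℕ) - bilat q γ a)
      = P * (bilat q γ (11 : ℕ) - bilat q γ (1 : ℕ)) := by
    rw [← Finset.mul_sum]
    congr 1
    generalize bilat q γ = g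
    have : Finset.Icc 1 10 = Finset.Ico 1 11 := rfl
    rw [this, Finset.sum_Ico_sub (fun a : ℕ => g a) (by norm_num)]
  rw [h2] at h1
  have h3 : P * (1 + 2 * bilat q γ 1) = P - P * (bilat q γ (11 : ℕ) - bilat q γ (1 : ℕ)) := by
    have e1 := bilat_eq h0 hq γ (show 1 ≤ 11 by omega) le_rfl
    have e2 := bilat_eq h0 hq γ (show 1 ≤ 1 by omega) (show 1 ≤ 11 by omega)
    rw [show 12 - 11 = 1 by rfl] at e1
    rw [show 12 - 1 = 11 by rfl] at e2
    rw [e1, show (1 : ℤ) = ((1 : ℕ) : ℤ) by rfl, e2]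
    ring
  rw [h3]
  refine (htot.sub h1).congr_fun fun c => ?_
  have hc1 := Int.emod_nonneg c (show (11 : ℤ) ≠ 0 by norm_num)
  have hc2 := Int.emod_lt_of_pos c (show (0 : ℤ) < 11 by norm_num)
  simp only [show Finset.Icc 1 10 = {1, 2, 3, 4, 5, 6, 7, 8, 9, 10} by decide]
  generalize c % 11 = r at hc1 hc2
  interval_cases r <;> norm_num
end ClassSums

section Counts

variable {𝕜 : Type*} [NormedField 𝕜] [CompleteSpace 𝕜] {q : 𝕜}

lemma hasSum_crankWeight_class (hq : ‖q‖ < 1 / 2) (P : ℤ → Prop) [DecidablePred P] :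
    HasSum (fun c => if P c then crankWeight q c else 0)
      (genFn q (fun s => P (msCrank s)) + (if P 0 then -q else 0) + (if P 1 then q else 0)) := by
  have h1 := hasSum_genFn_fiber (q := q) hq msCrank P
  have h2 := hasSum_ite_eq (0 : ℤ) (if P 0 then -q else 0)
  have h3 := hasSum_ite_eq (1 : ℤ) (if P 1 then q else 0)
  refine ((h1.add h2).add h3).congr_fun fun c => ?_
  rw [crankWeight]
  by_cases hP : P c
  · rw [if_pos hP, if_pos hP]
    congr 1
    · congr 1
      by_cases hc : c = 0
      · subst hc
        simp [hP]
      · simp [hc]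
    · by_cases hc : c = 1
      · subst hc
        simp [hP]
      · simp [hc]
  · rw [if_neg hP, if_neg hP]
    by_cases hc : c = 0
    · subst hc
      simp [hP]
    · by_cases hc : c = 1
      · subst hc
        simp [hP]
      · rename_i hc0
        simp [hc, hc0]

lemma crankTail_eq (h0 : q ≠ 0) (hq : ‖q‖ < 1) {m : ℕ} (hm : 1 ≤ m) :
    crankTail q m = (eulerProd q)⁻¹ * tail q 0 m := by
  obtain ⟨B, hB⟩ := norm_crankTail_le h0 hq
  exact eq_mul_tail hq 0 _ _ hB (fun m _ => crankTail_rec h0 hq m) hm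

/-- The total mass of the partitions. -/
lemma genFn_true (h0 : q ≠ 0) (hq : ‖q‖ < 1 / 2) :
    genFn q (fun _ => True) = (eulerProd q)⁻¹ := by
  have hq1 : ‖q‖ < 1 := by linarith
  have h1 := hasSum_crankWeight_class hq fun _ => True
  simp only [if_true, neg_add_cancel_right] at h1
  have hB : Tendsto (crankTail q) atTop (𝓝 0) := by
    obtain ⟨B, hB⟩ := norm_crankTail_le h0 hq1
    refine squeeze_zero_norm (a := fun m => ‖q‖ ^ m * (‖(eulerProd q)⁻¹‖ + B)) (fun m => ?_) ?_
    · rw [crankTail_rec h0 hq1, norm_mul, norm_pow]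
      gcongr
      refine (norm_sub_le _ _).trans ?_
      gcongr
      exact hB _
    · simpa using (tendsto_pow_atTop_nhds_zero_of_lt_one (norm_nonneg q) hq1).mul_const
        (‖(eulerProd q)⁻¹‖ + B)
  have hs : ∀ n, ∑ i ∈ Finset.range n, (crankTail q i - crankTail q (i + 1))
      = crankTail q 0 - crankTail q n := fun n => Finset.sum_range_sub' _ n
  have hp : HasSum (fun n : ℕ => crankWeight q n) (crankTail q 0) := by
    have h2 : Summable fun n : ℕ => crankWeight q n :=
      h1.summable.comp_injective Nat.cast_injective
    have h3 := h2.hasSum.tendsto_sum_nat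
    simp_rw [crankWeight_natCast h0 hq, hs] at h3
    have h4 : Tendsto (fun n => crankTail q 0 - crankTail q n) atTop (𝓝 (crankTail q 0)) := by
      simpa using hB.const_sub (crankTail q 0)
    have h5 := tendsto_nhds_unique h3 h4
    rw [← h5]
    simp_rw [← crankWeight_natCast h0 hq]
    exact h2.hasSum
  have hn : HasSum (fun n : ℕ => crankWeight q (-(n + 1))) (crankTail q 1) := by
    have h2 := (hasSum_nat_add_iff' 1).2 hp
    rw [Finset.sum_range_one, crankWeight_natCast h0 hq] at h2
    have e : crankTail q 0 - (crankTail q 0 - crankTail q (0 + 1)) = crankTail q 1 := by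
      rw [zero_add]; ring
    rw [e] at h2
    refine h2.congr_fun fun n => ?_
    have := crankWeight_neg_natCast h0 hq (n + 1)
    rw [← crankWeight_natCast h0 hq] at this
    rw [← this]
    push_cast
    ring_nf
  have h := (hp.of_nat_of_neg_add_one hn).unique h1
  have h6 := crankTail_rec h0 hq1 0
  rw [pow_zero, one_mul, zero_add] at h6
  rw [← h, h6]
  ring

lemma hasSum_crankCount (hq : ‖q‖ < 1 / 2) (a : ℤ) :
    HasSum (fun n : ℕ => (crankCount a n : 𝕜) * q ^ n)
      (∑' c : ℤ, if c % 11 = a % 11 then crankWeight q c else 0) := by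
  have h1 := hasSum_card_mul_pow hq fun s => msCrank s % 11 = a % 11
  have h2 := hasSum_ite_eq (1 : ℕ) (if (0 : ℤ) % 11 = a % 11 then -q else 0)
  have h3 := hasSum_ite_eq (1 : ℕ) (if (1 : ℤ) % 11 = a % 11 then q else 0)
  have hc : ∀ n (π : Nat.Partition n), msCrank π.parts = partitionCrank π := by
    intro n π
    rw [msCrank, crankPair, partitionCrank]
    split_ifs with h
    · simp
    · rfl
  rw [(hasSum_crankWeight_class hq fun c => c % 11 = a % 11).tsum_eq]
  refine ((h1.add h2).add h3).congr_fun fun n => ?_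
  by_cases hn : n = 1
  · subst hn
    rw [if_pos rfl, if_pos rfl, crankCount, if_pos rfl, pow_one]
    have hall : ∀ π : Nat.Partition 1, msCrank π.parts = -1 := by
      intro π
      rw [Subsingleton.elim π (Nat.Partition.indiscrete 1)]
      decide
    have hcard : (Finset.univ.filter fun π : Nat.Partition 1 => msCrank π.parts % 11 = a % 11).card
        = if a % 11 = 10 then 1 else 0 := by
      simp only [hall]
      by_cases h : a % 11 = 10
      · rw [if_pos h, h]
        rfl
      · rw [if_neg h, Finset.card_eq_zero, Finset.filter_eq_empty_iff]
        intro _ _ h'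
        exact h (by rw [← h']; rfl)
    rw [hcard]
    have ha1 := Int.emod_nonneg a (show (11 : ℤ) ≠ 0 by norm_num)
    have ha2 := Int.emod_lt_of_pos a (show (0 : ℤ) < 11 by norm_num)
    generalize a % 11 = r at ha1 ha2
    interval_cases r <;> norm_num
  · rw [if_neg hn, if_neg hn, crankCount, if_neg hn, add_zero, add_zero]
    simp only [hc, Int.cast_natCast]

lemma hasSum_rankCount (hq : ‖q‖ < 1 / 2) (a : ℤ) :
    HasSum (fun n : ℕ => (rankCount a 11 n : 𝕜) * q ^ n)
      (∑' c : ℤ, if c % 11 = a % 11 then genFn q (msRank · = c) else 0) := by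
  have h1 := hasSum_card_mul_pow hq fun s => msRank s % 11 = a % 11
  rw [(hasSum_genFn_fiber (q := q) hq msRank fun c => c % 11 = a % 11).tsum_eq]
  exact h1

lemma genFn_msRank_natCast (h0 : q ≠ 0) (hq : ‖q‖ < 1 / 2) {c : ℕ} (hc : 1 ≤ c) :
    genFn q (msRank · = c) = (eulerProd q)⁻¹ * (tail q 1 c - tail q 1 (c + 1)) := by
  have key : ∀ m : ℕ, 1 ≤ m → genFn q (fun s => (m : ℤ) ≤ msRank s)
      = (eulerProd q)⁻¹ * tail q 1 m := fun m hm =>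
    eq_mul_tail (by linarith) 1 _ (fun m : ℕ => genFn q fun s => (m : ℤ) ≤ msRank s)
      (fun m => norm_genFn_le hq _)
      (fun m hm => by rw [← genFn_true h0 hq]; exact genFn_msRank_ge hq hm) hm
  rw [mul_sub, ← key c hc, ← key (c + 1) (by omega), eq_sub_iff_add_eq, eq_comm]
  exact genFn_or hq (fun s _ => by push_cast; omega) (fun s _ h => by push_cast; omega)

lemma genFn_msRank_neg_natCast (h0 : q ≠ 0) (hq : ‖q‖ < 1 / 2) {c : ℕ} (hc : 1 ≤ c) :
    genFn q (msRank · = -(c : ℤ)) = (eulerProd q)⁻¹ * (tail q 1 c - tail q 1 (c + 1)) := by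
  have key : ∀ m : ℕ, 1 ≤ m → genFn q (fun s => (m : ℤ) ≤ -msRank s)
      = (eulerProd q)⁻¹ * tail q 1 m := fun m hm =>
    eq_mul_tail (by linarith) 1 _ (fun m : ℕ => genFn q fun s => (m : ℤ) ≤ -msRank s)
      (fun m => norm_genFn_le hq _)
      (fun m hm => by rw [← genFn_true h0 hq]; exact genFn_msRank_le hq hm) hm
  rw [mul_sub, ← key c hc, ← key (c + 1) (by omega), eq_sub_iff_add_eq, eq_comm]
  exact genFn_or hq (fun s _ => by push_cast; omega) (fun s _ h => by push_cast; omega)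

variable (h0 : q ≠ 0) (hq : ‖q‖ < 1 / 2)
include h0 hq

lemma hasSum_rankCount_bilat {a : ℕ} (h1 : 1 ≤ a) (h2 : a ≤ 10) :
    HasSum (fun n : ℕ => (rankCount a 11 n : 𝕜) * q ^ n)
      ((eulerProd q)⁻¹ * (bilat q 1 (a + 1 : ℕ) - bilat q 1 a)) := by
  have := hasSum_class h0 (by linarith) 1 (eulerProd q)⁻¹ (fun c => genFn q (msRank · = c))
    (fun c hc => genFn_msRank_natCast h0 hq hc) (fun c hc => genFn_msRank_neg_natCast h0 hq hc)
    h1 h2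
  rw [← this.tsum_eq]
  exact hasSum_rankCount hq a

lemma hasSum_rankCount_zero :
    HasSum (fun n : ℕ => (rankCount 0 11 n : 𝕜) * q ^ n)
      ((eulerProd q)⁻¹ * (1 + 2 * bilat q 1 1)) := by
  have htot := hasSum_genFn_fiber (q := q) hq msRank fun _ => True
  simp only [if_true, genFn_true h0 hq] at htot
  have := hasSum_class_zero h0 (by linarith) 1 (eulerProd q)⁻¹ (fun c => genFn q (msRank · = c))
    (fun c hc => genFn_msRank_natCast h0 hq hc) (fun c hc => genFn_msRank_neg_natCast h0 hq hc)
    htot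
  rw [← this.tsum_eq]
  exact hasSum_rankCount hq 0

lemma crankWeight_eq_tail {c : ℕ} (hc : 1 ≤ c) :
    crankWeight q c = (eulerProd q)⁻¹ * (tail q 0 c - tail q 0 (c + 1)) := by
  rw [crankWeight_natCast h0 hq, crankTail_eq h0 (by linarith) hc,
    crankTail_eq h0 (by linarith) (by omega), mul_sub]

lemma crankWeight_neg_eq_tail {c : ℕ} (hc : 1 ≤ c) :
    crankWeight q (-(c : ℤ)) = (eulerProd q)⁻¹ * (tail q 0 c - tail q 0 (c + 1)) := by
  rw [crankWeight_neg_natCast h0 hq, crankTail_eq h0 (by linarith) hc,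
    crankTail_eq h0 (by linarith) (by omega), mul_sub]

lemma hasSum_crankCount_bilat {a : ℕ} (h1 : 1 ≤ a) (h2 : a ≤ 10) :
    HasSum (fun n : ℕ => (crankCount a n : 𝕜) * q ^ n)
      ((eulerProd q)⁻¹ * (bilat q 0 (a + 1 : ℕ) - bilat q 0 a)) := by
  have := hasSum_class h0 (by linarith) 0 (eulerProd q)⁻¹ (crankWeight q)
    (fun c hc => crankWeight_eq_tail h0 hq hc) (fun c hc => crankWeight_neg_eq_tail h0 hq hc)
    h1 h2
  rw [← this.tsum_eq]
  exact hasSum_crankCount hq a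

lemma hasSum_crankCount_zero :
    HasSum (fun n : ℕ => (crankCount 0 n : 𝕜) * q ^ n)
      ((eulerProd q)⁻¹ * (1 + 2 * bilat q 0 1)) := by
  have htot := hasSum_crankWeight_class hq fun _ => True
  simp only [if_true, neg_add_cancel_right, genFn_true h0 hq] at htot
  have := hasSum_class_zero h0 (by linarith) 0 (eulerProd q)⁻¹ (crankWeight q)
    (fun c hc => crankWeight_eq_tail h0 hq hc) (fun c hc => crankWeight_neg_eq_tail h0 hq hc)
    htot
  rw [← this.tsum_eq]
  exact hasSum_crankCount hq 0

end Counts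

section Fourier

/-- The discrete Fourier transform of a real function on `ZMod 11`. -/
noncomputable def hat (f : ZMod 11 → ℝ) (j : ZMod 11) : ℂ :=
  ∑ r, (f r : ℂ) * ZMod.stdAddChar (j * r)

lemma hat_add (f g : ZMod 11 → ℝ) (j : ZMod 11) : hat (f + g) j = hat f j + hat g j := by
  simp [hat, add_mul, Finset.sum_add_distrib]

lemma hat_smul (c : ℝ) (f : ZMod 11 → ℝ) (j : ZMod 11) : hat (c • f) j = c * hat f j := by
  simp [hat, Finset.mul_sum, mul_assoc]

lemma hat_single (e : ZMod 11) (a : ℝ) (j : ZMod 11) :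
    hat (Pi.single e a) j = a * ZMod.stdAddChar (j * e) := by
  rw [hat, Finset.sum_eq_single e]
  · simp
  · intro r _ hr
    simp [hr]
  · simp

lemma hat_sum {ι : Type*} (s : Finset ι) (f : ι → ZMod 11 → ℝ) (j : ZMod 11) :
    hat (∑ i ∈ s, f i) j = ∑ i ∈ s, hat (f i) j := by
  classical
  induction s using Finset.induction_on with
  | empty => simp [hat]
  | insert i s hi ih => rw [Finset.sum_insert hi, Finset.sum_insert hi, hat_add, ih]

lemma hat_shift (e : ZMod 11) (f : ZMod 11 → ℝ) (j : ZMod 11) :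
    hat (fun s => f (s - e)) j = ZMod.stdAddChar (j * e) * hat f j := by
  rw [hat, hat, Finset.mul_sum, ← Equiv.sum_comp (Equiv.addRight e)]
  refine Finset.sum_congr rfl fun r _ => ?_
  rw [Equiv.coe_addRight, add_sub_cancel_right, mul_add, AddChar.map_add_eq_mul]
  ring

lemma eq_of_hat_eq {f g : ZMod 11 → ℝ} (h : ∀ j, hat f j = hat g j) : f = g := by
  have key : ∀ (f : ZMod 11 → ℝ) (s : ZMod 11),
      ∑ j, ZMod.stdAddChar (j * -s) * hat f j = 11 * (f s : ℂ) := by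
    intro f s
    simp only [hat, Finset.mul_sum]
    rw [Finset.sum_comm, Finset.sum_eq_single s]
    · have : ∀ j : ZMod 11, ZMod.stdAddChar (j * -s) * ((f s : ℂ) * ZMod.stdAddChar (j * s))
          = f s := by
        intro j
        rw [mul_left_comm, ← AddChar.map_add_eq_mul, ← mul_add, neg_add_cancel, mul_zero,
          AddChar.map_zero_eq_one, mul_one]
      rw [Finset.sum_congr rfl fun j _ => this j, Finset.sum_const, Finset.card_univ, ZMod.card,
        nsmul_eq_mul]
      norm_num
    · intro r _ hr
      have h1 := AddChar.sum_mulShift (R' := ℂ) (r - s) (ZMod.isPrimitive_stdAddChar 11)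
      rw [if_neg (sub_ne_zero.2 hr)] at h1
      have : ∀ j : ZMod 11, ZMod.stdAddChar (j * -s) * ((f r : ℂ) * ZMod.stdAddChar (j * r))
          = f r * ZMod.stdAddChar (j * (r - s)) := by
        intro j
        rw [mul_left_comm, ← AddChar.map_add_eq_mul, ← mul_add, neg_add_eq_sub]
      rw [Finset.sum_congr rfl fun j _ => this j, ← Finset.mul_sum, h1]
      simp
    · simp
  funext s
  have h1 := key f s
  simp_rw [h, key g s] at h1
  exact_mod_cast (mul_left_cancel₀ (by norm_num) h1).symm

lemma stdAddChar_pow (j : ZMod 11) (n : ℕ) :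
    (ZMod.stdAddChar j : ℂ) ^ n = ZMod.stdAddChar (j * (n : ZMod 11)) := by
  rw [← AddChar.map_nsmul_eq_pow, nsmul_eq_mul, mul_comm]

lemma stdAddChar_zpow (j : ZMod 11) (n : ℤ) :
    (ZMod.stdAddChar j : ℂ) ^ n = ZMod.stdAddChar (j * (n : ZMod 11)) := by
  rw [← AddChar.map_zsmul_eq_zpow, zsmul_eq_mul, mul_comm]

lemma norm_stdAddChar_mul (j : ZMod 11) {q : ℝ} (h0 : 0 < q) :
    ‖ZMod.stdAddChar j * (q : ℂ)‖ = q := by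
  rw [norm_mul, Complex.norm_real, Real.norm_of_nonneg h0.le, AddChar.norm_apply, one_mul]

lemma stdAddChar_mul_ne_zero (j : ZMod 11) {q : ℝ} (h0 : 0 < q) :
    ZMod.stdAddChar j * (q : ℂ) ≠ 0 := by
  rw [← norm_pos_iff, norm_stdAddChar_mul j h0]
  exact h0

lemma hasSum_hat {q : ℝ} (c : ℕ → ℝ) (hc : Summable fun n => c n * q ^ n)
    (j : ZMod 11) :
    HasSum (fun n : ℕ => (c n : ℂ) * (ZMod.stdAddChar j * q) ^ n)
      (hat (fun s => ∑' n : ℕ, if (n : ZMod 11) = s then c n * q ^ n else 0) j) := by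
  have h1 : ∀ s : ZMod 11, HasSum (fun n : ℕ => ((if (n : ZMod 11) = s then c n * q ^ n else 0 : ℝ) : ℂ)
      * ZMod.stdAddChar (j * s))
      (((∑' n : ℕ, if (n : ZMod 11) = s then c n * q ^ n else 0 : ℝ) : ℂ)
        * ZMod.stdAddChar (j * s)) := by
    intro s
    refine HasSum.mul_right _ (Complex.hasSum_ofReal.2 (Summable.hasSum ?_))
    refine Summable.of_norm_bounded hc.abs fun n => ?_
    split_ifs
    · exact le_rfl
    · rw [norm_zero]
      positivity
  refine (hasSum_sum fun s (_ : s ∈ Finset.univ) => h1 s).congr_fun fun n => ?_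
  rw [Finset.sum_eq_single (n : ZMod 11)]
  · rw [if_pos rfl, mul_pow, stdAddChar_pow]
    push_cast
    ring
  · intro s _ hs
    rw [if_neg hs.symm]
    simp
  · simp

/-- Splitting a bilateral sum into residue classes centred at `s`. -/
lemma tsum_int_split {f : ℤ → ℂ} (hf : Summable f) (s : ℤ) :
    ∑' k, f k = ∑' m : ℤ, f (11 * m + s)
      + ∑ t ∈ Finset.Icc (1 : ℤ) 5,
        (∑' m : ℤ, f (11 * m + (s + t)) + ∑' m : ℤ, f (11 * m + (s - t))) := by
  have h1 : Summable fun x : Fin 11 × ℤ => f (11 * x.2 + ((x.1 : ℕ) : ℤ) + (s - 5)) := by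
    rw [← ((Equiv.prodComm ℤ (Fin 11)).symm.trans ((Int.divModEquiv 11).symm.trans
      (Equiv.addRight (s - 5)))).summable_iff] at hf
    refine hf.congr fun x => ?_
    simp [Int.divModEquiv, mul_comm]
  have h2 : ∑' k, f k = ∑' x : Fin 11 × ℤ, f (11 * x.2 + ((x.1 : ℕ) : ℤ) + (s - 5)) := by
    rw [← ((Equiv.prodComm ℤ (Fin 11)).symm.trans ((Int.divModEquiv 11).symm.trans
      (Equiv.addRight (s - 5)))).tsum_eq]
    refine tsum_congr fun x => ?_
    simp [Int.divModEquiv, mul_comm]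
  rw [h2, h1.tsum_prod, tsum_fintype,
    Fin.sum_univ_eq_sum_range (fun r : ℕ => ∑' m : ℤ, f (11 * m + (r : ℤ) + (s - 5))) 11]
  obtain ⟨g, hg⟩ : ∃ g : ℤ → ℂ, ∀ t, g t = ∑' m : ℤ, f (11 * m + t) := ⟨_, fun _ => rfl⟩
  have hr : ∀ r : ℕ, ∑' m : ℤ, f (11 * m + (r : ℤ) + (s - 5)) = g (s + (r - 5)) := by
    intro r
    rw [hg]
    refine tsum_congr fun m => ?_
    congr 1
    ring
  simp only [hr, ← hg]
  rw [show Finset.Icc (1 : ℤ) 5 = {1, 2, 3, 4, 5} by decide]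
  simp [Finset.sum_range_succ]
  simp only [sub_eq_add_neg]
  ring

end Fourier

section Sections

/-- The function on `ZMod 11` with mass `x₀` at `c` and mass `x t` at `c + κ * t ^ 2`. -/
noncomputable def spread (c κ : ZMod 11) (x₀ : ℝ) (x : ℤ → ℝ) : ZMod 11 → ℝ :=
  Pi.single c x₀ + ∑ t ∈ Finset.Icc (1 : ℤ) 5, Pi.single (c + κ * (t : ZMod 11) ^ 2) (x t)

lemma hat_spread (c κ : ZMod 11) (x₀ : ℝ) (x : ℤ → ℝ) (j : ZMod 11) :
    hat (spread c κ x₀ x) j = x₀ * ZMod.stdAddChar (j * c)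
      + ∑ t ∈ Finset.Icc (1 : ℤ) 5, x t * ZMod.stdAddChar (j * (c + κ * (t : ZMod 11) ^ 2)) := by
  rw [spread, hat_add, hat_single, hat_sum]
  simp only [hat_single]

/-- A bilateral series with quadratic exponents, evaluated at a rotation of `q`. -/
lemma tsum_eq_hat_spread {f g : ℤ → ℂ} (hf : Summable f) (s : ℤ) (c κ j : ZMod 11)
    {e : ℤ → ZMod 11} (hfg : ∀ k, f k = ZMod.stdAddChar (j * e k) * g k)
    (he : ∀ m t, e (11 * m + (s + t)) = c + κ * (t : ZMod 11) ^ 2)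
    (y : ℤ → ℝ) (hy : ∀ r, ∑' m : ℤ, g (11 * m + r) = y r) :
    ∑' k, f k = hat (spread c κ (y s) fun t => y (s + t) + y (s - t)) j := by
  have key : ∀ t : ℤ, ∑' m : ℤ, f (11 * m + (s + t))
      = y (s + t) * ZMod.stdAddChar (j * (c + κ * (t : ZMod 11) ^ 2)) := by
    intro t
    rw [← hy, mul_comm, ← tsum_mul_left]
    exact tsum_congr fun m => by rw [hfg, he]
  rw [tsum_int_split hf s, hat_spread]
  have h0 := key 0
  simp only [add_zero, Int.cast_zero] at h0
  rw [h0]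
  congr 1
  · congr 3
    ring
  · refine Finset.sum_congr rfl fun t _ => ?_
    rw [sub_eq_add_neg, key, key]
    push_cast
    rw [neg_sq]
    ring

lemma tri_cast (n : ℤ) : (tri n : ZMod 11) = 6 * ((n : ZMod 11) * (n - 1)) := by
  have h := congrArg (Int.cast : ℤ → ZMod 11) (two_mul_tri n)
  push_cast at h
  have h11 : (11 : ZMod 11) = 0 := rfl
  linear_combination 6 * h - (tri n : ZMod 11) * h11

lemma rotate_zpow {q : ℝ} (j : ZMod 11) (n : ℤ) :
    (ZMod.stdAddChar j * (q : ℂ)) ^ n = ZMod.stdAddChar (j * (n : ZMod 11)) * ((q ^ n : ℝ) : ℂ) := by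
  rw [mul_zpow, stdAddChar_zpow]
  push_cast
  rfl

lemma rotate_zpow_eleven {q : ℝ} (j : ZMod 11) (n : ℤ) :
    (ZMod.stdAddChar j * (q : ℂ)) ^ (11 * n) = ((q ^ (11 * n) : ℝ) : ℂ) := by
  have h : (((11 * n : ℤ)) : ZMod 11) = 0 := by
    push_cast
    rw [show (11 : ZMod 11) = 0 from rfl, zero_mul]
  rw [rotate_zpow, h, mul_zero, AddChar.map_zero_eq_one, one_mul]

variable {q : ℝ} (h0 : 0 < q) (h1 : q < 1)
include h0 h1

lemma eulerProd_rotate (j : ZMod 11) :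
    eulerProd (ZMod.stdAddChar j * (q : ℂ))
      = hat (spread 5 7 (pentClass q 2) fun t => pentClass q (2 + t) + pentClass q (2 - t)) j := by
  have hn : ‖ZMod.stdAddChar j * (q : ℂ)‖ < 1 := by rwa [norm_stdAddChar_mul j h0]
  rw [eulerProd_eq_tsum hn]
  refine tsum_eq_hat_spread (summable_norm_pentagonal hn).of_norm 2 5 7 j
    (e := fun k => ((3 * tri k + k : ℤ) : ZMod 11))
    (g := fun k => (((-1) ^ k * q ^ (3 * tri k + k) : ℝ) : ℂ)) (fun k => ?_) (fun m t => ?_)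
    (pentClass q) fun r => ?_
  · rw [rotate_zpow]
    push_cast
    ring
  · have h11 : (11 : ZMod 11) = 0 := rfl
    push_cast
    rw [tri_cast]
    push_cast
    generalize (t : ZMod 11) = t
    generalize (m : ZMod 11) = m
    rw [h11]
    linear_combination (t ^ 2 + 5 * t + 3) * h11
  · rw [← Complex.ofReal_tsum]
    rfl

lemma bilat_rank_rotate (j : ZMod 11) {s : ℤ} (h2 : 1 ≤ 17 - 3 * s) (h3 : 17 - 3 * s ≤ 11) :
    bilat (ZMod.stdAddChar j * (q : ℂ)) 1 (17 - 3 * s)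
      = hat (spread (-7 * s ^ 2) 7 (rankClass q (17 - 3 * s) s)
        fun t => rankClass q (17 - 3 * s) (s + t) + rankClass q (17 - 3 * s) (s - t)) j := by
  have hn : ‖ZMod.stdAddChar j * (q : ℂ)‖ < 1 := by rwa [norm_stdAddChar_mul j h0]
  obtain ⟨b, hb⟩ := Int.eq_ofNat_of_zero_le (show 0 ≤ 17 - 3 * s by omega)
  have hs := (hasSum_bilat (stdAddChar_mul_ne_zero j h0) hn 1 (b := b) (by omega)
    (by omega)).summable
  rw [bilat]
  rw [← hb] at hs
  refine tsum_eq_hat_spread hs s (-7 * s ^ 2) 7 j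
    (e := fun k => ((3 * tri k + k + (17 - 3 * s) * k : ℤ) : ZMod 11))
    (g := fun k => (((-1) ^ k * q ^ (3 * tri k + k + (17 - 3 * s) * k)
      * (1 - q ^ (11 * k))⁻¹ : ℝ) : ℂ)) (fun k => ?_) (fun m t => ?_)
    (rankClass q (17 - 3 * s)) fun r => ?_
  · rw [rotate_zpow, rotate_zpow_eleven,
      show (2 * ((1 : ℕ) : ℤ) + 1) * tri k + ((1 : ℕ) : ℤ) * k = 3 * tri k + k by push_cast; ring]
    push_cast
    ring
  · have h11 : (11 : ZMod 11) = 0 := rfl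
    push_cast
    rw [tri_cast]
    push_cast
    generalize (t : ZMod 11) = t
    generalize (m : ZMod 11) = m
    generalize (s : ZMod 11) = s
    rw [h11]
    linear_combination (t ^ 2 + 3 * s * t + 2 * s ^ 2) * h11
  · rw [← Complex.ofReal_tsum]
    rfl

lemma bilat_crank_rotate (j : ZMod 11) {s : ℤ} (h2 : 1 ≤ 6 - s) (h3 : 6 - s ≤ 11) :
    bilat (ZMod.stdAddChar j * (q : ℂ)) 0 (6 - s)
      = hat (spread (-6 * s ^ 2) 6 (crankClass q (6 - s) s)
        fun t => crankClass q (6 - s) (s + t) + crankClass q (6 - s) (s - t)) j := by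
  have hn : ‖ZMod.stdAddChar j * (q : ℂ)‖ < 1 := by rwa [norm_stdAddChar_mul j h0]
  obtain ⟨b, hb⟩ := Int.eq_ofNat_of_zero_le (show 0 ≤ 6 - s by omega)
  have hs := (hasSum_bilat (stdAddChar_mul_ne_zero j h0) hn 0 (b := b) (by omega)
    (by omega)).summable
  rw [bilat]
  rw [← hb] at hs
  refine tsum_eq_hat_spread hs s (-6 * s ^ 2) 6 j
    (e := fun k => ((tri k + (6 - s) * k : ℤ) : ZMod 11))
    (g := fun k => (((-1) ^ k * q ^ (tri k + (6 - s) * k)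
      * (1 - q ^ (11 * k))⁻¹ : ℝ) : ℂ)) (fun k => ?_) (fun m t => ?_)
    (crankClass q (6 - s)) fun r => ?_
  · rw [rotate_zpow, rotate_zpow_eleven,
      show (2 * ((0 : ℕ) : ℤ) + 1) * tri k + ((0 : ℕ) : ℤ) * k = tri k by push_cast; ring]
    push_cast
    ring
  · have h11 : (11 : ZMod 11) = 0 := rfl
    push_cast
    rw [tri_cast]
    push_cast
    generalize (t : ZMod 11) = t
    generalize (m : ZMod 11) = m
    generalize (s : ZMod 11) = s
    rw [h11]
    linear_combination (s * t + s ^ 2) * h11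
  · rw [← Complex.ofReal_tsum]
    rfl

end Sections

section Elimination

/-- The class components of the rank Lambert series that do not come from `eulerProd`. -/
noncomputable def rankExtra (q : ℝ) (s : ℤ) : ZMod 11 → ℝ :=
  spread (-7 * s ^ 2) 7 0 fun t =>
    if t = s then unitD q s + unitD q (2 * s) + 1 - 3 * s / 11
    else (-1) ^ (s + t) * (eulerProd (q ^ 121) ^ 2 * unitP q t * unitP q (2 * t)
      / (unitP q s * unitP q (s - t) * unitP q (s + t)))

/-- The class components of the crank Lambert series. -/
noncomputable def crankExtra (q : ℝ) (s : ℤ) : ZMod 11 → ℝ :=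
  spread (-6 * s ^ 2) 6 ((-1) ^ s * (eulerProd (q ^ 121) ^ 2 / unitP q s)) fun t =>
    if t = s then unitD q (2 * s) - unitD q s - s / 11
    else (-1) ^ (s + t) * (eulerProd (q ^ 121) ^ 2 * unitP q s * unitP q (2 * t)
      / (unitP q t * unitP q (s + t) * unitP q (s - t)))

/-- The normalized class components of `eulerProd`. -/
noncomputable def eulerUnit (q : ℝ) : ZMod 11 → ℝ :=
  spread 5 7 1 fun t => (-1) ^ t * (unitP q (2 * t) / unitP q t)

/-- A convolution equation read off from a product of transforms. -/
lemma conv_of_hat_mul {c κ : ZMod 11} {x₀ : ℝ} {x : ℤ → ℝ} {f g : ZMod 11 → ℝ}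
    (h : ∀ j, hat (spread c κ x₀ x) j * hat f j = hat g j) (r : ZMod 11) :
    x₀ * f (r - c) + ∑ t ∈ Finset.Icc (1 : ℤ) 5, x t * f (r - (c + κ * (t : ZMod 11) ^ 2)) = g r := by
  have key : (x₀ • (fun s => f (s - c))
      + ∑ t ∈ Finset.Icc (1 : ℤ) 5, x t • fun s => f (s - (c + κ * (t : ZMod 11) ^ 2))) = g := by
    refine eq_of_hat_eq fun j => ?_
    rw [← h j, hat_spread, hat_add, hat_smul, hat_shift, hat_sum, add_mul, Finset.sum_mul]
    simp only [hat_smul, hat_shift, mul_assoc]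
  have := congrFun key r
  simpa [Finset.sum_apply] using this

variable {q : ℝ} (h0 : 0 < q) (h1 : q < 1)
include h0 h1

lemma eulerProd_rotate_unit (j : ZMod 11) :
    eulerProd (ZMod.stdAddChar j * (q : ℂ))
      = ((q ^ 5 * eulerProd (q ^ 121) : ℝ) : ℂ) * hat (eulerUnit q) j := by
  rw [eulerProd_rotate h0 h1, eulerUnit, hat_spread, hat_spread, mul_add, Finset.mul_sum]
  congr 1
  · rw [pentClass_two h0, thetaThree_one (base_pos h0) (base_lt_one h0 h1)]
    push_cast
    ring
  · refine Finset.sum_congr rfl fun t ht => ?_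
    rw [Finset.mem_Icc] at ht
    rw [pentClass_pair h0 h1 (by omega), thetaThree_one (base_pos h0) (base_lt_one h0 h1)]
    push_cast
    ring

lemma bilat_rank_rotate_unit (j : ZMod 11) {s : ℤ} (h2 : 2 ≤ s) (h3 : s ≤ 5) :
    bilat (ZMod.stdAddChar j * (q : ℂ)) 1 (17 - 3 * s)
      = mockFactor q s * ZMod.stdAddChar (j * (-5 - 7 * (s : ZMod 11) ^ 2))
          * eulerProd (ZMod.stdAddChar j * (q : ℂ)) + hat (rankExtra q s) j := by
  have hsh : ∀ e : ZMod 11, ZMod.stdAddChar (j * (-5 - 7 * (s : ZMod 11) ^ 2))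
      * ZMod.stdAddChar (j * (5 + e)) = ZMod.stdAddChar (j * (-7 * (s : ZMod 11) ^ 2 + e)) := by
    intro e
    rw [← AddChar.map_add_eq_mul]
    congr 1
    ring
  rw [bilat_rank_rotate h0 h1 j (by omega) (by omega), eulerProd_rotate h0 h1, rankExtra,
    hat_spread, hat_spread, hat_spread, mul_add, Finset.mul_sum, add_assoc,
    Complex.ofReal_zero, zero_mul, zero_add, ← Finset.sum_add_distrib]
  congr 1
  · have := hsh 0
    rw [add_zero, add_zero] at this
    rw [rankClass_self h0 h1, ← this]
    push_cast
    ring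
  · refine Finset.sum_congr rfl fun t ht => ?_
    rw [Finset.mem_Icc] at ht
    rw [← hsh]
    split_ifs with hts
    · subst hts
      rw [← two_mul, sub_self, rankClass_pair_self h0 h1 (by omega)]
      push_cast
      ring
    · rw [rankClass_pair h0 h1 (by omega) (by omega) (by omega) (by omega)]
      push_cast
      ring

lemma bilat_crank_rotate_unit (j : ZMod 11) {s : ℤ} (h2 : 1 ≤ s) (h3 : s ≤ 5) :
    bilat (ZMod.stdAddChar j * (q : ℂ)) 0 (6 - s) = hat (crankExtra q s) j := by
  rw [bilat_crank_rotate h0 h1 j (by omega) (by omega), crankExtra, hat_spread, hat_spread]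
  congr 1
  · rw [crankClass_self h0 h1 (by omega)]
  · refine Finset.sum_congr rfl fun t ht => ?_
    rw [Finset.mem_Icc] at ht
    congr 2
    split_ifs with hts
    · subst hts
      rw [← two_mul, sub_self, crankClass_pair_self h0 h1 (by omega) (by omega)]
    · rw [crankClass_pair h0 h1 (by omega) (by omega) (by omega) (by omega)]

end Elimination

/-- An integral combination of the rank and crank counts, the ranks `2` and `3` being weighted
equally. -/
def countComb (v₀ v₁ v₂ v₄ v₅ m₀ m₃ : ℤ) (n : ℕ) : ℤ :=
  v₀ * rankCount 0 11 n + v₁ * rankCount 1 11 n + v₂ * rankCount 2 11 n + v₂ * rankCount 3 11 n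
    + v₄ * rankCount 4 11 n + v₅ * rankCount 5 11 n + m₀ * crankCount 0 n
    + m₃ * crankCount 3 n

/-- The corresponding combination of Lambert series components. -/
noncomputable def extraComb (q : ℝ) (v₀ v₁ v₂ v₄ v₅ m₀ m₃ : ℤ) : ZMod 11 → ℝ :=
  (-(2 * v₀ - v₁) : ℝ) • rankExtra q 2 + (v₁ - v₂ : ℝ) • rankExtra q 5
    + (-(v₂ - v₄) : ℝ) • rankExtra q 3 + (v₄ - v₅ : ℝ) • rankExtra q 4
    + (2 * m₀ : ℝ) • crankExtra q 5 + (-m₃ : ℝ) • crankExtra q 3 + (m₃ : ℝ) • crankExtra q 2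
    + Pi.single 0 (v₀ + m₀ : ℝ)

section Generic

variable {𝕜 : Type*} [NormedField 𝕜] [CompleteSpace 𝕜] {q : 𝕜} (h0 : q ≠ 0) (hq : ‖q‖ < 1 / 2)
include h0 hq

lemma bilat_reflect (γ : ℕ) {b : ℕ} (h1 : 1 ≤ b) (h2 : b ≤ 11) :
    bilat q γ (12 - b : ℕ) = -bilat q γ b := by
  have hq1 : ‖q‖ < 1 := by linarith
  rw [bilat_eq h0 hq1 γ h1 h2, bilat_eq h0 hq1 γ (show 1 ≤ 12 - b by omega) (by omega),
    Nat.sub_sub_self (by omega)]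
  ring

lemma hasSum_countComb (v₀ v₁ v₂ v₄ v₅ m₀ m₃ : ℤ) :
    HasSum (fun n : ℕ => (countComb v₀ v₁ v₂ v₄ v₅ m₀ m₃ n : 𝕜) * q ^ n)
      ((eulerProd q)⁻¹ * (-(2 * v₀ - v₁) * bilat q 1 11 + (v₁ - v₂) * bilat q 1 2
        + -(v₂ - v₄) * bilat q 1 8 + (v₄ - v₅) * bilat q 1 5 + 2 * m₀ * bilat q 0 1
        + -m₃ * bilat q 0 3 + m₃ * bilat q 0 4 + (v₀ + m₀))) := by
  have r0 := hasSum_rankCount_zero h0 hq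
  have r1 := hasSum_rankCount_bilat h0 hq (a := 1) (by norm_num) (by norm_num)
  have r2 := hasSum_rankCount_bilat h0 hq (a := 2) (by norm_num) (by norm_num)
  have r3 := hasSum_rankCount_bilat h0 hq (a := 3) (by norm_num) (by norm_num)
  have r4 := hasSum_rankCount_bilat h0 hq (a := 4) (by norm_num) (by norm_num)
  have r5 := hasSum_rankCount_bilat h0 hq (a := 5) (by norm_num) (by norm_num)
  have c0 := hasSum_crankCount_zero h0 hq
  have c3 := hasSum_crankCount_bilat h0 hq (a := 3) (by norm_num) (by norm_num)
  have e6 : bilat q 1 6 = 0 := by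
    have := bilat_eq h0 (by linarith) 1 (b := 6) (by norm_num) (by norm_num)
    norm_num at this
    exact this
  have e1 := bilat_reflect h0 hq 1 (b := 1) (by norm_num) (by norm_num)
  have e4 := bilat_reflect h0 hq 1 (b := 4) (by norm_num) (by norm_num)
  norm_num at r1 r2 r3 r4 r5 c3 e1 e4
  have key := (((((((r0.mul_left (v₀ : 𝕜)).add (r1.mul_left (v₁ : 𝕜))).add
    (r2.mul_left (v₂ : 𝕜))).add (r3.mul_left (v₂ : 𝕜))).add (r4.mul_left (v₄ : 𝕜))).add
    (r5.mul_left (v₅ : 𝕜))).add (c0.mul_left (m₀ : 𝕜))).add (c3.mul_left (m₃ : 𝕜))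
  have e11 : bilat q 1 11 = -bilat q 1 1 := e1
  have e8 : bilat q 1 8 = -bilat q 1 4 := e4
  convert key using 1
  · rfl
  · funext n
    rw [countComb]
    push_cast
    ring
  · rw [e11, e8]
    linear_combination (-v₅ * (eulerProd q)⁻¹ : 𝕜) * e6

end Generic

section Equations

variable {q : ℝ} (h0 : 0 < q) (h1 : q < 1 / 2)
include h0 h1

theorem countComb_section {v₀ v₁ v₂ v₄ v₅ m₀ m₃ : ℤ} :
    ∃ f : ZMod 11 → ℝ,
      HasSum (fun n : ℕ => (countComb v₀ v₁ v₂ v₄ v₅ m₀ m₃ (11 * n + 10) : ℝ) * q ^ (11 * n + 10))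
        (f 10) ∧
      ∀ r, q ^ 5 * eulerProd (q ^ 121) * (f (r - 5) + ∑ t ∈ Finset.Icc (1 : ℤ) 5,
        (-1) ^ t * (unitP q (2 * t) / unitP q t) * f (r - (5 + 7 * (t : ZMod 11) ^ 2)))
        = extraComb q v₀ v₁ v₂ v₄ v₅ m₀ m₃ r := by
  have hq : ∀ j : ZMod 11, ‖ZMod.stdAddChar j * (q : ℂ)‖ < 1 / 2 := fun j => by
    rwa [norm_stdAddChar_mul j h0]
  have hc : Summable fun n : ℕ => (countComb v₀ v₁ v₂ v₄ v₅ m₀ m₃ n : ℝ) * q ^ n :=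
    (hasSum_countComb h0.ne' (by rwa [Real.norm_of_nonneg h0.le]) v₀ v₁ v₂ v₄ v₅ m₀ m₃).summable
  generalize hφ : countComb v₀ v₁ v₂ v₄ v₅ m₀ m₃ = φ at hc ⊢
  set F : ZMod 11 → ℝ := fun s => ∑' n : ℕ, if (n : ZMod 11) = s then (φ n : ℝ) * q ^ n else 0
    with hF
  set mock : ℤ → ZMod 11 → ℝ := fun s => Pi.single (-5 - 7 * (s : ZMod 11) ^ 2) (mockFactor q s)
    with hmock
  set f : ZMod 11 → ℝ := F + (2 * v₀ - v₁ : ℝ) • mock 2 + (-(v₁ - v₂) : ℝ) • mock 5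
    + (v₂ - v₄ : ℝ) • mock 3 + (-(v₄ - v₅) : ℝ) • mock 4 with hf
  refine ⟨f, ?_, ?_⟩
  · have hf10 : f 10 = F 10 := by
      have h2 : (10 : ZMod 11) ≠ -5 - 7 * ((2 : ℤ) : ZMod 11) ^ 2 := by decide
      have h3 : (10 : ZMod 11) ≠ -5 - 7 * ((3 : ℤ) : ZMod 11) ^ 2 := by decide
      have h4 : (10 : ZMod 11) ≠ -5 - 7 * ((4 : ℤ) : ZMod 11) ^ 2 := by decide
      have h5 : (10 : ZMod 11) ≠ -5 - 7 * ((5 : ℤ) : ZMod 11) ^ 2 := by decide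
      simp only [hf, hmock, Pi.add_apply, Pi.smul_apply, Pi.single_eq_of_ne h2,
        Pi.single_eq_of_ne h3, Pi.single_eq_of_ne h4, Pi.single_eq_of_ne h5, smul_zero, add_zero]
    rw [hf10, hF]
    have hinj : Function.Injective fun n : ℕ => 11 * n + 10 := fun a b h => by
      simp only at h
      omega
    have hs : Summable fun n : ℕ => if (n : ZMod 11) = 10 then (φ n : ℝ) * q ^ n else 0 := by
      refine Summable.of_norm_bounded hc.norm fun n => ?_
      split_ifs
      · exact le_rfl
      · rw [norm_zero]
        exact norm_nonneg _
    have := hs.hasSum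
    rw [← hinj.hasSum_iff] at this
    · refine this.congr_fun fun n => ?_
      have h10 : ((11 * n + 10 : ℕ) : ZMod 11) = 10 := by
        push_cast
        rw [show (11 : ZMod 11) = 0 from rfl, zero_mul, zero_add]
      simp only [Function.comp_apply, if_pos h10]
    · intro n hn
      refine if_neg fun h => hn ⟨n / 11, ?_⟩
      have h' : ((n : ℕ) : ZMod 11) = ((10 : ℕ) : ZMod 11) := by exact_mod_cast h
      rw [ZMod.natCast_eq_natCast_iff, Nat.ModEq] at h'
      simp only
      omega
  · have hat_eq : ∀ j, hat (eulerUnit q) j * hat ((q ^ 5 * eulerProd (q ^ 121)) • f) j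
        = hat (extraComb q v₀ v₁ v₂ v₄ v₅ m₀ m₃) j := by
      intro j
      have hne := stdAddChar_mul_ne_zero j h0
      have hE := eulerProd_ne_zero (lt_trans (hq j) (by norm_num : (1 / 2 : ℝ) < 1))
      have s1 := hasSum_countComb hne (hq j) v₀ v₁ v₂ v₄ v₅ m₀ m₃
      have s2 := hasSum_hat (fun n => (φ n : ℝ)) hc j
      rw [hφ] at s1
      have s3 := s2.unique (s1.congr_fun fun n => by push_cast; rfl)
      have h1' : q < 1 := by linarith
      have b2 := bilat_rank_rotate_unit h0 h1' j (s := 2) (by norm_num) (by norm_num)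
      have b3 := bilat_rank_rotate_unit h0 h1' j (s := 3) (by norm_num) (by norm_num)
      have b4 := bilat_rank_rotate_unit h0 h1' j (s := 4) (by norm_num) (by norm_num)
      have b5 := bilat_rank_rotate_unit h0 h1' j (s := 5) (by norm_num) (by norm_num)
      have d2 := bilat_crank_rotate_unit h0 h1' j (s := 2) (by norm_num) (by norm_num)
      have d3 := bilat_crank_rotate_unit h0 h1' j (s := 3) (by norm_num) (by norm_num)
      have d5 := bilat_crank_rotate_unit h0 h1' j (s := 5) (by norm_num) (by norm_num)
      have eu := eulerProd_rotate_unit h0 h1' j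
      have s4 := congrArg (eulerProd (ZMod.stdAddChar j * (q : ℂ)) * ·) s3
      simp only [mul_inv_cancel_left₀ hE] at s4
      rw [← hF] at s4
      norm_num only at b2 b3 b4 b5 d2 d3 d5
      rw [b2, b3, b4, b5, d2, d3, d5] at s4
      rw [hat_smul, mul_left_comm, ← mul_assoc, ← eu, hf]
      simp only [extraComb, hmock, hat_add, hat_smul, hat_single]
      simp only [mul_add, s4]
      push_cast
      simp only [mul_zero, AddChar.map_zero_eq_one]
      ring_nf
    intro r
    have := conv_of_hat_mul hat_eq r
    rw [← this, mul_add, Finset.mul_sum]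
    simp only [Pi.smul_apply, smul_eq_mul]
    congr 1
    · ring
    · exact Finset.sum_congr rfl fun t _ => by ring

end Equations

section Algebra

set_option linter.unusedSimpArgs false
set_option linter.unusedVariables false

/-- First coordinate of the modular curve of level `11`. -/
noncomputable def uX (p : ℤ → ℝ) : ℝ := p 3 * p 4 * p 5 / (p 1 ^ 2 * p 2)

/-- The unit `uX - 1`. -/
noncomputable def uA (p : ℤ → ℝ) : ℝ := p 4 * p 5 ^ 2 / (p 1 ^ 2 * p 3)

/-- Second coordinate of the modular curve of level `11`. -/
noncomputable def uY (p : ℤ → ℝ) : ℝ := p 3 * p 5 ^ 3 / (p 1 ^ 3 * p 2)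

/-- The unit `uX + uY`. -/
noncomputable def uB (p : ℤ → ℝ) : ℝ := p 2 * p 4 * p 5 ^ 2 / p 1 ^ 4

/-- An eleventh root of a unit. -/
noncomputable def uU (p : ℤ → ℝ) : ℝ := p 1 / p 5

/-- Nonvanishing theta constants subject to the relations of level `11`. -/
structure UnitRelations (p : ℤ → ℝ) : Prop where
  ne : ∀ n, 1 ≤ n → n ≤ 5 → p n ≠ 0
  relA : uA p = uX p - 1
  relB : uB p = uX p + uY p
  curve : uY p ^ 2 + uY p = uX p ^ 3 - uX p ^ 2

/-- The fifth root of the norm of `eulerUnit`, up to units. -/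
def discUnit (X Y : ℝ) : ℝ := -1 - 2 * X + 5 * X ^ 2 - X ^ 3 + (3 * X - 2) * Y

/-- The coefficient of the cofactor of `eulerUnit` in class `0`. -/
def cofPoly0 (X A Y : ℝ) : ℝ :=
  X ^ 2 * ((11 - 165 * X + 781 * X ^ 2 - 1672 * X ^ 3 + 2090 * X ^ 4 - 1705 * X ^ 5 + 1012 * X ^
  6 - 176 * X ^ 7 - 385 * X ^ 8 + 209 * X ^ 9 + 11 * X ^ 10) + (-242 * X + 968 * X ^ 2 - 1452 *
  X ^ 3 + 1089 * X ^ 4 - 484 * X ^ 5 + 484 * X ^ 6 - 484 * X ^ 7 + 121 * X ^ 8) * Y)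

/-- The coefficient of the cofactor of `eulerUnit` in class `1`. -/
def cofPoly1 (X A Y : ℝ) : ℝ :=
  A ^ 3 * ((5 * X ^ 2 + 76 * X ^ 3 - 123 * X ^ 4 - 476 * X ^ 5 + 1580 * X ^ 6 - 2224 * X ^ 7 +
  2477 * X ^ 8 - 2756 * X ^ 9 + 2232 * X ^ 10 - 794 * X ^ 11 - 157 * X ^ 12 + 160 * X ^ 13) + (5
  + 81 * X - 47 * X ^ 2 - 594 * X ^ 3 + 1181 * X ^ 4 - 801 * X ^ 5 + 341 * X ^ 6 - 446 * X ^ 7 -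
  120 * X ^ 8 + 1203 * X ^ 9 - 1088 * X ^ 10 + 240 * X ^ 11 + 15 * X ^ 12) * Y)

/-- The coefficient of the cofactor of `eulerUnit` in class `2`. -/
def cofPoly2 (X A Y : ℝ) : ℝ :=
  A ^ 2 * ((2 * X ^ 2 + 59 * X ^ 3 - 91 * X ^ 4 - 461 * X ^ 5 + 1699 * X ^ 6 - 2896 * X ^ 7 +
  3600 * X ^ 8 - 2968 * X ^ 9 + 587 * X ^ 10 + 1350 * X ^ 11 - 1187 * X ^ 12 + 284 * X ^ 13 + 22
  * X ^ 14) + (2 + 61 * X - 32 * X ^ 2 - 550 * X ^ 3 + 1304 * X ^ 4 - 1438 * X ^ 5 + 1199 * X ^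
  6 - 416 * X ^ 7 - 884 * X ^ 8 + 952 * X ^ 9 + 194 * X ^ 10 - 553 * X ^ 11 + 160 * X ^ 12) * Y)

/-- The coefficient of the cofactor of `eulerUnit` in class `3`. -/
def cofPoly3 (X A Y : ℝ) : ℝ :=
  A ^ 2 * ((-X ^ 2 - 35 * X ^ 3 - 59 * X ^ 4 + 731 * X ^ 5 - 1603 * X ^ 6 + 1360 * X ^ 7 + 301 *
  X ^ 8 - 1717 * X ^ 9 + 1450 * X ^ 10 - 268 * X ^ 11 - 336 * X ^ 12 + 177 * X ^ 13) + (-1 - 36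
  * X - 94 * X ^ 2 + 671 * X ^ 3 - 949 * X ^ 4 + 26 * X ^ 5 + 1012 * X ^ 6 - 155 * X ^ 7 - 1978
  * X ^ 8 + 2681 * X ^ 9 - 1406 * X ^ 10 + 194 * X ^ 11 + 30 * X ^ 12) * Y)

/-- The coefficient of the cofactor of `eulerUnit` in class `4`. -/
def cofPoly4 (X A Y : ℝ) : ℝ :=
  X ^ 1 * A ^ 2 * ((30 * X ^ 2 + 27 * X ^ 3 - 296 * X ^ 4 + 331 * X ^ 5 - 162 * X ^ 6 + 971 * X
  ^ 7 - 2245 * X ^ 8 + 2268 * X ^ 9 - 1208 * X ^ 10 + 243 * X ^ 11 + 42 * X ^ 12) + (30 + 57 * X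
  - 274 * X ^ 2 + 181 * X ^ 3 - 459 * X ^ 4 + 2202 * X ^ 5 - 3462 * X ^ 6 + 2266 * X ^ 7 - 237 *
  X ^ 8 - 480 * X ^ 9 + 162 * X ^ 10) * Y)

/-- The coefficient of the cofactor of `eulerUnit` in class `5`. -/
def cofPoly5 (X A Y : ℝ) : ℝ :=
  X ^ 1 * A ^ 2 * ((-15 * X ^ 2 - 85 * X ^ 3 + 335 * X ^ 4 - 226 * X ^ 5 - 249 * X ^ 6 + 488 * X
  ^ 7 - 456 * X ^ 8 + 582 * X ^ 9 - 617 * X ^ 10 + 247 * X ^ 11 + X ^ 12) + (-15 - 100 * X + 280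
  * X ^ 2 - 173 * X ^ 3 + 345 * X ^ 4 - 1211 * X ^ 5 + 1346 * X ^ 6 - 143 * X ^ 7 - 448 * X ^ 8
  + 42 * X ^ 9 + 40 * X ^ 10) * Y)

/-- The coefficient of the cofactor of `eulerUnit` in class `6`. -/
def cofPoly6 (X A Y : ℝ) : ℝ :=
  X ^ 1 * A ^ 1 * ((-7 * X ^ 2 - 81 * X ^ 3 + 255 * X ^ 4 + 119 * X ^ 5 - 1392 * X ^ 6 + 2439 *
  X ^ 7 - 2456 * X ^ 8 + 1878 * X ^ 9 - 935 * X ^ 10 + 119 * X ^ 11 + 61 * X ^ 12) + (-7 - 91 *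
  X + 273 * X ^ 2 - 196 * X ^ 3 + 199 * X ^ 4 - 864 * X ^ 5 + 1364 * X ^ 6 - 1325 * X ^ 7 + 1305
  * X ^ 8 - 846 * X ^ 9 + 185 * X ^ 10 + X ^ 11) * Y)

/-- The coefficient of the cofactor of `eulerUnit` in class `7`. -/
def cofPoly7 (X A Y : ℝ) : ℝ :=
  X ^ 1 * A ^ 1 * ((3 * X ^ 2 + 50 * X ^ 3 + 43 * X ^ 4 - 1002 * X ^ 5 + 2406 * X ^ 6 - 2632 * X
  ^ 7 + 1387 * X ^ 8 + 42 * X ^ 9 - 530 * X ^ 10 + 230 * X ^ 11 + 2 * X ^ 12) + (3 + 75 * X -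
  133 * X ^ 2 - 60 * X ^ 3 - 3 * X ^ 4 + 735 * X ^ 5 - 1554 * X ^ 6 + 1551 * X ^ 7 - 588 * X ^ 8
  - 103 * X ^ 9 + 69 * X ^ 10) * Y)

/-- The coefficient of the cofactor of `eulerUnit` in class `8`. -/
def cofPoly8 (X A Y : ℝ) : ℝ :=
  X ^ 1 * A ^ 1 * ((-3 * X ^ 2 + 21 * X ^ 3 - 420 * X ^ 4 + 1468 * X ^ 5 - 2307 * X ^ 6 + 1780 *
  X ^ 7 - 507 * X ^ 8 - 102 * X ^ 9 - 24 * X ^ 10 + 87 * X ^ 11) + (-1 - 57 * X + 48 * X ^ 2 +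
  103 * X ^ 3 + 78 * X ^ 4 - 582 * X ^ 5 + 238 * X ^ 6 + 756 * X ^ 7 - 806 * X ^ 8 + 191 * X ^ 9
  + 3 * X ^ 10) * Y)

/-- The coefficient of the cofactor of `eulerUnit` in class `9`. -/
def cofPoly9 (X A Y : ℝ) : ℝ :=
  X ^ 2 * ((-15 * X + 178 * X ^ 2 - 925 * X ^ 3 + 2532 * X ^ 4 - 3681 * X ^ 5 + 2887 * X ^ 6 -
  1358 * X ^ 7 + 803 * X ^ 8 - 647 * X ^ 9 + 221 * X ^ 10 + 5 * X ^ 11) + (-42 + 33 * X + 199 *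
  X ^ 2 - 385 * X ^ 3 + 591 * X ^ 4 - 1110 * X ^ 5 + 1039 * X ^ 6 - 112 * X ^ 7 - 310 * X ^ 8 +
  96 * X ^ 9) * Y)

/-- The coefficient of the cofactor of `eulerUnit` in class `10`. -/
def cofPoly10 (X A Y : ℝ) : ℝ :=
  X ^ 2 * ((-1 + 65 * X - 416 * X ^ 2 + 1512 * X ^ 3 - 2939 * X ^ 4 + 3047 * X ^ 5 - 1545 * X ^
  6 + 291 * X ^ 7 + 76 * X ^ 8 - 207 * X ^ 9 + 119 * X ^ 10) + (21 + 115 * X - 625 * X ^ 2 +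
  1229 * X ^ 3 - 1146 * X ^ 4 + 101 * X ^ 5 + 922 * X ^ 6 - 772 * X ^ 7 + 147 * X ^ 8 + 7 * X ^
  9) * Y)

/-- The cofactor of `eulerUnit`. -/
noncomputable def cofactor (p : ℤ → ℝ) : ZMod 11 → ℝ :=
  ![
    cofPoly0 (uX p) (uA p) (uY p) * 1,
    cofPoly1 (uX p) (uA p) (uY p) * uU p ^ 10,
    cofPoly2 (uX p) (uA p) (uY p) * uU p ^ 9,
    cofPoly3 (uX p) (uA p) (uY p) * uU p ^ 8,
    cofPoly4 (uX p) (uA p) (uY p) * uU p ^ 7,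
    cofPoly5 (uX p) (uA p) (uY p) * uU p ^ 6,
    cofPoly6 (uX p) (uA p) (uY p) * uU p ^ 5,
    cofPoly7 (uX p) (uA p) (uY p) * uU p ^ 4,
    cofPoly8 (uX p) (uA p) (uY p) * uU p ^ 3,
    cofPoly9 (uX p) (uA p) (uY p) * uU p ^ 2,
    cofPoly10 (uX p) (uA p) (uY p) * uU p]

lemma cofactor_apply (p : ℤ → ℝ) :
    cofactor p 0 = cofPoly0 (uX p) (uA p) (uY p) * 1 ∧
    cofactor p 1 = cofPoly1 (uX p) (uA p) (uY p) * uU p ^ 10 ∧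
    cofactor p 2 = cofPoly2 (uX p) (uA p) (uY p) * uU p ^ 9 ∧
    cofactor p 3 = cofPoly3 (uX p) (uA p) (uY p) * uU p ^ 8 ∧
    cofactor p 4 = cofPoly4 (uX p) (uA p) (uY p) * uU p ^ 7 ∧
    cofactor p 5 = cofPoly5 (uX p) (uA p) (uY p) * uU p ^ 6 ∧
    cofactor p 6 = cofPoly6 (uX p) (uA p) (uY p) * uU p ^ 5 ∧
    cofactor p 7 = cofPoly7 (uX p) (uA p) (uY p) * uU p ^ 4 ∧
    cofactor p 8 = cofPoly8 (uX p) (uA p) (uY p) * uU p ^ 3 ∧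
    cofactor p 9 = cofPoly9 (uX p) (uA p) (uY p) * uU p ^ 2 ∧
    cofactor p 10 = cofPoly10 (uX p) (uA p) (uY p) * uU p :=
  ⟨rfl, rfl, rfl, rfl, rfl, rfl, rfl, rfl, rfl, rfl, rfl⟩

variable {p : ℤ → ℝ} (h : UnitRelations p)
include h

lemma UnitRelations.ne_zero : p 1 ≠ 0 ∧ p 2 ≠ 0 ∧ p 3 ≠ 0 ∧ p 4 ≠ 0 ∧ p 5 ≠ 0 ∧
    uX p ≠ 0 ∧ uA p ≠ 0 ∧ uY p ≠ 0 ∧ uB p ≠ 0 := by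
  have := h.ne
  simp [uX, uA, uY, uB, this]

lemma cofactor_conv_0 :
    cofactor p 0 - p 2 / p 1 * cofactor p 4 + p 4 / p 2 * cofactor p 5 - p 5 / p 3 * cofactor p
    3 + p 3 / p 4 * cofactor p 9 - p 1 / p 5 * cofactor p 1 = -(discUnit (uX p) (uY p) ^ 5 * uX
    p * uY p / (uA p ^ 2 * uB p ^ 2)) := by
  obtain ⟨n1, n2, n3, n4, n5, hX, hA, hY, hB⟩ := h.ne_zero
  obtain ⟨g0, g1, g2, g3, g4, g5⟩ :
      uA p ^ 2 * uY p ^ 3 * uB p ^ 2 * (1 * 1) = 1 * (uA p ^ 2 * uY p ^ 3 * uB p ^ 2) ∧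
      uA p ^ 2 * uY p ^ 3 * uB p ^ 2 * (p 2 / p 1 * uU p ^ 7) = 1 * (uX p * uA p * uY p * uB p ^ 2) ∧
      uA p ^ 2 * uY p ^ 3 * uB p ^ 2 * (p 4 / p 2 * uU p ^ 6) = 1 * (uX p ^ 2 * uA p ^ 2 * uY p * uB p) ∧
      uA p ^ 2 * uY p ^ 3 * uB p ^ 2 * (p 5 / p 3 * uU p ^ 8) = 1 * (uX p * uA p ^ 2 * uY p * uB p) ∧
      uA p ^ 2 * uY p ^ 3 * uB p ^ 2 * (p 3 / p 4 * uU p ^ 2) = 1 * (uA p * uY p ^ 3 * uB p ^ 2) ∧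
      uA p ^ 2 * uY p ^ 3 * uB p ^ 2 * (p 1 / p 5 * uU p ^ 10) = 1 * (uX p ^ 2 * uA p * uB p) := by
    refine ⟨?_, ?_, ?_, ?_, ?_, ?_⟩ <;> simp only [uX, uA, uY, uB, uU] <;> field_simp
  have gr : uA p ^ 2 * uY p ^ 3 * uB p ^ 2 * (uX p * uY p / (uA p ^ 2 * uB p ^ 2)) = uX p * uY p ^ 4 := by
    field_simp
  have hK : uA p ^ 2 * uY p ^ 3 * uB p ^ 2 ≠ 0 := by positivity
  simp only [cofactor_apply p]
  refine mul_left_cancel₀ hK ?_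
  have hc := h.curve
  simp only [h.relA, h.relB] at g0 g1 g2 g3 g4 g5 gr ⊢
  generalize uX p = X, uY p = Y, uU p = U at *
  linear_combination (norm := (simp only [cofPoly0, cofPoly4, cofPoly5, cofPoly3, cofPoly9, cofPoly1, discUnit]; ring1))
    cofPoly0 X (X - 1) Y * g0 - cofPoly4 X (X - 1) Y * g1 + cofPoly5 X (X - 1) Y * g2 - cofPoly3
    X (X - 1) Y * g3 + cofPoly9 X (X - 1) Y * g4 - cofPoly1 X (X - 1) Y * g5 + discUnit X Y ^ 5
    * gr + 1 * ((-5 * X ^ 3 - 61 * X ^ 4 + 336 * X ^ 5 - 116 * X ^ 6 - 2563 * X ^ 7 + 8269 * X ^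
    8 - 14365 * X ^ 9 + 18439 * X ^ 10 - 20155 * X ^ 11 + 18235 * X ^ 12 - 11677 * X ^ 13 + 3983
    * X ^ 14 + 157 * X ^ 15 - 637 * X ^ 16 + 160 * X ^ 17) + (-4 * X ^ 2 - 24 * X ^ 3 + 369 * X
    ^ 4 - 1325 * X ^ 5 + 1819 * X ^ 6 + 951 * X ^ 7 - 9528 * X ^ 8 + 24403 * X ^ 9 - 40987 * X ^
    10 + 47971 * X ^ 11 - 37973 * X ^ 12 + 18974 * X ^ 13 - 5000 * X ^ 14 + 205 * X ^ 15 + 150 *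
    X ^ 16 - X ^ 17) * Y + (X + 36 * X ^ 2 + 27 * X ^ 3 - 1255 * X ^ 4 + 5053 * X ^ 5 - 9698 * X
    ^ 6 + 7915 * X ^ 7 + 8126 * X ^ 8 - 34496 * X ^ 9 + 52343 * X ^ 10 - 47510 * X ^ 11 + 27478
    * X ^ 12 - 9545 * X ^ 13 + 1504 * X ^ 14 + 22 * X ^ 15 - X ^ 16) * Y ^ 2 + (-2 * X - 16 * X
    ^ 2 - 45 * X ^ 3 + 743 * X ^ 4 - 2245 * X ^ 5 + 3368 * X ^ 6 - 2818 * X ^ 7 - 758 * X ^ 8 +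
    7708 * X ^ 9 - 12995 * X ^ 10 + 10981 * X ^ 11 - 4748 * X ^ 12 + 797 * X ^ 13 + 31 * X ^ 14)
    * Y ^ 3 + (-8 * X - 38 * X ^ 2 + 69 * X ^ 3 + 460 * X ^ 4 + 1309 * X ^ 5 - 13078 * X ^ 6 +
    30607 * X ^ 7 - 33532 * X ^ 8 + 18274 * X ^ 9 - 4119 * X ^ 10 - 67 * X ^ 11 + 127 * X ^ 12)
    * Y ^ 4 + (-32 * X - 40 * X ^ 2 + 412 * X ^ 3 + 1758 * X ^ 4 - 11965 * X ^ 5 + 25073 * X ^ 6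
    - 25415 * X ^ 7 + 12942 * X ^ 8 - 2997 * X ^ 9 + 270 * X ^ 10) * Y ^ 5 + (-48 * X + 80 * X ^
    2 + 1000 * X ^ 3 - 4640 * X ^ 4 + 8445 * X ^ 5 - 7533 * X ^ 6 + 3105 * X ^ 7 - 405 * X ^ 8)
    * Y ^ 6 + (-32 * X + 240 * X ^ 2 - 720 * X ^ 3 + 1080 * X ^ 4 - 810 * X ^ 5 + 243 * X ^ 6) *
    Y ^ 7) * hc

lemma cofactor_conv_1 :
    cofactor p 1 - p 2 / p 1 * cofactor p 5 + p 4 / p 2 * cofactor p 6 - p 5 / p 3 * cofactor p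
    4 + p 3 / p 4 * cofactor p 10 - p 1 / p 5 * cofactor p 2 = 0 := by
  obtain ⟨n1, n2, n3, n4, n5, hX, hA, hY, hB⟩ := h.ne_zero
  obtain ⟨g0, g1, g2, g3, g4, g5⟩ :
      uX p ^ 2 * (1 * uU p ^ 10) = uU p ^ 10 * (uX p ^ 2) ∧
      uX p ^ 2 * (p 2 / p 1 * uU p ^ 6) = uU p ^ 10 * (uX p * uY p * uB p) ∧
      uX p ^ 2 * (p 4 / p 2 * uU p ^ 5) = uU p ^ 10 * (uX p ^ 2 * uA p * uY p) ∧
      uX p ^ 2 * (p 5 / p 3 * uU p ^ 7) = uU p ^ 10 * (uX p * uA p * uY p) ∧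
      uX p ^ 2 * (p 3 / p 4 * uU p) = uU p ^ 10 * (uY p ^ 3 * uB p) ∧
      uX p ^ 2 * (p 1 / p 5 * uU p ^ 9) = uU p ^ 10 * (uX p ^ 2) := by
    refine ⟨?_, ?_, ?_, ?_, ?_, ?_⟩ <;> simp only [uX, uA, uY, uB, uU] <;> field_simp
  have hK : uX p ^ 2 ≠ 0 := by positivity
  simp only [cofactor_apply p]
  refine mul_left_cancel₀ hK ?_
  have hc := h.curve
  simp only [h.relA, h.relB] at g0 g1 g2 g3 g4 g5 ⊢
  generalize uX p = X, uY p = Y, uU p = U at *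
  linear_combination (norm := (simp only [cofPoly1, cofPoly5, cofPoly6, cofPoly4, cofPoly10, cofPoly2]; ring1))
    cofPoly1 X (X - 1) Y * g0 - cofPoly5 X (X - 1) Y * g1 + cofPoly6 X (X - 1) Y * g2 - cofPoly4
    X (X - 1) Y * g3 + cofPoly10 X (X - 1) Y * g4 - cofPoly2 X (X - 1) Y * g5 + U ^ 10 * ((-7 *
    X ^ 2 - 123 * X ^ 3 + 420 * X ^ 4 + 524 * X ^ 5 - 4569 * X ^ 6 + 10455 * X ^ 7 - 15001 * X ^
    8 + 16502 * X ^ 9 - 13776 * X ^ 10 + 7251 * X ^ 11 - 1126 * X ^ 12 - 1151 * X ^ 13 + 739 * X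
    ^ 14 - 138 * X ^ 15) + (37 * X ^ 2 + 98 * X ^ 3 - 745 * X ^ 4 + 665 * X ^ 5 + 1845 * X ^ 6 -
    4519 * X ^ 7 + 3675 * X ^ 8 - 731 * X ^ 9 - 871 * X ^ 10 + 1042 * X ^ 11 - 760 * X ^ 12 +
    297 * X ^ 13 - 33 * X ^ 14) * Y + (-22 * X ^ 2 - 29 * X ^ 3 + 324 * X ^ 4 - 342 * X ^ 5 -
    564 * X ^ 6 + 1800 * X ^ 7 - 2366 * X ^ 8 + 1985 * X ^ 9 - 843 * X ^ 10 - 67 * X ^ 11 + 126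
    * X ^ 12) * Y ^ 2 + (21 * X ^ 2 + 115 * X ^ 3 - 625 * X ^ 4 + 1229 * X ^ 5 - 1146 * X ^ 6 +
    101 * X ^ 7 + 922 * X ^ 8 - 772 * X ^ 9 + 147 * X ^ 10 + 7 * X ^ 11) * Y ^ 3) * hc

lemma cofactor_conv_2 :
    cofactor p 2 - p 2 / p 1 * cofactor p 6 + p 4 / p 2 * cofactor p 7 - p 5 / p 3 * cofactor p
    5 + p 3 / p 4 * cofactor p 0 - p 1 / p 5 * cofactor p 3 = 0 := by
  obtain ⟨n1, n2, n3, n4, n5, hX, hA, hY, hB⟩ := h.ne_zero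
  obtain ⟨g0, g1, g2, g3, g4, g5⟩ :
      uX p ^ 2 * (1 * uU p ^ 9) = uU p ^ 9 * (uX p ^ 2) ∧
      uX p ^ 2 * (p 2 / p 1 * uU p ^ 5) = uU p ^ 9 * (uX p * uY p * uB p) ∧
      uX p ^ 2 * (p 4 / p 2 * uU p ^ 4) = uU p ^ 9 * (uX p ^ 2 * uA p * uY p) ∧
      uX p ^ 2 * (p 5 / p 3 * uU p ^ 6) = uU p ^ 9 * (uX p * uA p * uY p) ∧
      uX p ^ 2 * (p 3 / p 4 * 1) = uU p ^ 9 * (uY p ^ 3 * uB p) ∧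
      uX p ^ 2 * (p 1 / p 5 * uU p ^ 8) = uU p ^ 9 * (uX p ^ 2) := by
    refine ⟨?_, ?_, ?_, ?_, ?_, ?_⟩ <;> simp only [uX, uA, uY, uB, uU] <;> field_simp
  have hK : uX p ^ 2 ≠ 0 := by positivity
  simp only [cofactor_apply p]
  refine mul_left_cancel₀ hK ?_
  have hc := h.curve
  simp only [h.relA, h.relB] at g0 g1 g2 g3 g4 g5 ⊢
  generalize uX p = X, uY p = Y, uU p = U at *
  linear_combination (norm := (simp only [cofPoly2, cofPoly6, cofPoly7, cofPoly5, cofPoly0, cofPoly3]; ring1))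
    cofPoly2 X (X - 1) Y * g0 - cofPoly6 X (X - 1) Y * g1 + cofPoly7 X (X - 1) Y * g2 - cofPoly5
    X (X - 1) Y * g3 + cofPoly0 X (X - 1) Y * g4 - cofPoly3 X (X - 1) Y * g5 + U ^ 9 * ((3 * X ^
    2 + 91 * X ^ 3 - 126 * X ^ 4 - 1160 * X ^ 5 + 4494 * X ^ 6 - 7558 * X ^ 7 + 7555 * X ^ 8 -
    4550 * X ^ 9 + 388 * X ^ 10 + 2481 * X ^ 11 - 2469 * X ^ 12 + 958 * X ^ 13 - 85 * X ^ 14 -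
    22 * X ^ 15) + (-18 * X ^ 2 - 150 * X ^ 3 + 628 * X ^ 4 - 194 * X ^ 5 - 2036 * X ^ 6 + 3579
    * X ^ 7 - 2062 * X ^ 8 - 896 * X ^ 9 + 2476 * X ^ 10 - 1898 * X ^ 11 + 624 * X ^ 12 - 52 * X
    ^ 13 - X ^ 14) * Y + (11 * X ^ 2 + 77 * X ^ 3 - 429 * X ^ 4 + 748 * X ^ 5 - 451 * X ^ 6 -
    132 * X ^ 7 + 44 * X ^ 8 + 792 * X ^ 9 - 990 * X ^ 10 + 330 * X ^ 11 + 11 * X ^ 12) * Y ^ 2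
    + (-242 * X ^ 3 + 968 * X ^ 4 - 1452 * X ^ 5 + 1089 * X ^ 6 - 484 * X ^ 7 + 484 * X ^ 8 -
    484 * X ^ 9 + 121 * X ^ 10) * Y ^ 3) * hc

lemma cofactor_conv_3 :
    cofactor p 3 - p 2 / p 1 * cofactor p 7 + p 4 / p 2 * cofactor p 8 - p 5 / p 3 * cofactor p
    6 + p 3 / p 4 * cofactor p 1 - p 1 / p 5 * cofactor p 4 = 0 := by
  obtain ⟨n1, n2, n3, n4, n5, hX, hA, hY, hB⟩ := h.ne_zero
  obtain ⟨g0, g1, g2, g3, g4, g5⟩ :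
      uX p * uA p * (1 * uU p ^ 8) = uU p ^ 8 * (uX p * uA p) ∧
      uX p * uA p * (p 2 / p 1 * uU p ^ 4) = uU p ^ 8 * (uA p * uY p * uB p) ∧
      uX p * uA p * (p 4 / p 2 * uU p ^ 3) = uU p ^ 8 * (uX p * uA p ^ 2 * uY p) ∧
      uX p * uA p * (p 5 / p 3 * uU p ^ 5) = uU p ^ 8 * (uA p ^ 2 * uY p) ∧
      uX p * uA p * (p 3 / p 4 * uU p ^ 10) = uU p ^ 8 * (uX p) ∧
      uX p * uA p * (p 1 / p 5 * uU p ^ 7) = uU p ^ 8 * (uX p * uA p) := by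
    refine ⟨?_, ?_, ?_, ?_, ?_, ?_⟩ <;> simp only [uX, uA, uY, uB, uU] <;> field_simp
  have hK : uX p * uA p ≠ 0 := by positivity
  simp only [cofactor_apply p]
  refine mul_left_cancel₀ hK ?_
  have hc := h.curve
  simp only [h.relA, h.relB] at g0 g1 g2 g3 g4 g5 ⊢
  generalize uX p = X, uY p = Y, uU p = U at *
  linear_combination (norm := (simp only [cofPoly3, cofPoly7, cofPoly8, cofPoly6, cofPoly1, cofPoly4]; ring1))
    cofPoly3 X (X - 1) Y * g0 - cofPoly7 X (X - 1) Y * g1 + cofPoly8 X (X - 1) Y * g2 - cofPoly6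
    X (X - 1) Y * g3 + cofPoly1 X (X - 1) Y * g4 - cofPoly4 X (X - 1) Y * g5 + U ^ 8 * ((-4 * X
    - 3 * X ^ 2 + 227 * X ^ 3 - 980 * X ^ 4 + 1665 * X ^ 5 - 557 * X ^ 6 - 2857 * X ^ 7 + 6544 *
    X ^ 8 - 7677 * X ^ 9 + 4910 * X ^ 10 - 386 * X ^ 11 - 1913 * X ^ 12 + 1326 * X ^ 13 - 295 *
    X ^ 14) + (-3 * X - 69 * X ^ 2 + 280 * X ^ 3 - 281 * X ^ 4 + 16 * X ^ 5 - 681 * X ^ 6 + 3027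
    * X ^ 7 - 5394 * X ^ 8 + 5244 * X ^ 9 - 2624 * X ^ 10 + 313 * X ^ 11 + 241 * X ^ 12 - 69 * X
    ^ 13) * Y) * hc

lemma cofactor_conv_4 :
    cofactor p 4 - p 2 / p 1 * cofactor p 8 + p 4 / p 2 * cofactor p 9 - p 5 / p 3 * cofactor p
    7 + p 3 / p 4 * cofactor p 2 - p 1 / p 5 * cofactor p 5 = 0 := by
  obtain ⟨n1, n2, n3, n4, n5, hX, hA, hY, hB⟩ := h.ne_zero
  obtain ⟨g0, g1, g2, g3, g4, g5⟩ :
      uX p * uA p * (1 * uU p ^ 7) = uU p ^ 7 * (uX p * uA p) ∧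
      uX p * uA p * (p 2 / p 1 * uU p ^ 3) = uU p ^ 7 * (uA p * uY p * uB p) ∧
      uX p * uA p * (p 4 / p 2 * uU p ^ 2) = uU p ^ 7 * (uX p * uA p ^ 2 * uY p) ∧
      uX p * uA p * (p 5 / p 3 * uU p ^ 4) = uU p ^ 7 * (uA p ^ 2 * uY p) ∧
      uX p * uA p * (p 3 / p 4 * uU p ^ 9) = uU p ^ 7 * (uX p) ∧
      uX p * uA p * (p 1 / p 5 * uU p ^ 6) = uU p ^ 7 * (uX p * uA p) := by
    refine ⟨?_, ?_, ?_, ?_, ?_, ?_⟩ <;> simp only [uX, uA, uY, uB, uU] <;> field_simp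
  have hK : uX p * uA p ≠ 0 := by positivity
  simp only [cofactor_apply p]
  refine mul_left_cancel₀ hK ?_
  have hc := h.curve
  simp only [h.relA, h.relB] at g0 g1 g2 g3 g4 g5 ⊢
  generalize uX p = X, uY p = Y, uU p = U at *
  linear_combination (norm := (simp only [cofPoly4, cofPoly8, cofPoly9, cofPoly7, cofPoly2, cofPoly5]; ring1))
    cofPoly4 X (X - 1) Y * g0 - cofPoly8 X (X - 1) Y * g1 + cofPoly9 X (X - 1) Y * g2 - cofPoly7
    X (X - 1) Y * g3 + cofPoly2 X (X - 1) Y * g4 - cofPoly5 X (X - 1) Y * g5 + U ^ 7 * ((2 * X +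
    12 * X ^ 2 - 172 * X ^ 3 + 440 * X ^ 4 + 229 * X ^ 5 - 2937 * X ^ 6 + 5630 * X ^ 7 - 3900 *
    X ^ 8 - 2192 * X ^ 9 + 6515 * X ^ 10 - 5401 * X ^ 11 + 2013 * X ^ 12 - 176 * X ^ 13 - 63 * X
    ^ 14) + (X + 55 * X ^ 2 - 161 * X ^ 3 + 50 * X ^ 4 + 80 * X ^ 5 + 635 * X ^ 6 - 1480 * X ^ 7
    + 302 * X ^ 8 + 2080 * X ^ 9 - 2559 * X ^ 10 + 1185 * X ^ 11 - 185 * X ^ 12 - 3 * X ^ 13) *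
    Y) * hc

lemma cofactor_conv_5 :
    cofactor p 5 - p 2 / p 1 * cofactor p 9 + p 4 / p 2 * cofactor p 10 - p 5 / p 3 * cofactor p
    8 + p 3 / p 4 * cofactor p 3 - p 1 / p 5 * cofactor p 6 = 0 := by
  obtain ⟨n1, n2, n3, n4, n5, hX, hA, hY, hB⟩ := h.ne_zero
  obtain ⟨g0, g1, g2, g3, g4, g5⟩ :
      uX p * uA p * (1 * uU p ^ 6) = uU p ^ 6 * (uX p * uA p) ∧
      uX p * uA p * (p 2 / p 1 * uU p ^ 2) = uU p ^ 6 * (uA p * uY p * uB p) ∧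
      uX p * uA p * (p 4 / p 2 * uU p) = uU p ^ 6 * (uX p * uA p ^ 2 * uY p) ∧
      uX p * uA p * (p 5 / p 3 * uU p ^ 3) = uU p ^ 6 * (uA p ^ 2 * uY p) ∧
      uX p * uA p * (p 3 / p 4 * uU p ^ 8) = uU p ^ 6 * (uX p) ∧
      uX p * uA p * (p 1 / p 5 * uU p ^ 5) = uU p ^ 6 * (uX p * uA p) := by
    refine ⟨?_, ?_, ?_, ?_, ?_, ?_⟩ <;> simp only [uX, uA, uY, uB, uU] <;> field_simp
  have hK : uX p * uA p ≠ 0 := by positivity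
  simp only [cofactor_apply p]
  refine mul_left_cancel₀ hK ?_
  have hc := h.curve
  simp only [h.relA, h.relB] at g0 g1 g2 g3 g4 g5 ⊢
  generalize uX p = X, uY p = Y, uU p = U at *
  linear_combination (norm := (simp only [cofPoly5, cofPoly9, cofPoly10, cofPoly8, cofPoly3, cofPoly6]; ring1))
    cofPoly5 X (X - 1) Y * g0 - cofPoly9 X (X - 1) Y * g1 + cofPoly10 X (X - 1) Y * g2 -
    cofPoly8 X (X - 1) Y * g3 + cofPoly3 X (X - 1) Y * g4 - cofPoly6 X (X - 1) Y * g5 + U ^ 6 *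
    ((-X - 12 * X ^ 2 + 105 * X ^ 3 - 36 * X ^ 4 - 1217 * X ^ 5 + 3936 * X ^ 6 - 5650 * X ^ 7 +
    4558 * X ^ 8 - 3149 * X ^ 9 + 3332 * X ^ 10 - 3185 * X ^ 11 + 1681 * X ^ 12 - 361 * X ^ 13 -
    X ^ 14) + (-42 * X ^ 2 + 75 * X ^ 3 + 166 * X ^ 4 - 584 * X ^ 5 + 976 * X ^ 6 - 1701 * X ^ 7
    + 2149 * X ^ 8 - 1151 * X ^ 9 - 198 * X ^ 10 + 406 * X ^ 11 - 96 * X ^ 12) * Y) * hc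

lemma cofactor_conv_6 :
    cofactor p 6 - p 2 / p 1 * cofactor p 10 + p 4 / p 2 * cofactor p 0 - p 5 / p 3 * cofactor p
    9 + p 3 / p 4 * cofactor p 4 - p 1 / p 5 * cofactor p 7 = 0 := by
  obtain ⟨n1, n2, n3, n4, n5, hX, hA, hY, hB⟩ := h.ne_zero
  obtain ⟨g0, g1, g2, g3, g4, g5⟩ :
      uX p * uA p * (1 * uU p ^ 5) = uU p ^ 5 * (uX p * uA p) ∧
      uX p * uA p * (p 2 / p 1 * uU p) = uU p ^ 5 * (uA p * uY p * uB p) ∧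
      uX p * uA p * (p 4 / p 2 * 1) = uU p ^ 5 * (uX p * uA p ^ 2 * uY p) ∧
      uX p * uA p * (p 5 / p 3 * uU p ^ 2) = uU p ^ 5 * (uA p ^ 2 * uY p) ∧
      uX p * uA p * (p 3 / p 4 * uU p ^ 7) = uU p ^ 5 * (uX p) ∧
      uX p * uA p * (p 1 / p 5 * uU p ^ 4) = uU p ^ 5 * (uX p * uA p) := by
    refine ⟨?_, ?_, ?_, ?_, ?_, ?_⟩ <;> simp only [uX, uA, uY, uB, uU] <;> field_simp
  have hK : uX p * uA p ≠ 0 := by positivity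
  simp only [cofactor_apply p]
  refine mul_left_cancel₀ hK ?_
  have hc := h.curve
  simp only [h.relA, h.relB] at g0 g1 g2 g3 g4 g5 ⊢
  generalize uX p = X, uY p = Y, uU p = U at *
  linear_combination (norm := (simp only [cofPoly6, cofPoly10, cofPoly0, cofPoly9, cofPoly4, cofPoly7]; ring1))
    cofPoly6 X (X - 1) Y * g0 - cofPoly10 X (X - 1) Y * g1 + cofPoly0 X (X - 1) Y * g2 -
    cofPoly9 X (X - 1) Y * g3 + cofPoly4 X (X - 1) Y * g4 - cofPoly7 X (X - 1) Y * g5 + U ^ 5 *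
    ((20 * X ^ 2 - 124 * X ^ 3 + 20 * X ^ 4 + 1536 * X ^ 5 - 5412 * X ^ 6 + 10002 * X ^ 7 -
    12130 * X ^ 8 + 10192 * X ^ 9 - 5717 * X ^ 10 + 1745 * X ^ 11 - 31 * X ^ 12 - 101 * X ^ 13)
    + (21 * X ^ 2 + 94 * X ^ 3 - 740 * X ^ 4 + 1854 * X ^ 5 - 2375 * X ^ 6 + 1247 * X ^ 7 + 821
    * X ^ 8 - 1694 * X ^ 9 + 919 * X ^ 10 - 140 * X ^ 11 - 7 * X ^ 12) * Y) * hc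

lemma cofactor_conv_7 :
    cofactor p 7 - p 2 / p 1 * cofactor p 0 + p 4 / p 2 * cofactor p 1 - p 5 / p 3 * cofactor p
    10 + p 3 / p 4 * cofactor p 5 - p 1 / p 5 * cofactor p 8 = 0 := by
  obtain ⟨n1, n2, n3, n4, n5, hX, hA, hY, hB⟩ := h.ne_zero
  obtain ⟨g0, g1, g2, g3, g4, g5⟩ :
      uX p * uA p * uY p ^ 2 * uB p * (1 * uU p ^ 4) = uU p ^ 4 * (uX p * uA p * uY p ^ 2 * uB p) ∧
      uX p * uA p * uY p ^ 2 * uB p * (p 2 / p 1 * 1) = uU p ^ 4 * (uA p * uY p ^ 3 * uB p ^ 2) ∧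
      uX p * uA p * uY p ^ 2 * uB p * (p 4 / p 2 * uU p ^ 10) = uU p ^ 4 * (uX p ^ 3 * uA p) ∧
      uX p * uA p * uY p ^ 2 * uB p * (p 5 / p 3 * uU p) = uU p ^ 4 * (uA p ^ 2 * uY p ^ 3 * uB p) ∧
      uX p * uA p * uY p ^ 2 * uB p * (p 3 / p 4 * uU p ^ 6) = uU p ^ 4 * (uX p * uY p ^ 2 * uB p) ∧
      uX p * uA p * uY p ^ 2 * uB p * (p 1 / p 5 * uU p ^ 3) = uU p ^ 4 * (uX p * uA p * uY p ^ 2 * uB p) := by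
    refine ⟨?_, ?_, ?_, ?_, ?_, ?_⟩ <;> simp only [uX, uA, uY, uB, uU] <;> field_simp
  have hK : uX p * uA p * uY p ^ 2 * uB p ≠ 0 := by positivity
  simp only [cofactor_apply p]
  refine mul_left_cancel₀ hK ?_
  have hc := h.curve
  simp only [h.relA, h.relB] at g0 g1 g2 g3 g4 g5 ⊢
  generalize uX p = X, uY p = Y, uU p = U at *
  linear_combination (norm := (simp only [cofPoly7, cofPoly0, cofPoly1, cofPoly10, cofPoly5, cofPoly8]; ring1))
    cofPoly7 X (X - 1) Y * g0 - cofPoly0 X (X - 1) Y * g1 + cofPoly1 X (X - 1) Y * g2 -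
    cofPoly10 X (X - 1) Y * g3 + cofPoly5 X (X - 1) Y * g4 - cofPoly8 X (X - 1) Y * g5 + U ^ 4 *
    ((5 * X ^ 3 + 61 * X ^ 4 - 336 * X ^ 5 + 116 * X ^ 6 + 2563 * X ^ 7 - 8269 * X ^ 8 + 14365 *
    X ^ 9 - 18439 * X ^ 10 + 20155 * X ^ 11 - 18235 * X ^ 12 + 11677 * X ^ 13 - 3983 * X ^ 14 -
    157 * X ^ 15 + 637 * X ^ 16 - 160 * X ^ 17) + (-5 * X ^ 3 - 61 * X ^ 4 + 332 * X ^ 5 - 219 *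
    X ^ 6 - 1624 * X ^ 7 + 4881 * X ^ 8 - 7179 * X ^ 9 + 7898 * X ^ 10 - 8274 * X ^ 11 + 7553 *
    X ^ 12 - 4695 * X ^ 13 + 1603 * X ^ 14 - 195 * X ^ 15 - 15 * X ^ 16) * Y + (-5 * X ^ 3 + 60
    * X ^ 4 + 22 * X ^ 5 - 938 * X ^ 6 + 2530 * X ^ 7 - 2477 * X ^ 8 - 608 * X ^ 9 + 4000 * X ^
    10 - 4119 * X ^ 11 + 1623 * X ^ 12 + 75 * X ^ 13 - 163 * X ^ 14) * Y ^ 2 + (-10 * X ^ 2 - 7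
    * X ^ 3 + 86 * X ^ 4 - 207 * X ^ 5 + 610 * X ^ 6 - 762 * X ^ 7 - 971 * X ^ 8 + 4231 * X ^ 9
    - 5363 * X ^ 10 + 2984 * X ^ 11 - 573 * X ^ 12 - 18 * X ^ 13) * Y ^ 3 + (-242 * X ^ 3 + 1210
    * X ^ 4 - 2420 * X ^ 5 + 2541 * X ^ 6 - 1573 * X ^ 7 + 968 * X ^ 8 - 968 * X ^ 9 + 605 * X ^
    10 - 121 * X ^ 11) * Y ^ 4) * hc

lemma cofactor_conv_8 :
    cofactor p 8 - p 2 / p 1 * cofactor p 1 + p 4 / p 2 * cofactor p 2 - p 5 / p 3 * cofactor p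
    0 + p 3 / p 4 * cofactor p 6 - p 1 / p 5 * cofactor p 9 = 0 := by
  obtain ⟨n1, n2, n3, n4, n5, hX, hA, hY, hB⟩ := h.ne_zero
  obtain ⟨g0, g1, g2, g3, g4, g5⟩ :
      uX p * uA p * uY p ^ 2 * uB p * (1 * uU p ^ 3) = uU p ^ 3 * (uX p * uA p * uY p ^ 2 * uB p) ∧
      uX p * uA p * uY p ^ 2 * uB p * (p 2 / p 1 * uU p ^ 10) = uU p ^ 3 * (uX p ^ 2 * uB p) ∧
      uX p * uA p * uY p ^ 2 * uB p * (p 4 / p 2 * uU p ^ 9) = uU p ^ 3 * (uX p ^ 3 * uA p) ∧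
      uX p * uA p * uY p ^ 2 * uB p * (p 5 / p 3 * 1) = uU p ^ 3 * (uA p ^ 2 * uY p ^ 3 * uB p) ∧
      uX p * uA p * uY p ^ 2 * uB p * (p 3 / p 4 * uU p ^ 5) = uU p ^ 3 * (uX p * uY p ^ 2 * uB p) ∧
      uX p * uA p * uY p ^ 2 * uB p * (p 1 / p 5 * uU p ^ 2) = uU p ^ 3 * (uX p * uA p * uY p ^ 2 * uB p) := by
    refine ⟨?_, ?_, ?_, ?_, ?_, ?_⟩ <;> simp only [uX, uA, uY, uB, uU] <;> field_simp
  have hK : uX p * uA p * uY p ^ 2 * uB p ≠ 0 := by positivity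
  simp only [cofactor_apply p]
  refine mul_left_cancel₀ hK ?_
  have hc := h.curve
  simp only [h.relA, h.relB] at g0 g1 g2 g3 g4 g5 ⊢
  generalize uX p = X, uY p = Y, uU p = U at *
  linear_combination (norm := (simp only [cofPoly8, cofPoly1, cofPoly2, cofPoly0, cofPoly6, cofPoly9]; ring1))
    cofPoly8 X (X - 1) Y * g0 - cofPoly1 X (X - 1) Y * g1 + cofPoly2 X (X - 1) Y * g2 - cofPoly0
    X (X - 1) Y * g3 + cofPoly6 X (X - 1) Y * g4 - cofPoly9 X (X - 1) Y * g5 + U ^ 3 * ((3 * X ^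
    3 + 11 * X ^ 4 - 63 * X ^ 5 + 66 * X ^ 6 - 121 * X ^ 7 + 895 * X ^ 8 - 2586 * X ^ 9 + 3130 *
    X ^ 10 + 98 * X ^ 11 - 5222 * X ^ 12 + 6963 * X ^ 13 - 4328 * X ^ 14 + 1256 * X ^ 15 - 80 *
    X ^ 16 - 22 * X ^ 17) + (5 * X ^ 2 + 63 * X ^ 3 - 281 * X ^ 4 - 100 * X ^ 5 + 2457 * X ^ 6 -
    6320 * X ^ 7 + 9493 * X ^ 8 - 11401 * X ^ 9 + 12703 * X ^ 10 - 12208 * X ^ 11 + 8425 * X ^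
    12 - 3435 * X ^ 13 + 584 * X ^ 14 + 15 * X ^ 15) * Y + (-5 * X ^ 2 - 68 * X ^ 3 + 444 * X ^
    4 - 1098 * X ^ 5 + 1317 * X ^ 6 - 114 * X ^ 7 - 2306 * X ^ 8 + 3964 * X ^ 9 - 3331 * X ^ 10
    + 1410 * X ^ 11 - 171 * X ^ 12 - 35 * X ^ 13 - 7 * X ^ 14) * Y ^ 2 + (242 * X ^ 3 - 1452 * X
    ^ 4 + 3630 * X ^ 5 - 4961 * X ^ 6 + 4114 * X ^ 7 - 2541 * X ^ 8 + 1936 * X ^ 9 - 1573 * X ^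
    10 + 726 * X ^ 11 - 121 * X ^ 12) * Y ^ 3) * hc

lemma cofactor_conv_9 :
    cofactor p 9 - p 2 / p 1 * cofactor p 2 + p 4 / p 2 * cofactor p 3 - p 5 / p 3 * cofactor p
    1 + p 3 / p 4 * cofactor p 7 - p 1 / p 5 * cofactor p 10 = 0 := by
  obtain ⟨n1, n2, n3, n4, n5, hX, hA, hY, hB⟩ := h.ne_zero
  obtain ⟨g0, g1, g2, g3, g4, g5⟩ :
      uA p * uY p ^ 2 * uB p * (1 * uU p ^ 2) = uU p ^ 2 * (uA p * uY p ^ 2 * uB p) ∧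
      uA p * uY p ^ 2 * uB p * (p 2 / p 1 * uU p ^ 9) = uU p ^ 2 * (uX p * uB p) ∧
      uA p * uY p ^ 2 * uB p * (p 4 / p 2 * uU p ^ 8) = uU p ^ 2 * (uX p ^ 2 * uA p) ∧
      uA p * uY p ^ 2 * uB p * (p 5 / p 3 * uU p ^ 10) = uU p ^ 2 * (uX p * uA p) ∧
      uA p * uY p ^ 2 * uB p * (p 3 / p 4 * uU p ^ 4) = uU p ^ 2 * (uY p ^ 2 * uB p) ∧
      uA p * uY p ^ 2 * uB p * (p 1 / p 5 * uU p) = uU p ^ 2 * (uA p * uY p ^ 2 * uB p) := by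
    refine ⟨?_, ?_, ?_, ?_, ?_, ?_⟩ <;> simp only [uX, uA, uY, uB, uU] <;> field_simp
  have hK : uA p * uY p ^ 2 * uB p ≠ 0 := by positivity
  simp only [cofactor_apply p]
  refine mul_left_cancel₀ hK ?_
  have hc := h.curve
  simp only [h.relA, h.relB] at g0 g1 g2 g3 g4 g5 ⊢
  generalize uX p = X, uY p = Y, uU p = U at *
  linear_combination (norm := (simp only [cofPoly9, cofPoly2, cofPoly3, cofPoly1, cofPoly7, cofPoly10]; ring1))
    cofPoly9 X (X - 1) Y * g0 - cofPoly2 X (X - 1) Y * g1 + cofPoly3 X (X - 1) Y * g2 - cofPoly1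
    X (X - 1) Y * g3 + cofPoly7 X (X - 1) Y * g4 - cofPoly10 X (X - 1) Y * g5 + U ^ 2 * ((-5 * X
    - 62 * X ^ 2 + 312 * X ^ 3 + 24 * X ^ 4 - 3007 * X ^ 5 + 9233 * X ^ 6 - 15067 * X ^ 7 +
    15965 * X ^ 8 - 12628 * X ^ 9 + 9495 * X ^ 10 - 7555 * X ^ 11 + 4870 * X ^ 12 - 1895 * X ^
    13 + 315 * X ^ 14 + 5 * X ^ 15) + (3 * X + 5 * X ^ 2 - 158 * X ^ 3 + 485 * X ^ 4 - 322 * X ^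
    5 - 393 * X ^ 6 - 535 * X ^ 7 + 3548 * X ^ 8 - 3967 * X ^ 9 - 67 * X ^ 10 + 3089 * X ^ 11 -
    2178 * X ^ 12 + 483 * X ^ 13 + 7 * X ^ 14) * Y + (-3 * X - 9 * X ^ 2 + 227 * X ^ 3 - 979 * X
    ^ 4 + 2381 * X ^ 5 - 4089 * X ^ 6 + 5237 * X ^ 7 - 4433 * X ^ 8 + 1596 * X ^ 9 + 632 * X ^
    10 - 718 * X ^ 11 + 158 * X ^ 12) * Y ^ 2) * hc

lemma cofactor_conv_10 :
    cofactor p 10 - p 2 / p 1 * cofactor p 3 + p 4 / p 2 * cofactor p 4 - p 5 / p 3 * cofactor p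
    2 + p 3 / p 4 * cofactor p 8 - p 1 / p 5 * cofactor p 0 = 0 := by
  obtain ⟨n1, n2, n3, n4, n5, hX, hA, hY, hB⟩ := h.ne_zero
  obtain ⟨g0, g1, g2, g3, g4, g5⟩ :
      uA p * uY p ^ 2 * uB p * (1 * uU p) = uU p * (uA p * uY p ^ 2 * uB p) ∧
      uA p * uY p ^ 2 * uB p * (p 2 / p 1 * uU p ^ 8) = uU p * (uX p * uB p) ∧
      uA p * uY p ^ 2 * uB p * (p 4 / p 2 * uU p ^ 7) = uU p * (uX p ^ 2 * uA p) ∧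
      uA p * uY p ^ 2 * uB p * (p 5 / p 3 * uU p ^ 9) = uU p * (uX p * uA p) ∧
      uA p * uY p ^ 2 * uB p * (p 3 / p 4 * uU p ^ 3) = uU p * (uY p ^ 2 * uB p) ∧
      uA p * uY p ^ 2 * uB p * (p 1 / p 5 * 1) = uU p * (uA p * uY p ^ 2 * uB p) := by
    refine ⟨?_, ?_, ?_, ?_, ?_, ?_⟩ <;> simp only [uX, uA, uY, uB, uU] <;> field_simp
  have hK : uA p * uY p ^ 2 * uB p ≠ 0 := by positivity
  simp only [cofactor_apply p]
  refine mul_left_cancel₀ hK ?_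
  have hc := h.curve
  simp only [h.relA, h.relB] at g0 g1 g2 g3 g4 g5 ⊢
  generalize uX p = X, uY p = Y, uU p = U at *
  linear_combination (norm := (simp only [cofPoly10, cofPoly3, cofPoly4, cofPoly2, cofPoly8, cofPoly0]; ring1))
    cofPoly10 X (X - 1) Y * g0 - cofPoly3 X (X - 1) Y * g1 + cofPoly4 X (X - 1) Y * g2 -
    cofPoly2 X (X - 1) Y * g3 + cofPoly8 X (X - 1) Y * g4 - cofPoly0 X (X - 1) Y * g5 + U * ((2
    * X + 56 * X ^ 2 - 203 * X ^ 3 - 163 * X ^ 4 + 2060 * X ^ 5 - 5371 * X ^ 6 + 9248 * X ^ 7 -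
    13631 * X ^ 8 + 16490 * X ^ 9 - 13688 * X ^ 10 + 6407 * X ^ 11 - 851 * X ^ 12 - 594 * X ^ 13
    + 258 * X ^ 14 - 20 * X ^ 15) + (-X - 22 * X ^ 2 + 237 * X ^ 3 - 933 * X ^ 4 + 2204 * X ^ 5
    - 3500 * X ^ 6 + 3210 * X ^ 7 - 47 * X ^ 8 - 3396 * X ^ 9 + 3200 * X ^ 10 - 719 * X ^ 11 -
    438 * X ^ 12 + 205 * X ^ 13) * Y + (X + 35 * X ^ 2 - 441 * X ^ 3 + 1895 * X ^ 4 - 4249 * X ^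
    5 + 5576 * X ^ 6 - 3640 * X ^ 7 - 371 * X ^ 8 + 2288 * X ^ 9 - 1311 * X ^ 10 + 207 * X ^ 11
    + 10 * X ^ 12) * Y ^ 2) * hc

end Algebra

section Derivations

set_option linter.unusedSimpArgs false

/-- Theta constants `p` with logarithmic derivatives `d`, of period `11`, subject to the
addition formula. -/
structure LogUnitRelations (p d : ℤ → ℝ) (K : ℝ) : Prop extends UnitRelations p where
  unit_neg : ∀ n, p (-n) = -p n
  unit_add : ∀ n, p (n + 11) = -p n
  log_neg : ∀ n, ¬(11 : ℤ) ∣ n → d (-n) = -d n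
  log_add : ∀ n, ¬(11 : ℤ) ∣ n → d (n + 11) = d n
  add_formula : ∀ i j, ¬(11 : ℤ) ∣ i → ¬(11 : ℤ) ∣ j → ¬(11 : ℤ) ∣ i + j → ¬(11 : ℤ) ∣ i - j →
    d (j + i) + d (j - i) - 2 * d j
      = K * (p (2 * j) * p i ^ 2 / (p j ^ 2 * p (j + i) * p (i - j)))

variable {p d : ℤ → ℝ} {K : ℝ}

lemma uU_pow_eleven (h : UnitRelations p) :
    uU p ^ 11 * (uA p * uY p ^ 3 * uB p) = uX p ^ 2 := by
  obtain ⟨n1, n2, n3, n4, n5, -⟩ := h.ne_zero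
  simp only [uX, uA, uY, uB, uU]
  field_simp

lemma log_monomials (h : UnitRelations p) :
    uX p ^ 2 * uA p * (p 5 * (p 2 ^ 3 / (p 1 ^ 3 * p 3))) =
      uU p ^ 4 * (uA p * uY p * uB p ^ 2) ∧
    uX p ^ 2 * uA p * (p 5 * (p 2 * p 4 ^ 2 / (p 1 ^ 2 * p 3 * p 5))) =
      uU p ^ 4 * (uX p ^ 2 * uA p ^ 2 * uB p) ∧
    uX p ^ 2 * uA p * (p 5 * (p 2 * p 5 / (p 1 ^ 2 * p 4))) =
      uU p ^ 4 * (uA p * uY p ^ 2 * uB p) ∧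
    uX p ^ 2 * uA p * (p 5 * (p 3 ^ 2 / (p 1 ^ 2 * p 4))) =
      uU p ^ 4 * (uX p * uY p ^ 2 * uB p) ∧
    uX p ^ 2 * uA p * (p 5 * (p 3 ^ 2 * p 4 / (p 1 * p 2 ^ 2 * p 5))) =
      uU p ^ 4 * (uX p ^ 3 * uA p * uY p) := by
  obtain ⟨n1, n2, n3, n4, n5, -⟩ := h.ne_zero
  refine ⟨?_, ?_, ?_, ?_, ?_⟩ <;> simp only [uX, uA, uY, uB, uU] <;> field_simp

variable (h : LogUnitRelations p d K)
include h

lemma unit_reduce : p 6 = p 5 ∧ p 7 = p 4 ∧ p 8 = p 3 ∧ p 9 = p 2 ∧ p 10 = p 1 ∧ p 12 = -p 1 ∧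
    p 16 = -p 5 ∧ p (-1) = -p 1 ∧ p (-2) = -p 2 ∧ p (-3) = -p 3 ∧ p (-4) = -p 4 := by
  have a := h.unit_add
  have n := h.unit_neg
  have e : ∀ k, p (11 - k) = p k := fun k => by
    rw [sub_eq_neg_add, a, n, neg_neg]
  exact ⟨e 5, e 4, e 3, e 2, e 1, a 1, (a 5), n 1, n 2, n 3, n 4⟩

lemma log_reduce : d 6 = -d 5 ∧ d 7 = -d 4 ∧ d 8 = -d 3 ∧ d 9 = -d 2 ∧ d 10 = -d 1 ∧
    d (-1) = -d 1 ∧ d (-3) = -d 3 ∧ d (-5) = -d 5 ∧ d (-7) = d 4 := by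
  have n : ∀ k, ¬(11 : ℤ) ∣ k → d (-k) = -d k := h.log_neg
  have e : ∀ k, ¬(11 : ℤ) ∣ k → d (11 - k) = -d k := fun k hk => by
    rw [sub_eq_neg_add, h.log_add _ (by rwa [dvd_neg]), n k hk]
  have e7 : d 7 = -d 4 := e 4 (by norm_num)
  refine ⟨e 5 (by norm_num), e7, e 3 (by norm_num), e 2 (by norm_num), e 1 (by norm_num),
    n 1 (by norm_num), n 3 (by norm_num), n 5 (by norm_num), ?_⟩
  rw [n 7 (by norm_num), e7, neg_neg]

lemma log_relation_1_2 : -3 * d 1 + d 3 = K * (p 2 ^ 3 / (p 1 ^ 3 * p 3)) := by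
  obtain ⟨n1, n2, n3, n4, n5, -⟩ := h.ne_zero
  have := h.add_formula 2 1 (by norm_num) (by norm_num) (by norm_num) (by norm_num)
  norm_num [unit_reduce h, log_reduce h] at this
  field_simp at this ⊢
  linear_combination this

lemma log_relation_1_4 : -2 * d 1 - d 3 + d 5 = K * (p 2 * p 4 ^ 2 / (p 1 ^ 2 * p 3 * p 5)) := by
  obtain ⟨n1, n2, n3, n4, n5, -⟩ := h.ne_zero
  have := h.add_formula 4 1 (by norm_num) (by norm_num) (by norm_num) (by norm_num)
  norm_num [unit_reduce h, log_reduce h] at this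
  field_simp at this ⊢
  linear_combination this

lemma log_relation_1_6 : -2 * d 1 - d 4 - d 5 = K * (p 2 * p 5 / (p 1 ^ 2 * p 4)) := by
  obtain ⟨n1, n2, n3, n4, n5, -⟩ := h.ne_zero
  have := h.add_formula 6 1 (by norm_num) (by norm_num) (by norm_num) (by norm_num)
  norm_num [unit_reduce h, log_reduce h] at this
  field_simp at this ⊢
  linear_combination this

lemma log_relation_1_8 : -2 * d 1 - d 2 + d 4 = K * (p 3 ^ 2 / (p 1 ^ 2 * p 4)) := by
  obtain ⟨n1, n2, n3, n4, n5, -⟩ := h.ne_zero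
  have := h.add_formula 8 1 (by norm_num) (by norm_num) (by norm_num) (by norm_num)
  norm_num [unit_reduce h, log_reduce h] at this
  field_simp at this ⊢
  linear_combination this

lemma log_relation_2_3 : -d 1 - 2 * d 2 + d 5 = K * (p 3 ^ 2 * p 4 / (p 1 * p 2 ^ 2 * p 5)) := by
  obtain ⟨n1, n2, n3, n4, n5, -⟩ := h.ne_zero
  have := h.add_formula 3 2 (by norm_num) (by norm_num) (by norm_num) (by norm_num)
  norm_num [unit_reduce h, log_reduce h] at this
  field_simp at this ⊢
  linear_combination this

/-- Numerator of the logarithmic derivative of index `1`. -/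
def logPoly1 (X Y : ℝ) : ℝ :=
  (-5 * X ^ 2 + 18 * X ^ 3 - 13 * X ^ 4) + (-5 + 10 * X + 5 * X ^ 2 - 9 * X ^ 3) * Y

/-- Numerator of the logarithmic derivative of index `2`. -/
def logPoly2 (X Y : ℝ) : ℝ :=
  (X ^ 2 - 8 * X ^ 3 + 7 * X ^ 4) + (1 - 2 * X - X ^ 2 - 7 * X ^ 3) * Y

/-- Numerator of the logarithmic derivative of index `3`. -/
def logPoly3 (X Y : ℝ) : ℝ :=
  (7 * X ^ 2 - 12 * X ^ 3 + 5 * X ^ 4) + (7 - 14 * X + 15 * X ^ 2 - 5 * X ^ 3) * Y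

/-- Numerator of the logarithmic derivative of index `4`. -/
def logPoly4 (X Y : ℝ) : ℝ :=
  (-9 * X ^ 2 + 6 * X ^ 3 + 3 * X ^ 4) + (-9 - 4 * X + 9 * X ^ 2 - 3 * X ^ 3) * Y

/-- Numerator of the logarithmic derivative of index `5`. -/
def logPoly5 (X Y : ℝ) : ℝ :=
  (-3 * X ^ 2 + 2 * X ^ 3 + X ^ 4) + (-3 + 6 * X + 3 * X ^ 2 - X ^ 3) * Y

lemma log_eq_1 : 22 * uX p ^ 2 * p 5 * d 1 = K * uU p ^ 4 * logPoly1 (uX p) (uY p) := by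
  obtain ⟨n1, n2, n3, n4, n5, hX, hA, hY, hB⟩ := h.toUnitRelations.ne_zero
  have hK : uX p ^ 2 * uA p ≠ 0 := by positivity
  have r0 := log_relation_1_2 h
  have r1 := log_relation_1_4 h
  have r2 := log_relation_1_6 h
  have r3 := log_relation_1_8 h
  have r4 := log_relation_2_3 h
  obtain ⟨g0, g1, g2, g3, g4⟩ := log_monomials h.toUnitRelations
  refine mul_left_cancel₀ hK ?_
  have hc := h.curve
  simp only [h.relA, h.relB] at g0 g1 g2 g3 g4 ⊢
  generalize uX p = X, uY p = Y, uU p = U at *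
  linear_combination (norm := (simp only [logPoly1]; ring1))
    -3 * X ^ 2 * p 5 * (X ^ 2 * (X - 1)) * r0 - 3 * K * X ^ 2 * g0 - 3 * X ^ 2 * p 5 * (X ^ 2 *
    (X - 1)) * r1 - 3 * K * X ^ 2 * g1 - 2 * X ^ 2 * p 5 * (X ^ 2 * (X - 1)) * r2 - 2 * K * X ^
    2 * g2 - 2 * X ^ 2 * p 5 * (X ^ 2 * (X - 1)) * r3 - 2 * K * X ^ 2 * g3 + 1 * X ^ 2 * p 5 *
    (X ^ 2 * (X - 1)) * r4 + 1 * K * X ^ 2 * g4 + K * U ^ 4 * ((-5 * X ^ 2 + 15 * X ^ 3 - 10 * X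
    ^ 4) + (5 * X ^ 2 - 7 * X ^ 3) * Y) * hc

lemma log_eq_2 : 22 * uX p ^ 2 * p 5 * d 2 = K * uU p ^ 4 * logPoly2 (uX p) (uY p) := by
  obtain ⟨n1, n2, n3, n4, n5, hX, hA, hY, hB⟩ := h.toUnitRelations.ne_zero
  have hK : uX p ^ 2 * uA p ≠ 0 := by positivity
  have r0 := log_relation_1_2 h
  have r1 := log_relation_1_4 h
  have r2 := log_relation_1_6 h
  have r3 := log_relation_1_8 h
  have r4 := log_relation_2_3 h
  obtain ⟨g0, g1, g2, g3, g4⟩ := log_monomials h.toUnitRelations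
  refine mul_left_cancel₀ hK ?_
  have hc := h.curve
  simp only [h.relA, h.relB] at g0 g1 g2 g3 g4 ⊢
  generalize uX p = X, uY p = Y, uU p = U at *
  linear_combination (norm := (simp only [logPoly2]; ring1))
    5 * X ^ 2 * p 5 * (X ^ 2 * (X - 1)) * r0 + 5 * K * X ^ 2 * g0 + 5 * X ^ 2 * p 5 * (X ^ 2 *
    (X - 1)) * r1 + 5 * K * X ^ 2 * g1 - 4 * X ^ 2 * p 5 * (X ^ 2 * (X - 1)) * r2 - 4 * K * X ^
    2 * g2 - 4 * X ^ 2 * p 5 * (X ^ 2 * (X - 1)) * r3 - 4 * K * X ^ 2 * g3 - 9 * X ^ 2 * p 5 *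
    (X ^ 2 * (X - 1)) * r4 - 9 * K * X ^ 2 * g4 + K * U ^ 4 * ((X ^ 2 - 3 * X ^ 3 + 2 * X ^ 4) +
    (-X ^ 2 - 3 * X ^ 3) * Y) * hc

lemma log_eq_3 : 22 * uX p ^ 2 * p 5 * d 3 = K * uU p ^ 4 * logPoly3 (uX p) (uY p) := by
  obtain ⟨n1, n2, n3, n4, n5, hX, hA, hY, hB⟩ := h.toUnitRelations.ne_zero
  have hK : uX p ^ 2 * uA p ≠ 0 := by positivity
  have r0 := log_relation_1_2 h
  have r1 := log_relation_1_4 h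
  have r2 := log_relation_1_6 h
  have r3 := log_relation_1_8 h
  have r4 := log_relation_2_3 h
  obtain ⟨g0, g1, g2, g3, g4⟩ := log_monomials h.toUnitRelations
  refine mul_left_cancel₀ hK ?_
  have hc := h.curve
  simp only [h.relA, h.relB] at g0 g1 g2 g3 g4 ⊢
  generalize uX p = X, uY p = Y, uU p = U at *
  linear_combination (norm := (simp only [logPoly3]; ring1))
    13 * X ^ 2 * p 5 * (X ^ 2 * (X - 1)) * r0 + 13 * K * X ^ 2 * g0 - 9 * X ^ 2 * p 5 * (X ^ 2 *
    (X - 1)) * r1 - 9 * K * X ^ 2 * g1 - 6 * X ^ 2 * p 5 * (X ^ 2 * (X - 1)) * r2 - 6 * K * X ^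
    2 * g2 - 6 * X ^ 2 * p 5 * (X ^ 2 * (X - 1)) * r3 - 6 * K * X ^ 2 * g3 + 3 * X ^ 2 * p 5 *
    (X ^ 2 * (X - 1)) * r4 + 3 * K * X ^ 2 * g4 + K * U ^ 4 * ((7 * X ^ 2 - 21 * X ^ 3 + 14 * X
    ^ 4) + (-7 * X ^ 2 + X ^ 3) * Y) * hc

lemma log_eq_4 : 22 * uX p ^ 2 * p 5 * d 4 = K * uU p ^ 4 * logPoly4 (uX p) (uY p) := by
  obtain ⟨n1, n2, n3, n4, n5, hX, hA, hY, hB⟩ := h.toUnitRelations.ne_zero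
  have hK : uX p ^ 2 * uA p ≠ 0 := by positivity
  have r0 := log_relation_1_2 h
  have r1 := log_relation_1_4 h
  have r2 := log_relation_1_6 h
  have r3 := log_relation_1_8 h
  have r4 := log_relation_2_3 h
  obtain ⟨g0, g1, g2, g3, g4⟩ := log_monomials h.toUnitRelations
  refine mul_left_cancel₀ hK ?_
  have hc := h.curve
  simp only [h.relA, h.relB] at g0 g1 g2 g3 g4 ⊢
  generalize uX p = X, uY p = Y, uU p = U at *
  linear_combination (norm := (simp only [logPoly4]; ring1))
    -1 * X ^ 2 * p 5 * (X ^ 2 * (X - 1)) * r0 - 1 * K * X ^ 2 * g0 - 1 * X ^ 2 * p 5 * (X ^ 2 *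
    (X - 1)) * r1 - 1 * K * X ^ 2 * g1 - 8 * X ^ 2 * p 5 * (X ^ 2 * (X - 1)) * r2 - 8 * K * X ^
    2 * g2 + 14 * X ^ 2 * p 5 * (X ^ 2 * (X - 1)) * r3 + 14 * K * X ^ 2 * g3 - 7 * X ^ 2 * p 5 *
    (X ^ 2 * (X - 1)) * r4 - 7 * K * X ^ 2 * g4 + K * U ^ 4 * ((-9 * X ^ 2 + 5 * X ^ 3 + 4 * X ^
    4) + (9 * X ^ 2 + 5 * X ^ 3) * Y) * hc

lemma log_eq_5 : 22 * uX p ^ 2 * p 5 * d 5 = K * uU p ^ 4 * logPoly5 (uX p) (uY p) := by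
  obtain ⟨n1, n2, n3, n4, n5, hX, hA, hY, hB⟩ := h.toUnitRelations.ne_zero
  have hK : uX p ^ 2 * uA p ≠ 0 := by positivity
  have r0 := log_relation_1_2 h
  have r1 := log_relation_1_4 h
  have r2 := log_relation_1_6 h
  have r3 := log_relation_1_8 h
  have r4 := log_relation_2_3 h
  obtain ⟨g0, g1, g2, g3, g4⟩ := log_monomials h.toUnitRelations
  refine mul_left_cancel₀ hK ?_
  have hc := h.curve
  simp only [h.relA, h.relB] at g0 g1 g2 g3 g4 ⊢
  generalize uX p = X, uY p = Y, uU p = U at *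
  linear_combination (norm := (simp only [logPoly5]; ring1))
    7 * X ^ 2 * p 5 * (X ^ 2 * (X - 1)) * r0 + 7 * K * X ^ 2 * g0 + 7 * X ^ 2 * p 5 * (X ^ 2 *
    (X - 1)) * r1 + 7 * K * X ^ 2 * g1 - 10 * X ^ 2 * p 5 * (X ^ 2 * (X - 1)) * r2 - 10 * K * X
    ^ 2 * g2 - 10 * X ^ 2 * p 5 * (X ^ 2 * (X - 1)) * r3 - 10 * K * X ^ 2 * g3 + 5 * X ^ 2 * p 5
    * (X ^ 2 * (X - 1)) * r4 + 5 * K * X ^ 2 * g4 + K * U ^ 4 * ((-3 * X ^ 2 + 9 * X ^ 3 - 6 * X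
    ^ 4) + (3 * X ^ 2 - 13 * X ^ 3) * Y) * hc

end Derivations

section Evaluations

set_option linter.unusedSimpArgs false

/-- The components of a rank series, in terms of theta constants. -/
noncomputable def rankVec (p d : ℤ → ℝ) (K : ℝ) (s t : ℤ) : ℝ :=
  if t = s then d s + d (2 * s) + 1 - 3 * s / 11
  else (-1) ^ (s + t) * (K * p t * p (2 * t) / (p s * p (s - t) * p (s + t)))

/-- The components of a crank series, in terms of theta constants. -/
noncomputable def crankVec (p d : ℤ → ℝ) (K : ℝ) (s t : ℤ) : ℝ :=
  if t = s then d (2 * s) - d s - s / 11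
  else (-1) ^ (s + t) * (K * p s * p (2 * t) / (p t * p (s + t) * p (s - t)))

lemma sum_cofactor_spread (g : ZMod 11 → ℝ) (b c κ : ZMod 11) (x₀ : ℝ) (x : ℤ → ℝ) :
    ∑ r, g (b - r) * spread c κ x₀ x r
      = x₀ * g (b - c) + ∑ t ∈ Finset.Icc (1 : ℤ) 5, x t * g (b - (c + κ * (t : ZMod 11) ^ 2)) := by
  simp only [spread, Pi.add_apply, Finset.sum_apply, mul_add, Finset.sum_add_distrib,
    Finset.mul_sum]
  rw [Finset.sum_comm]
  simp [Pi.single_apply, mul_comm]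

lemma sum_Icc_one_five (f : ℤ → ℝ) :
    ∑ t ∈ Finset.Icc (1 : ℤ) 5, f t = f 1 + f 2 + f 3 + f 4 + f 5 := by
  rw [show Finset.Icc (1 : ℤ) 5 = {1, 2, 3, 4, 5} by decide]
  simp [add_assoc]

variable {p d : ℤ → ℝ} {K : ℝ}

/-- The value of the cofactor on the rank components of index `2`. -/
def rankPoly2 (X Y : ℝ) : ℝ :=
  (20 + 174 * X + 30 * X ^ 2 - 2866 * X ^ 3 + 3022 * X ^ 4 + 6610 * X ^ 5 - 3926 * X ^ 6 - 29362
  * X ^ 7 + 55008 * X ^ 8 - 41728 * X ^ 9 + 15400 * X ^ 10 - 2370 * X ^ 11 - 10 * X ^ 12) + (40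
  - 178 * X + 2404 * X ^ 2 - 9542 * X ^ 3 + 6544 * X ^ 4 + 31966 * X ^ 5 - 75422 * X ^ 6 + 66444
  * X ^ 7 - 24972 * X ^ 8 + 2328 * X ^ 9 + 416 * X ^ 10 - 2 * X ^ 11) * Y

/-- The value of the cofactor on the rank components of index `3`. -/
def rankPoly3 (X Y : ℝ) : ℝ :=
  (8 + 30 * X - 318 * X ^ 2 - 482 * X ^ 3 + 1750 * X ^ 4 + 16306 * X ^ 5 - 77004 * X ^ 6 +
  144046 * X ^ 7 - 144352 * X ^ 8 + 79660 * X ^ 9 - 20592 * X ^ 10 + 438 * X ^ 11 + 502 * X ^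
  12) + (-6 + 316 * X - 2730 * X ^ 2 + 10448 * X ^ 3 - 26308 * X ^ 4 + 52338 * X ^ 5 - 78868 * X
  ^ 6 + 79052 * X ^ 7 - 47600 * X ^ 8 + 15548 * X ^ 9 - 2170 * X ^ 10 - 36 * X ^ 11) * Y

/-- The value of the cofactor on the rank components of index `4`. -/
def rankPoly4 (X Y : ℝ) : ℝ :=
  (18 + 172 * X + 148 * X ^ 2 - 1486 * X ^ 3 - 5330 * X ^ 4 + 25936 * X ^ 5 - 34582 * X ^ 6 +
  10070 * X ^ 7 + 18210 * X ^ 8 - 18754 * X ^ 9 + 5544 * X ^ 10 + 298 * X ^ 11 - 240 * X ^ 12) +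
  (-8 + 634 * X - 3002 * X ^ 2 + 8658 * X ^ 3 - 16282 * X ^ 4 + 9064 * X ^ 5 + 18908 * X ^ 6 -
  35368 * X ^ 7 + 23866 * X ^ 8 - 7444 * X ^ 9 + 942 * X ^ 10 + 18 * X ^ 11) * Y

/-- The value of the cofactor on the rank components of index `5`. -/
def rankPoly5 (X Y : ℝ) : ℝ :=
  (6 + 50 * X - 46 * X ^ 2 - 598 * X ^ 3 - 2202 * X ^ 4 + 15018 * X ^ 5 - 21002 * X ^ 6 - 6492 *
  X ^ 7 + 42040 * X ^ 8 - 39684 * X ^ 9 + 13838 * X ^ 10 - 546 * X ^ 11 - 388 * X ^ 12) + (-10 +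
  336 * X - 1998 * X ^ 2 + 5416 * X ^ 3 - 7026 * X ^ 4 - 3058 * X ^ 5 + 26176 * X ^ 6 - 39260 *
  X ^ 7 + 28232 * X ^ 8 - 10504 * X ^ 9 + 1678 * X ^ 10 + 28 * X ^ 11) * Y

/-- The value of the cofactor on the crank components. -/
def crankPoly (X Y : ℝ) : ℝ :=
  (1 + 12 * X + 29 * X ^ 2 - 151 * X ^ 3 - 136 * X ^ 4 - 192 * X ^ 5 + 4702 * X ^ 6 - 11796 * X
  ^ 7 + 13119 * X ^ 8 - 7351 * X ^ 9 + 1936 * X ^ 10 - 157 * X ^ 11 - 17 * X ^ 12) + (2 - 10 * X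
  + 228 * X ^ 2 - 1059 * X ^ 3 + 2085 * X ^ 4 - 2178 * X ^ 5 + 1345 * X ^ 6 - 827 * X ^ 7 + 826
  * X ^ 8 - 515 * X ^ 9 + 100 * X ^ 10 + X ^ 11) * Y

variable (h : LogUnitRelations p d K)
include h

lemma rankVec_eval_2 :
    22 * uA p * p 5 * (∑ t ∈ Finset.Icc (1 : ℤ) 5, rankVec p d K 2 t
        * cofactor p (4 - (-7 * ((2 : ℤ) : ZMod 11) ^ 2 + 7 * (t : ZMod 11) ^ 2)))
      = K * uX p * rankPoly2 (uX p) (uY p) + 22 * uA p * p 5 * ((1 - 3 * 2 / 11) * cofactor p 4) := by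
  obtain ⟨n1, n2, n3, n4, n5, hX, hA, hY, hB⟩ := h.toUnitRelations.ne_zero
  rw [sum_Icc_one_five]
  obtain ⟨v1, v2, v3, v4, v5⟩ :
      rankVec p d K 2 1 = -K * (1 / p 3) ∧
      rankVec p d K 2 2 = d 2 + d 4 + (1 - 3 * 2 / 11) ∧
      rankVec p d K 2 3 = K * (p 3 / (p 1 * p 2)) ∧
      rankVec p d K 2 4 = -K * (p 3 * p 4 / (p 2 ^ 2 * p 5)) ∧
      rankVec p d K 2 5 = K * (p 1 * p 5 / (p 2 * p 3 * p 4)) := by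
    refine ⟨?_, ?_, ?_, ?_, ?_⟩ <;> norm_num [rankVec, unit_reduce h, log_reduce h] <;>
      first | ring1 | field_simp
  rw [v1, v2, v3, v4, v5]
  change _ * (_ * cofactor p 3 + _ * cofactor p 4 + _ * cofactor p 2 + _ * cofactor p 8 + _ * cofactor p 0) = _
  simp only [cofactor_apply p]
  clear v1 v2 v3 v4 v5
  have hK : uX p * uA p * uY p ^ 3 * uB p ≠ 0 := by positivity
  obtain ⟨g1, g3, g4, g5⟩ :
      uX p * uA p * uY p ^ 3 * uB p * (p 5 * ((1 / p 3) * uU p ^ 8)) = uX p ^ 2 * uA p * uY p ∧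
      uX p * uA p * uY p ^ 3 * uB p * (p 5 * ((p 3 / (p 1 * p 2)) * uU p ^ 9)) = uX p ^ 3 * uY p ∧
      uX p * uA p * uY p ^ 3 * uB p * (p 5 * ((p 3 * p 4 / (p 2 ^ 2 * p 5)) * uU p ^ 3)) = uX p ^ 3 * uA p * uY p ^ 2 ∧
      uX p * uA p * uY p ^ 3 * uB p * (p 5 * ((p 1 * p 5 / (p 2 * p 3 * p 4)) * 1)) = uA p ^ 2 * uY p ^ 4 := by
    refine ⟨?_, ?_, ?_, ?_⟩ <;> simp only [uX, uA, uY, uB, uU] <;> field_simp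
  have l2 := log_eq_2 h
  have l4 := log_eq_4 h
  have hU := uU_pow_eleven h.toUnitRelations
  refine mul_left_cancel₀ (pow_ne_zero 2 hX) (mul_left_cancel₀ hK ?_)
  have hc := h.curve
  simp only [h.relA, h.relB] at hU g1 g3 g4 g5 ⊢
  generalize uX p = X, uY p = Y, uU p = U at *
  linear_combination (norm := (simp only [cofPoly0, cofPoly2, cofPoly3, cofPoly4, cofPoly8, logPoly2, logPoly4, rankPoly2]; ring1))
    -22 * K * X ^ 2 * (X - 1) * cofPoly3 X (X - 1) Y * g1 + 22 * K * X ^ 2 * (X - 1) * cofPoly2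
    X (X - 1) Y * g3 - 22 * K * X ^ 2 * (X - 1) * cofPoly8 X (X - 1) Y * g4 + 22 * K * X ^ 2 *
    (X - 1) * cofPoly0 X (X - 1) Y * g5 + X * (X - 1) * Y ^ 3 * (X + Y) * U ^ 7 * (X - 1) *
    cofPoly4 X (X - 1) Y * l2 + X * (X - 1) * Y ^ 3 * (X + Y) * U ^ 7 * (X - 1) * cofPoly4 X (X
    - 1) Y * l4 + K * X * (X - 1) * cofPoly4 X (X - 1) Y * (logPoly2 X Y + logPoly4 X Y) * hU +
    K * X ^ 2 * ((240 * X ^ 4 - 204 * X ^ 5 - 2926 * X ^ 6 + 7290 * X ^ 7 - 3860 * X ^ 8 + 1268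
    * X ^ 9 - 20340 * X ^ 10 + 36874 * X ^ 11 - 4964 * X ^ 12 - 53852 * X ^ 13 + 76528 * X ^ 14
    - 51302 * X ^ 15 + 17174 * X ^ 16 - 1506 * X ^ 17 - 420 * X ^ 18) + (262 * X ^ 2 + 576 * X ^
    3 - 5434 * X ^ 4 - 5688 * X ^ 5 + 86298 * X ^ 6 - 230884 * X ^ 7 + 316536 * X ^ 8 - 276724 *
    X ^ 9 + 212562 * X ^ 10 - 186834 * X ^ 11 + 133058 * X ^ 12 - 43842 * X ^ 13 - 7526 * X ^ 14
    + 9456 * X ^ 15 - 1752 * X ^ 16 - 64 * X ^ 17) * Y + (-262 * X ^ 2 - 556 * X ^ 3 + 5526 * X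
    ^ 4 - 710 * X ^ 5 - 44650 * X ^ 6 + 97586 * X ^ 7 - 40834 * X ^ 8 - 144010 * X ^ 9 + 287402
    * X ^ 10 - 262158 * X ^ 11 + 140064 * X ^ 12 - 43464 * X ^ 13 + 5812 * X ^ 14 + 254 * X ^
    15) * Y ^ 2 + (40 * X ^ 2 + 5106 * X ^ 3 - 34686 * X ^ 4 + 99858 * X ^ 5 - 172916 * X ^ 6 +
    225072 * X ^ 7 - 253798 * X ^ 8 + 240360 * X ^ 9 - 168614 * X ^ 10 + 77878 * X ^ 11 - 20546
    * X ^ 12 + 2244 * X ^ 13 + 2 * X ^ 14) * Y ^ 3) * hc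

lemma rankVec_eval_3 :
    22 * uA p * p 5 * (∑ t ∈ Finset.Icc (1 : ℤ) 5, rankVec p d K 3 t
        * cofactor p (4 - (-7 * ((3 : ℤ) : ZMod 11) ^ 2 + 7 * (t : ZMod 11) ^ 2)))
      = K * uX p * rankPoly3 (uX p) (uY p) + 22 * uA p * p 5 * ((1 - 3 * 3 / 11) * cofactor p 4) := by
  obtain ⟨n1, n2, n3, n4, n5, hX, hA, hY, hB⟩ := h.toUnitRelations.ne_zero
  rw [sum_Icc_one_five]
  obtain ⟨v1, v2, v3, v4, v5⟩ :
      rankVec p d K 3 1 = K * (p 1 / (p 3 * p 4)) ∧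
      rankVec p d K 3 2 = -K * (p 2 * p 4 / (p 1 * p 3 * p 5)) ∧
      rankVec p d K 3 3 = d 3 - d 5 + (1 - 3 * 3 / 11) ∧
      rankVec p d K 3 4 = K * (1 / p 1) ∧
      rankVec p d K 3 5 = -K * (p 1 * p 5 / (p 2 * p 3 ^ 2)) := by
    refine ⟨?_, ?_, ?_, ?_, ?_⟩ <;> norm_num [rankVec, unit_reduce h, log_reduce h] <;>
      first | ring1 | field_simp
  rw [v1, v2, v3, v4, v5]
  change _ * (_ * cofactor p 5 + _ * cofactor p 6 + _ * cofactor p 4 + _ * cofactor p 10 + _ * cofactor p 2) = _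
  simp only [cofactor_apply p]
  clear v1 v2 v3 v4 v5
  have hK : uA p * uY p ^ 3 * uB p ^ 2 ≠ 0 := by positivity
  obtain ⟨g1, g2, g4, g5⟩ :
      uA p * uY p ^ 3 * uB p ^ 2 * (p 5 * ((p 1 / (p 3 * p 4)) * uU p ^ 6)) = uA p * uY p ^ 2 * uB p ∧
      uA p * uY p ^ 3 * uB p ^ 2 * (p 5 * ((p 2 * p 4 / (p 1 * p 3 * p 5)) * uU p ^ 5)) = uX p * uA p * uY p * uB p ^ 2 ∧
      uA p * uY p ^ 3 * uB p ^ 2 * (p 5 * ((1 / p 1) * uU p)) = uA p * uY p ^ 3 * uB p ^ 2 ∧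
      uA p * uY p ^ 3 * uB p ^ 2 * (p 5 * ((p 1 * p 5 / (p 2 * p 3 ^ 2)) * uU p ^ 9)) = uX p * uA p ^ 2 * uY p := by
    refine ⟨?_, ?_, ?_, ?_⟩ <;> simp only [uX, uA, uY, uB, uU] <;> field_simp
  have l3 := log_eq_3 h
  have l5 := log_eq_5 h
  have hU := uU_pow_eleven h.toUnitRelations
  refine mul_left_cancel₀ (pow_ne_zero 2 hX) (mul_left_cancel₀ hK ?_)
  have hc := h.curve
  simp only [h.relA, h.relB] at hU g1 g2 g4 g5 ⊢
  generalize uX p = X, uY p = Y, uU p = U at *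
  linear_combination (norm := (simp only [cofPoly10, cofPoly2, cofPoly4, cofPoly5, cofPoly6, logPoly3, logPoly5, rankPoly3]; ring1))
    22 * K * X ^ 2 * (X - 1) * cofPoly5 X (X - 1) Y * g1 - 22 * K * X ^ 2 * (X - 1) * cofPoly6 X
    (X - 1) Y * g2 + 22 * K * X ^ 2 * (X - 1) * cofPoly10 X (X - 1) Y * g4 - 22 * K * X ^ 2 * (X
    - 1) * cofPoly2 X (X - 1) Y * g5 + (X - 1) * Y ^ 3 * (X + Y) ^ 2 * U ^ 7 * (X - 1) *
    cofPoly4 X (X - 1) Y * l3 - (X - 1) * Y ^ 3 * (X + Y) ^ 2 * U ^ 7 * (X - 1) * cofPoly4 X (X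
    - 1) Y * l5 + K * (X + Y) * (X - 1) * cofPoly4 X (X - 1) Y * (logPoly3 X Y - logPoly5 X Y) *
    hU + K * X ^ 2 * ((-300 * X ^ 4 + 750 * X ^ 5 + 2618 * X ^ 6 - 13848 * X ^ 7 + 25780 * X ^ 8
    - 35740 * X ^ 9 + 70734 * X ^ 10 - 144680 * X ^ 11 + 205492 * X ^ 12 - 192032 * X ^ 13 +
    117454 * X ^ 14 - 44426 * X ^ 15 + 8414 * X ^ 16 - 48 * X ^ 17 - 168 * X ^ 18) + (44 * X +
    822 * X ^ 2 - 6300 * X ^ 3 + 8604 * X ^ 4 + 44466 * X ^ 5 - 227304 * X ^ 6 + 530194 * X ^ 7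
    - 812912 * X ^ 8 + 892532 * X ^ 9 - 673442 * X ^ 10 + 260114 * X ^ 11 + 84016 * X ^ 12 -
    190672 * X ^ 13 + 126478 * X ^ 14 - 42214 * X ^ 15 + 5090 * X ^ 16 + 484 * X ^ 17) * Y +
    (-344 * X - 222 * X ^ 2 + 7306 * X ^ 3 - 16622 * X ^ 4 - 8128 * X ^ 5 + 110442 * X ^ 6 -
    263756 * X ^ 7 + 345044 * X ^ 8 - 255838 * X ^ 9 + 61796 * X ^ 10 + 83836 * X ^ 11 - 119326
    * X ^ 12 + 84280 * X ^ 13 - 34804 * X ^ 14 + 6168 * X ^ 15 + 168 * X ^ 16) * Y ^ 2 + (14 * X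
    - 796 * X ^ 2 + 4134 * X ^ 3 - 9908 * X ^ 4 + 24578 * X ^ 5 - 70766 * X ^ 6 + 159042 * X ^ 7
    - 263258 * X ^ 8 + 332096 * X ^ 9 - 305708 * X ^ 10 + 180536 * X ^ 11 - 52664 * X ^ 12 + 204
    * X ^ 13 + 2496 * X ^ 14) * Y ^ 3 + (-6 * X + 784 * X ^ 2 - 1440 * X ^ 3 - 5170 * X ^ 4 +
    20312 * X ^ 5 - 14392 * X ^ 6 - 51522 * X ^ 7 + 148548 * X ^ 8 - 181982 * X ^ 9 + 120634 * X
    ^ 10 - 41016 * X ^ 11 + 5060 * X ^ 12 + 190 * X ^ 13) * Y ^ 4) * hc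

lemma rankVec_eval_4 :
    22 * uA p * p 5 * (∑ t ∈ Finset.Icc (1 : ℤ) 5, rankVec p d K 4 t
        * cofactor p (4 - (-7 * ((4 : ℤ) : ZMod 11) ^ 2 + 7 * (t : ZMod 11) ^ 2)))
      = K * uX p * rankPoly4 (uX p) (uY p) + 22 * uA p * p 5 * ((1 - 3 * 4 / 11) * cofactor p 4) := by
  obtain ⟨n1, n2, n3, n4, n5, hX, hA, hY, hB⟩ := h.toUnitRelations.ne_zero
  rw [sum_Icc_one_five]
  obtain ⟨v1, v2, v3, v4, v5⟩ :
      rankVec p d K 4 1 = -K * (p 1 * p 2 / (p 3 * p 4 * p 5)) ∧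
      rankVec p d K 4 2 = K * (1 / p 5) ∧
      rankVec p d K 4 3 = -K * (p 3 * p 5 / (p 1 * p 4 ^ 2)) ∧
      rankVec p d K 4 4 = d 4 - d 3 + (1 - 3 * 4 / 11) ∧
      rankVec p d K 4 5 = K * (p 5 / (p 2 * p 4)) := by
    refine ⟨?_, ?_, ?_, ?_, ?_⟩ <;> norm_num [rankVec, unit_reduce h, log_reduce h] <;>
      first | ring1 | field_simp
  rw [v1, v2, v3, v4, v5]
  change _ * (_ * cofactor p 10 + _ * cofactor p 0 + _ * cofactor p 9 + _ * cofactor p 4 + _ * cofactor p 7) = _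
  simp only [cofactor_apply p]
  clear v1 v2 v3 v4 v5
  have hK : uX p * uA p * uY p ^ 3 * uB p ≠ 0 := by positivity
  obtain ⟨g1, g2, g3, g5⟩ :
      uX p * uA p * uY p ^ 3 * uB p * (p 5 * ((p 1 * p 2 / (p 3 * p 4 * p 5)) * uU p)) = uA p * uY p ^ 3 * uB p ∧
      uX p * uA p * uY p ^ 3 * uB p * (p 5 * ((1 / p 5) * 1)) = uX p * uA p * uY p ^ 3 * uB p ∧
      uX p * uA p * uY p ^ 3 * uB p * (p 5 * ((p 3 * p 5 / (p 1 * p 4 ^ 2)) * uU p ^ 2)) = uY p ^ 4 * uB p ∧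
      uX p * uA p * uY p ^ 3 * uB p * (p 5 * ((p 5 / (p 2 * p 4)) * uU p ^ 4)) = uX p * uA p * uY p ^ 3 := by
    refine ⟨?_, ?_, ?_, ?_⟩ <;> simp only [uX, uA, uY, uB, uU] <;> field_simp
  have l4 := log_eq_4 h
  have l3 := log_eq_3 h
  have hU := uU_pow_eleven h.toUnitRelations
  refine mul_left_cancel₀ (pow_ne_zero 2 hX) (mul_left_cancel₀ hK ?_)
  have hc := h.curve
  simp only [h.relA, h.relB] at hU g1 g2 g3 g5 ⊢
  generalize uX p = X, uY p = Y, uU p = U at *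
  linear_combination (norm := (simp only [cofPoly0, cofPoly10, cofPoly4, cofPoly7, cofPoly9, logPoly4, logPoly3, rankPoly4]; ring1))
    -22 * K * X ^ 2 * (X - 1) * cofPoly10 X (X - 1) Y * g1 + 22 * K * X ^ 2 * (X - 1) * cofPoly0
    X (X - 1) Y * g2 - 22 * K * X ^ 2 * (X - 1) * cofPoly9 X (X - 1) Y * g3 + 22 * K * X ^ 2 *
    (X - 1) * cofPoly7 X (X - 1) Y * g5 + X * (X - 1) * Y ^ 3 * (X + Y) * U ^ 7 * (X - 1) *
    cofPoly4 X (X - 1) Y * l4 - X * (X - 1) * Y ^ 3 * (X + Y) * U ^ 7 * (X - 1) * cofPoly4 X (X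
    - 1) Y * l3 + K * X * (X - 1) * cofPoly4 X (X - 1) Y * (logPoly4 X Y - logPoly3 X Y) * hU +
    K * X ^ 2 * ((480 * X ^ 4 - 1068 * X ^ 5 - 4466 * X ^ 6 + 20894 * X ^ 7 - 35660 * X ^ 8 +
    48076 * X ^ 9 - 101092 * X ^ 10 + 205198 * X ^ 11 - 275644 * X ^ 12 + 238092 * X ^ 13 -
    131096 * X ^ 14 + 42134 * X ^ 15 - 5494 * X ^ 16 - 438 * X ^ 17 + 84 * X ^ 18) + (480 * X ^
    2 - 828 * X ^ 3 - 5170 * X ^ 4 + 21316 * X ^ 5 - 41838 * X ^ 6 + 89398 * X ^ 7 - 216436 * X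
    ^ 8 + 385512 * X ^ 9 - 444580 * X ^ 10 + 326086 * X ^ 11 - 145790 * X ^ 12 + 34482 * X ^ 13
    - 2204 * X ^ 14 - 602 * X ^ 15 + 258 * X ^ 16 - 84 * X ^ 17) * Y + (-480 * X ^ 2 + 868 * X ^
    3 + 3572 * X ^ 4 - 10000 * X ^ 5 - 1454 * X ^ 6 + 26828 * X ^ 7 - 17186 * X ^ 8 - 42830 * X
    ^ 9 + 94522 * X ^ 10 - 89134 * X ^ 11 + 47280 * X ^ 12 - 13888 * X ^ 13 + 2142 * X ^ 14 -
    240 * X ^ 15) * Y ^ 2 + (454 * X ^ 2 - 3868 * X ^ 3 + 11632 * X ^ 4 - 21230 * X ^ 5 + 29972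
    * X ^ 6 - 22988 * X ^ 7 - 11496 * X ^ 8 + 36166 * X ^ 9 - 14268 * X ^ 10 - 18594 * X ^ 11 +
    19628 * X ^ 12 - 5280 * X ^ 13 - 128 * X ^ 14) * Y ^ 3 + (-924 * X ^ 2 + 1650 * X ^ 3 + 3652
    * X ^ 4 - 12848 * X ^ 5 + 21472 * X ^ 6 - 37422 * X ^ 7 + 47278 * X ^ 8 - 25322 * X ^ 9 -
    4356 * X ^ 10 + 8932 * X ^ 11 - 2112 * X ^ 12) * Y ^ 4) * hc

lemma rankVec_eval_5 :
    22 * uA p * p 5 * (∑ t ∈ Finset.Icc (1 : ℤ) 5, rankVec p d K 5 t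
        * cofactor p (4 - (-7 * ((5 : ℤ) : ZMod 11) ^ 2 + 7 * (t : ZMod 11) ^ 2)))
      = K * uX p * rankPoly5 (uX p) (uY p) + 22 * uA p * p 5 * ((1 - 3 * 5 / 11) * cofactor p 4) := by
  obtain ⟨n1, n2, n3, n4, n5, hX, hA, hY, hB⟩ := h.toUnitRelations.ne_zero
  rw [sum_Icc_one_five]
  obtain ⟨v1, v2, v3, v4, v5⟩ :
      rankVec p d K 5 1 = K * (p 1 * p 2 / (p 4 * p 5 ^ 2)) ∧
      rankVec p d K 5 2 = -K * (p 2 / (p 3 * p 5)) ∧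
      rankVec p d K 5 3 = K * (1 / p 2) ∧
      rankVec p d K 5 4 = -K * (p 3 * p 4 / (p 1 * p 2 * p 5)) ∧
      rankVec p d K 5 5 = d 5 - d 1 + (1 - 3 * 5 / 11) := by
    refine ⟨?_, ?_, ?_, ?_, ?_⟩ <;> norm_num [rankVec, unit_reduce h, log_reduce h] <;>
      first | ring1 | field_simp
  rw [v1, v2, v3, v4, v5]
  change _ * (_ * cofactor p 7 + _ * cofactor p 8 + _ * cofactor p 6 + _ * cofactor p 1 + _ * cofactor p 4) = _
  simp only [cofactor_apply p]
  clear v1 v2 v3 v4 v5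
  have hK : uA p * uY p ^ 3 * uB p ≠ 0 := by positivity
  obtain ⟨g1, g2, g3, g4⟩ :
      uA p * uY p ^ 3 * uB p * (p 5 * ((p 1 * p 2 / (p 4 * p 5 ^ 2)) * uU p ^ 4)) = uY p ^ 2 * uB p ∧
      uA p * uY p ^ 3 * uB p * (p 5 * ((p 2 / (p 3 * p 5)) * uU p ^ 3)) = uA p * uY p ^ 2 * uB p ∧
      uA p * uY p ^ 3 * uB p * (p 5 * ((1 / p 2) * uU p ^ 5)) = uX p * uA p * uY p ^ 2 ∧
      uA p * uY p ^ 3 * uB p * (p 5 * ((p 3 * p 4 / (p 1 * p 2 * p 5)) * uU p ^ 10)) = uX p ^ 3 := by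
    refine ⟨?_, ?_, ?_, ?_⟩ <;> simp only [uX, uA, uY, uB, uU] <;> field_simp
  have l5 := log_eq_5 h
  have l1 := log_eq_1 h
  have hU := uU_pow_eleven h.toUnitRelations
  refine mul_left_cancel₀ (pow_ne_zero 2 hX) (mul_left_cancel₀ hK ?_)
  have hc := h.curve
  simp only [h.relA, h.relB] at hU g1 g2 g3 g4 ⊢
  generalize uX p = X, uY p = Y, uU p = U at *
  linear_combination (norm := (simp only [cofPoly1, cofPoly4, cofPoly6, cofPoly7, cofPoly8, logPoly5, logPoly1, rankPoly5]; ring1))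
    22 * K * X ^ 2 * (X - 1) * cofPoly7 X (X - 1) Y * g1 - 22 * K * X ^ 2 * (X - 1) * cofPoly8 X
    (X - 1) Y * g2 + 22 * K * X ^ 2 * (X - 1) * cofPoly6 X (X - 1) Y * g3 - 22 * K * X ^ 2 * (X
    - 1) * cofPoly1 X (X - 1) Y * g4 + (X - 1) * Y ^ 3 * (X + Y) * U ^ 7 * (X - 1) * cofPoly4 X
    (X - 1) Y * l5 - (X - 1) * Y ^ 3 * (X + Y) * U ^ 7 * (X - 1) * cofPoly4 X (X - 1) Y * l1 + K
    * 1 * (X - 1) * cofPoly4 X (X - 1) Y * (logPoly5 X Y - logPoly1 X Y) * hU + K * X ^ 2 *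
    ((-170 * X ^ 3 - 796 * X ^ 4 + 7084 * X ^ 5 - 9110 * X ^ 6 - 34466 * X ^ 7 + 147446 * X ^ 8
    - 265636 * X ^ 9 + 297852 * X ^ 10 - 242882 * X ^ 11 + 155286 * X ^ 12 - 62912 * X ^ 13 -
    8102 * X ^ 14 + 29042 * X ^ 15 - 15568 * X ^ 16 + 2932 * X ^ 17) + (-60 * X + 186 * X ^ 2 +
    748 * X ^ 3 - 3022 * X ^ 4 + 2598 * X ^ 5 - 14648 * X ^ 6 + 94424 * X ^ 7 - 253878 * X ^ 8 +
    374226 * X ^ 9 - 339320 * X ^ 10 + 204572 * X ^ 11 - 91752 * X ^ 12 + 33402 * X ^ 13 - 8304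
    * X ^ 14 + 834 * X ^ 15 - 6 * X ^ 16) * Y + (60 * X + 18 * X ^ 2 + 1176 * X ^ 3 - 8760 * X ^
    4 + 17240 * X ^ 5 + 3582 * X ^ 6 - 81350 * X ^ 7 + 188644 * X ^ 8 - 238880 * X ^ 9 + 184290
    * X ^ 10 - 86650 * X ^ 11 + 24286 * X ^ 12 - 3950 * X ^ 13 + 294 * X ^ 14) * Y ^ 2 + (-10 *
    X + 346 * X ^ 2 - 2334 * X ^ 3 + 7414 * X ^ 4 - 12442 * X ^ 5 + 3968 * X ^ 6 + 29234 * X ^ 7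
    - 65436 * X ^ 8 + 67492 * X ^ 9 - 38736 * X ^ 10 + 12182 * X ^ 11 - 1650 * X ^ 12 - 28 * X ^
    13) * Y ^ 3) * hc

lemma crankVec_eval_2 :
    22 * uA p * p 5 * ((-1) ^ (2 : ℤ) * (K / p 2) * cofactor p (4 - -6 * ((2 : ℤ) : ZMod 11) ^ 2)
      + ∑ t ∈ Finset.Icc (1 : ℤ) 5, crankVec p d K 2 t
        * cofactor p (4 - (-6 * ((2 : ℤ) : ZMod 11) ^ 2 + 6 * (t : ZMod 11) ^ 2)))
      = -8 * K * uX p * crankPoly (uX p) (uY p) + 22 * uA p * p 5 * ((-(2 / 11)) * cofactor p 4) := by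
  obtain ⟨n1, n2, n3, n4, n5, hX, hA, hY, hB⟩ := h.toUnitRelations.ne_zero
  rw [sum_Icc_one_five]
  obtain ⟨v1, v2, v3, v4, v5⟩ :
      crankVec p d K 2 1 = -K * (p 2 ^ 2 / (p 1 ^ 2 * p 3)) ∧
      crankVec p d K 2 2 = -d 2 + d 4 + (-(2 / 11)) ∧
      crankVec p d K 2 3 = K * (p 2 / (p 1 * p 3)) ∧
      crankVec p d K 2 4 = -K * (p 3 / (p 4 * p 5)) ∧
      crankVec p d K 2 5 = K * (p 1 * p 2 / (p 3 * p 4 * p 5)) := by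
    refine ⟨?_, ?_, ?_, ?_, ?_⟩ <;> norm_num [crankVec, unit_reduce h, log_reduce h] <;>
      first | ring1 | field_simp
  have v0 : (-1) ^ (2 : ℤ) * (K / p 2) = K * (1 / p 2) := by
    norm_num
    try field_simp
  rw [v0, v1, v2, v3, v4, v5]
  change _ * (_ * cofactor p 6 + (_ * cofactor p 0 + _ * cofactor p 4 + _ * cofactor p 7 + _ * cofactor p 9 + _ * cofactor p 10)) = _
  simp only [cofactor_apply p]
  clear v0 v1 v2 v3 v4 v5
  have hK : uX p * uA p * uY p ^ 3 * uB p ≠ 0 := by positivity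
  obtain ⟨g0, g1, g3, g4, g5⟩ :
      uX p * uA p * uY p ^ 3 * uB p * (p 5 * ((1 / p 2) * uU p ^ 5)) = uX p ^ 2 * uA p * uY p ^ 2 ∧
      uX p * uA p * uY p ^ 3 * uB p * (p 5 * ((p 2 ^ 2 / (p 1 ^ 2 * p 3)) * 1)) = uA p * uY p ^ 3 * uB p ^ 2 ∧
      uX p * uA p * uY p ^ 3 * uB p * (p 5 * ((p 2 / (p 1 * p 3)) * uU p ^ 4)) = uX p * uA p * uY p ^ 2 * uB p ∧
      uX p * uA p * uY p ^ 3 * uB p * (p 5 * ((p 3 / (p 4 * p 5)) * uU p ^ 2)) = uX p * uY p ^ 3 * uB p ∧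
      uX p * uA p * uY p ^ 3 * uB p * (p 5 * ((p 1 * p 2 / (p 3 * p 4 * p 5)) * uU p)) = uA p * uY p ^ 3 * uB p := by
    refine ⟨?_, ?_, ?_, ?_, ?_⟩ <;> simp only [uX, uA, uY, uB, uU] <;> field_simp
  have l2 := log_eq_2 h
  have l4 := log_eq_4 h
  have hU := uU_pow_eleven h.toUnitRelations
  refine mul_left_cancel₀ (pow_ne_zero 2 hX) (mul_left_cancel₀ hK ?_)
  have hc := h.curve
  simp only [h.relA, h.relB] at hU g0 g1 g3 g4 g5 ⊢
  generalize uX p = X, uY p = Y, uU p = U at *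
  linear_combination (norm := (simp only [cofPoly0, cofPoly10, cofPoly4, cofPoly6, cofPoly7, cofPoly9, logPoly2, logPoly4, crankPoly]; ring1))
    22 * K * X ^ 2 * (X - 1) * cofPoly6 X (X - 1) Y * g0 - 22 * K * X ^ 2 * (X - 1) * cofPoly0 X
    (X - 1) Y * g1 + 22 * K * X ^ 2 * (X - 1) * cofPoly7 X (X - 1) Y * g3 - 22 * K * X ^ 2 * (X
    - 1) * cofPoly9 X (X - 1) Y * g4 + 22 * K * X ^ 2 * (X - 1) * cofPoly10 X (X - 1) Y * g5 - X
    * (X - 1) * Y ^ 3 * (X + Y) * U ^ 7 * (X - 1) * cofPoly4 X (X - 1) Y * l2 + X * (X - 1) * Y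
    ^ 3 * (X + Y) * U ^ 7 * (X - 1) * cofPoly4 X (X - 1) Y * l4 + K * X * (X - 1) * cofPoly4 X
    (X - 1) Y * (-logPoly2 X Y + logPoly4 X Y) * hU + K * X ^ 2 * ((300 * X ^ 4 - 750 * X ^ 5 -
    2618 * X ^ 6 + 13848 * X ^ 7 - 25780 * X ^ 8 + 35740 * X ^ 9 - 70734 * X ^ 10 + 144680 * X ^
    11 - 205492 * X ^ 12 + 192032 * X ^ 13 - 117454 * X ^ 14 + 44426 * X ^ 15 - 8414 * X ^ 16 +
    48 * X ^ 17 + 168 * X ^ 18) + (300 * X ^ 2 - 270 * X ^ 3 - 3916 * X ^ 4 + 11150 * X ^ 5 -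
    14354 * X ^ 6 + 36544 * X ^ 7 - 116688 * X ^ 8 + 205800 * X ^ 9 - 191738 * X ^ 10 + 75574 *
    X ^ 11 + 22822 * X ^ 12 - 38616 * X ^ 13 + 14182 * X ^ 14 - 214 * X ^ 15 - 408 * X ^ 16 -
    168 * X ^ 17) * Y + (-300 * X ^ 2 + 328 * X ^ 3 + 4878 * X ^ 4 - 23674 * X ^ 5 + 66612 * X ^
    6 - 138382 * X ^ 7 + 201974 * X ^ 8 - 178852 * X ^ 9 + 50664 * X ^ 10 + 76448 * X ^ 11 -
    96818 * X ^ 12 + 42250 * X ^ 13 - 3262 * X ^ 14 - 1866 * X ^ 15) * Y ^ 2 + (204 * X ^ 2 -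
    432 * X ^ 3 - 694 * X ^ 4 + 2046 * X ^ 5 + 1094 * X ^ 6 - 7278 * X ^ 7 + 18676 * X ^ 8 -
    59162 * X ^ 9 + 117192 * X ^ 10 - 119776 * X ^ 11 + 58968 * X ^ 12 - 10604 * X ^ 13 - 234 *
    X ^ 14) * Y ^ 3 + (5324 * X ^ 3 - 31944 * X ^ 4 + 79860 * X ^ 5 - 109142 * X ^ 6 + 90508 * X
    ^ 7 - 55902 * X ^ 8 + 42592 * X ^ 9 - 34606 * X ^ 10 + 15972 * X ^ 11 - 2662 * X ^ 12) * Y ^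
    4) * hc

lemma crankVec_eval_3 :
    22 * uA p * p 5 * ((-1) ^ (3 : ℤ) * (K / p 3) * cofactor p (4 - -6 * ((3 : ℤ) : ZMod 11) ^ 2)
      + ∑ t ∈ Finset.Icc (1 : ℤ) 5, crankVec p d K 3 t
        * cofactor p (4 - (-6 * ((3 : ℤ) : ZMod 11) ^ 2 + 6 * (t : ZMod 11) ^ 2)))
      = 10 * K * uX p * crankPoly (uX p) (uY p) + 22 * uA p * p 5 * ((-(3 / 11)) * cofactor p 4) := by
  obtain ⟨n1, n2, n3, n4, n5, hX, hA, hY, hB⟩ := h.toUnitRelations.ne_zero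
  rw [sum_Icc_one_five]
  obtain ⟨v1, v2, v3, v4, v5⟩ :
      crankVec p d K 3 1 = K * (p 3 / (p 1 * p 4)) ∧
      crankVec p d K 3 2 = -K * (p 3 * p 4 / (p 1 * p 2 * p 5)) ∧
      crankVec p d K 3 3 = -d 3 - d 5 + (-(3 / 11)) ∧
      crankVec p d K 3 4 = K * (p 3 ^ 2 / (p 1 * p 4 ^ 2)) ∧
      crankVec p d K 3 5 = -K * (p 1 / (p 2 * p 5)) := by
    refine ⟨?_, ?_, ?_, ?_, ?_⟩ <;> norm_num [crankVec, unit_reduce h, log_reduce h] <;>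
      first | ring1 | field_simp
  have v0 : (-1) ^ (3 : ℤ) * (K / p 3) = -K * (1 / p 3) := by
    norm_num
    try field_simp
  rw [v0, v1, v2, v3, v4, v5]
  change _ * (_ * cofactor p 3 + (_ * cofactor p 8 + _ * cofactor p 1 + _ * cofactor p 4 + _ * cofactor p 6 + _ * cofactor p 7)) = _
  simp only [cofactor_apply p]
  clear v0 v1 v2 v3 v4 v5
  have hK : uA p ^ 2 * uY p ^ 3 * uB p ≠ 0 := by positivity
  obtain ⟨g0, g1, g2, g4, g5⟩ :
      uA p ^ 2 * uY p ^ 3 * uB p * (p 5 * ((1 / p 3) * uU p ^ 8)) = uX p * uA p ^ 2 * uY p ∧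
      uA p ^ 2 * uY p ^ 3 * uB p * (p 5 * ((p 3 / (p 1 * p 4)) * uU p ^ 3)) = uA p * uY p ^ 3 * uB p ∧
      uA p ^ 2 * uY p ^ 3 * uB p * (p 5 * ((p 3 * p 4 / (p 1 * p 2 * p 5)) * uU p ^ 10)) = uX p ^ 3 * uA p ∧
      uA p ^ 2 * uY p ^ 3 * uB p * (p 5 * ((p 3 ^ 2 / (p 1 * p 4 ^ 2)) * uU p ^ 5)) = uY p ^ 3 * uB p ∧
      uA p ^ 2 * uY p ^ 3 * uB p * (p 5 * ((p 1 / (p 2 * p 5)) * uU p ^ 4)) = uX p * uA p ^ 2 * uY p ^ 2 := by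
    refine ⟨?_, ?_, ?_, ?_, ?_⟩ <;> simp only [uX, uA, uY, uB, uU] <;> field_simp
  have l3 := log_eq_3 h
  have l5 := log_eq_5 h
  have hU := uU_pow_eleven h.toUnitRelations
  refine mul_left_cancel₀ (pow_ne_zero 2 hX) (mul_left_cancel₀ hK ?_)
  have hc := h.curve
  simp only [h.relA, h.relB] at hU g0 g1 g2 g4 g5 ⊢
  generalize uX p = X, uY p = Y, uU p = U at *
  linear_combination (norm := (simp only [cofPoly1, cofPoly3, cofPoly4, cofPoly6, cofPoly7, cofPoly8, logPoly3, logPoly5, crankPoly]; ring1))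
    -22 * K * X ^ 2 * (X - 1) * cofPoly3 X (X - 1) Y * g0 + 22 * K * X ^ 2 * (X - 1) * cofPoly8
    X (X - 1) Y * g1 - 22 * K * X ^ 2 * (X - 1) * cofPoly1 X (X - 1) Y * g2 + 22 * K * X ^ 2 *
    (X - 1) * cofPoly6 X (X - 1) Y * g4 - 22 * K * X ^ 2 * (X - 1) * cofPoly7 X (X - 1) Y * g5 -
    (X - 1) ^ 2 * Y ^ 3 * (X + Y) * U ^ 7 * (X - 1) * cofPoly4 X (X - 1) Y * l3 - (X - 1) ^ 2 *
    Y ^ 3 * (X + Y) * U ^ 7 * (X - 1) * cofPoly4 X (X - 1) Y * l5 + K * (X - 1) * (X - 1) *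
    cofPoly4 X (X - 1) Y * (-logPoly3 X Y - logPoly5 X Y) * hU + K * X ^ 2 * ((-10 * X ^ 3 +
    1784 * X ^ 4 - 8396 * X ^ 5 + 2372 * X ^ 6 + 76536 * X ^ 7 - 277608 * X ^ 8 + 561728 * X ^ 9
    - 846226 * X ^ 10 + 1068570 * X ^ 11 - 1125892 * X ^ 12 + 907848 * X ^ 13 - 495050 * X ^ 14
    + 142224 * X ^ 15 + 5600 * X ^ 16 - 17252 * X ^ 17 + 3772 * X ^ 18) + (-142 * X - 190 * X ^
    2 + 1784 * X ^ 3 + 8322 * X ^ 4 - 67256 * X ^ 5 + 187796 * X ^ 6 - 269068 * X ^ 7 + 120212 *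
    X ^ 8 + 296062 * X ^ 9 - 666200 * X ^ 10 + 618898 * X ^ 11 - 228988 * X ^ 12 - 86864 * X ^
    13 + 133728 * X ^ 14 - 57052 * X ^ 15 + 8880 * X ^ 16 + 78 * X ^ 17) * Y + (142 * X + 114 *
    X ^ 2 - 3118 * X ^ 3 + 874 * X ^ 4 + 44102 * X ^ 5 - 149988 * X ^ 6 + 202266 * X ^ 7 - 6074
    * X ^ 8 - 422814 * X ^ 9 + 752620 * X ^ 10 - 698498 * X ^ 11 + 373496 * X ^ 12 - 98492 * X ^
    13 + 1866 * X ^ 14 + 3504 * X ^ 15) * Y ^ 2 + (-152 * X - 366 * X ^ 2 + 2604 * X ^ 3 + 1566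
    * X ^ 4 - 24642 * X ^ 5 + 54204 * X ^ 6 - 51988 * X ^ 7 - 12020 * X ^ 8 + 117884 * X ^ 9 -
    177300 * X ^ 10 + 132812 * X ^ 11 - 49730 * X ^ 12 + 7050 * X ^ 13 + 78 * X ^ 14) * Y ^ 3) *
    hc

lemma crankVec_eval_5 :
    22 * uA p * p 5 * ((-1) ^ (5 : ℤ) * (K / p 5) * cofactor p (4 - -6 * ((5 : ℤ) : ZMod 11) ^ 2)
      + ∑ t ∈ Finset.Icc (1 : ℤ) 5, crankVec p d K 5 t
        * cofactor p (4 - (-6 * ((5 : ℤ) : ZMod 11) ^ 2 + 6 * (t : ZMod 11) ^ 2)))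
      = 2 * K * uX p * crankPoly (uX p) (uY p) + 22 * uA p * p 5 * ((-(5 / 11)) * cofactor p 4) := by
  obtain ⟨n1, n2, n3, n4, n5, hX, hA, hY, hB⟩ := h.toUnitRelations.ne_zero
  rw [sum_Icc_one_five]
  obtain ⟨v1, v2, v3, v4, v5⟩ :
      crankVec p d K 5 1 = K * (p 2 / (p 1 * p 4)) ∧
      crankVec p d K 5 2 = -K * (p 5 / (p 2 * p 3)) ∧
      crankVec p d K 5 3 = K * (p 5 ^ 2 / (p 2 * p 3 ^ 2)) ∧
      crankVec p d K 5 4 = -K * (p 3 * p 5 / (p 1 * p 2 * p 4)) ∧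
      crankVec p d K 5 5 = -d 5 - d 1 + (-(5 / 11)) := by
    refine ⟨?_, ?_, ?_, ?_, ?_⟩ <;> norm_num [crankVec, unit_reduce h, log_reduce h] <;>
      first | ring1 | field_simp
  have v0 : (-1) ^ (5 : ℤ) * (K / p 5) = -K * (1 / p 5) := by
    norm_num
    try field_simp
  rw [v0, v1, v2, v3, v4, v5]
  change _ * (_ * cofactor p 0 + (_ * cofactor p 5 + _ * cofactor p 9 + _ * cofactor p 1 + _ * cofactor p 3 + _ * cofactor p 4)) = _
  simp only [cofactor_apply p]
  clear v0 v1 v2 v3 v4 v5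
  have hK : uA p * uY p ^ 3 * uB p ^ 2 ≠ 0 := by positivity
  obtain ⟨g0, g1, g2, g3, g4⟩ :
      uA p * uY p ^ 3 * uB p ^ 2 * (p 5 * ((1 / p 5) * 1)) = uA p * uY p ^ 3 * uB p ^ 2 ∧
      uA p * uY p ^ 3 * uB p ^ 2 * (p 5 * ((p 2 / (p 1 * p 4)) * uU p ^ 6)) = uY p ^ 2 * uB p ^ 2 ∧
      uA p * uY p ^ 3 * uB p ^ 2 * (p 5 * ((p 5 / (p 2 * p 3)) * uU p ^ 2)) = uA p ^ 2 * uY p ^ 3 * uB p ∧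
      uA p * uY p ^ 3 * uB p ^ 2 * (p 5 * ((p 5 ^ 2 / (p 2 * p 3 ^ 2)) * uU p ^ 10)) = uX p * uA p ^ 2 * uY p ∧
      uA p * uY p ^ 3 * uB p ^ 2 * (p 5 * ((p 3 * p 5 / (p 1 * p 2 * p 4)) * uU p ^ 8)) = uX p * uY p ^ 2 * uB p := by
    refine ⟨?_, ?_, ?_, ?_, ?_⟩ <;> simp only [uX, uA, uY, uB, uU] <;> field_simp
  have l5 := log_eq_5 h
  have l1 := log_eq_1 h
  have hU := uU_pow_eleven h.toUnitRelations
  refine mul_left_cancel₀ (pow_ne_zero 2 hX) (mul_left_cancel₀ hK ?_)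
  have hc := h.curve
  simp only [h.relA, h.relB] at hU g0 g1 g2 g3 g4 ⊢
  generalize uX p = X, uY p = Y, uU p = U at *
  linear_combination (norm := (simp only [cofPoly0, cofPoly1, cofPoly3, cofPoly4, cofPoly5, cofPoly9, logPoly5, logPoly1, crankPoly]; ring1))
    -22 * K * X ^ 2 * (X - 1) * cofPoly0 X (X - 1) Y * g0 + 22 * K * X ^ 2 * (X - 1) * cofPoly5
    X (X - 1) Y * g1 - 22 * K * X ^ 2 * (X - 1) * cofPoly9 X (X - 1) Y * g2 + 22 * K * X ^ 2 *
    (X - 1) * cofPoly1 X (X - 1) Y * g3 - 22 * K * X ^ 2 * (X - 1) * cofPoly3 X (X - 1) Y * g4 -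
    (X - 1) * Y ^ 3 * (X + Y) ^ 2 * U ^ 7 * (X - 1) * cofPoly4 X (X - 1) Y * l5 - (X - 1) * Y ^
    3 * (X + Y) ^ 2 * U ^ 7 * (X - 1) * cofPoly4 X (X - 1) Y * l1 + K * (X + Y) * (X - 1) *
    cofPoly4 X (X - 1) Y * (-logPoly5 X Y - logPoly1 X Y) * hU + K * X ^ 2 * ((-240 * X ^ 4 +
    864 * X ^ 5 + 1540 * X ^ 6 - 13604 * X ^ 7 + 31800 * X ^ 8 - 46808 * X ^ 9 + 80752 * X ^ 10
    - 168324 * X ^ 11 + 270680 * X ^ 12 - 291944 * X ^ 13 + 207624 * X ^ 14 - 93436 * X ^ 15 +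
    22668 * X ^ 16 - 1068 * X ^ 17 - 504 * X ^ 18) + (110 * X + 882 * X ^ 2 - 9462 * X ^ 3 +
    22094 * X ^ 4 + 30174 * X ^ 5 - 275396 * X ^ 6 + 716632 * X ^ 7 - 1132640 * X ^ 8 + 1361072
    * X ^ 9 - 1488520 * X ^ 10 + 1527286 * X ^ 11 - 1279130 * X ^ 12 + 746026 * X ^ 13 - 249986
    * X ^ 14 + 18514 * X ^ 15 + 16788 * X ^ 16 - 4444 * X ^ 17) * Y + (-350 * X - 160 * X ^ 2 +
    11270 * X ^ 3 - 36402 * X ^ 4 + 29340 * X ^ 5 + 57360 * X ^ 6 - 140552 * X ^ 7 + 112034 * X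
    ^ 8 - 97020 * X ^ 9 + 268152 * X ^ 10 - 466858 * X ^ 11 + 433846 * X ^ 12 - 225968 * X ^ 13
    + 61138 * X ^ 14 - 5080 * X ^ 15 - 750 * X ^ 16) * Y ^ 2 + (328 * X + 98 * X ^ 2 - 9972 * X
    ^ 3 + 49058 * X ^ 4 - 138566 * X ^ 5 + 270932 * X ^ 6 - 386176 * X ^ 7 + 402186 * X ^ 8 -
    303010 * X ^ 9 + 168730 * X ^ 10 - 70234 * X ^ 11 + 16182 * X ^ 12 + 1888 * X ^ 13 - 1444 *
    X ^ 14) * Y ^ 3 + (4 * X - 24 * X ^ 2 + 5800 * X ^ 3 - 34518 * X ^ 4 + 86148 * X ^ 5 -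
    117668 * X ^ 6 + 97554 * X ^ 7 - 60246 * X ^ 8 + 45898 * X ^ 9 - 37288 * X ^ 10 + 17202 * X
    ^ 11 - 2860 * X ^ 12 - 2 * X ^ 13) * Y ^ 4) * hc

end Evaluations

section Elimination

lemma cofactor_conv {p d : ℤ → ℝ} {K : ℝ} (h : LogUnitRelations p d K) (m : ZMod 11) :
    cofactor p m + ∑ t ∈ Finset.Icc (1 : ℤ) 5,
        (-1) ^ t * (p (2 * t) / p t) * cofactor p (m - 7 * (t : ZMod 11) ^ 2)
      = if m = 0 then -(discUnit (uX p) (uY p) ^ 5 * uX p * uY p / (uA p ^ 2 * uB p ^ 2))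
        else 0 := by
  obtain ⟨q6, q7, q8, q9, q10, -⟩ := unit_reduce h
  have hu := h.toUnitRelations
  rw [sum_Icc_one_five]
  norm_num [q6, q8, q10]
  have hm : m = 0 ∨ m = 1 ∨ m = 2 ∨ m = 3 ∨ m = 4 ∨ m = 5 ∨ m = 6 ∨ m = 7 ∨ m = 8 ∨ m = 9 ∨ m = 10 := by
    revert m
    decide
  rcases hm with rfl | rfl | rfl | rfl | rfl | rfl | rfl | rfl | rfl | rfl | rfl
  · rw [if_pos rfl, show (0 : ZMod 11) - 7 = 4 from rfl, show (0 : ZMod 11) - 28 = 5 from rfl, show (0 : ZMod 11) - 63 = 3 from rfl, show (0 : ZMod 11) - 112 = 9 from rfl, show (0 : ZMod 11) - 175 = 1 from rfl]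
    linear_combination cofactor_conv_0 hu
  · rw [if_neg (by decide), show (1 : ZMod 11) - 7 = 5 from rfl, show (1 : ZMod 11) - 28 = 6 from rfl, show (1 : ZMod 11) - 63 = 4 from rfl, show (1 : ZMod 11) - 112 = 10 from rfl, show (1 : ZMod 11) - 175 = 2 from rfl]
    linear_combination cofactor_conv_1 hu
  · rw [if_neg (by decide), show (2 : ZMod 11) - 7 = 6 from rfl, show (2 : ZMod 11) - 28 = 7 from rfl, show (2 : ZMod 11) - 63 = 5 from rfl, show (2 : ZMod 11) - 112 = 0 from rfl, show (2 : ZMod 11) - 175 = 3 from rfl]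
    linear_combination cofactor_conv_2 hu
  · rw [if_neg (by decide), show (3 : ZMod 11) - 7 = 7 from rfl, show (3 : ZMod 11) - 28 = 8 from rfl, show (3 : ZMod 11) - 63 = 6 from rfl, show (3 : ZMod 11) - 112 = 1 from rfl, show (3 : ZMod 11) - 175 = 4 from rfl]
    linear_combination cofactor_conv_3 hu
  · rw [if_neg (by decide), show (4 : ZMod 11) - 7 = 8 from rfl, show (4 : ZMod 11) - 28 = 9 from rfl, show (4 : ZMod 11) - 63 = 7 from rfl, show (4 : ZMod 11) - 112 = 2 from rfl, show (4 : ZMod 11) - 175 = 5 from rfl]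
    linear_combination cofactor_conv_4 hu
  · rw [if_neg (by decide), show (5 : ZMod 11) - 7 = 9 from rfl, show (5 : ZMod 11) - 28 = 10 from rfl, show (5 : ZMod 11) - 63 = 8 from rfl, show (5 : ZMod 11) - 112 = 3 from rfl, show (5 : ZMod 11) - 175 = 6 from rfl]
    linear_combination cofactor_conv_5 hu
  · rw [if_neg (by decide), show (6 : ZMod 11) - 7 = 10 from rfl, show (6 : ZMod 11) - 28 = 0 from rfl, show (6 : ZMod 11) - 63 = 9 from rfl, show (6 : ZMod 11) - 112 = 4 from rfl, show (6 : ZMod 11) - 175 = 7 from rfl]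
    linear_combination cofactor_conv_6 hu
  · rw [if_neg (by decide), show (7 : ZMod 11) - 7 = 0 from rfl, show (7 : ZMod 11) - 28 = 1 from rfl, show (7 : ZMod 11) - 63 = 10 from rfl, show (7 : ZMod 11) - 112 = 5 from rfl, show (7 : ZMod 11) - 175 = 8 from rfl]
    linear_combination cofactor_conv_7 hu
  · rw [if_neg (by decide), show (8 : ZMod 11) - 7 = 1 from rfl, show (8 : ZMod 11) - 28 = 2 from rfl, show (8 : ZMod 11) - 63 = 0 from rfl, show (8 : ZMod 11) - 112 = 6 from rfl, show (8 : ZMod 11) - 175 = 9 from rfl]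
    linear_combination cofactor_conv_8 hu
  · rw [if_neg (by decide), show (9 : ZMod 11) - 7 = 2 from rfl, show (9 : ZMod 11) - 28 = 3 from rfl, show (9 : ZMod 11) - 63 = 1 from rfl, show (9 : ZMod 11) - 112 = 7 from rfl, show (9 : ZMod 11) - 175 = 10 from rfl]
    linear_combination cofactor_conv_9 hu
  · rw [if_neg (by decide), show (10 : ZMod 11) - 7 = 3 from rfl, show (10 : ZMod 11) - 28 = 4 from rfl, show (10 : ZMod 11) - 63 = 2 from rfl, show (10 : ZMod 11) - 112 = 8 from rfl, show (10 : ZMod 11) - 175 = 0 from rfl]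
    linear_combination cofactor_conv_10 hu

lemma sum_mul_of_conv {g f L : ZMod 11 → ℝ} {x : ℤ → ℝ} {c N : ℝ}
    (hg : ∀ m, g m + ∑ t ∈ Finset.Icc (1 : ℤ) 5, x t * g (m - 7 * (t : ZMod 11) ^ 2)
      = if m = 0 then N else 0)
    (hf : ∀ r, c * (f (r - 5) + ∑ t ∈ Finset.Icc (1 : ℤ) 5,
      x t * f (r - (5 + 7 * (t : ZMod 11) ^ 2))) = L r) :
    ∑ r, g (4 - r) * L r = c * (N * f 10) := by
  have hs : ∀ a : ZMod 11, ∑ r, g (4 - r) * f (r - (5 + a)) = ∑ s, g (10 - s - a) * f s := by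
    intro a
    refine Fintype.sum_equiv (Equiv.subRight (5 + a)) _ _ fun r => ?_
    have h11 : (11 : ZMod 11) = 0 := rfl
    rw [Equiv.subRight_apply, show (4 : ZMod 11) - r = 10 - (r - (5 + a)) - a by
      linear_combination -h11]
  have hs0 := hs 0
  rw [add_zero] at hs0
  calc ∑ r, g (4 - r) * L r
      = c * (∑ r, g (4 - r) * f (r - 5) + ∑ t ∈ Finset.Icc (1 : ℤ) 5,
          x t * ∑ r, g (4 - r) * f (r - (5 + 7 * (t : ZMod 11) ^ 2))) := by
        simp only [← hf, mul_add, Finset.sum_add_distrib, Finset.mul_sum]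
        rw [Finset.sum_comm]
        congr 1
        · exact Finset.sum_congr rfl fun _ _ => by ring
        · exact Finset.sum_congr rfl fun _ _ => Finset.sum_congr rfl fun _ _ => by ring
    _ = c * ∑ s, (g (10 - s) + ∑ t ∈ Finset.Icc (1 : ℤ) 5,
          x t * g (10 - s - 7 * (t : ZMod 11) ^ 2)) * f s := by
        simp only [hs0, hs, add_mul, Finset.sum_add_distrib, Finset.mul_sum, Finset.sum_mul,
          sub_zero]
        congr 2
        rw [Finset.sum_comm]
        exact Finset.sum_congr rfl fun _ _ => Finset.sum_congr rfl fun _ _ => by ring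
    _ = c * (N * f 10) := by
        simp only [hg, sub_eq_zero, ite_mul, zero_mul]
        rw [Finset.sum_ite_eq Finset.univ (10 : ZMod 11) fun s => N * f s]
        simp

/-- The value of the cofactor on a combination of rank and crank components. -/
def combPoly (v₀ v₁ v₂ v₄ v₅ m₀ m₃ X Y : ℝ) : ℝ :=
  -(2 * v₀ - v₁) * rankPoly2 X Y + (v₁ - v₂) * rankPoly5 X Y + -(v₂ - v₄) * rankPoly3 X Y
    + (v₄ - v₅) * rankPoly4 X Y + (4 * m₀ - 18 * m₃) * crankPoly X Y

lemma extraComb_eval {q : ℝ}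
    (h : LogUnitRelations (unitP q) (unitD q) (eulerProd (q ^ 121) ^ 2))
    {v₀ v₁ v₂ v₄ v₅ m₀ m₃ : ℤ} (hv : v₀ + v₁ + 2 * v₂ + v₄ + v₅ + m₀ + m₃ = 0) :
    22 * uA (unitP q) * unitP q 5
        * ∑ r, cofactor (unitP q) (4 - r) * extraComb q v₀ v₁ v₂ v₄ v₅ m₀ m₃ r
      = eulerProd (q ^ 121) ^ 2 * uX (unitP q)
        * combPoly v₀ v₁ v₂ v₄ v₅ m₀ m₃ (uX (unitP q)) (uY (unitP q)) := by
  have r : ∀ s : ℤ, ∑ r, cofactor (unitP q) (4 - r) * rankExtra q s r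
      = ∑ t ∈ Finset.Icc (1 : ℤ) 5, rankVec (unitP q) (unitD q) (eulerProd (q ^ 121) ^ 2) s t
        * cofactor (unitP q) (4 - (-7 * (s : ZMod 11) ^ 2 + 7 * (t : ZMod 11) ^ 2)) := fun s =>
    (sum_cofactor_spread _ _ _ _ _ _).trans (by rw [zero_mul, zero_add]; rfl)
  have c : ∀ s : ℤ, ∑ r, cofactor (unitP q) (4 - r) * crankExtra q s r
      = (-1) ^ s * (eulerProd (q ^ 121) ^ 2 / unitP q s)
          * cofactor (unitP q) (4 - -6 * (s : ZMod 11) ^ 2)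
        + ∑ t ∈ Finset.Icc (1 : ℤ) 5, crankVec (unitP q) (unitD q) (eulerProd (q ^ 121) ^ 2) s t
          * cofactor (unitP q) (4 - (-6 * (s : ZMod 11) ^ 2 + 6 * (t : ZMod 11) ^ 2)) := fun s =>
    sum_cofactor_spread _ _ _ _ _ _
  have e2 := rankVec_eval_2 h
  have e3 := rankVec_eval_3 h
  have e4 := rankVec_eval_4 h
  have e5 := rankVec_eval_5 h
  have k2 := crankVec_eval_2 h
  have k3 := crankVec_eval_3 h
  have k5 := crankVec_eval_5 h
  rw [← r] at e2 e3 e4 e5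
  rw [← c] at k2 k3 k5
  have hs : ∑ r, cofactor (unitP q) (4 - r) * (Pi.single 0 (v₀ + m₀ : ℝ) : ZMod 11 → ℝ) r
      = (v₀ + m₀) * cofactor (unitP q) 4 := by
    simp [Pi.single_apply, mul_comm]
  have hv' : (v₀ + v₁ + 2 * v₂ + v₄ + v₅ + m₀ + m₃ : ℝ) = 0 := by exact_mod_cast hv
  simp only [extraComb, Pi.add_apply, Pi.smul_apply, smul_eq_mul, mul_add,
    Finset.sum_add_distrib, mul_left_comm (cofactor _ _), ← Finset.mul_sum]
  rw [hs, combPoly]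
  linear_combination (-(2 * v₀ - v₁) : ℝ) * e2 + (v₁ - v₂ : ℝ) * e5 - (v₂ - v₄ : ℝ) * e3
    + (v₄ - v₅ : ℝ) * e4 + (2 * m₀ : ℝ) * k5 - (m₃ : ℝ) * k3 + (m₃ : ℝ) * k2
    + 2 * uA (unitP q) * unitP q 5 * cofactor (unitP q) 4 * hv'

lemma combPoly_first {X Y : ℝ} (hc : Y ^ 2 + Y = X ^ 3 - X ^ 2) :
    combPoly 0 3 (-2) (-1) 2 (-2) 2 X Y * ((X + Y) ^ 2) = 242 * (X * Y) * discUnit X Y ^ 4 := by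
  linear_combination (norm := (simp only [combPoly, rankPoly2, rankPoly3, rankPoly4, rankPoly5, crankPoly, discUnit]; ring1))
    ((-242 * X - 2420 * X ^ 2 - 3388 * X ^ 3 + 18392 * X ^ 4 + 60258 * X ^ 5 - 236676 * X ^ 6 +
    275638 * X ^ 7 - 125356 * X ^ 8 + 10406 * X ^ 9 + 3388 * X ^ 10) + (-1936 * X - 8470 * X ^ 2
    + 16456 * X ^ 3 + 148588 * X ^ 4 - 494648 * X ^ 5 + 586850 * X ^ 6 - 288706 * X ^ 7 + 39204
    * X ^ 8 + 1936 * X ^ 9 + 242 * X ^ 10) * Y + (-3872 * X - 3872 * X ^ 2 + 108416 * X ^ 3 -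
    312664 * X ^ 4 + 368082 * X ^ 5 - 182952 * X ^ 6 + 26136 * X ^ 7) * Y ^ 2 + (-3872 * X +
    23232 * X ^ 2 - 52272 * X ^ 3 + 52272 * X ^ 4 - 19602 * X ^ 5) * Y ^ 3) * hc

lemma combPoly_second {X Y : ℝ} (hc : Y ^ 2 + Y = X ^ 3 - X ^ 2) :
    combPoly 3 (-3) 1 (-2) 0 1 (-1) X Y * ((X + Y) ^ 3) = 242 * (X * (X - 1) ^ 2 * Y) * discUnit X Y ^ 4 := by
  linear_combination (norm := (simp only [combPoly, rankPoly2, rankPoly3, rankPoly4, rankPoly5, crankPoly, discUnit]; ring1))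
    ((-242 * X - 2178 * X ^ 2 - 968 * X ^ 3 + 28314 * X ^ 4 + 12342 * X ^ 5 - 212234 * X ^ 6 +
    310728 * X ^ 7 - 110836 * X ^ 8 - 88814 * X ^ 9 + 82280 * X ^ 10 - 18392 * X ^ 11 - 242 * X
    ^ 12) + (-2420 * X - 8954 * X ^ 2 + 42592 * X ^ 3 + 91718 * X ^ 4 - 522236 * X ^ 5 + 727694
    * X ^ 6 - 352110 * X ^ 7 - 47674 * X ^ 8 + 84942 * X ^ 9 - 8470 * X ^ 10 - 5808 * X ^ 11 +
    242 * X ^ 12) * Y + (-242 - 6050 * X + 9438 * X ^ 2 + 104544 * X ^ 3 - 406802 * X ^ 4 +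
    603306 * X ^ 5 - 429308 * X ^ 6 + 134552 * X ^ 7 - 10164 * X ^ 8 + 4114 * X ^ 9 - 3630 * X ^
    10) * Y ^ 2 + (-3872 * X + 30976 * X ^ 2 - 102608 * X ^ 3 + 180048 * X ^ 4 - 176418 * X ^ 5
    + 91476 * X ^ 6 - 19602 * X ^ 7) * Y ^ 3) * hc

lemma combPoly_third {X Y : ℝ} (hc : Y ^ 2 + Y = X ^ 3 - X ^ 2) :
    combPoly (-1) 2 (-1) 4 (-3) (-1) 1 X Y * ((X + Y) ^ 2) = 242 * ((X - 1) * Y) * discUnit X Y ^ 4 := by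
  linear_combination (norm := (simp only [combPoly, rankPoly2, rankPoly3, rankPoly4, rankPoly5, crankPoly, discUnit]; ring1))
    ((242 + 2178 * X + 968 * X ^ 2 - 21780 * X ^ 3 - 41866 * X ^ 4 + 296934 * X ^ 5 - 512314 * X
    ^ 6 + 400994 * X ^ 7 - 135762 * X ^ 8 + 7018 * X ^ 9 + 3388 * X ^ 10) + (1936 + 6534 * X -
    24926 * X ^ 2 - 132132 * X ^ 3 + 643236 * X ^ 4 - 1081498 * X ^ 5 + 875556 * X ^ 6 - 327910
    * X ^ 7 + 37268 * X ^ 8 + 1694 * X ^ 9 + 242 * X ^ 10) * Y + (3872 - 112288 * X ^ 2 + 421080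
    * X ^ 3 - 680746 * X ^ 4 + 551034 * X ^ 5 - 209088 * X ^ 6 + 26136 * X ^ 7) * Y ^ 2 + (3872
    - 27104 * X + 75504 * X ^ 2 - 104544 * X ^ 3 + 71874 * X ^ 4 - 19602 * X ^ 5) * Y ^ 3) * hc

lemma combPoly_fourth {X Y : ℝ} (hc : Y ^ 2 + Y = X ^ 3 - X ^ 2) :
    combPoly (-6) (-6) 6 (-3) (-8) 6 5 X Y * ((X - 1) * (X + Y)) = 242 * (Y) * discUnit X Y ^ 4 := by
  linear_combination (norm := (simp only [combPoly, rankPoly2, rankPoly3, rankPoly4, rankPoly5, crankPoly, discUnit]; ring1))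
    ((-242 - 2420 * X + 3146 * X ^ 2 - 11132 * X ^ 3 + 144958 * X ^ 4 - 438262 * X ^ 5 + 565796
    * X ^ 6 - 349932 * X ^ 7 + 99704 * X ^ 8 - 11616 * X ^ 9 - 242 * X ^ 10) + (-1936 - 1936 * X
    - 13068 * X ^ 2 + 233288 * X ^ 3 - 696234 * X ^ 4 + 877008 * X ^ 5 - 513282 * X ^ 6 + 128502
    * X ^ 7 - 13068 * X ^ 8) * Y + (-3872 - 3872 * X + 108416 * X ^ 2 - 312664 * X ^ 3 + 368082
    * X ^ 4 - 182952 * X ^ 5 + 26136 * X ^ 6) * Y ^ 2 + (-3872 + 23232 * X - 52272 * X ^ 2 +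
    52272 * X ^ 3 - 19602 * X ^ 4) * Y ^ 3) * hc

end Elimination

section Duplication

variable {Q : ℝ}

lemma multipliable_poch (h0 : 0 < Q) (h1 : Q < 1) (x : ℝ) :
    Multipliable fun i : ℕ => 1 - x * Q ^ i := by
  have : Summable fun i : ℕ => ‖-(x * Q ^ i)‖ := by
    simp_rw [norm_neg, norm_mul, norm_pow]
    exact (summable_geometric_of_lt_one (norm_nonneg _) (norm_lt_one_of_pos h0 h1)).mul_left _
  simpa only [sub_eq_add_neg] using multipliable_one_add_of_summable this

lemma poch_mul_poch_neg (h0 : 0 < Q) (h1 : Q < 1) (x : ℝ) :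
    poch Q x * poch Q (-x) = poch (Q ^ 2) (x ^ 2) := by
  rw [poch, poch, poch, ← (multipliable_poch h0 h1 x).tprod_mul (multipliable_poch h0 h1 (-x))]
  exact tprod_congr fun i => by ring

lemma poch_sq_mul_poch_sq (h0 : 0 < Q) (h1 : Q < 1) (x : ℝ) :
    poch (Q ^ 2) x * poch (Q ^ 2) (x * Q) = poch Q x := by
  have m : ∀ y : ℝ, Multipliable fun i : ℕ => 1 - y * (Q ^ 2) ^ i :=
    multipliable_poch (pow_pos h0 2) (pow_lt_one₀ h0.le h1 two_ne_zero)
  have e : ∀ i : ℕ, 1 - x * (Q ^ 2) ^ i = 1 - x * Q ^ (2 * i) := fun i => by rw [pow_mul]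
  have o : ∀ i : ℕ, 1 - x * Q * (Q ^ 2) ^ i = 1 - x * Q ^ (2 * i + 1) := fun i => by ring
  rw [poch, poch, poch, tprod_congr e, tprod_congr o]
  exact tprod_even_mul_odd (f := fun i : ℕ => 1 - x * Q ^ i) ((multipliable_congr e).1 (m x))
    ((multipliable_congr o).1 (m (x * Q)))

/-- The duplication formula over a square root `s` of the nome. -/
theorem theta_duplication (h0 : 0 < Q) (h1 : Q < 1) {s a : ℝ} (hs : s ^ 2 = Q) (ha : a ≠ 0) :
    theta Q a * theta Q (-a) * theta Q (a * s) * theta Q (-(a * s))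
      = eulerProd Q ^ 3 * theta Q (a ^ 2) := by
  have s0 : s ≠ 0 := fun h => h0.ne' (by rw [← hs, h]; norm_num)
  have has := mul_ne_zero ha s0
  have k : Q * (a * s)⁻¹ = s * a⁻¹ := by
    rw [← hs]
    field_simp
  have p1 := poch_mul_poch_neg h0 h1 a
  have p2 := poch_mul_poch_neg h0 h1 (Q * a⁻¹)
  have p3 := poch_mul_poch_neg h0 h1 (a * s)
  have p4 := poch_mul_poch_neg h0 h1 (s * a⁻¹)
  have p5 := poch_sq_mul_poch_sq h0 h1 (a ^ 2)
  have p6 := poch_sq_mul_poch_sq h0 h1 (Q * (a ^ 2)⁻¹)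
  rw [mul_pow, hs] at p3
  rw [mul_pow, hs, inv_pow] at p4
  rw [show Q * (a ^ 2)⁻¹ * Q = (Q * a⁻¹) ^ 2 by ring] at p6
  rw [theta_eq_poch h0 h1 ha, theta_eq_poch h0 h1 (neg_ne_zero.2 ha), theta_eq_poch h0 h1 has,
    theta_eq_poch h0 h1 (neg_ne_zero.2 has), theta_eq_poch h0 h1 (pow_ne_zero 2 ha), inv_neg,
    inv_neg, k, mul_neg, mul_neg, k, ← p5, ← p6, ← p1, ← p2, ← p3, ← p4]
  ring

theorem theta_two_torsion (h0 : 0 < Q) (h1 : Q < 1) {s : ℝ} (hs : s ^ 2 = Q) :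
    theta Q (-1) * theta Q s * theta Q (-s) = 2 * eulerProd Q ^ 3 := by
  have s0 : s ≠ 0 := fun h => h0.ne' (by rw [← hs, h]; norm_num)
  have k : Q * s⁻¹ = s := by
    rw [← hs]
    field_simp
  have n1 : (-1 : ℝ) ≠ 0 := by norm_num
  have p1 := poch_mul_poch_neg h0 h1 Q
  have p2 := poch_mul_poch_neg h0 h1 s
  have p3 := poch_sq_mul_poch_sq h0 h1 Q
  have n : poch Q Q ≠ 0 := by
    rw [poch_self]
    exact eulerProd_ne_zero (norm_lt_one_of_pos h0 h1)
  rw [hs] at p2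
  rw [← p2, ← sq Q, ← p1] at p3
  have p4 : poch Q s * poch Q (-s) * poch Q (-Q) = 1 := mul_left_cancel₀ n (by linear_combination p3)
  rw [theta_eq_poch h0 h1 n1, theta_eq_poch h0 h1 s0, theta_eq_poch h0 h1 (neg_ne_zero.2 s0),
    inv_neg, inv_neg, mul_neg, mul_neg, k, poch_step h0 h1 n1, neg_one_mul, inv_one, mul_one]
  linear_combination 2 * eulerProd Q ^ 3
    * (poch Q s * poch Q (-s) * poch Q (-Q) + 1) * p4

lemma bracket_neg_one (h0 : 0 < Q) (h1 : Q < 1) {a : ℝ} (ha : a ≠ 0) :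
    bracket Q a (-1) = theta Q (-a) ^ 2 / a := by
  have := theta_mul_theta h0 h1 ha (neg_ne_zero.2 one_ne_zero)
  rw [eq_div_iff ha, mul_comm, ← this, div_neg, div_one, mul_neg, mul_one, sq]

lemma bracket_sqrt (h0 : 0 < Q) (h1 : Q < 1) {s a : ℝ} (hs : s ^ 2 = Q) (ha : a ≠ 0) :
    bracket Q a s = -theta Q (a * s) ^ 2 / s := by
  have s0 : s ≠ 0 := fun h => h0.ne' (by rw [← hs, h]; norm_num)
  have has := mul_ne_zero ha s0
  have := theta_mul_theta h0 h1 ha s0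
  have k := theta_mul_zpow h0 has (-1)
  rw [show a * s * Q ^ (-1 : ℤ) = a / s by rw [zpow_neg_one, ← hs]; field_simp] at k
  rw [k] at this
  norm_num [tri] at this
  rw [← mul_right_inj' ha, ← this, show Q⁻¹ = (s ^ 2)⁻¹ by rw [hs]]
  field_simp

end Duplication

section Instance

variable {q : ℝ}

lemma bracket_eq_unitP (h0 : 0 < q) (h1 : q < 1) (i j : ℤ) :
    bracket (q ^ 121) (q ^ (11 * i)) (q ^ (11 * j)) = q ^ (-(i * i) - j * j)
      * (eulerProd (q ^ 121) ^ 2 * (unitP q (i + j) * unitP q (i - j))) := by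
  have hi := (zpow_pos h0 (11 * i)).ne'
  have := theta_mul_theta (base_pos h0) (base_lt_one h0 h1) hi (zpow_pos h0 (11 * j)).ne'
  rw [← zpow_add₀ h0.ne', ← zpow_sub₀ h0.ne', ← mul_add, ← mul_sub, theta_eq_unitP h0 h1,
    theta_eq_unitP h0 h1] at this
  have e : q ^ (11 * i) * q ^ (-(i * i) - j * j)
      = q ^ (-(tri (i + j) - 5 * (i + j))) * q ^ (-(tri (i - j) - 5 * (i - j))) := by
    rw [← zpow_add₀ h0.ne', ← zpow_add₀ h0.ne']
    congr 1
    linarith [two_mul_tri (i + j), two_mul_tri (i - j)]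
  rw [← mul_right_inj' hi, ← this]
  linear_combination (-(eulerProd (q ^ 121) ^ 2 * (unitP q (i + j) * unitP q (i - j)))) * e

lemma unitP_plucker (h0 : 0 < q) (h1 : q < 1) (a b c d : ℤ) :
    unitP q (a + b) * unitP q (a - b) * (unitP q (c + d) * unitP q (c - d))
      - unitP q (a + c) * unitP q (a - c) * (unitP q (b + d) * unitP q (b - d))
      + unitP q (a + d) * unitP q (a - d) * (unitP q (b + c) * unitP q (b - c)) = 0 := by
  have key := bracket_plucker (Q := q ^ 121) (q ^ (11 * a)) (q ^ (11 * b)) (q ^ (11 * c))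
    (q ^ (11 * d))
  have e : ∀ i j : ℤ, q ^ (-(i * i) - j * j) = q ^ (-(i * i)) * q ^ (-(j * j)) := fun i j => by
    rw [← zpow_add₀ h0.ne', sub_eq_add_neg]
  simp only [bracket_eq_unitP h0 h1, e] at key
  have ne : q ^ (-(a * a)) * q ^ (-(b * b)) * q ^ (-(c * c)) * q ^ (-(d * d))
      * eulerProd (q ^ 121) ^ 4 ≠ 0 := by
    have := base_euler_ne h0 h1
    positivity
  refine mul_left_cancel₀ ne ?_
  linear_combination key

lemma unitP_reduce (h0 : 0 < q) : unitP q 6 = unitP q 5 ∧ unitP q 7 = unitP q 4 ∧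
    unitP q 8 = unitP q 3 ∧ unitP q 9 = unitP q 2 ∧ unitP q (-1) = -unitP q 1 ∧
    unitP q (-2) = -unitP q 2 ∧ unitP q (-3) = -unitP q 3 ∧ unitP q (-4) = -unitP q 4 ∧
    unitP q (-5) = -unitP q 5 := by
  have e : ∀ k, unitP q (11 - k) = unitP q k := fun k => by
    rw [sub_eq_neg_add, unitP_add_eleven h0, unitP_neg h0, neg_neg]
  exact ⟨e 5, e 4, e 3, e 2, unitP_neg h0 1, unitP_neg h0 2, unitP_neg h0 3, unitP_neg h0 4,
    unitP_neg h0 5⟩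

/-- The three term relations that pin down the modular curve of level `11`. -/
lemma unitP_quartics (h0 : 0 < q) (h1 : q < 1) :
    unitP q 4 ^ 3 * unitP q 5 = unitP q 3 * unitP q 5 ^ 3 + unitP q 1 ^ 3 * unitP q 2 ∧
    unitP q 3 ^ 2 * unitP q 4 * unitP q 5
      = unitP q 2 * unitP q 4 * unitP q 5 ^ 2 + unitP q 1 ^ 2 * unitP q 2 * unitP q 3 ∧
    unitP q 2 ^ 2 * unitP q 4 * unitP q 5
      = unitP q 1 * unitP q 3 * unitP q 5 ^ 2 + unitP q 1 ^ 2 * unitP q 3 * unitP q 4 := by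
  obtain ⟨e6, e7, e8, e9, m1, m2, m3, m4, m5⟩ := unitP_reduce h0
  have r1 := unitP_plucker h0 h1 0 1 4 5
  have r2 := unitP_plucker h0 h1 0 1 3 5
  have r3 := unitP_plucker h0 h1 0 1 2 5
  norm_num [e6, e7, e8, e9, m1, m2, m3, m4, m5] at r1 r2 r3
  exact ⟨by linear_combination -r1, by linear_combination -r2, by linear_combination -r3⟩

lemma unitD_add_formula (h0 : 0 < q) (h1 : q < 1) {i j : ℤ} (hj : ¬11 ∣ j)
    (hp : ¬11 ∣ i + j) (hm : ¬11 ∣ i - j) : unitD q (j + i) + unitD q (j - i) - 2 * unitD q j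
      = eulerProd (q ^ 121) ^ 2 * (unitP q (2 * j) * unitP q i ^ 2
        / (unitP q j ^ 2 * unitP q (j + i) * unitP q (i - j))) := by
  have := logTheta_add (base_pos h0) (base_lt_one h0 h1) (zpow_pos h0 (11 * i))
    (zpow_pos h0 (11 * j)) (offLattice_zpow h0 h1 hj)
    (by rw [← zpow_add₀ h0.ne', ← mul_add]; exact offLattice_zpow h0 h1 hp)
    (by rw [← zpow_sub₀ h0.ne', ← mul_sub]; exact offLattice_zpow h0 h1 hm)
  rw [← zpow_add₀ h0.ne', ← zpow_sub₀ h0.ne', ← zpow_sub₀ h0.ne', ← zpow_natCast _ 2, ← zpow_mul,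
    ← mul_add, ← mul_sub, ← mul_sub, show 11 * j * ((2 : ℕ) : ℤ) = 11 * (2 * j) by push_cast; ring,
    theta_eq_unitP h0 h1, theta_eq_unitP h0 h1, theta_eq_unitP h0 h1, theta_eq_unitP h0 h1,
    theta_eq_unitP h0 h1, add_comm i j] at this
  have e : q ^ (-(tri (2 * j) - 5 * (2 * j))) * (q ^ (-(tri i - 5 * i))) ^ 2
      = (q ^ (-(tri j - 5 * j))) ^ 2 * q ^ (-(tri (j + i) - 5 * (j + i)))
        * q ^ (-(tri (i - j) - 5 * (i - j))) := by
    rw [sq, sq, ← zpow_add₀ h0.ne', ← zpow_add₀ h0.ne', ← zpow_add₀ h0.ne', ← zpow_add₀ h0.ne',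
      ← zpow_add₀ h0.ne']
    congr 1
    linarith [two_mul_tri (2 * j), two_mul_tri i, two_mul_tri j, two_mul_tri (j + i),
      two_mul_tri (i - j)]
  have n1 := unitP_ne_zero h0 h1 hj
  have n2 := unitP_ne_zero h0 h1 hp
  have n3 := unitP_ne_zero h0 h1 hm
  have nJ := base_euler_ne h0 h1
  rw [add_comm] at n2
  have p1 := zpow_pos h0 (-(tri j - 5 * j))
  have p2 := zpow_pos h0 (-(tri (j + i) - 5 * (j + i)))
  have p3 := zpow_pos h0 (-(tri (i - j) - 5 * (i - j)))
  rw [unitD, unitD, unitD]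
  push_cast
  refine Eq.trans (by ring) (this.trans ?_)
  rw [← mul_div_assoc, div_eq_div_iff (by positivity) (by positivity)]
  linear_combination (eulerProd (q ^ 121) ^ 6 * unitP q (2 * j) * unitP q i ^ 2
    * (unitP q j ^ 2 * unitP q (j + i) * unitP q (i - j))) * e

theorem logUnitRelations (h0 : 0 < q) (h1 : q < 1) :
    LogUnitRelations (unitP q) (unitD q) (eulerProd (q ^ 121) ^ 2) := by
  obtain ⟨r1, r2, r3⟩ := unitP_quartics h0 h1
  have ne : ∀ n, 1 ≤ n → n ≤ 5 → unitP q n ≠ 0 := fun n _ _ => unitP_ne_zero h0 h1 (by omega)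
  have n1 := ne 1 (by norm_num) (by norm_num)
  have n2 := ne 2 (by norm_num) (by norm_num)
  have n3 := ne 3 (by norm_num) (by norm_num)
  have n4 := ne 4 (by norm_num) (by norm_num)
  have n5 := ne 5 (by norm_num) (by norm_num)
  have hA : uA (unitP q) = uX (unitP q) - 1 := by
    simp only [uA, uX]
    field_simp
    linear_combination -r2
  refine ⟨⟨ne, hA, ?_, ?_⟩, unitP_neg h0, unitP_add_eleven h0, fun n hn => unitD_neg h0 h1 hn,
    fun n hn => unitD_add_eleven h0 h1 hn, fun i j _ hj hp hm => unitD_add_formula h0 h1 hj hp hm⟩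
  · simp only [uB, uX, uY]
    field_simp
    linear_combination r3
  · have hY : uY (unitP q) + 1
        = unitP q 4 ^ 3 * unitP q 5 / (unitP q 1 ^ 3 * unitP q 2) := by
      simp only [uY]
      field_simp
      linear_combination -r1
    have : uY (unitP q) * (uY (unitP q) + 1) = uX (unitP q) ^ 2 * uA (unitP q) := by
      rw [hY]
      simp only [uA, uX, uY]
      field_simp
    rw [hA] at this
    linear_combination this

end Instance

/-- The discriminant of the binary cubic whose values give the `2`-torsion of the level `11` Tate
curve. -/
lemma cubic_discriminant {X Y e₀ e₁ e₂ e₃ : ℝ} (hc : Y ^ 2 + Y = X ^ 3 - X ^ 2) (hX : X ≠ 0)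
    (hA : X - 1 ≠ 0) (hY : Y ≠ 0) (hB : X + Y ≠ 0) (h₃ : e₃ * Y ^ 3 = -(X ^ 4 * (X - 1) * e₀))
    (v₃ : (e₀ + e₁ + e₂ + e₃) * (X + Y) = -(X * e₀))
    (v₄ : (e₀ * (X + Y) ^ 3 + Y * (X + Y) ^ 2 * e₁ + Y ^ 2 * (X + Y) * e₂ + Y ^ 3 * e₃)
      * (X - 1) ^ 2 = -(X ^ 2 * Y * (X + Y) * e₀)) :
    (e₁ ^ 2 * e₂ ^ 2 - 4 * e₀ * e₂ ^ 3 - 4 * e₁ ^ 3 * e₃ + 18 * e₀ * e₁ * e₂ * e₃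
      - 27 * e₀ ^ 2 * e₃ ^ 2) * ((X - 1) ^ 2 * Y ^ 3 * (X + Y) ^ 2)
      = -(16 * X ^ 5 * discUnit X Y * e₀ ^ 4) := by
  obtain ⟨k1, d1⟩ : ∃ k, k = (2 - 3 * X) + (2 - 2 * X - X ^ 2) * Y := ⟨_, rfl⟩
  obtain ⟨k2, d2⟩ : ∃ k, k = (1 - 2 * X - X ^ 2 + 5 * X ^ 3 - X ^ 4) + (1 - 2 * X + 2 * X ^ 3) * Y := ⟨_, rfl⟩
  obtain ⟨k3, d3⟩ : ∃ k, k = (-1 + 2 * X ^ 2 - 2 * X ^ 3) + (-1 + X ^ 2 - X ^ 3) * Y := ⟨_, rfl⟩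
  have t₃ : X ^ 2 * (X - 1) ^ 2 * e₃ = k3 * e₀ := by
    refine mul_left_cancel₀ (pow_ne_zero 3 hY) ?_
    rw [d3]
    linear_combination X ^ 2 * (X - 1) ^ 2 * h₃
      - e₀ * (
        (-X ^ 4 + 2 * X ^ 5 - X ^ 6) + (X ^ 2 - X ^ 3) * Y + (-1 + X ^ 2 - X ^ 3) * Y ^ 2) * hc
  have w₃ : X * (X * (X - 1) ^ 2 * e₁ - k1 * e₀) + (X ^ 2 * (X - 1) ^ 2 * e₂ - k2 * e₀) = 0 := by
    refine mul_left_cancel₀ hB ?_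
    linear_combination (norm := (simp only [d1, d2, d3]; ring1)) X ^ 2 * (X - 1) ^ 2 * v₃
      - (X + Y) * t₃ - e₀ * (
        (-X ^ 2)) * hc
  have w₄ : (X + Y) * X * (X * (X - 1) ^ 2 * e₁ - k1 * e₀)
      + Y * (X ^ 2 * (X - 1) ^ 2 * e₂ - k2 * e₀) = 0 := by
    refine mul_left_cancel₀ (mul_ne_zero hY hB) ?_
    linear_combination (norm := (simp only [d1, d2, d3]; ring1)) X ^ 2 * v₄ - Y ^ 3 * t₃
      - e₀ * (
        (X ^ 3 - X ^ 4) + (X + 2 * X ^ 2 - 3 * X ^ 3) * Y + (-X ^ 2) * Y ^ 2) * hc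
  have t₁ : X * (X - 1) ^ 2 * e₁ = k1 * e₀ :=
    mul_left_cancel₀ (pow_ne_zero 2 hX) (by linear_combination w₄ - Y * w₃)
  have t₂ : X ^ 2 * (X - 1) ^ 2 * e₂ = k2 * e₀ := by linear_combination w₃ - X * t₁
  rw [mul_comm, ← eq_div_iff (by positivity)] at t₁ t₂ t₃
  have key : (k1 ^ 2 * k2 ^ 2 - 4 * k2 ^ 3 * (X - 1) ^ 2 - 4 * k1 ^ 3 * k3 * X
      + 18 * k1 * k2 * k3 * X * (X - 1) ^ 2 - 27 * k3 ^ 2 * X ^ 2 * (X - 1) ^ 4)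
      * (Y ^ 3 * (X + Y) ^ 2) = -(16 * X ^ 11 * (X - 1) ^ 6 * discUnit X Y) := by
    linear_combination (norm := (simp only [d1, d2, d3, discUnit]; ring1)) (
        (-16 * X ^ 9 + 48 * X ^ 10 + 80 * X ^ 11 - 576 * X ^ 12 + 1120 * X ^ 13 - 1104 * X ^ 14
        + 592 * X ^ 15 - 160 * X ^ 16 + 16 * X ^ 17) + (16 * X ^ 7 - 32 * X ^ 8 - 144 * X ^ 9 +
        672 * X ^ 10 - 1216 * X ^ 11 + 1248 * X ^ 12 - 784 * X ^ 13 + 288 * X ^ 14 - 48 * X ^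
        15) * Y + (-16 * X ^ 5 + 16 * X ^ 6 + 176 * X ^ 7 - 544 * X ^ 8 + 592 * X ^ 9 - 80 * X ^
        10 - 416 * X ^ 11 + 400 * X ^ 12 - 144 * X ^ 13 + 16 * X ^ 14) * Y ^ 2 + (4 * X ^ 2 + 8
        * X ^ 3 - 80 * X ^ 4 - 48 * X ^ 5 + 484 * X ^ 6 - 360 * X ^ 7 - 383 * X ^ 8 + 563 * X ^
        9 - 196 * X ^ 10 - 8 * X ^ 11 + 16 * X ^ 12 - 4 * X ^ 13) * Y ^ 3 + (8 * X + 24 * X ^ 2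
        - 96 * X ^ 3 - 176 * X ^ 4 + 380 * X ^ 5 + 421 * X ^ 6 - 658 * X ^ 7 - 562 * X ^ 8 +
        1072 * X ^ 9 - 468 * X ^ 10 + 24 * X ^ 11 + 16 * X ^ 12) * Y ^ 4 + (4 + 24 * X - 12 * X
        ^ 2 - 216 * X ^ 3 + 28 * X ^ 4 + 646 * X ^ 5 - 150 * X ^ 6 - 857 * X ^ 7 + 568 * X ^ 8 +
        88 * X ^ 9 - 184 * X ^ 10 + 40 * X ^ 11) * Y ^ 5 + (8 + 24 * X - 80 * X ^ 2 - 108 * X ^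
        3 + 237 * X ^ 4 + 174 * X ^ 5 - 320 * X ^ 6 - 80 * X ^ 7 + 252 * X ^ 8 - 136 * X ^ 9 +
        16 * X ^ 10) * Y ^ 6 + (4 + 8 * X - 48 * X ^ 2 + 4 * X ^ 3 + 113 * X ^ 4 - 92 * X ^ 5 -
        4 * X ^ 6 + 24 * X ^ 7 - 8 * X ^ 8 - 4 * X ^ 9) * Y ^ 7) * hc
  rw [t₁, t₂, t₃]
  field_simp
  linear_combination e₀ ^ 4 * key

section Torsion

variable {q s : ℝ}

/-- The three `2`-torsion differences, taken together. -/
lemma bracket_torsion {Q : ℝ} (h0 : 0 < Q) (h1 : Q < 1) (hs : s ^ 2 = Q) :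
    (bracket Q (-1) s * bracket Q (-1) (-s) * bracket Q s (-s)) ^ 2 * Q ^ 3
      = 16 * eulerProd Q ^ 12 := by
  have s0 : s ≠ 0 := fun h => h0.ne' (by rw [← hs, h]; norm_num)
  have n1 : (-1 : ℝ) ≠ 0 := by norm_num
  have hs' : (-s) ^ 2 = Q := by rw [neg_sq, hs]
  have k := theta_mul_zpow h0 n1 1
  norm_num at k
  rw [bracket_sqrt h0 h1 hs n1, bracket_sqrt h0 h1 hs' n1, bracket_sqrt h0 h1 hs' s0,
    mul_neg (-1), mul_neg s, ← sq s, hs, k, neg_one_mul, neg_neg]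
  have := theta_two_torsion h0 h1 hs
  have e : Q ^ 3 = s ^ 6 := by rw [← hs]; ring
  rw [e]
  field_simp
  linear_combination ((theta Q (-1) * theta Q s * theta Q (-s)) ^ 3
    + (theta Q (-1) * theta Q s * theta Q (-s)) ^ 2 * (2 * eulerProd Q ^ 3)
    + (theta Q (-1) * theta Q s * theta Q (-s)) * (2 * eulerProd Q ^ 3) ^ 2
    + (2 * eulerProd Q ^ 3) ^ 3) * this

/-- The linear form attached to a point `e`, at the vector of index `i`. -/
noncomputable def torsionForm (q e : ℝ) (i : ℤ) : ℝ :=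
  q ^ (i * i) * bracket (q ^ 121) (q ^ (11 * i)) e

lemma torsionForm_mul (h0 : 0 < q) (h1 : q < 1) (hs : s ^ 2 = q ^ 121) (i : ℤ) :
    unitP q i ^ 2 * (torsionForm q (-1) i * torsionForm q s i * torsionForm q (-s) i) * q ^ 121
      = -(eulerProd (q ^ 121) ^ 6 * unitP q (2 * i) ^ 2) := by
  have b0 := base_pos h0
  have b1 := base_lt_one h0 h1
  have s0 : s ≠ 0 := fun h => b0.ne' (by rw [← hs, h]; norm_num)
  have ha := (zpow_pos h0 (11 * i)).ne'
  have d := theta_duplication b0 b1 hs ha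
  have hs' : (-s) ^ 2 = q ^ 121 := by rw [neg_sq, hs]
  have e2 : (q ^ (11 * i)) ^ 2 = q ^ (11 * (2 * i)) := by
    rw [← zpow_natCast, ← zpow_mul]
    congr 1
    push_cast
    ring
  rw [e2, theta_eq_unitP h0 h1, theta_eq_unitP h0 h1] at d
  rw [torsionForm, torsionForm, torsionForm, bracket_neg_one b0 b1 ha, bracket_sqrt b0 b1 hs ha,
    bracket_sqrt b0 b1 hs' ha, mul_neg, ← hs]
  rw [← hs] at d
  have nJ : eulerProd (s ^ 2) ≠ 0 := by
    rw [hs]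
    exact base_euler_ne h0 h1
  have e : (q ^ (i * i)) ^ 3 * (q ^ (-(tri (2 * i) - 5 * (2 * i)))) ^ 2
      = q ^ (11 * i) * (q ^ (-(tri i - 5 * i))) ^ 2 := by
    simp only [← zpow_natCast, ← zpow_mul, ← zpow_add₀ h0.ne']
    congr 1
    push_cast
    linarith [two_mul_tri (2 * i), two_mul_tri i]
  generalize q ^ (-(tri (2 * i) - 5 * (2 * i))) = M at d e
  have L0 := zpow_pos h0 (-(tri i - 5 * i))
  generalize q ^ (-(tri i - 5 * i)) = L at d e L0
  generalize theta (s ^ 2) (-q ^ (11 * i)) = t₁ at d ⊢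
  generalize theta (s ^ 2) (q ^ (11 * i) * s) = t₂ at d ⊢
  generalize theta (s ^ 2) (-(q ^ (11 * i) * s)) = t₃ at d ⊢
  have d' : L * unitP q i * (t₁ * t₂ * t₃) = eulerProd (s ^ 2) ^ 3 * (M * unitP q (2 * i)) :=
    mul_left_cancel₀ nJ (by linear_combination d)
  field_simp
  refine mul_left_cancel₀ (pow_ne_zero 2 L0.ne') ?_
  linear_combination (-(q ^ (i * i)) ^ 3 * (L * unitP q i * (t₁ * t₂ * t₃)
    + eulerProd (s ^ 2) ^ 3 * (M * unitP q (2 * i)))) * d'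
    - (eulerProd (s ^ 2) ^ 6 * unitP q (2 * i) ^ 2) * e

lemma torsionForm_plucker (h0 : 0 < q) (h1 : q < 1) (e : ℝ) (i j k : ℤ) :
    unitP q (i + j) * unitP q (i - j) * torsionForm q e k
      - unitP q (i + k) * unitP q (i - k) * torsionForm q e j
      + unitP q (j + k) * unitP q (j - k) * torsionForm q e i = 0 := by
  have key := bracket_plucker (Q := q ^ 121) (q ^ (11 * i)) (q ^ (11 * j)) (q ^ (11 * k)) e
  have nJ := base_euler_ne h0 h1
  have := zpow_pos h0 (i * i)
  have := zpow_pos h0 (j * j)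
  have := zpow_pos h0 (k * k)
  simp only [bracket_eq_unitP h0 h1, sub_eq_add_neg (-(_ * _)), zpow_add₀ h0.ne' (-(_ * _)),
    zpow_neg] at key
  unfold torsionForm
  field_simp at key
  refine mul_left_cancel₀ (pow_ne_zero 2 nJ) ?_
  linear_combination key

lemma torsionForm_det (h0 : 0 < q) (h1 : q < 1) (e f : ℝ) :
    torsionForm q e 1 * torsionForm q f 2 - torsionForm q f 1 * torsionForm q e 2
      = -(eulerProd (q ^ 121) ^ 2 * (unitP q 1 * unitP q 3) * bracket (q ^ 121) e f) := by
  have key := bracket_plucker (Q := q ^ 121) (q ^ (11 * (1 : ℤ))) (q ^ (11 * (2 : ℤ))) e f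
  rw [bracket_eq_unitP h0 h1, show (1 : ℤ) - 2 = -1 by norm_num, unitP_neg h0] at key
  norm_num at key
  unfold torsionForm
  have e5 : q ^ (-5 : ℤ) = (q ^ 5)⁻¹ := zpow_neg q 5
  norm_num [e5] at key ⊢
  field_simp at key
  linear_combination -key

/-- The remaining relation between the units and the nome. -/
theorem discUnit_mul (h0 : 0 < q) (h1 : q < 1) :
    discUnit (uX (unitP q)) (uY (unitP q)) * unitP q 1 ^ 3 = -(q ^ 121
      * (unitP q 2 ^ 2 * unitP q 3 ^ 2 * unitP q 4 ^ 5 * unitP q 5 ^ 6)) := by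
  have hu := (logUnitRelations h0 h1).toUnitRelations
  obtain ⟨n1, n2, n3, n4, n5, nX, nA, nY, nB⟩ := hu.ne_zero
  obtain ⟨e6, e7, e8, e9, m1, m2, m3, m4, m5⟩ := unitP_reduce h0
  have nJ := base_euler_ne h0 h1
  have b0 := base_pos h0
  obtain ⟨s, hs⟩ : ∃ s : ℝ, s ^ 2 = q ^ 121 := ⟨√(q ^ 121), Real.sq_sqrt b0.le⟩
  have det := bracket_torsion b0 (base_lt_one h0 h1) hs
  have d1 := torsionForm_det h0 h1 (-1) s
  have d2 := torsionForm_det h0 h1 (-1) (-s)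
  have d3 := torsionForm_det h0 h1 s (-s)
  have l3 : ∀ e, unitP q 1 * unitP q 3 * torsionForm q e 3
      = -(unitP q 1 * unitP q 5 * torsionForm q e 1 - unitP q 2 * unitP q 4 * torsionForm q e 2) :=
    fun e => by
      have := torsionForm_plucker h0 h1 e 1 2 3
      norm_num [m1, m2, m3] at this
      linear_combination -this
  have l4 : ∀ e, unitP q 1 * unitP q 3 * torsionForm q e 4
      = unitP q 3 * unitP q 5 * torsionForm q e 2 - unitP q 2 * unitP q 5 * torsionForm q e 1 :=
    fun e => by
      have := torsionForm_plucker h0 h1 e 1 2 4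
      norm_num [m1, m2, m3, e6] at this
      linear_combination -this
  have v1 := torsionForm_mul h0 h1 hs 1
  have v2 := torsionForm_mul h0 h1 hs 2
  have v3 := torsionForm_mul h0 h1 hs 3
  have v4 := torsionForm_mul h0 h1 hs 4
  norm_num [e6, e8] at v1 v2 v3 v4
  obtain ⟨κ, hκ⟩ : ∃ κ, κ = eulerProd (q ^ 121) ^ 6 / q ^ 121 := ⟨_, rfl⟩
  have hκ4 : κ ^ 4 * (q ^ 121) ^ 3 * q ^ 121 = eulerProd (q ^ 121) ^ 24 := by
    rw [hκ]
    field_simp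
  have hκ1 : κ * q ^ 121 = eulerProd (q ^ 121) ^ 6 := by
    rw [hκ]
    field_simp
  rw [← hκ1] at v1 v2 v3 v4
  have l3a := l3 (-1)
  have l3b := l3 s
  have l3c := l3 (-s)
  have l4a := l4 (-1)
  have l4b := l4 s
  have l4c := l4 (-s)
  clear l3 l4
  generalize torsionForm q (-1) = a at *
  generalize torsionForm q s = b at *
  generalize torsionForm q (-s) = c at *
  have hr : uY (unitP q) = unitP q 1 * unitP q 3 * unitP q 5 / (unitP q 2 ^ 2 * unitP q 4)
      * uB (unitP q) := by
    simp only [uY, uB]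
    field_simp
  have M : uX (unitP q) ^ 5 * unitP q 1 * unitP q 5 ^ 12 * unitP q 2 ^ 8
      * (unitP q 2 ^ 2 * unitP q 3 ^ 2 * unitP q 4 ^ 5 * unitP q 5 ^ 6)
      = unitP q 1 ^ 12 * (unitP q 2 * unitP q 3 * unitP q 4 * unitP q 5) ^ 6
        * (uA (unitP q) ^ 2 * uY (unitP q) ^ 3 * uB (unitP q) ^ 2) := by
    simp only [uX, uA, uY, uB]
    field_simp
  obtain ⟨e₀, h₀⟩ : ∃ e, e = (unitP q 1 * unitP q 5) ^ 3 * (a 1 * b 1 * c 1) := ⟨_, rfl⟩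
  obtain ⟨e₁, h₁⟩ : ∃ e, e = -((unitP q 1 * unitP q 5) ^ 2 * (unitP q 2 * unitP q 4)
    * (a 1 * b 1 * c 2 + a 1 * b 2 * c 1 + a 2 * b 1 * c 1)) := ⟨_, rfl⟩
  obtain ⟨e₂, h₂⟩ : ∃ e, e = (unitP q 1 * unitP q 5) * (unitP q 2 * unitP q 4) ^ 2
    * (a 1 * b 2 * c 2 + a 2 * b 1 * c 2 + a 2 * b 2 * c 1) := ⟨_, rfl⟩
  obtain ⟨e₃, h₃⟩ : ∃ e, e = -((unitP q 2 * unitP q 4) ^ 3 * (a 2 * b 2 * c 2)) := ⟨_, rfl⟩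
  have k₀ : e₀ = -(κ * (unitP q 1 * unitP q 5 ^ 3 * unitP q 2 ^ 2)) := by
    refine mul_left_cancel₀ b0.ne' ?_
    rw [h₀]
    linear_combination unitP q 1 * unitP q 5 ^ 3 * v1
  have k₃ : e₃ = κ * (unitP q 2 * unitP q 4 ^ 5) := by
    refine mul_left_cancel₀ b0.ne' ?_
    rw [h₃]
    linear_combination (-(unitP q 2 * unitP q 4 ^ 3)) * v2
  have w₃ : e₀ + e₁ + e₂ + e₃ = κ * (unitP q 1 ^ 3 * unitP q 3 * unitP q 5 ^ 2) := by
    have : e₀ + e₁ + e₂ + e₃ = -((unitP q 1 * unitP q 3 * a 3) * (unitP q 1 * unitP q 3 * b 3)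
        * (unitP q 1 * unitP q 3 * c 3)) := by
      rw [l3a, l3b, l3c, h₀, h₁, h₂, h₃]
      ring
    rw [this]
    refine mul_left_cancel₀ b0.ne' ?_
    linear_combination (-(unitP q 1 ^ 3 * unitP q 3)) * v3
  obtain ⟨r, hr'⟩ : ∃ r, r = unitP q 1 * unitP q 3 * unitP q 5 / (unitP q 2 ^ 2 * unitP q 4) :=
    ⟨_, rfl⟩
  have w₄ : e₀ + r * e₁ + r ^ 2 * e₂ + r ^ 3 * e₃
      = κ * (unitP q 1 ^ 6 * unitP q 3 ^ 5 / (unitP q 2 ^ 3 * unitP q 4 ^ 2)) := by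
    have : unitP q 2 ^ 3 * (e₀ + r * e₁ + r ^ 2 * e₂ + r ^ 3 * e₃)
        = -(unitP q 1 ^ 3 * ((unitP q 1 * unitP q 3 * a 4) * (unitP q 1 * unitP q 3 * b 4)
        * (unitP q 1 * unitP q 3 * c 4))) := by
      rw [l4a, l4b, l4c, h₀, h₁, h₂, h₃, hr']
      field_simp
      ring
    have e : unitP q 2 ^ 3 * unitP q 4 ^ 2 * (unitP q 1 ^ 6 * unitP q 3 ^ 5
        / (unitP q 2 ^ 3 * unitP q 4 ^ 2)) = unitP q 1 ^ 6 * unitP q 3 ^ 5 := by field_simp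
    refine mul_left_cancel₀ (mul_ne_zero b0.ne'
      (mul_ne_zero (pow_ne_zero 3 n2) (pow_ne_zero 2 n4))) ?_
    linear_combination q ^ 121 * unitP q 4 ^ 2 * this - unitP q 1 ^ 6 * unitP q 3 ^ 3 * v4
      - κ * q ^ 121 * e
  rw [← hr'] at hr
  have disc := cubic_discriminant (e₀ := e₀) (e₁ := e₁) (e₂ := e₂) (e₃ := e₃) hu.curve nX
    (by rwa [← hu.relA]) nY (by rwa [← hu.relB])
    (by
      rw [← hu.relA, k₀, k₃]
      simp only [uX, uA, uY]
      field_simp)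
    (by
      rw [← hu.relB, w₃, k₀]
      simp only [uX, uB]
      field_simp)
    (by
      have : (e₀ * uB (unitP q) ^ 3 + uY (unitP q) * uB (unitP q) ^ 2 * e₁
          + uY (unitP q) ^ 2 * uB (unitP q) * e₂ + uY (unitP q) ^ 3 * e₃)
          = uB (unitP q) ^ 3 * (e₀ + r * e₁ + r ^ 2 * e₂ + r ^ 3 * e₃) := by
        rw [hr]
        ring
      rw [← hu.relA, ← hu.relB, this, w₄, k₀]
      simp only [uX, uA, uY, uB]
      field_simp)
  rw [← hu.relA, ← hu.relB] at disc
  have sq_eq : e₁ ^ 2 * e₂ ^ 2 - 4 * e₀ * e₂ ^ 3 - 4 * e₁ ^ 3 * e₃ + 18 * e₀ * e₁ * e₂ * e₃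
      - 27 * e₀ ^ 2 * e₃ ^ 2 = (unitP q 1 * unitP q 5 * unitP q 2 * unitP q 4) ^ 6
        * ((a 1 * b 2 - b 1 * a 2) * (a 1 * c 2 - c 1 * a 2) * (b 1 * c 2 - c 1 * b 2)) ^ 2 := by
    rw [h₀, h₁, h₂, h₃]
    ring
  rw [sq_eq, d1, d2, d3, k₀] at disc
  generalize discUnit (uX (unitP q)) (uY (unitP q)) = G at disc ⊢
  refine mul_left_cancel₀ (mul_ne_zero (mul_ne_zero (mul_ne_zero (pow_ne_zero 5 nX) n1)
    (pow_ne_zero 12 n5)) (pow_ne_zero 8 n2)) ?_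
  rw [mul_neg, mul_left_comm _ (q ^ 121), M]
  refine mul_left_cancel₀ (mul_ne_zero (by norm_num : (16 : ℝ) ≠ 0) (pow_ne_zero 24 nJ)) ?_
  linear_combination (q ^ 121) ^ 3 * q ^ 121 * disc
    - (unitP q 1 ^ 12 * (unitP q 2 * unitP q 3 * unitP q 4 * unitP q 5) ^ 6
      * eulerProd (q ^ 121) ^ 12 * (uA (unitP q) ^ 2 * uY (unitP q) ^ 3 * uB (unitP q) ^ 2)
      * q ^ 121) * det - (16 * uX (unitP q) ^ 5 * G
      * (unitP q 1 * unitP q 5 ^ 3 * unitP q 2 ^ 2) ^ 4) * hκ4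

end Torsion

section NonnegSeries

open PowerSeries

/-- Functions on `(0, 1)` given by a power series with nonnegative coefficients and constant
coefficient at least one. -/
def NonnegSeries (φ : ℝ → ℝ) : Prop :=
  ∃ A : ℝ⟦X⟧, 1 ≤ coeff 0 A ∧ (∀ n, 0 ≤ coeff n A) ∧
    ∀ y, 0 < y → y < 1 → HasSum (fun n => coeff n A * y ^ n) (φ y)

lemma hasSum_coeff_mul {A B : ℝ⟦X⟧} {y a b : ℝ}
    (hA : HasSum (fun n => coeff n A * y ^ n) a) (hB : HasSum (fun n => coeff n B * y ^ n) b) :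
    HasSum (fun n => coeff n (A * B) * y ^ n) (a * b) := by
  have sA : Summable fun n => ‖coeff n A * y ^ n‖ := hA.summable.norm
  have sB : Summable fun n => ‖coeff n B * y ^ n‖ := hB.summable.norm
  have e : ∀ n, coeff n (A * B) * y ^ n
      = ∑ k ∈ Finset.HasAntidiagonal.antidiagonal n, coeff k.1 A * y ^ k.1 * (coeff k.2 B * y ^ k.2) := fun n => by
    rw [coeff_mul, Finset.sum_mul]
    refine Finset.sum_congr rfl fun k hk => ?_
    rw [← Finset.HasAntidiagonal.mem_antidiagonal.1 hk, pow_add]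
    ring
  have s := (summable_norm_sum_mul_antidiagonal_of_summable_norm sA sB).of_norm
  rw [← hA.tsum_eq, ← hB.tsum_eq, tsum_mul_tsum_eq_tsum_sum_antidiagonal_of_summable_norm sA sB]
  exact s.hasSum.congr_fun e

lemma coeff_mul_nonneg {A B : ℝ⟦X⟧} (nA : ∀ n, 0 ≤ coeff n A) (nB : ∀ n, 0 ≤ coeff n B) (n : ℕ) :
    0 ≤ coeff n (A * B) := by
  rw [coeff_mul]
  exact Finset.sum_nonneg fun k _ => mul_nonneg (nA _) (nB _)

lemma coeff_le_coeff_mul {A B : ℝ⟦X⟧} (nA : ∀ n, 0 ≤ coeff n A) (nB : ∀ n, 0 ≤ coeff n B)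
    (hB : 1 ≤ coeff 0 B) (n : ℕ) : coeff n A ≤ coeff n (A * B) := by
  rw [coeff_mul]
  refine (le_mul_of_one_le_right (nA n) hB).trans
    (Finset.single_le_sum (f := fun k : ℕ × ℕ => coeff k.1 A * coeff k.2 B)
      (fun k _ => mul_nonneg (nA _) (nB _)) (a := (n, 0))
      (Finset.HasAntidiagonal.mem_antidiagonal.2 (add_zero n)))

lemma NonnegSeries.mul {φ ψ : ℝ → ℝ} (hφ : NonnegSeries φ) (hψ : NonnegSeries ψ) :
    NonnegSeries fun y => φ y * ψ y := by
  obtain ⟨A, a0, nA, hA⟩ := hφ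
  obtain ⟨B, b0, nB, hB⟩ := hψ
  exact ⟨A * B, a0.trans (coeff_le_coeff_mul nA nB b0 0), coeff_mul_nonneg nA nB,
    fun y h0 h1 => hasSum_coeff_mul (hA y h0 h1) (hB y h0 h1)⟩

lemma hasSum_coeff_X_pow (m : ℕ) (y : ℝ) :
    HasSum (fun n => coeff n (X ^ m : ℝ⟦X⟧) * y ^ n) (y ^ m) := by
  have := hasSum_ite_eq m (y ^ m)
  refine this.congr_fun fun n => ?_
  rw [coeff_X_pow]
  split_ifs with h
  · rw [h, one_mul]
  · rw [zero_mul]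

lemma coeff_X_pow_nonneg (m n : ℕ) : 0 ≤ coeff n (X ^ m : ℝ⟦X⟧) := by
  rw [coeff_X_pow]
  split_ifs <;> norm_num

lemma NonnegSeries.pow {φ : ℝ → ℝ} (hφ : NonnegSeries φ) (m : ℕ) :
    NonnegSeries fun y => φ y ^ m := by
  induction m with
  | zero =>
    refine ⟨X ^ 0, by simp, coeff_X_pow_nonneg 0, fun y _ _ => ?_⟩
    simpa only [pow_zero] using hasSum_coeff_X_pow 0 y
  | succ m ih =>
    simp only [pow_succ]
    exact ih.mul hφ

lemma NonnegSeries.congr {φ ψ : ℝ → ℝ} (hφ : NonnegSeries φ)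
    (h : ∀ y, 0 < y → y < 1 → φ y = ψ y) : NonnegSeries ψ := by
  obtain ⟨A, a0, nA, hA⟩ := hφ
  exact ⟨A, a0, nA, fun y h0 h1 => h y h0 h1 ▸ hA y h0 h1⟩

lemma nonnegSeries_geometric {m : ℕ} (hm : m ≠ 0) : NonnegSeries fun y => (1 - y ^ m)⁻¹ := by
  refine ⟨mk fun n => if m ∣ n then 1 else 0, by simp, fun n => ?_, fun y h0 h1 => ?_⟩
  · rw [coeff_mk]
    split_ifs <;> norm_num
  · have g := hasSum_geometric_of_lt_one (pow_nonneg h0.le m) (pow_lt_one₀ h0.le h1 hm)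
    rw [← (mul_right_injective₀ hm).hasSum_iff fun n hn => ?_]
    · exact g.congr_fun fun n => by simp [pow_mul]
    · rw [coeff_mk, if_neg fun ⟨k, hk⟩ => hn ⟨k, hk.symm⟩, zero_mul]

lemma nonnegSeries_block {m n : ℕ} (hm : m ≠ 0) (hn : n ≠ 0) :
    NonnegSeries fun y => (1 - y ^ (m + n)) / ((1 - y ^ m) * (1 - y ^ n)) := by
  obtain ⟨A, a0, nA, hA⟩ := nonnegSeries_geometric hm
  obtain ⟨B, -, nB, hB⟩ := nonnegSeries_geometric hn
  have nXB := coeff_mul_nonneg (coeff_X_pow_nonneg n) nB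
  refine ⟨A + X ^ n * B, ?_, fun k => ?_, fun y h0 h1 => ?_⟩
  · rw [map_add]
    linarith [nXB 0]
  · rw [map_add]
    exact add_nonneg (nA k) (nXB k)
  · have a := sub_pos.2 (pow_lt_one₀ h0.le h1 hm)
    have b := sub_pos.2 (pow_lt_one₀ h0.le h1 hn)
    have := (hA y h0 h1).add
      (hasSum_coeff_mul (hasSum_coeff_X_pow n y) (hB y h0 h1))
    beta_reduce
    rw [show (1 - y ^ (m + n)) / ((1 - y ^ m) * (1 - y ^ n))
      = (1 - y ^ m)⁻¹ + y ^ n * (1 - y ^ n)⁻¹ by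
        field_simp
        ring]
    exact this.congr_fun fun k => by rw [map_add, add_mul]

lemma nonnegSeries_of_tendsto {g : ℕ → ℝ → ℝ} {φ : ℝ → ℝ} (hg : ∀ i, NonnegSeries (g i))
    (h : ∀ y, 0 < y → y < 1 →
      Tendsto (fun N => ∏ i ∈ Finset.range N, g i y) atTop (𝓝 (φ y))) : NonnegSeries φ := by
  choose G g0 nG hG using hg
  set P : ℕ → ℝ⟦X⟧ := fun N => ∏ i ∈ Finset.range N, G i
  have nP : ∀ N n, 0 ≤ coeff n (P N) := fun N => by
    induction N with
    | zero => simpa [P] using coeff_X_pow_nonneg 0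
    | succ N ih =>
      simp only [P, Finset.prod_range_succ]
      exact coeff_mul_nonneg ih (nG N)
  have mono : ∀ n, Monotone fun N => coeff n (P N) := fun n =>
    monotone_nat_of_le_succ fun N => by
      simp only [P, Finset.prod_range_succ]
      exact coeff_le_coeff_mul (nP N) (nG N) (g0 N) n
  have sP : ∀ y, 0 < y → y < 1 → ∀ N,
      HasSum (fun n => coeff n (P N) * y ^ n) (∏ i ∈ Finset.range N, g i y) := by
    intro y h0 h1 N
    induction N with
    | zero => simpa [P] using hasSum_coeff_X_pow 0 y
    | succ N ih =>
      simp only [P, Finset.prod_range_succ]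
      exact hasSum_coeff_mul ih (hG N y h0 h1)
  have le : ∀ y, 0 < y → y < 1 → ∀ N, ∏ i ∈ Finset.range N, g i y ≤ φ y := fun y h0 h1 =>
    Monotone.ge_of_tendsto (monotone_nat_of_le_succ fun N =>
      hasSum_le (fun n => mul_le_mul_of_nonneg_right (mono n N.le_succ) (pow_pos h0 n).le)
        (sP y h0 h1 N) (sP y h0 h1 (N + 1))) (h y h0 h1)
  have lim : ∀ n, Tendsto (fun N => coeff n (P N)) atTop (𝓝 (⨆ N, coeff n (P N))) := fun n => by
    refine tendsto_atTop_ciSup (mono n) ⟨φ 2⁻¹ / 2⁻¹ ^ n, ?_⟩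
    rintro _ ⟨N, rfl⟩
    have y0 : (0 : ℝ) < 2⁻¹ := by norm_num
    have y1 : (2⁻¹ : ℝ) < 1 := by norm_num
    rw [le_div_iff₀ (pow_pos y0 n)]
    exact (le_hasSum (sP _ y0 y1 N) n fun k _ =>
      mul_nonneg (nP N k) (pow_pos y0 k).le).trans (le _ y0 y1 N)
  have ge : ∀ n N, coeff n (P N) ≤ ⨆ N, coeff n (P N) := fun n N =>
    (mono n).ge_of_tendsto (lim n) N
  have na : ∀ n, 0 ≤ ⨆ N, coeff n (P N) := fun n => (nP 0 n).trans (ge n 0)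
  refine ⟨mk fun n => ⨆ N, coeff n (P N), ?_, fun n => ?_, fun y h0 h1 => ?_⟩
  · rw [coeff_mk]
    simpa [P] using ge 0 0
  · rw [coeff_mk]
    exact na n
  · simp only [coeff_mk]
    have b : ∀ s : Finset ℕ, ∑ n ∈ s, (⨆ N, coeff n (P N)) * y ^ n ≤ φ y := fun s =>
      le_of_tendsto (tendsto_finsetSum s fun n _ => (lim n).mul_const _)
        (Eventually.of_forall fun N => (sum_le_hasSum s (fun n _ =>
          mul_nonneg (nP N n) (pow_pos h0 n).le) (sP y h0 h1 N)).trans (le y h0 h1 N))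
    have s := summable_of_sum_le (fun n => mul_nonneg (na n) (pow_pos h0 n).le) b
    rw [← le_antisymm (s.tsum_le_of_sum_le b) (le_of_tendsto (h y h0 h1)
      (Eventually.of_forall fun N => hasSum_le (fun n =>
        mul_le_mul_of_nonneg_right (ge n N) (pow_pos h0 n).le) (sP y h0 h1 N) s.hasSum))]
    exact s.hasSum

/-- Coefficients of a power series are determined by its values near `0` from the right. -/
lemma coeff_eq_zero_of_hasSum {d : ℕ → ℝ} {ε : ℝ} (hε : 0 < ε)
    (h : ∀ y, 0 < y → y < ε → HasSum (fun n => d n * y ^ n) 0) (n : ℕ) : d n = 0 := by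
  induction n using Nat.strong_induction_on with
  | _ n ih =>
  have shift : ∀ y, 0 < y → y < ε → HasSum (fun k => d (k + n) * y ^ k) 0 := fun y h0 h1 => by
    have := (hasSum_nat_add_iff' n).2 (h y h0 h1)
    rw [Finset.sum_eq_zero fun i hi => by rw [ih i (Finset.mem_range.1 hi), zero_mul],
      sub_zero] at this
    have := this.mul_right (y ^ n)⁻¹
    rw [zero_mul] at this
    refine this.congr_fun fun k => ?_
    rw [pow_add]
    field_simp
  have e2 : 0 < ε / 2 := by positivity
  have key := tendsto_tsum_of_dominated_convergence (𝓕 := 𝓝[>] (0 : ℝ))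
    (f := fun y k => d (k + n) * y ^ k) (g := fun k => d (k + n) * 0 ^ k)
    (shift _ e2 (by linarith)).summable.norm
    (fun k => ((continuous_const.mul (continuous_pow k)).tendsto 0).mono_left nhdsWithin_le_nhds)
    (by
      filter_upwards [Ioo_mem_nhdsGT e2] with y hy k
      rw [norm_mul, norm_mul, norm_pow, norm_pow, Real.norm_of_nonneg hy.1.le,
        Real.norm_of_nonneg e2.le]
      have := pow_le_pow_left₀ hy.1.le hy.2.le k
      gcongr)
  rw [tsum_eq_single 0 fun k hk => by rw [zero_pow hk, mul_zero], pow_zero, mul_one,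
    zero_add] at key
  refine tendsto_nhds_unique key (tendsto_const_nhds.congr' ?_)
  filter_upwards [Ioo_mem_nhdsGT e2] with y hy
  exact (shift y hy.1 (by linarith [hy.2])).tsum_eq.symm

end NonnegSeries

section Quotient

lemma tendsto_poch {Q : ℝ} (h0 : 0 < Q) (h1 : Q < 1) (x : ℝ) :
    Tendsto (fun N => ∏ i ∈ Finset.range N, (1 - x * Q ^ i)) atTop (𝓝 (poch Q x)) :=
  (multipliable_poch h0 h1 x).hasProd.tendsto_prod_nat

lemma poch_pos {y : ℝ} (h0 : 0 < y) (h1 : y < 1) {k : ℕ} (hk : k ≠ 0) :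
    0 < poch (y ^ 11) (y ^ k) := by
  have b0 := pow_pos h0 11
  have b1 := pow_lt_one₀ h0.le h1 (n := 11) (by norm_num)
  have hk1 := pow_lt_one₀ h0.le h1 hk
  have hi : ∀ i : ℕ, y ^ k * (y ^ 11) ^ i < 1 := fun i =>
    mul_lt_one_of_nonneg_of_lt_one_left (pow_pos h0 k).le hk1 (pow_le_one₀ b0.le b1.le)
  refine lt_of_le_of_ne (ge_of_tendsto' (tendsto_poch b0 b1 _) fun N => Finset.prod_nonneg
    fun i _ => sub_nonneg.2 (hi i).le) (Ne.symm ?_)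
  have := tprod_one_add_ne_zero_of_summable (f := fun i : ℕ => -(y ^ k * (y ^ 11) ^ i))
    (fun i => by
      rw [← sub_eq_add_neg]
      exact (sub_pos.2 (hi i)).ne') (by
      simp_rw [norm_neg, norm_mul, norm_pow]
      exact (summable_geometric_of_lt_one (by positivity) (by
        rwa [Real.norm_of_nonneg h0.le])).mul_left _)
  simpa [poch, sub_eq_add_neg] using this

lemma nonnegSeries_inv_poch {k : ℕ} (hk : k ≠ 0) :
    NonnegSeries fun y => (poch (y ^ 11) (y ^ k))⁻¹ := by
  refine nonnegSeries_of_tendsto (g := fun i y => (1 - y ^ (k + 11 * i))⁻¹)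
    (fun i => nonnegSeries_geometric (by omega)) fun y h0 h1 => ?_
  refine ((tendsto_poch (pow_pos h0 11) (pow_lt_one₀ h0.le h1 (by norm_num))
    (y ^ k)).inv₀ (poch_pos h0 h1 hk).ne').congr fun N => ?_
  rw [← Finset.prod_inv_distrib]
  exact Finset.prod_congr rfl fun i _ => by rw [pow_add, pow_mul]

lemma tendsto_eulerProd_even {Q : ℝ} (h0 : 0 < Q) (h1 : Q < 1) :
    Tendsto (fun N => ∏ i ∈ Finset.range N, ((1 - Q ^ (2 * i + 1)) * (1 - Q ^ (2 * i + 2)))) atTop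
      (𝓝 (eulerProd Q)) := by
  have t := (tendsto_poch h0 h1 Q).comp (tendsto_id.const_mul_atTop' (two_pos))
  rw [poch_self] at t
  refine t.congr fun N => ?_
  simp only [Function.comp_apply, id]
  induction N with
  | zero => rfl
  | succ N ih =>
    rw [mul_add_one 2 N, Finset.prod_range_succ (n := 2 * N + 1), Finset.prod_range_succ, ih, Finset.prod_range_succ]
    ring

lemma nonnegSeries_euler_div :
    NonnegSeries fun y => eulerProd (y ^ 11) / (poch (y ^ 11) (y ^ 5) * poch (y ^ 11) (y ^ 6)) ^ 2 := by
  refine NonnegSeries.congr (NonnegSeries.mul (nonnegSeries_geometric (m := 6) (by norm_num))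
    (nonnegSeries_of_tendsto (g := fun i y => (1 - y ^ (5 + 11 * i + (6 + 11 * i)))
        / ((1 - y ^ (5 + 11 * i)) * (1 - y ^ (6 + 11 * i)))
      * ((1 - y ^ (5 + 11 * i + (17 + 11 * i)))
        / ((1 - y ^ (5 + 11 * i)) * (1 - y ^ (17 + 11 * i)))))
      (φ := fun y => eulerProd (y ^ 11) / (poch (y ^ 11) (y ^ 5) * poch (y ^ 11) (y ^ 6)
        * (poch (y ^ 11) (y ^ 5) * poch (y ^ 11) (y ^ 17))))
      (fun i => (nonnegSeries_block (by omega) (by omega)).mul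
        (nonnegSeries_block (by omega) (by omega))) fun y h0 h1 => ?_)) fun y h0 h1 => ?_
  · have b0 := pow_pos h0 11
    have b1 := pow_lt_one₀ h0.le h1 (n := 11) (by norm_num)
    have p5 := poch_pos h0 h1 (k := 5) (by norm_num)
    have p6 := poch_pos h0 h1 (k := 6) (by norm_num)
    have p17 := poch_pos h0 h1 (k := 17) (by norm_num)
    refine ((tendsto_eulerProd_even b0 b1).div (((tendsto_poch b0 b1 _).mul
      (tendsto_poch b0 b1 _)).mul ((tendsto_poch b0 b1 _).mul (tendsto_poch b0 b1 _)))
      (by positivity)).congr fun N => ?_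
    rw [Pi.div_apply]
    rw [← Finset.prod_mul_distrib, ← Finset.prod_mul_distrib, ← Finset.prod_mul_distrib,
      ← Finset.prod_div_distrib]
    refine Finset.prod_congr rfl fun i _ => ?_
    rw [div_mul_div_comm]
    simp only [← pow_mul, ← pow_add]
    ring_nf
  · have p5 := poch_pos h0 h1 (k := 5) (by norm_num)
    have p17 := poch_pos h0 h1 (k := 17) (by norm_num)
    have s := sub_pos.2 (pow_lt_one₀ h0.le h1 (n := 6) (by norm_num))
    rw [poch_step (x := y ^ 6) (pow_pos h0 11) (pow_lt_one₀ h0.le h1 (by norm_num))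
      (pow_pos h0 6).ne', ← pow_add]
    norm_num
    field_simp

/-- The product attached to the class `k` modulo `11`. -/
noncomputable def pochPair (y : ℝ) (k : ℕ) : ℝ :=
  poch (y ^ 11) (y ^ k) * poch (y ^ 11) (y ^ (11 - k))

lemma nonnegSeries_inv_pochPair {k : ℕ} (h0 : k ≠ 0) (h1 : k < 11) :
    NonnegSeries fun y => (pochPair y k)⁻¹ :=
  ((nonnegSeries_inv_poch h0).mul (nonnegSeries_inv_poch (k := 11 - k) (by omega))).congr
    fun y _ _ => (mul_inv _ _).symm

lemma nonnegSeries_quotient (e₁ e₂ e₃ e₄ e₅ : ℕ) :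
    NonnegSeries fun y => eulerProd (y ^ 11) / (pochPair y 1 ^ e₁ * pochPair y 2 ^ e₂
      * pochPair y 3 ^ e₃ * pochPair y 4 ^ e₄ * pochPair y 5 ^ (e₅ + 2)) := by
  have h : ∀ k ∈ Finset.Icc 1 5, ∀ e : ℕ, NonnegSeries fun y => (pochPair y k)⁻¹ ^ e :=
    fun k hk e => (nonnegSeries_inv_pochPair (by grind) (by grind)).pow e
  refine (((((nonnegSeries_euler_div.mul (h 1 (by decide) e₁)).mul (h 2 (by decide) e₂)).mul
    (h 3 (by decide) e₃)).mul (h 4 (by decide) e₄)).mul (h 5 (by decide) e₅)).congr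
    fun y h0 h1 => ?_
  have : poch (y ^ 11) (y ^ 5) * poch (y ^ 11) (y ^ 6) = pochPair y 5 := rfl
  simp only [this, div_eq_mul_inv, mul_inv, inv_pow, pow_add]
  ring

end Quotient

section Value

variable {q : ℝ}

lemma section_value (h0 : 0 < q) (h1 : q < 1) {v₀ v₁ v₂ v₄ v₅ m₀ m₃ : ℤ}
    (hv : v₀ + v₁ + 2 * v₂ + v₄ + v₅ + m₀ + m₃ = 0) {f : ZMod 11 → ℝ}
    (hf : ∀ r, q ^ 5 * eulerProd (q ^ 121) * (f (r - 5) + ∑ t ∈ Finset.Icc (1 : ℤ) 5,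
      (-1) ^ t * (unitP q (2 * t) / unitP q t) * f (r - (5 + 7 * (t : ZMod 11) ^ 2)))
      = extraComb q v₀ v₁ v₂ v₄ v₅ m₀ m₃ r) {den num : ℝ}
    (hc : combPoly v₀ v₁ v₂ v₄ v₅ m₀ m₃ (uX (unitP q)) (uY (unitP q)) * den
      = 242 * num * discUnit (uX (unitP q)) (uY (unitP q)) ^ 4) :
    q ^ 126 * (unitP q 2 ^ 2 * unitP q 3 ^ 2 * unitP q 4 ^ 5 * unitP q 5 ^ 7 * uY (unitP q) * den)
        * f 10
      = 11 * eulerProd (q ^ 121)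
        * (uA (unitP q) * uB (unitP q) ^ 2 * num * unitP q 1 ^ 3) := by
  have hu := logUnitRelations h0 h1
  obtain ⟨n1, n2, n3, n4, n5, nX, nA, nY, nB⟩ := hu.toUnitRelations.ne_zero
  have nJ := base_euler_ne h0 h1
  have hG := discUnit_mul h0 h1
  have hs := sum_mul_of_conv (cofactor_conv hu) hf
  have he := extraComb_eval hu hv
  rw [hs] at he
  generalize discUnit (uX (unitP q)) (uY (unitP q)) = G at *
  have nG : G ≠ 0 := by
    rintro rfl
    have := base_pos h0
    rw [zero_mul, eq_comm, neg_eq_zero] at hG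
    exact absurd hG (by positivity)
  field_simp at he
  refine mul_left_cancel₀ (pow_ne_zero 4 nG) ?_
  linear_combination (q ^ 5 * unitP q 5 * uY (unitP q) * den * f 10 * G ^ 4) * hG
    + den * unitP q 1 ^ 3 / 22 * he
    + uA (unitP q) * eulerProd (q ^ 121) * uB (unitP q) ^ 2 * unitP q 1 ^ 3 / 22 * hc

lemma unitP_eq_pochPair (h0 : 0 < q) (h1 : q < 1) {k : ℕ} (hk : k < 11) :
    unitP q k = q ^ (tri k - 5 * k) * pochPair (q ^ 11) k := by
  have nJ := base_euler_ne h0 h1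
  rw [unitP, theta_eq_poch (base_pos h0) (base_lt_one h0 h1) (zpow_pos h0 _).ne', pochPair,
    show q ^ (11 * (k : ℤ)) = (q ^ 11) ^ k by rw [← pow_mul, ← zpow_natCast]; rfl,
    show q ^ 121 * ((q ^ 11) ^ k)⁻¹ = (q ^ 11) ^ (11 - k) by
      rw [pow_sub₀ _ (pow_pos h0 11).ne' hk.le, ← pow_mul,
        ← pow_mul q 11 11], ← pow_mul q 11 11]
  field_simp

lemma pochPair_pos {y : ℝ} (h0 : 0 < y) (h1 : y < 1) {k : ℕ} (hk : k ≠ 0) (hk' : k < 11) :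
    0 < pochPair y k :=
  mul_pos (poch_pos h0 h1 hk) (poch_pos h0 h1 (by omega))

theorem countComb_nonneg {v₀ v₁ v₂ v₄ v₅ m₀ m₃ : ℤ} (hv : v₀ + v₁ + 2 * v₂ + v₄ + v₅ + m₀ + m₃ = 0)
    (e₁ e₂ e₃ e₄ e₅ v : ℕ)
    (he : 5 * e₁ + 9 * e₂ + 12 * e₃ + 14 * e₄ + 15 * (e₅ + 2) = 136 + 11 * v)
    (h : ∀ p, UnitRelations p → ∃ den num, den ≠ 0 ∧ combPoly v₀ v₁ v₂ v₄ v₅ m₀ m₃ (uX p) (uY p)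
      * den = 242 * num * discUnit (uX p) (uY p) ^ 4 ∧ uA p * uB p ^ 2 * num * p 1 ^ 3
        * (p 1 ^ e₁ * p 2 ^ e₂ * p 3 ^ e₃ * p 4 ^ e₄ * p 5 ^ (e₅ + 2))
        = p 2 ^ 2 * p 3 ^ 2 * p 4 ^ 5 * p 5 ^ 7 * uY p * den) (n : ℕ) :
    0 ≤ countComb v₀ v₁ v₂ v₄ v₅ m₀ m₃ (11 * n + 10) := by
  obtain ⟨A, -, nA, hA⟩ := nonnegSeries_quotient e₁ e₂ e₃ e₄ e₅
  have nXA := coeff_mul_nonneg (coeff_X_pow_nonneg v) nA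
  have key := coeff_eq_zero_of_hasSum (ε := (1 / 2) ^ 11) (by norm_num)
    (d := fun n => countComb v₀ v₁ v₂ v₄ v₅ m₀ m₃ (11 * n + 10)
      - 11 * PowerSeries.coeff n (PowerSeries.X ^ v * A)) (fun y y0 y1 => ?_) n
  · have : (0 : ℝ) ≤ countComb v₀ v₁ v₂ v₄ v₅ m₀ m₃ (11 * n + 10) := by linarith [nXA n]
    exact_mod_cast this
  obtain ⟨q, h0, rfl⟩ : ∃ q : ℝ, 0 < q ∧ q ^ 11 = y :=
    ⟨y ^ ((11 : ℕ) : ℝ)⁻¹, Real.rpow_pos_of_pos y0 _, Real.rpow_inv_natCast_pow y0.le (by norm_num)⟩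
  have h2 : q < 1 / 2 := lt_of_pow_lt_pow_left₀ 11 (by norm_num) y1
  have h1 : q < 1 := by linarith
  have y1' := pow_lt_one₀ h0.le h1 (n := 11) (by norm_num)
  obtain ⟨f, hs, hf⟩ := countComb_section (v₀ := v₀) (v₁ := v₁) (v₂ := v₂) (v₄ := v₄) (v₅ := v₅)
    (m₀ := m₀) (m₃ := m₃) h0 h2
  have hu := (logUnitRelations h0 h1).toUnitRelations
  obtain ⟨n1, n2, n3, n4, n5, nX, nA', nY, nB⟩ := hu.ne_zero
  obtain ⟨den, num, nd, hc, hm⟩ := h _ hu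
  have val := section_value h0 h1 hv hf hc
  have val' : q ^ 126 * (unitP q 1 ^ e₁ * unitP q 2 ^ e₂ * unitP q 3 ^ e₃ * unitP q 4 ^ e₄
      * unitP q 5 ^ (e₅ + 2)) * f 10 = 11 * eulerProd (q ^ 121) := by
    refine mul_left_cancel₀ (mul_ne_zero (mul_ne_zero (mul_ne_zero (mul_ne_zero (mul_ne_zero
      (pow_ne_zero 2 n2) (pow_ne_zero 2 n3)) (pow_ne_zero 5 n4)) (pow_ne_zero 7 n5)) nY) nd) ?_
    linear_combination (unitP q 1 ^ e₁ * unitP q 2 ^ e₂ * unitP q 3 ^ e₃ * unitP q 4 ^ e₄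
      * unitP q 5 ^ (e₅ + 2)) * val + 11 * eulerProd (q ^ 121) * hm
  have u1 := unitP_eq_pochPair h0 h1 (k := 1) (by norm_num)
  have u2 := unitP_eq_pochPair h0 h1 (k := 2) (by norm_num)
  have u3 := unitP_eq_pochPair h0 h1 (k := 3) (by norm_num)
  have u4 := unitP_eq_pochPair h0 h1 (k := 4) (by norm_num)
  have u5 := unitP_eq_pochPair h0 h1 (k := 5) (by norm_num)
  norm_num [tri] at u1 u2 u3 u4 u5
  have P1 := pochPair_pos y0 y1' (k := 1) (by norm_num) (by norm_num)
  have P2 := pochPair_pos y0 y1' (k := 2) (by norm_num) (by norm_num)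
  have P3 := pochPair_pos y0 y1' (k := 3) (by norm_num) (by norm_num)
  have P4 := pochPair_pos y0 y1' (k := 4) (by norm_num) (by norm_num)
  have P5 := pochPair_pos y0 y1' (k := 5) (by norm_num) (by norm_num)
  have fe : f 10 = q ^ 10 * (11 * ((q ^ 11) ^ v * (eulerProd ((q ^ 11) ^ 11)
      / (pochPair (q ^ 11) 1 ^ e₁ * pochPair (q ^ 11) 2 ^ e₂ * pochPair (q ^ 11) 3 ^ e₃
        * pochPair (q ^ 11) 4 ^ e₄ * pochPair (q ^ 11) 5 ^ (e₅ + 2))))) := by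
    have ex : q ^ 126 * ((q ^ (-5 : ℤ)) ^ e₁ * (q ^ (-9 : ℤ)) ^ e₂ * (q ^ (-12 : ℤ)) ^ e₃
        * (q ^ (-14 : ℤ)) ^ e₄ * (q ^ (-15 : ℤ)) ^ (e₅ + 2)) * (q ^ 10 * (q ^ 11) ^ v) = 1 := by
      simp only [← zpow_natCast, ← zpow_mul, ← zpow_add₀ h0.ne']
      refine (congrArg (q ^ ·) (?_ : _ = (0 : ℤ))).trans (zpow_zero q)
      push_cast
      linarith
    have z : ∀ m : ℕ, q ^ (-(m : ℤ)) = (q ^ m)⁻¹ := fun m => by rw [zpow_neg, zpow_natCast]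
    rw [show q ^ (-5 : ℤ) = _ from z 5, show q ^ (-9 : ℤ) = _ from z 9,
      show q ^ (-12 : ℤ) = _ from z 12, show q ^ (-14 : ℤ) = _ from z 14,
      show q ^ (-15 : ℤ) = _ from z 15] at ex
    rw [u1, u2, u3, u4, u5] at val'
    simp only [mul_pow] at val'
    rw [← pow_mul q 11 11, mul_div_assoc', mul_div_assoc', mul_div_assoc', eq_div_iff (by positivity)]
    linear_combination (q ^ 10 * (q ^ 11) ^ v) * val' - f 10 * (pochPair (q ^ 11) 1 ^ e₁
      * pochPair (q ^ 11) 2 ^ e₂ * pochPair (q ^ 11) 3 ^ e₃ * pochPair (q ^ 11) 4 ^ e₄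
      * pochPair (q ^ 11) 5 ^ (e₅ + 2)) * ex
  have sA := (hasSum_coeff_mul (hasSum_coeff_X_pow v (q ^ 11)) (hA _ y0 y1')).mul_left 11
  have sc := hs.mul_left (q ^ 10)⁻¹
  rw [fe, inv_mul_cancel_left₀ (pow_pos h0 10).ne'] at sc
  have := sc.sub sA
  rw [sub_self] at this
  refine this.congr_fun fun k => ?_
  rw [pow_add, pow_mul]
  field_simp

end Value

/-- Rank-crank inequalities for the residue 10 modulo 11. -/
theorem rank_crank_inequalities_residue_ten (n : ℕ) :
    (3 * (rankCount 1 11 (11  *  n  +  10) : ℤ)  +  2 * (rankCount 5 11 (11  *  n  +  10) : ℤ)  +  2 * crankCount 3 (11  *  n  +  10) ≥ 2 * (rankCount 2 11 (11  *  n  +  10) : ℤ)  +  2 * (rankCount 3 11 (11  *  n  +  10) : ℤ)  +  (rankCount 4 11 (11  *  n  +  10) : ℤ)  +  2 * crankCount 0 (11  *  n  +  10))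
    ∧ (3 * (rankCount 0 11 (11  *  n  +  10) : ℤ)  +  (rankCount 2 11 (11  *  n  +  10) : ℤ)  +  (rankCount 3 11 (11  *  n  +  10) : ℤ)  +  crankCount 0 (11  *  n  +  10) ≥ 3 * (rankCount 1 11 (11  *  n  +  10) : ℤ)  +  2 * (rankCount 4 11 (11  *  n  +  10) : ℤ)  +  crankCount 3 (11  *  n  +  10))
    ∧ (2 * (rankCount 1 11 (11  *  n  +  10) : ℤ)  +  4 * (rankCount 4 11 (11  *  n  +  10) : ℤ)  +  crankCount 3 (11  *  n  +  10) ≥ (rankCount 0 11 (11  *  n  +  10) : ℤ)  +  (rankCount 2 11 (11  *  n  +  10) : ℤ)  +  (rankCount 3 11 (11  *  n  +  10) : ℤ)  +  3 * (rankCount 5 11 (11  *  n  +  10) : ℤ)  +  crankCount 0 (11  *  n  +  10))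
    ∧ (6 * (rankCount 2 11 (11  *  n  +  10) : ℤ)  +  6 * (rankCount 3 11 (11  *  n  +  10) : ℤ)  +  6 * crankCount 0 (11  *  n  +  10)  +  5 * crankCount 3 (11  *  n  +  10) ≥ 6 * (rankCount 0 11 (11  *  n  +  10) : ℤ)  +  6 * (rankCount 1 11 (11  *  n  +  10) : ℤ)  +  3 * (rankCount 4 11 (11  *  n  +  10) : ℤ)  +  8 * (rankCount 5 11 (11  *  n  +  10) : ℤ)) := by
  have first := countComb_nonneg (v₀ := 0) (v₁ := 3) (v₂ := -2) (v₄ := -1) (v₅ := 2) (m₀ := -2)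
    (m₃ := 2) (by norm_num) 1 3 2 3 2 2 (by norm_num) (fun p hu => by
      obtain ⟨n1, n2, n3, n4, n5, nX, nA, nY, nB⟩ := hu.ne_zero
      refine ⟨uB p ^ 2, uX p * uY p, pow_ne_zero 2 nB, ?_, ?_⟩
      · rw [hu.relB]
        push_cast
        exact combPoly_first hu.curve
      · simp only [uX, uA, uY, uB]
        field_simp) n
  have second := countComb_nonneg (v₀ := 3) (v₁ := -3) (v₂ := 1) (v₄ := -2) (v₅ := 0) (m₀ := 1)
    (m₃ := -1) (by norm_num) 1 4 4 2 0 1 (by norm_num) (fun p hu => by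
      obtain ⟨n1, n2, n3, n4, n5, nX, nA, nY, nB⟩ := hu.ne_zero
      refine ⟨uB p ^ 3, uX p * uA p ^ 2 * uY p, pow_ne_zero 3 nB, ?_, ?_⟩
      · rw [hu.relA, hu.relB]
        push_cast
        exact combPoly_second hu.curve
      · simp only [uX, uA, uY, uB]
        field_simp) n
  have third := countComb_nonneg (v₀ := -1) (v₁ := 2) (v₂ := -1) (v₄ := 4) (v₅ := -3) (m₀ := -1)
    (m₃ := 1) (by norm_num) 1 2 4 3 1 2 (by norm_num) (fun p hu => by
      obtain ⟨n1, n2, n3, n4, n5, nX, nA, nY, nB⟩ := hu.ne_zero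
      refine ⟨uB p ^ 2, uA p * uY p, pow_ne_zero 2 nB, ?_, ?_⟩
      · rw [hu.relA, hu.relB]
        push_cast
        exact combPoly_third hu.curve
      · simp only [uA, uY, uB]
        field_simp) n
  have fourth := countComb_nonneg (v₀ := -6) (v₁ := -6) (v₂ := 6) (v₄ := -3) (v₅ := -8) (m₀ := 6)
    (m₃ := 5) (by norm_num) 1 1 2 4 3 3 (by norm_num) (fun p hu => by
      obtain ⟨n1, n2, n3, n4, n5, nX, nA, nY, nB⟩ := hu.ne_zero
      refine ⟨uA p * uB p, uY p, mul_ne_zero nA nB, ?_, ?_⟩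
      · rw [hu.relA, hu.relB]
        push_cast
        exact combPoly_fourth hu.curve
      · simp only [uA, uY, uB]
        field_simp) n
  unfold countComb at first second third fourth
  refine ⟨?_, ?_, ?_, ?_⟩ <;> linarith
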